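/- Let $K$ be an algebraically closed field of characteristic $0$ that is complete with respect to a non-trivial (possibly non-archimedean) absolute value $|\cdot|$, and let $f\in K(z)$ be a rational function of degree $d>1$. *Notation.* Let $\|\cdot\|$ be the maximum norm on $K^2$ if $K$ is non-archimedean and the Euclidean norm $\sqrt{|p_0|^2+|p_1|^2}$ if $K$ is archimedean, let $p\wedge q=p_0q_1-p_1q_0$, and let $[z,w]=|p\wedge q|/(\|p\|\|q\|)$ (for lifts $p,q$ of $z,w$) be the normalized chordal metric on $\mathbb P^1=\mathbb P^1(K)$. Let $\mathsf P^1\supset\mathbb P^1$ be the Berkovich projective line over $K$ (so $\mathsf P^1=\mathbb P^1$ if $K$ is archimedean), to which $f$ extends continuously, and let $[\cdot,\cdot]_{\mathrm{can}}$ be the generalized Hsia kernel on $\mathsf P^1$, the extension $[S,S']_{\mathrm{can}}=\limsup_{\mathbb P^1\times\mathbb P^1\ni(z,w)\to(S,S')}[z,w]$ of the chordal metric. Let $\Omega_{\mathrm{can}}$ be the Dirac measure at the Gauss point (non-archimedean $K$) or the normalized Fubini–Study measure (archimedean $K$), and let $\Delta$ be the Laplacian on $\mathsf P^1$, normalized by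 $\Delta\log[\cdot,S]_{\mathrm{can}}=\delta_S-\Omega_{\mathrm{can}}$; thus, for a continuous $g:\mathsf P^1\to\mathbb R$ and a probability Radon measure $\mu$ on $\mathsf P^1$, $\Delta g+\Omega_{\mathrm{can}}=\mu$ means that $g-\int_{\mathsf P^1}\log[\cdot,S]_{\mathrm{can}}\,d\mu(S)$ is constant. Let $F$ be a non-degenerate homogeneous lift of $f$ to $K^2$ and $g_F=\lim_{n\to\infty}d^{-n}(\log\|F^n\|-d^n\log\|\cdot\|)$, extended continuously to $\mathsf P^1$. The equilibrium measure of $f$ is $\mu_f=\Delta g_F+\Omega_{\mathrm{can}}$. The dynamical Green function $g_f$ is the unique continuous function $g$ on $\mathsf P^1$ such that $\Delta g+\Omega_{\mathrm{can}}=\mu_f$ and $\sup_\nu\iint(\log[S,S']_{\mathrm{can}}-g(S)-g(S'))\,d\nu(S)\,d\nu(S')=0$, where $\nu$ runs over the probability Radon measures on $\mathsf P^1$. Let $f^\#$ be the chordal derivative $f^\#(z)=\lim_{w\to z}[f(w),f(z)]/[w,z]$ of $f$, extended continuously from $\mathbb P^1$ to $\mathsf P^1$, and $L(f)=\int_{\mathsf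 P^1}\log(f^\#)\,d\mu_f$. For $n\ge1$ let $[f^n,\mathrm{Id}]_{\mathrm{can}}$ be the continuous extension of $z\mapsto[f^n(z),z]$ to $\mathsf P^1$, let $\Phi(f^n,\mathrm{Id})_{g_f}=\log[f^n,\mathrm{Id}]_{\mathrm{can}}-g_f\circ f^n-g_f$, and let $[f^n=\mathrm{Id}]=\sum_{w\in\mathbb P^1:\,f^n(w)=w}\delta_w$, where each $w$ is counted with its multiplicity as a root of $f^n=\mathrm{Id}$. Finally let $\mathrm{SAT}(f)=\bigcup_{n\ge1}(\mathrm{Fix}(f^n)\cap C(f^n))$ be the set of superattracting periodic points of $f$ in $\mathbb P^1$, where $\mathrm{Fix}(f^n)$ and $C(f^n)$ are the sets of fixed points and of critical points of $f^n$ in $\mathbb P^1$. *Statement.* The functions $\log(f^\#)$ and $\log[f^n,\mathrm{Id}]_{\mathrm{can}}$ ($n\ge 1$) are $\mu_f$-integrable, and $$\frac1{d^n}\int_{\mathsf P^1\setminus \mathrm{SAT}(f)}\log(f^\#)\,d[f^n=\mathrm{Id}]-\frac{[f^n=\mathrm{Id}](\mathsf P^1\setminus \mathrm{SAT}(f))}{d^n}L(f)=-\frac{2d-2}{d^n}\int_{\mathsf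 P^1}\Phi(f^n,\mathrm{Id})_{g_f}\,d\mu_f+O(nd^{-n})\quad\text{as }n\to\infty.$$ -/

import Mathlib

open Filter Topology MeasureTheory
open scoped ENNReal LinearAlgebra.Projectivization

namespace BerkDyn

section Basic

variable (K : Type*) [NontriviallyNormedField K]

/-- The classical projective line `ℙ¹ = ℙ¹(K)`; the point `z ∈ K` is `[z : 1]` and
`∞ = [1 : 0]`. -/
abbrev P1 : Type _ := ℙ K (Fin 2 → K)

open Classical in
/-- The norm on `K²` as a function of the absolute values `a, b` of the two coordinates: the
maximum norm if `K` is non-archimedean, the Euclidean norm if `K` is archimedean. -/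
noncomputable def pairNorm (a b : ℝ) : ℝ :=
  if IsUltrametricDist K then max a b else Real.sqrt (a ^ 2 + b ^ 2)

theorem pairNorm_mul (c a b : ℝ) (hc : 0 ≤ c) :
    pairNorm K (c * a) (c * b) = c * pairNorm K a b := by
  unfold pairNorm
  split_ifs
  · exact (mul_max_of_nonneg a b hc).symm
  · rw [mul_pow, mul_pow, ← mul_add, Real.sqrt_mul (by positivity), Real.sqrt_sq hc]

variable {K}

/-- The norm `‖p‖` on `K²`. -/
noncomputable def vecNorm (p : Fin 2 → K) : ℝ := pairNorm K ‖p 0‖ ‖p 1‖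

/-- The wedge product `p ∧ q = p₀ q₁ - p₁ q₀`. -/
def wedge {R : Type*} [CommRing R] (p q : Fin 2 → R) : R := p 0 * q 1 - p 1 * q 0

/-- The normalized chordal metric `[z, w] = |p ∧ q| / (‖p‖ ‖q‖)` on `ℙ¹`. -/
noncomputable def chordal (z w : P1 K) : ℝ :=
  ‖wedge z.rep w.rep‖ / (vecNorm z.rep * vecNorm w.rep)

/-- The filter `ℙ¹ ∋ w → z`, `w ≠ z`, for the chordal metric. -/
noncomputable def punctured (z : P1 K) : Filter (P1 K) :=
  comap (fun w => chordal w z) (𝓝[≠] 0)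

end Basic

section Berkovich

variable (K : Type*) [NontriviallyNormedField K]

/-- The multiplicative seminorms on `K[X₀, X₁]` that extend the absolute value of `K` and do not
vanish at both `X₀` and `X₁`. -/
structure HomSeminorm where
  /-- the underlying multiplicative seminorm -/
  toSeminorm : MulRingSeminorm (MvPolynomial (Fin 2) K)
  map_C : ∀ a : K, toSeminorm (MvPolynomial.C a) = ‖a‖
  nontriv : toSeminorm (MvPolynomial.X 0) ≠ 0 ∨ toSeminorm (MvPolynomial.X 1) ≠ 0

variable {K}

/-- `‖S‖ = ‖(|X₀|_S, |X₁|_S)‖`. -/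
noncomputable def HomSeminorm.norm (S : HomSeminorm K) : ℝ :=
  pairNorm K (S.toSeminorm (MvPolynomial.X 0)) (S.toSeminorm (MvPolynomial.X 1))

variable (K)

/-- Two seminorms are equivalent if there is `C > 0` such that they differ by the factor `C ^ d`
on the homogeneous polynomials of degree `d`, for every `d`. -/
instance HomSeminorm.setoid : Setoid (HomSeminorm K) where
  r S S' := ∃ C : ℝ, 0 < C ∧ ∀ (d : ℕ) (G : MvPolynomial (Fin 2) K), G.IsHomogeneous d →
    S.toSeminorm G = C ^ d * S'.toSeminorm G
  iseqv :=
    { refl := fun _ => ⟨1, one_pos, fun _ _ _ => by simp⟩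
      symm := by
        rintro S S' ⟨C, hC, h⟩
        refine ⟨C⁻¹, inv_pos.2 hC, fun d G hG => ?_⟩
        rw [h d G hG, ← mul_assoc, ← mul_pow, inv_mul_cancel₀ hC.ne', one_pow, one_mul]
      trans := by
        rintro S S' S'' ⟨C, hC, h⟩ ⟨C', hC', h'⟩
        refine ⟨C * C', mul_pos hC hC', fun d G hG => ?_⟩
        rw [h d G hG, h' d G hG, mul_pow, mul_assoc] }

/-- The Berkovich projective line `𝖯¹ = 𝖯¹(K)`, by the `Proj` construction. For archimedean `K`
every seminorm as above is `G ↦ |G(p)|` for some `p ∈ K² \ {0}`, so that `𝖯¹ = ℙ¹`. -/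
def Berk : Type _ := Quotient (HomSeminorm.setoid K)

variable {K}

/-- The value at `G`, homogeneous of degree `d`, of the representative of `S ∈ 𝖯¹` that is
normalized by `‖S‖ = 1`. -/
noncomputable def Berk.val (S : Berk K) (d : ℕ)
    (G : MvPolynomial.homogeneousSubmodule (Fin 2) K d) : ℝ :=
  Quotient.lift (fun s : HomSeminorm K => s.toSeminorm G.1 / s.norm ^ d) (by
    rintro s s' ⟨C, hC, h⟩
    have hn : s.norm = C * s'.norm := by
      unfold HomSeminorm.norm
      rw [h 1 _ (MvPolynomial.isHomogeneous_X K 0), h 1 _ (MvPolynomial.isHomogeneous_X K 1),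
        pow_one, pairNorm_mul K _ _ _ hC.le]
    rw [h d G.1 ((MvPolynomial.mem_homogeneousSubmodule d G.1).1 G.2), hn, mul_pow,
      mul_div_mul_left _ _ (pow_pos hC d).ne']) S

/-- The topology of `𝖯¹`: the coarsest one for which the normalized evaluation at every
homogeneous polynomial is continuous. -/
noncomputable instance : TopologicalSpace (Berk K) :=
  TopologicalSpace.induced
    (fun S (i : Σ d : ℕ, MvPolynomial.homogeneousSubmodule (Fin 2) K d) => S.val i.1 i.2)
    inferInstance

noncomputable instance : MeasurableSpace (Berk K) := borel (Berk K)

instance : BorelSpace (Berk K) := ⟨rfl⟩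

/-- The seminorm `G ↦ |G(p)|` of a point `p ∈ K² \ {0}`. -/
noncomputable def evalSeminorm (p : Fin 2 → K) (hp : p ≠ 0) : HomSeminorm K where
  toSeminorm :=
    { toFun := fun G => ‖MvPolynomial.eval p G‖
      map_zero' := by simp
      add_le' := fun G H => by rw [map_add]; exact norm_add_le _ _
      neg' := fun G => by simp
      map_one' := by simp
      map_mul' := fun G H => by simp }
  map_C a := by
    change ‖MvPolynomial.eval p (MvPolynomial.C a)‖ = ‖a‖
    simp
  nontriv := by
    change ‖MvPolynomial.eval p (MvPolynomial.X 0)‖ ≠ 0 ∨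
      ‖MvPolynomial.eval p (MvPolynomial.X 1)‖ ≠ 0
    by_contra h
    push Not at h
    apply hp
    ext i
    fin_cases i
    · simpa using h.1
    · simpa using h.2

/-- The embedding `ℙ¹ ⊆ 𝖯¹`. -/
noncomputable def toBerk (z : P1 K) : Berk K := ⟦evalSeminorm z.rep z.rep_nonzero⟧

/-- The continuous extension to `𝖯¹` of a function on `ℙ¹` (a dense subset of `𝖯¹`). -/
noncomputable def berkExtend (φ : P1 K → ℝ) (S : Berk K) : ℝ :=
  limUnder (comap toBerk (𝓝 S)) φ

/-- The generalized Hsia kernel `[S, S']_can` on `𝖯¹`, the limit superior of the chordal distance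
`[z, w]` as the classical points `z, w` tend to `S, S'`. It is the chordal metric itself if `K` is
archimedean. -/
noncomputable def hsia (S S' : Berk K) : ℝ :=
  limsup (fun zw : P1 K × P1 K => chordal zw.1 zw.2)
    (comap toBerk (𝓝 S) ×ˢ comap toBerk (𝓝 S'))

end Berkovich

section Potential

variable {K : Type*} [NontriviallyNormedField K]

open Classical in
/-- `-log t ∈ [0, ∞]` for `t ∈ [0, 1]`. -/
noncomputable def negLog (t : ℝ) : ℝ≥0∞ := if t ≤ 0 then ⊤ else ENNReal.ofReal (-Real.log t)

/-- `-∫ log [S, ·]_can dμ ∈ [0, ∞]`. -/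
noncomputable def negPotential (μ : Measure (Berk K)) (S : Berk K) : ℝ≥0∞ :=
  ∫⁻ S', negLog (hsia S S') ∂μ

/-- `μ` is a probability Radon measure on `𝖯¹`. -/
structure IsProbRadon (μ : Measure (Berk K)) : Prop where
  isProbabilityMeasure : IsProbabilityMeasure μ
  regular : μ.Regular

/-- `g` is a continuous weight on `𝖯¹` and `μ^g := Δ g + Ω_can` is the probability Radon measure
`μ`. The Laplacian `Δ` on `𝖯¹` is the inverse of forming logarithmic potentials: it is normalized
by `Δ log [·, S']_can = δ_{S'} - Ω_can`, so that `Δ ∫ log [·, S']_can dμ(S') = μ - Ω_can`, and its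
kernel consists of the constants. So `Δ g = μ - Ω_can` means that `g` is, up to a constant, the
logarithmic potential of `μ`. -/
structure HasWeightMeasure (g : Berk K → ℝ) (μ : Measure (Berk K)) : Prop where
  continuous : Continuous g
  isProbRadon : IsProbRadon μ
  potential_ne_top : ∀ S, negPotential μ S ≠ ⊤
  eq_potential : ∃ C : ℝ, ∀ S, g S = C - (negPotential μ S).toReal

/-- The energy `∫∫ Φ_g d(ν × ν) ∈ [-∞, ∞)`, where
`Φ_g(S, S') = log [S, S']_can - g(S) - g(S')`. -/
noncomputable def energy (g : Berk K → ℝ) (ν : Measure (Berk K)) : EReal :=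
  -((∫⁻ S, negPotential ν S ∂ν : ℝ≥0∞) : EReal) - ((2 * ∫ S, g S ∂ν : ℝ) : EReal)

/-- The `g`-equilibrium energy `V_g` of `𝖯¹`. -/
noncomputable def equilibriumEnergy (g : Berk K → ℝ) : EReal :=
  ⨆ ν : {ν : Measure (Berk K) // IsProbRadon ν}, energy g ν.1

/-- `log φ`, as a function with values in `[-∞, ∞)`, is integrable; here `φ ≥ 0`. -/
def LogIntegrable (φ : Berk K → ℝ) (μ : Measure (Berk K)) : Prop :=
  (∀ᵐ S ∂μ, 0 < φ S) ∧ Integrable (fun S => Real.log (φ S)) μ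

end Potential

section Dynamics

variable {K : Type*} [NontriviallyNormedField K]

/-- The degree of a rational function. -/
noncomputable def deg (f : RatFunc K) : ℕ := max f.num.natDegree f.denom.natDegree

/-- The homogeneous lift `F = (F₀, F₁)` of `f`: the homogenizations, of degree `deg f`, of the
numerator and of the denominator of `f` in lowest terms. -/
noncomputable def lift (f : RatFunc K) : Fin 2 → MvPolynomial (Fin 2) K :=
  ![f.num.homogenize (deg f), f.denom.homogenize (deg f)]

/-- The iterates `F^n` of the lift `F`. -/
noncomputable def liftIter (f : RatFunc K) : ℕ → Fin 2 → MvPolynomial (Fin 2) K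
  | 0 => MvPolynomial.X
  | n + 1 => fun i => MvPolynomial.aeval (liftIter f n) (lift f i)

theorem lift_isHomogeneous (f : RatFunc K) (i : Fin 2) :
    (lift f i).IsHomogeneous (deg f) := by
  fin_cases i <;> exact Polynomial.isHomogeneous_homogenize _

theorem liftIter_isHomogeneous (f : RatFunc K) (n : ℕ) (i : Fin 2) :
    (liftIter f n i).IsHomogeneous (deg f ^ n) := by
  induction n generalizing i with
  | zero => exact MvPolynomial.isHomogeneous_X K i
  | succ n ih => exact (lift_isHomogeneous f i).aeval _ ih

theorem eval_homogenize (P : Polynomial K) (n : ℕ) (p : Fin 2 → K) :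
    MvPolynomial.eval p (P.homogenize n) =
      ∑ kl ∈ Finset.HasAntidiagonal.antidiagonal n, P.coeff kl.1 * (p 0 ^ kl.1 * p 1 ^ kl.2) := by
  simp only [Polynomial.homogenize, map_sum]
  refine Finset.sum_congr rfl fun kl _ => ?_
  rw [MvPolynomial.eval_monomial, Finsupp.prod_fintype _ _ (fun _ => pow_zero _)]
  simp [Fin.prod_univ_two]

/-- The lift is non-degenerate: `F⁻¹(0) ⊆ {0}`. -/
theorem lift_nondegenerate (f : RatFunc K) (p : Fin 2 → K)
    (h : ∀ i, MvPolynomial.eval p (lift f i) = 0) : p = 0 := by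
  have h0 : MvPolynomial.eval p (f.num.homogenize (deg f)) = 0 := h 0
  have h1 : MvPolynomial.eval p (f.denom.homogenize (deg f)) = 0 := h 1
  by_cases hp : p 1 = 0
  · have key : ∀ P : Polynomial K,
        MvPolynomial.eval p (P.homogenize (deg f)) = P.coeff (deg f) * p 0 ^ deg f := by
      intro P
      rw [eval_homogenize, Finset.sum_eq_single (deg f, 0)]
      · simp
      · rintro ⟨k, l⟩ hkl hne
        have hl : l ≠ 0 := by
          rintro rfl
          apply hne
          simpa using hkl
        simp [hp, hl]
      · simp
    rw [key] at h0 h1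
    have hc : f.num.coeff (deg f) ≠ 0 ∨ f.denom.coeff (deg f) ≠ 0 := by
      by_cases hle : f.num.natDegree ≤ f.denom.natDegree
      · right
        rw [deg, max_eq_right hle]
        exact Polynomial.leadingCoeff_ne_zero.2 f.denom_ne_zero
      · left
        rw [deg, max_eq_left (not_le.1 hle).le]
        refine Polynomial.leadingCoeff_ne_zero.2 fun h => hle ?_
        simp [h]
    have hp0 : p 0 ^ deg f = 0 := by
      rcases hc with hc | hc
      · exact (mul_eq_zero.1 h0).resolve_left hc
      · exact (mul_eq_zero.1 h1).resolve_left hc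
    have hp0' : p 0 = 0 := by
      by_contra hne
      exact pow_ne_zero _ hne hp0
    ext i
    fin_cases i
    · exact hp0'
    · exact hp
  · exfalso
    have key : ∀ P : Polynomial K, P.natDegree ≤ deg f →
        MvPolynomial.eval p (P.homogenize (deg f)) = p 1 ^ deg f * P.eval (p 0 / p 1) := by
      intro P hP
      rw [eval_homogenize, Finset.Nat.sum_antidiagonal_eq_sum_range_succ_mk,
        Polynomial.eval_eq_sum_range' (Nat.lt_succ_of_le hP), Finset.mul_sum]
      refine Finset.sum_congr rfl fun k hk => ?_
      have hk' : k ≤ deg f := Nat.lt_succ_iff.1 (Finset.mem_range.1 hk)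
      have : p 1 ^ deg f = p 1 ^ k * p 1 ^ (deg f - k) := by
        rw [← pow_add, Nat.add_sub_of_le hk']
      simp only
      rw [this, div_pow]
      field_simp
    rw [key _ (le_max_left _ _)] at h0
    rw [key _ (le_max_right _ _)] at h1
    have e0 := (mul_eq_zero.1 h0).resolve_left (pow_ne_zero _ hp)
    have e1 := (mul_eq_zero.1 h1).resolve_left (pow_ne_zero _ hp)
    obtain ⟨a, b, hab⟩ := f.isCoprime_num_denom
    have := congrArg (Polynomial.eval (p 0 / p 1)) hab
    simp [e0, e1] at this

/-- The action of `f` on `ℙ¹`. -/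
noncomputable def map (f : RatFunc K) (z : P1 K) : P1 K :=
  Projectivization.mk K (fun i => MvPolynomial.eval z.rep (lift f i)) fun h =>
    z.rep_nonzero (lift_nondegenerate f z.rep fun i => congrFun h i)

/-- The pushforward `G ↦ |G ∘ F|_S` of a seminorm. -/
noncomputable def HomSeminorm.push [IsAlgClosed K] (f : RatFunc K) (S : HomSeminorm K) :
    HomSeminorm K where
  toSeminorm :=
    { toFun := fun G => S.toSeminorm (MvPolynomial.aeval (lift f) G)
      map_zero' := by rw [map_zero, map_zero]
      add_le' := fun G H => by rw [map_add]; exact map_add_le_add S.toSeminorm _ _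
      neg' := fun G => by rw [_root_.map_neg]; exact map_neg_eq_map S.toSeminorm _
      map_one' := by rw [map_one, map_one]
      map_mul' := fun G H => by rw [map_mul, map_mul] }
  map_C a := by
    change S.toSeminorm (MvPolynomial.aeval (lift f) (MvPolynomial.C a)) = ‖a‖
    rw [MvPolynomial.aeval_C]
    exact S.map_C a
  nontriv := by
    change S.toSeminorm (MvPolynomial.aeval (lift f) (MvPolynomial.X 0)) ≠ 0 ∨
      S.toSeminorm (MvPolynomial.aeval (lift f) (MvPolynomial.X 1)) ≠ 0
    rw [MvPolynomial.aeval_X, MvPolynomial.aeval_X]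
    by_contra hcon
    push Not at hcon
    have hX : ∀ j : Fin 2, S.toSeminorm (MvPolynomial.X j) = 0 := by
      intro j
      have hrad : (MvPolynomial.X j : MvPolynomial (Fin 2) K) ∈
          (Ideal.span {lift f 0, lift f 1}).radical := by
        rw [← MvPolynomial.vanishingIdeal_zeroLocus_eq_radical (K := K)]
        intro x hx
        have hx0 : x = 0 := by
          refine lift_nondegenerate f x fun i => ?_
          have := hx (lift f i) (Ideal.subset_span (by fin_cases i <;> simp))
          simpa [MvPolynomial.aeval_eq_eval] using this
        simp [hx0]
      obtain ⟨N, hN⟩ := hrad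
      obtain ⟨a, b, hab⟩ := Ideal.mem_span_pair.1 hN
      have h1 : S.toSeminorm (MvPolynomial.X j ^ N) ≤ 0 := by
        rw [← hab]
        refine (map_add_le_add S.toSeminorm _ _).trans ?_
        rw [map_mul, map_mul, hcon.1, hcon.2, mul_zero, mul_zero, add_zero]
      have h2 : S.toSeminorm (MvPolynomial.X j) ^ N = 0 := by
        rw [← map_pow]
        exact le_antisymm h1 (apply_nonneg S.toSeminorm _)
      by_contra hne
      exact pow_ne_zero N hne h2
    rcases S.nontriv with h | h
    · exact h (hX 0)
    · exact h (hX 1)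

/-- The action of `f` on `𝖯¹`. -/
noncomputable def berkMap [IsAlgClosed K] (f : RatFunc K) : Berk K → Berk K :=
  Quotient.map (HomSeminorm.push f) (by
    rintro S S' ⟨C, hC, h⟩
    refine ⟨C ^ deg f, pow_pos hC _, fun d G hG => ?_⟩
    rw [← pow_mul]
    exact h (deg f * d) _ (hG.aeval _ (lift_isHomogeneous f)))

/-- The function `T_{F^n} = log ‖F^n‖ - d^n log ‖·‖` on `𝖯¹`. (The values are those of the
seminorm normalized by `‖S‖ = 1`.) -/
noncomputable def liftT (f : RatFunc K) (n : ℕ) (S : Berk K) : ℝ :=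
  Real.log (pairNorm K
    (S.val (deg f ^ n) ⟨liftIter f n 0,
      (MvPolynomial.mem_homogeneousSubmodule _ _).2 (liftIter_isHomogeneous f n 0)⟩)
    (S.val (deg f ^ n) ⟨liftIter f n 1,
      (MvPolynomial.mem_homogeneousSubmodule _ _).2 (liftIter_isHomogeneous f n 1)⟩))

/-- The weight `g_F = lim T_{F^n} / d^n` on `𝖯¹`. -/
noncomputable def liftGreen (f : RatFunc K) (S : Berk K) : ℝ :=
  limUnder atTop fun n : ℕ => liftT f n S / (deg f : ℝ) ^ n

/-- The equilibrium measure `μ_f = Δ g_F + Ω_can` of `f`. -/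
noncomputable def eqMeasure (f : RatFunc K) : Measure (Berk K) :=
  Classical.epsilon fun μ => HasWeightMeasure (liftGreen f) μ

/-- The dynamical Green function `g_f` of `f`: the normalized (`V_g = 0`) continuous weight with
`μ^g = μ_f`. -/
noncomputable def green (f : RatFunc K) : Berk K → ℝ :=
  Classical.epsilon fun g => HasWeightMeasure g (eqMeasure f) ∧ equilibriumEnergy g = 0

/-- The chordal derivative `f^#(z) = lim_{w → z} [f(w), f(z)] / [w, z]` on `ℙ¹`. -/
noncomputable def chordalDeriv (f : RatFunc K) (z : P1 K) : ℝ :=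
  limUnder (punctured z) fun w => chordal (map f w) (map f z) / chordal w z

/-- The chordal derivative `f^#`, extended continuously to `𝖯¹`. -/
noncomputable def sharp (f : RatFunc K) : Berk K → ℝ := berkExtend (chordalDeriv f)

/-- The Lyapunov exponent `L(f) = ∫ log f^# dμ_f`. -/
noncomputable def lyapunov (f : RatFunc K) : ℝ := ∫ S, Real.log (sharp f S) ∂(eqMeasure f)

/-- The function `[f^n, Id]_can`, the continuous extension to `𝖯¹` of `z ↦ [f^n(z), z]`. -/
noncomputable def proximity (f : RatFunc K) (n : ℕ) : Berk K → ℝ :=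
  berkExtend fun z => chordal ((map f)^[n] z) z

/-- `Φ(f^n, Id)_{g_f} = log [f^n, Id]_can - g_f ∘ f^n - g_f`. -/
noncomputable def logProximity [IsAlgClosed K] (f : RatFunc K) (n : ℕ) (S : Berk K) : ℝ :=
  Real.log (proximity f n S) - green f ((berkMap f)^[n] S) - green f S

/-- The multiplicity of `w ∈ ℙ¹` as a root of `f^n = Id`: the exponent of the linear form `· ∧ w`
in the form `F^n ∧ Id` of degree `d^n + 1`. -/
noncomputable def fixMult (f : RatFunc K) (n : ℕ) (w : P1 K) : ℕ :=
  multiplicity (wedge MvPolynomial.X fun i => MvPolynomial.C (w.rep i))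
    (wedge (liftIter f n) MvPolynomial.X)

/-- The set `Fix(f^n)` of the fixed points of `f^n` in `ℙ¹`. -/
def fixSet (f : RatFunc K) (n : ℕ) : Set (P1 K) := {w | (map f)^[n] w = w}

/-- The measure `[f^n = Id]` on `𝖯¹`: the sum of the Dirac measures at the fixed points of `f^n`
in `ℙ¹`, counted with multiplicity. -/
noncomputable def fixMeasure (f : RatFunc K) (n : ℕ) : Measure (Berk K) :=
  Measure.sum fun w : fixSet f n => (fixMult f n w.1 : ℝ≥0∞) • Measure.dirac (toBerk w.1)

/-- The set `C(f^n)` of the critical points of `f^n` in `ℙ¹`: those `c = π(p)` at which the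
differential of `f^n`, that is the map `K² / K p → K² / K F^n(p)` induced by `DF^n(p)`, is zero. -/
def critSet (f : RatFunc K) (n : ℕ) : Set (P1 K) :=
  {c | ∀ q : Fin 2 → K,
    wedge (fun i => MvPolynomial.eval c.rep (liftIter f n i))
      (fun i => ∑ j, MvPolynomial.eval c.rep (MvPolynomial.pderiv j (liftIter f n i)) * q j) = 0}

/-- The set `SAT(f)` of the superattracting periodic points of `f` in `ℙ¹`. -/
def satSet (f : RatFunc K) : Set (P1 K) := ⋃ n ≥ 1, fixSet f n ∩ critSet f n

end Dynamics

end BerkDyn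

namespace BerkDyn

section PairNorm

variable (K : Type*) [NontriviallyNormedField K]

theorem pairNorm_nonneg {a b : ℝ} (ha : 0 ≤ a) : 0 ≤ pairNorm K a b := by
  unfold pairNorm
  split_ifs
  · exact le_max_of_le_left ha
  · positivity

theorem pairNorm_comm (a b : ℝ) : pairNorm K a b = pairNorm K b a := by
  unfold pairNorm
  rw [max_comm, add_comm (a ^ 2)]

theorem le_pairNorm_left {a b : ℝ} : a ≤ pairNorm K a b := by
  unfold pairNorm
  split_ifs
  · exact le_max_left _ _
  · exact Real.le_sqrt_of_sq_le (by nlinarith [sq_nonneg b])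

theorem le_pairNorm_right {a b : ℝ} : b ≤ pairNorm K a b := by
  rw [pairNorm_comm]
  exact le_pairNorm_left K

theorem pairNorm_pos {a b : ℝ} (ha : 0 ≤ a) (hb : 0 ≤ b) (h : a ≠ 0 ∨ b ≠ 0) :
    0 < pairNorm K a b := by
  rcases h with h | h
  · exact (lt_of_le_of_ne ha h.symm).trans_le (le_pairNorm_left K)
  · exact (lt_of_le_of_ne hb h.symm).trans_le (le_pairNorm_right K)

theorem pairNorm_mono {a b a' b' : ℝ} (ha : 0 ≤ a) (hb : 0 ≤ b) (h : a ≤ a') (h' : b ≤ b') :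
    pairNorm K a b ≤ pairNorm K a' b' := by
  unfold pairNorm
  split_ifs
  · exact max_le_max h h'
  · exact Real.sqrt_le_sqrt (by gcongr)

theorem pairNorm_add_le {a b a' b' : ℝ} :
    pairNorm K (a + a') (b + b') ≤ pairNorm K a b + pairNorm K a' b' := by
  unfold pairNorm
  split_ifs
  · exact max_le (add_le_add (le_max_left _ _) (le_max_left _ _))
      (add_le_add (le_max_right _ _) (le_max_right _ _))
  · rw [Real.sqrt_le_left (by positivity), add_sq √(a ^ 2 + b ^ 2), Real.sq_sqrt (by positivity),
      Real.sq_sqrt (by positivity)]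
    have h1 : a * a' + b * b' ≤ √(a ^ 2 + b ^ 2) * √(a' ^ 2 + b' ^ 2) := by
      rw [← Real.sqrt_mul (by positivity)]
      exact Real.le_sqrt_of_sq_le (by nlinarith [sq_nonneg (a * b' - a' * b)])
    nlinarith

theorem continuous_pairNorm : Continuous fun x : ℝ × ℝ => pairNorm K x.1 x.2 := by
  unfold pairNorm
  split_ifs <;> fun_prop

/-- The Cauchy–Schwarz inequality for the norm on `K²`. -/
theorem add_mul_le_pairNorm (h : ¬ IsUltrametricDist K) {a b a' b' : ℝ} :
    a * a' + b * b' ≤ pairNorm K a b * pairNorm K a' b' := by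
  unfold pairNorm
  rw [if_neg h, if_neg h, ← Real.sqrt_mul (by positivity)]
  exact Real.le_sqrt_of_sq_le (by nlinarith [sq_nonneg (a * b' - a' * b)])

theorem pairNorm_zero_right {a : ℝ} (ha : 0 ≤ a) : pairNorm K a 0 = a := by
  unfold pairNorm
  split_ifs
  · exact max_eq_left ha
  · simp [Real.sqrt_sq ha]

end PairNorm

section VecNorm

variable {K : Type*} [NontriviallyNormedField K]

theorem vecNorm_nonneg (p : Fin 2 → K) : 0 ≤ vecNorm p := pairNorm_nonneg K (norm_nonneg _)

theorem vecNorm_pos {p : Fin 2 → K} (hp : p ≠ 0) : 0 < vecNorm p := by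
  refine pairNorm_pos K (norm_nonneg _) (norm_nonneg _) ?_
  by_contra! h
  apply hp
  ext i
  fin_cases i
  · simpa using h.1
  · simpa using h.2

theorem vecNorm_smul (c : K) (p : Fin 2 → K) : vecNorm (c • p) = ‖c‖ * vecNorm p := by
  simp [vecNorm, pairNorm_mul K _ _ _ (norm_nonneg c)]

theorem vecNorm_add_le (p q : Fin 2 → K) : vecNorm (p + q) ≤ vecNorm p + vecNorm q := by
  unfold vecNorm
  refine le_trans (pairNorm_mono K (norm_nonneg _) (norm_nonneg _) (norm_add_le _ _)
    (norm_add_le _ _)) (pairNorm_add_le K)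

theorem vecNorm_neg (p : Fin 2 → K) : vecNorm (-p) = vecNorm p := by simp [vecNorm]

theorem vecNorm_add_le_max (h : IsUltrametricDist K) (p q : Fin 2 → K) :
    vecNorm (p + q) ≤ max (vecNorm p) (vecNorm q) := by
  unfold vecNorm pairNorm
  simp only [if_pos h]
  refine max_le ?_ ?_
  · exact (IsUltrametricDist.norm_add_le_max _ _).trans
      (max_le_max (le_max_left _ _) (le_max_left _ _))
  · exact (IsUltrametricDist.norm_add_le_max _ _).trans
      (max_le_max (le_max_right _ _) (le_max_right _ _))

theorem norm_apply_le_vecNorm (p : Fin 2 → K) (i : Fin 2) : ‖p i‖ ≤ vecNorm p := by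
  fin_cases i
  · exact le_pairNorm_left K
  · exact le_pairNorm_right K

theorem continuous_vecNorm : Continuous (vecNorm : (Fin 2 → K) → ℝ) :=
  (continuous_pairNorm K).comp (by fun_prop : Continuous fun p : Fin 2 → K => (‖p 0‖, ‖p 1‖))

theorem norm_wedge_le (p q : Fin 2 → K) : ‖wedge p q‖ ≤ vecNorm p * vecNorm q := by
  unfold wedge
  by_cases h : IsUltrametricDist K
  · rw [sub_eq_add_neg]
    refine (IsUltrametricDist.norm_add_le_max _ _).trans (max_le ?_ ?_)
    · rw [norm_mul]
      exact mul_le_mul (norm_apply_le_vecNorm p 0) (norm_apply_le_vecNorm q 1) (norm_nonneg _)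
        (vecNorm_nonneg _)
    · rw [norm_neg, norm_mul]
      exact mul_le_mul (norm_apply_le_vecNorm p 1) (norm_apply_le_vecNorm q 0) (norm_nonneg _)
        (vecNorm_nonneg _)
  · refine (norm_sub_le _ _).trans ?_
    rw [norm_mul, norm_mul]
    unfold vecNorm
    rw [pairNorm_comm K ‖q 0‖]
    exact add_mul_le_pairNorm K h

section Ring

variable {R : Type*} [CommRing R]

theorem wedge_self (p : Fin 2 → R) : wedge p p = 0 := by
  simp only [wedge]; ring

theorem wedge_comm (p q : Fin 2 → R) : wedge p q = -wedge q p := by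
  simp only [wedge]; ring

theorem wedge_smul_left (c : R) (p q : Fin 2 → R) : wedge (c • p) q = c * wedge p q := by
  simp only [wedge, Pi.smul_apply, smul_eq_mul]; ring

theorem wedge_smul_right (c : R) (p q : Fin 2 → R) : wedge p (c • q) = c * wedge p q := by
  simp only [wedge, Pi.smul_apply, smul_eq_mul]; ring

theorem wedge_add_left (p p' q : Fin 2 → R) : wedge (p + p') q = wedge p q + wedge p' q := by
  simp only [wedge, Pi.add_apply]; ring

theorem wedge_add_right (p q q' : Fin 2 → R) : wedge p (q + q') = wedge p q + wedge p q' := by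
  simp only [wedge, Pi.add_apply]; ring

/-- The Plücker relation in dimension two. -/
theorem wedge_smul_eq (p q r : Fin 2 → R) :
    wedge p q • r = wedge r q • p + wedge p r • q := by
  ext i
  fin_cases i <;> simp [wedge] <;> ring

theorem map_wedge {R' : Type*} [CommRing R'] (φ : R →+* R') (p q : Fin 2 → R) :
    φ (wedge p q) = wedge (fun i => φ (p i)) (fun i => φ (q i)) := by
  simp [wedge]

end Ring

theorem exists_wedge_eq_one {p : Fin 2 → K} (hp : p ≠ 0) : ∃ q : Fin 2 → K, wedge p q = 1 := by
  by_cases h : p 0 = 0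
  · have h1 : p 1 ≠ 0 := fun h1 => hp (by ext i; fin_cases i <;> simpa)
    exact ⟨![-(p 1)⁻¹, 0], by simp [wedge, h1]⟩
  · exact ⟨![0, (p 0)⁻¹], by simp [wedge, h]⟩

theorem wedge_eq_zero_iff {p q : Fin 2 → K} (hp : p ≠ 0) :
    wedge p q = 0 ↔ ∃ c : K, q = c • p := by
  constructor
  · intro h
    obtain ⟨r, hr⟩ := exists_wedge_eq_one hp
    refine ⟨wedge q r, ?_⟩
    have := wedge_smul_eq p r q
    rwa [hr, one_smul, h, zero_smul, add_zero] at this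
  · rintro ⟨c, rfl⟩
    rw [wedge_smul_right, wedge_self, mul_zero]

theorem vecNorm_rep_pos (z : P1 K) : 0 < vecNorm z.rep := vecNorm_pos z.rep_nonzero

theorem wedge_rep_eq_zero_iff (z w : P1 K) : wedge z.rep w.rep = 0 ↔ z = w := by
  rw [wedge_eq_zero_iff z.rep_nonzero]
  constructor
  · rintro ⟨c, hc⟩
    have hc0 : c ≠ 0 := by
      rintro rfl
      exact w.rep_nonzero (by simpa using hc)
    rw [← z.mk_rep, ← w.mk_rep]
    exact (Projectivization.mk_eq_mk_iff' K _ _ _ _).2 ⟨c⁻¹, by rw [hc, smul_smul,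
      inv_mul_cancel₀ hc0, one_smul]⟩
  · rintro rfl
    exact ⟨1, by simp⟩

theorem exists_rep_mk_smul (p : Fin 2 → K) (hp : p ≠ 0) :
    ∃ c : K, c ≠ 0 ∧ (Projectivization.mk K p hp).rep = c • p := by
  obtain ⟨a, ha⟩ := Projectivization.exists_smul_eq_mk_rep K p hp
  exact ⟨a, a.ne_zero, ha.symm⟩

theorem chordal_mk (p q : Fin 2 → K) (hp : p ≠ 0) (hq : q ≠ 0) :
    chordal (Projectivization.mk K p hp) (Projectivization.mk K q hq) =
      ‖wedge p q‖ / (vecNorm p * vecNorm q) := by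
  obtain ⟨a, ha, hpa⟩ := exists_rep_mk_smul p hp
  obtain ⟨b, hb, hqb⟩ := exists_rep_mk_smul q hq
  unfold chordal
  rw [hpa, hqb, wedge_smul_left, wedge_smul_right, vecNorm_smul, vecNorm_smul, norm_mul, norm_mul]
  have := vecNorm_pos hp
  have := vecNorm_pos hq
  have := norm_pos_iff.2 ha
  have := norm_pos_iff.2 hb
  field_simp

theorem chordal_nonneg (z w : P1 K) : 0 ≤ chordal z w :=
  div_nonneg (norm_nonneg _) (mul_nonneg (vecNorm_nonneg _) (vecNorm_nonneg _))

theorem chordal_le_one (z w : P1 K) : chordal z w ≤ 1 :=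
  div_le_one_of_le₀ (norm_wedge_le _ _) (mul_nonneg (vecNorm_nonneg _) (vecNorm_nonneg _))

theorem chordal_comm (z w : P1 K) : chordal z w = chordal w z := by
  unfold chordal
  rw [wedge_comm, norm_neg, mul_comm]

theorem chordal_eq_zero_iff (z w : P1 K) : chordal z w = 0 ↔ z = w := by
  unfold chordal
  rw [div_eq_zero_iff, norm_eq_zero, wedge_rep_eq_zero_iff, or_iff_left]
  exact (mul_pos (vecNorm_rep_pos z) (vecNorm_rep_pos w)).ne'

theorem chordal_self (z : P1 K) : chordal z z = 0 := (chordal_eq_zero_iff z z).2 rfl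

theorem chordal_triangle (z x w : P1 K) : chordal z w ≤ chordal z x + chordal x w := by
  have h1 := vecNorm_rep_pos z
  have h2 := vecNorm_rep_pos x
  have h3 := vecNorm_rep_pos w
  have h := congrArg vecNorm (wedge_smul_eq z.rep w.rep x.rep)
  rw [vecNorm_smul] at h
  have h' := h.le.trans (vecNorm_add_le _ _)
  rw [vecNorm_smul, vecNorm_smul] at h'
  unfold chordal
  rw [div_add_div _ _ (by positivity) (by positivity), div_le_div_iff₀ (by positivity)
    (by positivity)]
  have := mul_le_mul_of_nonneg_right h'
    (by positivity : 0 ≤ vecNorm z.rep * vecNorm w.rep * vecNorm x.rep)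
  nlinarith

theorem chordal_ultra (h : IsUltrametricDist K) (z x w : P1 K) :
    chordal z w ≤ max (chordal z x) (chordal x w) := by
  have h1 := vecNorm_rep_pos z
  have h2 := vecNorm_rep_pos x
  have h3 := vecNorm_rep_pos w
  have h0 := congrArg vecNorm (wedge_smul_eq z.rep w.rep x.rep)
  rw [vecNorm_smul] at h0
  have h' := h0.le.trans (vecNorm_add_le_max h _ _)
  rw [vecNorm_smul, vecNorm_smul] at h'
  rcases le_max_iff.1 h' with h' | h'
  · refine le_max_of_le_right ?_
    unfold chordal
    rw [div_le_div_iff₀ (by positivity) (by positivity)]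
    nlinarith
  · refine le_max_of_le_left ?_
    unfold chordal
    rw [div_le_div_iff₀ (by positivity) (by positivity)]
    nlinarith

end VecNorm

end BerkDyn

namespace BerkDyn

section Homogeneous

open MvPolynomial

variable {K : Type*} [NontriviallyNormedField K]

theorem aeval_smul_of_isHomogeneous {A : Type*} [CommRing A] [Algebra K A]
    {G : MvPolynomial (Fin 2) K} {d : ℕ} (hG : G.IsHomogeneous d) (c : A) (x : Fin 2 → A) :
    aeval (c • x) G = c ^ d * aeval x G := by
  rw [aeval_def, aeval_def, eval₂_eq, eval₂_eq, Finset.mul_sum]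
  refine Finset.sum_congr rfl fun m hm => ?_
  have hd : ∑ i ∈ m.support, m i = d := (hG.degree_eq_sum_deg_support hm).symm
  have : ∏ i ∈ m.support, (c • x) i ^ m i = c ^ d * ∏ i ∈ m.support, x i ^ m i := by
    rw [← hd, ← Finset.prod_pow_eq_pow_sum, ← Finset.prod_mul_distrib]
    exact Finset.prod_congr rfl fun i _ => by simp [mul_pow]
  rw [this]
  ring

theorem eval_smul_of_isHomogeneous {G : MvPolynomial (Fin 2) K} {d : ℕ} (hG : G.IsHomogeneous d)
    (c : K) (p : Fin 2 → K) : eval (c • p) G = c ^ d * eval p G := by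
  simpa [aeval_eq_eval] using aeval_smul_of_isHomogeneous hG c p

/-- The linear form `· ∧ b`. -/
noncomputable def linForm (b : Fin 2 → K) : MvPolynomial (Fin 2) K :=
  wedge X fun i => C (b i)

theorem linForm_isHomogeneous (b : Fin 2 → K) : (linForm b).IsHomogeneous 1 := by
  unfold linForm wedge
  have h : ∀ i j : Fin 2, (X i * C (b j) : MvPolynomial (Fin 2) K).IsHomogeneous 1 := fun i j => by
    simpa using (isHomogeneous_X K i).mul (isHomogeneous_C (Fin 2) (b j))
  exact (h 0 1).sub (h 1 0)

theorem eval_linForm (b p : Fin 2 → K) : eval p (linForm b) = wedge p b := by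
  simp [linForm, wedge]

theorem linForm_smul (c : K) (b : Fin 2 → K) : linForm (c • b) = C c * linForm b := by
  simp [linForm, wedge]
  ring

theorem linForm_ne_zero {b : Fin 2 → K} (hb : b ≠ 0) : linForm b ≠ 0 := by
  intro h
  obtain ⟨q, hq⟩ := exists_wedge_eq_one hb
  have := eval_linForm b q
  rw [h, map_zero, wedge_comm, hq] at this
  simp at this

theorem exists_eq_add_linForm_mul {p q : Fin 2 → K} {d : ℕ} {G : MvPolynomial (Fin 2) K}
    (hG : G.IsHomogeneous d) (hq : wedge p q = 1) :
    ∃ E, G = linForm q ^ d * C (eval p G) + linForm p * E := by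
  let I : Ideal (MvPolynomial (Fin 2) K) := Ideal.span {linForm p}
  have hX : (fun i => Ideal.Quotient.mk I (X i)) =
      Ideal.Quotient.mk I (linForm q) • fun i => Ideal.Quotient.mk I (C (p i)) := by
    funext i
    have h1 := congrFun (wedge_smul_eq (fun i => C (p i) : Fin 2 → MvPolynomial (Fin 2) K)
      (fun i => C (q i)) X) i
    have h2 : wedge (fun i => C (p i) : Fin 2 → MvPolynomial (Fin 2) K)
        (fun i => C (q i)) = 1 := by
      rw [← map_wedge (C : K →+* MvPolynomial (Fin 2) K), hq, map_one]
    have h3 : wedge (fun i => C (p i) : Fin 2 → MvPolynomial (Fin 2) K) X =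
      -linForm p := wedge_comm _ _
    rw [h2, h3] at h1
    simp only [Pi.smul_apply, Pi.add_apply, smul_eq_mul, one_mul] at h1
    rw [Pi.smul_apply, smul_eq_mul, ← map_mul, Ideal.Quotient.eq, Ideal.mem_span_singleton]
    refine ⟨-C (q i), ?_⟩
    rw [h1]
    unfold linForm
    ring
  have hcong : Ideal.Quotient.mk I G =
      Ideal.Quotient.mk I (linForm q ^ d * C (eval p G)) := by
    have e1 : Ideal.Quotient.mk I G = aeval (fun i => Ideal.Quotient.mk I (X i)) G := by
      have := (MvPolynomial.comp_aeval_apply (R := K) X (Ideal.Quotient.mkₐ K I) G)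
      rw [aeval_X_left_apply] at this
      exact this
    have e2 : Ideal.Quotient.mk I (C (eval p G)) =
        aeval (fun i => Ideal.Quotient.mk I (C (p i))) G := by
      have h3 := (MvPolynomial.comp_aeval_apply (R := K)
        (fun i => (C (p i) : MvPolynomial (Fin 2) K)) (Ideal.Quotient.mkₐ K I) G)
      have h4 : aeval (fun i => (C (p i) : MvPolynomial (Fin 2) K)) G =
          C (eval p G) := by
        have := (MvPolynomial.comp_aeval_apply (R := K) p
          (Algebra.ofId K (MvPolynomial (Fin 2) K)) G)
        rw [aeval_eq_eval] at this
        exact this.symm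
      rw [← h4]
      exact h3
    rw [e1, hX, aeval_smul_of_isHomogeneous hG, map_mul, map_pow, e2]
  rw [Ideal.Quotient.eq, Ideal.mem_span_singleton] at hcong
  obtain ⟨E, hE⟩ := hcong
  exact ⟨E, by rw [← hE]; ring⟩

end Homogeneous

section Seminorm

open MvPolynomial

variable {K : Type*} [NontriviallyNormedField K]

theorem HomSeminorm.nonneg (s : HomSeminorm K) (G : MvPolynomial (Fin 2) K) :
    0 ≤ s.toSeminorm G := apply_nonneg _ _

theorem HomSeminorm.norm_pos (s : HomSeminorm K) : 0 < s.norm :=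
  pairNorm_pos K (s.nonneg _) (s.nonneg _) s.nontriv

theorem HomSeminorm.map_C_mul (s : HomSeminorm K) (a : K) (G : MvPolynomial (Fin 2) K) :
    s.toSeminorm (C a * G) = ‖a‖ * s.toSeminorm G := by
  rw [map_mul, s.map_C]

/-- The value at `G` of the seminorm `S` normalized by `‖S‖ = 1`, where `G` is homogeneous of
degree `d`. -/
noncomputable def Berk.nv (S : Berk K) (d : ℕ) (G : MvPolynomial (Fin 2) K) : ℝ :=
  (Quotient.out S).toSeminorm G / (Quotient.out S).norm ^ d

theorem Berk.val_eq_nv (S : Berk K) (d : ℕ) (G : homogeneousSubmodule (Fin 2) K d) :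
    S.val d G = S.nv d G.1 := by
  conv_lhs => rw [← Quotient.out_eq S]
  rfl

theorem Berk.nv_mk (s : HomSeminorm K) {d : ℕ} {G : MvPolynomial (Fin 2) K}
    (hG : G.IsHomogeneous d) :
    Berk.nv (⟦s⟧ : Berk K) d G = s.toSeminorm G / s.norm ^ d := by
  have := Berk.val_eq_nv (⟦s⟧ : Berk K) d ⟨G, (mem_homogeneousSubmodule _ _).2 hG⟩
  rw [← this]
  rfl

theorem Berk.nv_nonneg (S : Berk K) (d : ℕ) (G : MvPolynomial (Fin 2) K) : 0 ≤ S.nv d G :=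
  div_nonneg (HomSeminorm.nonneg _ _) (pow_nonneg (HomSeminorm.norm_pos _).le _)

theorem Berk.nv_mul (S : Berk K) (d e : ℕ) (G H : MvPolynomial (Fin 2) K) :
    S.nv (d + e) (G * H) = S.nv d G * S.nv e H := by
  unfold Berk.nv
  rw [map_mul, pow_add, mul_div_mul_comm]

theorem Berk.nv_C_mul (S : Berk K) (d : ℕ) (a : K) (G : MvPolynomial (Fin 2) K) :
    S.nv d (C a * G) = ‖a‖ * S.nv d G := by
  unfold Berk.nv
  rw [HomSeminorm.map_C_mul, mul_div_assoc]

theorem Berk.nv_one (S : Berk K) : S.nv 0 1 = 1 := by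
  unfold Berk.nv
  simp

theorem Berk.continuous_nv {d : ℕ} {G : MvPolynomial (Fin 2) K} (hG : G.IsHomogeneous d) :
    Continuous fun S : Berk K => S.nv d G := by
  have h : Continuous fun S : Berk K =>
      (fun (i : Σ d : ℕ, homogeneousSubmodule (Fin 2) K d) => S.val i.1 i.2) :=
    continuous_induced_dom
  have := (continuous_apply (⟨d, ⟨G, (mem_homogeneousSubmodule _ _).2 hG⟩⟩ :
    Σ d : ℕ, homogeneousSubmodule (Fin 2) K d)).comp h
  simpa [Function.comp_def, Berk.val_eq_nv] using this

theorem Berk.tendsto_nhds_iff {α : Type*} {l : Filter α} {φ : α → Berk K} {S : Berk K} :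
    Tendsto φ l (𝓝 S) ↔ ∀ (d : ℕ) (G : MvPolynomial (Fin 2) K), G.IsHomogeneous d →
      Tendsto (fun x => (φ x).nv d G) l (𝓝 (S.nv d G)) := by
  constructor
  · intro h d G hG
    exact ((Berk.continuous_nv hG).tendsto S).comp h
  · intro h
    rw [nhds_induced, tendsto_comap_iff, tendsto_pi_nhds]
    rintro ⟨d, G⟩
    simpa [Berk.val_eq_nv, Function.comp_def] using
      h d G.1 ((mem_homogeneousSubmodule _ _).1 G.2)

theorem Berk.ext_nv {S S' : Berk K}
    (h : ∀ (d : ℕ) (G : MvPolynomial (Fin 2) K), G.IsHomogeneous d → S.nv d G = S'.nv d G) :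
    S = S' := by
  rw [← Quotient.out_eq S, ← Quotient.out_eq S']
  have h1 := (Quotient.out S).norm_pos
  have h2 := (Quotient.out S').norm_pos
  refine Quotient.sound ⟨(Quotient.out S).norm / (Quotient.out S').norm, by positivity,
    fun d G hG => ?_⟩
  have := h d G hG
  unfold Berk.nv at this
  rw [div_eq_div_iff (by positivity) (by positivity)] at this
  rw [div_pow, div_mul_eq_mul_div, eq_div_iff (by positivity)]
  linarith

instance : T2Space (Berk K) := by
  refine T2Space.of_injective_continuous (f := fun (S : Berk K)
    (i : Σ d : ℕ, homogeneousSubmodule (Fin 2) K d) => S.val i.1 i.2) ?_ continuous_induced_dom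
  intro S S' h
  refine Berk.ext_nv fun d G hG => ?_
  simpa [Berk.val_eq_nv] using
    congrFun h ⟨d, ⟨G, (mem_homogeneousSubmodule _ _).2 hG⟩⟩

/-- The seminorm `G ↦ |G(c X)|_s`. -/
noncomputable def HomSeminorm.rescale (s : HomSeminorm K) (c : K) (hc : c ≠ 0) :
    HomSeminorm K where
  toSeminorm :=
    { toFun := fun G => s.toSeminorm (aeval (fun i => C c * X i) G)
      map_zero' := by rw [map_zero, map_zero]
      add_le' := fun G H => by rw [map_add]; exact map_add_le_add s.toSeminorm _ _
      neg' := fun G => by rw [_root_.map_neg]; exact map_neg_eq_map s.toSeminorm _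
      map_one' := by rw [map_one, map_one]
      map_mul' := fun G H => by rw [map_mul, map_mul] }
  map_C a := by
    change s.toSeminorm (aeval (fun i => C c * X i) (C a)) = ‖a‖
    rw [aeval_C]
    exact s.map_C a
  nontriv := by
    change s.toSeminorm (aeval (fun i => C c * X i) (X 0)) ≠ 0 ∨
      s.toSeminorm (aeval (fun i => C c * X i) (X 1)) ≠ 0
    rw [aeval_X, aeval_X, s.map_C_mul, s.map_C_mul]
    exact s.nontriv.imp (mul_ne_zero (norm_ne_zero_iff.2 hc))
      (mul_ne_zero (norm_ne_zero_iff.2 hc))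

theorem HomSeminorm.rescale_apply (s : HomSeminorm K) (c : K) (hc : c ≠ 0) {d : ℕ}
    {G : MvPolynomial (Fin 2) K} (hG : G.IsHomogeneous d) :
    (s.rescale c hc).toSeminorm G = ‖c‖ ^ d * s.toSeminorm G := by
  change s.toSeminorm (aeval (fun i => C c * X i) G) = _
  have := aeval_smul_of_isHomogeneous hG (C c : MvPolynomial (Fin 2) K) X
  rw [aeval_X_left_apply, ← map_pow] at this
  rw [← norm_pow, ← s.map_C_mul, ← this]
  rfl

theorem HomSeminorm.rescale_equiv (s : HomSeminorm K) (c : K) (hc : c ≠ 0) :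
    (⟦s.rescale c hc⟧ : Berk K) = ⟦s⟧ :=
  Quotient.sound ⟨‖c‖, norm_pos_iff.2 hc, fun _ _ hG => s.rescale_apply c hc hG⟩

theorem HomSeminorm.norm_rescale (s : HomSeminorm K) (c : K) (hc : c ≠ 0) :
    (s.rescale c hc).norm = ‖c‖ * s.norm := by
  unfold HomSeminorm.norm
  rw [s.rescale_apply c hc (isHomogeneous_X K 0), s.rescale_apply c hc (isHomogeneous_X K 1),
    pow_one, pairNorm_mul K _ _ _ (norm_nonneg c)]

theorem exists_bounded_rep : ∃ R : ℝ, ∀ S : Berk K, ∃ s : HomSeminorm K,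
    (⟦s⟧ : Berk K) = S ∧ 1 ≤ s.norm ∧ s.norm ≤ R := by
  obtain ⟨c, hc⟩ := NormedField.exists_one_lt_norm K
  refine ⟨‖c‖, fun S => ?_⟩
  obtain ⟨s, rfl⟩ := Quotient.exists_rep S
  obtain ⟨n, hn1, hn2⟩ := exists_mem_Ico_zpow s.norm_pos hc
  have hc0 : c ≠ 0 := norm_pos_iff.1 (one_pos.trans hc)
  have hp : 0 < ‖c‖ ^ n := zpow_pos (one_pos.trans hc) n
  refine ⟨s.rescale (c ^ (-n)) (zpow_ne_zero _ hc0), s.rescale_equiv _ _, ?_, ?_⟩ <;>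
    rw [s.norm_rescale, norm_zpow, zpow_neg]
  · rw [inv_mul_eq_div, le_div_iff₀ hp, one_mul]
    exact hn1
  · rw [inv_mul_eq_div, div_le_iff₀ hp]
    rw [zpow_add_one₀ (by positivity)] at hn2
    linarith

theorem exists_seminorm_le (R : ℝ) (G : MvPolynomial (Fin 2) K) :
    ∃ M : ℝ, ∀ s : HomSeminorm K, s.norm ≤ R → s.toSeminorm G ≤ M := by
  induction G using MvPolynomial.induction_on with
  | C a => exact ⟨‖a‖, fun s _ => (s.map_C a).le⟩
  | add p q hp hq =>
    obtain ⟨M, hM⟩ := hp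
    obtain ⟨M', hM'⟩ := hq
    exact ⟨M + M', fun s hs =>
      (map_add_le_add s.toSeminorm _ _).trans (add_le_add (hM s hs) (hM' s hs))⟩
  | mul_X p i hp =>
    obtain ⟨M, hM⟩ := hp
    refine ⟨M * R, fun s hs => ?_⟩
    rw [map_mul]
    refine mul_le_mul (hM s hs) ?_ (s.nonneg _) ((s.nonneg _).trans (hM s hs))
    refine le_trans ?_ hs
    fin_cases i
    · exact le_pairNorm_left K
    · exact le_pairNorm_right K

instance : CompactSpace (Berk K) := by
  refine ⟨isCompact_iff_ultrafilter_le_nhds.2 fun U _ => ?_⟩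
  obtain ⟨R, hR⟩ := exists_bounded_rep (K := K)
  choose r hr hr1 hr2 using hR
  have hlim : ∀ G : MvPolynomial (Fin 2) K, ∃ L : ℝ,
      Tendsto (fun S => (r S).toSeminorm G) U (𝓝 L) := by
    intro G
    obtain ⟨M, hM⟩ := exists_seminorm_le R G
    obtain ⟨L, -, hL⟩ := (isCompact_Icc (a := (0 : ℝ)) (b := M)).ultrafilter_le_nhds
      (U.map fun S => (r S).toSeminorm G) (by
        rw [le_principal_iff]
        exact mem_map.2 (Filter.univ_mem' fun S => ⟨(r S).nonneg G, hM _ (hr2 S)⟩))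
    exact ⟨L, hL⟩
  choose L hL using hlim
  have hnorm : Tendsto (fun S => (r S).norm) U (𝓝 (pairNorm K (L (X 0)) (L (X 1)))) :=
    ((continuous_pairNorm K).tendsto (L (X 0), L (X 1))).comp ((hL (X 0)).prodMk_nhds (hL (X 1)))
  have hnorm1 : 1 ≤ pairNorm K (L (X 0)) (L (X 1)) :=
    ge_of_tendsto' hnorm hr1
  let s : HomSeminorm K :=
    { toSeminorm :=
        { toFun := L
          map_zero' := tendsto_nhds_unique (hL 0) (by simp)
          add_le' := fun G H => le_of_tendsto_of_tendsto' (hL (G + H)) ((hL G).add (hL H))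
            fun S => map_add_le_add _ _ _
          neg' := fun G => tendsto_nhds_unique (hL (-G)) (by simpa using hL G)
          map_one' := tendsto_nhds_unique (hL 1) (by simp)
          map_mul' := fun G H => tendsto_nhds_unique (hL (G * H))
            (by simpa using (hL G).mul (hL H)) }
      map_C := fun a => tendsto_nhds_unique (hL (C a)) (by simp [HomSeminorm.map_C])
      nontriv := by
        change L (X 0) ≠ 0 ∨ L (X 1) ≠ 0
        by_contra! h
        rw [h.1, h.2, pairNorm_zero_right K le_rfl] at hnorm1
        linarith }
  have hs : ∀ G, Tendsto (fun S => (r S).toSeminorm G) U (𝓝 (s.toSeminorm G)) := hL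
  refine ⟨⟦s⟧, Set.mem_univ _, ?_⟩
  have : Tendsto (fun S : Berk K => S) U (𝓝 ⟦s⟧) := by
    refine Berk.tendsto_nhds_iff.2 fun d G hG => ?_
    rw [Berk.nv_mk s hG]
    have heq : (fun S : Berk K => S.nv d G) =
        fun S => (r S).toSeminorm G / (r S).norm ^ d := by
      funext S
      conv_lhs => rw [← hr S, Berk.nv_mk _ hG]
    rw [heq]
    exact (hs G).div (hnorm.pow d) (pow_pos s.norm_pos d).ne'
  exact this

end Seminorm

section Points

open MvPolynomial

variable {K : Type*} [NontriviallyNormedField K]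

/-- The point of `𝖯¹` with the lift `p`. -/
noncomputable def pt (p : Fin 2 → K) (hp : p ≠ 0) : Berk K := ⟦evalSeminorm p hp⟧

theorem evalSeminorm_apply (p : Fin 2 → K) (hp : p ≠ 0) (G : MvPolynomial (Fin 2) K) :
    (evalSeminorm p hp).toSeminorm G = ‖eval p G‖ := rfl

theorem norm_evalSeminorm (p : Fin 2 → K) (hp : p ≠ 0) :
    (evalSeminorm p hp).norm = vecNorm p := by
  simp [HomSeminorm.norm, vecNorm, evalSeminorm_apply]

theorem nv_pt (p : Fin 2 → K) (hp : p ≠ 0) {d : ℕ} {G : MvPolynomial (Fin 2) K}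
    (hG : G.IsHomogeneous d) : (pt p hp).nv d G = ‖eval p G‖ / vecNorm p ^ d := by
  rw [pt, Berk.nv_mk _ hG, evalSeminorm_apply, norm_evalSeminorm]

theorem toBerk_eq_pt (z : P1 K) : toBerk z = pt z.rep z.rep_nonzero := rfl

theorem nv_toBerk (z : P1 K) {d : ℕ} {G : MvPolynomial (Fin 2) K}
    (hG : G.IsHomogeneous d) : (toBerk z).nv d G = ‖eval z.rep G‖ / vecNorm z.rep ^ d :=
  nv_pt _ _ hG

theorem toBerk_mk (p : Fin 2 → K) (hp : p ≠ 0) :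
    toBerk (Projectivization.mk K p hp) = pt p hp := by
  obtain ⟨c, hc, h⟩ := exists_rep_mk_smul p hp
  refine Berk.ext_nv fun d G hG => ?_
  rw [nv_toBerk _ hG, nv_pt _ _ hG, h, eval_smul_of_isHomogeneous hG, vecNorm_smul, norm_mul,
    norm_pow, mul_pow, mul_div_mul_left _ _ (pow_pos (norm_pos_iff.2 hc) d).ne']

/-- The chordal kernel `[w, S]` for `w ∈ ℙ¹` and `S ∈ 𝖯¹`. -/
noncomputable def kap (w : P1 K) (S : Berk K) : ℝ := S.nv 1 (linForm w.rep) / vecNorm w.rep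

theorem kap_nonneg (w : P1 K) (S : Berk K) : 0 ≤ kap w S :=
  div_nonneg (S.nv_nonneg _ _) (vecNorm_nonneg _)

theorem continuous_kap (w : P1 K) : Continuous (kap w) :=
  (Berk.continuous_nv (linForm_isHomogeneous _)).div_const _

theorem kap_toBerk (w z : P1 K) : kap w (toBerk z) = chordal w z := by
  rw [kap, nv_toBerk _ (linForm_isHomogeneous _), eval_linForm, pow_one, chordal_comm, chordal,
    div_div]

theorem kap_mk (p : Fin 2 → K) (hp : p ≠ 0) (S : Berk K) :
    kap (Projectivization.mk K p hp) S = S.nv 1 (linForm p) / vecNorm p := by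
  obtain ⟨c, hc, h⟩ := exists_rep_mk_smul p hp
  rw [kap, h, linForm_smul, Berk.nv_C_mul, vecNorm_smul, mul_div_mul_left _ _ (norm_ne_zero_iff.2 hc)]

theorem nv_linForm (w : P1 K) (S : Berk K) :
    S.nv 1 (linForm w.rep) = vecNorm w.rep * kap w S := by
  rw [kap, mul_div_cancel₀ _ (vecNorm_rep_pos w).ne']

theorem pairNorm_nv_X (S : Berk K) : pairNorm K (S.nv 1 (X 0)) (S.nv 1 (X 1)) = 1 := by
  unfold Berk.nv
  have h := (Quotient.out S).norm_pos
  rw [pow_one, div_eq_inv_mul, div_eq_inv_mul, pairNorm_mul K _ _ _ (inv_nonneg.2 h.le)]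
  exact inv_mul_cancel₀ h.ne'

theorem HomSeminorm.map_eq_of_sub_mul {s : HomSeminorm K} {G H E : MvPolynomial (Fin 2) K}
    {D : MvPolynomial (Fin 2) K} (hD : s.toSeminorm D = 0) (h : G = H + D * E) :
    s.toSeminorm G = s.toSeminorm H := by
  have h0 : s.toSeminorm (D * E) = 0 := by rw [map_mul, hD, zero_mul]
  refine le_antisymm ?_ ?_
  · rw [h]
    exact (map_add_le_add s.toSeminorm _ _).trans (by rw [h0, add_zero])
  · have h' : H = G + -(D * E) := by rw [h]; ring
    rw [h']
    refine (map_add_le_add s.toSeminorm _ _).trans ?_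
    rw [map_neg_eq_map, h0, add_zero]

/-- A classical point is determined by the vanishing of a linear form. -/
theorem eq_toBerk_of_kap_eq_zero {w : P1 K} {S : Berk K} (h : kap w S = 0) : S = toBerk w := by
  obtain ⟨s, rfl⟩ := Quotient.exists_rep S
  have hlin : s.toSeminorm (linForm w.rep) = 0 := by
    have h1 := nv_linForm w (⟦s⟧ : Berk K)
    change Berk.nv (⟦s⟧ : Berk K) 1 (linForm w.rep) = vecNorm w.rep * kap w (⟦s⟧ : Berk K) at h1
    rw [Berk.nv_mk _ (linForm_isHomogeneous _), show kap w (⟦s⟧ : Berk K) = 0 from h, mul_zero,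
      div_eq_zero_iff] at h1
    exact h1.resolve_right (by simpa using s.norm_pos.ne')
  obtain ⟨q, hq⟩ := exists_wedge_eq_one w.rep_nonzero
  have key : ∀ (d : ℕ) (G : MvPolynomial (Fin 2) K), G.IsHomogeneous d →
      s.toSeminorm G = s.toSeminorm (linForm q) ^ d * ‖eval w.rep G‖ := by
    intro d G hG
    obtain ⟨E, hE⟩ := exists_eq_add_linForm_mul hG hq
    rw [HomSeminorm.map_eq_of_sub_mul (H := linForm q ^ d * C (eval w.rep G)) hlin
      hE, map_mul, map_pow, s.map_C]
  have hn : s.norm = s.toSeminorm (linForm q) * vecNorm w.rep := by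
    unfold HomSeminorm.norm
    rw [key 1 _ (isHomogeneous_X K 0), key 1 _ (isHomogeneous_X K 1), pow_one,
      pairNorm_mul K _ _ _ (s.nonneg _), eval_X, eval_X]
    rfl
  have hpos : 0 < s.toSeminorm (linForm q) := by
    have := s.norm_pos
    rw [hn] at this
    exact pos_of_mul_pos_left this (vecNorm_nonneg _)
  refine Berk.ext_nv fun d G hG => ?_
  rw [Berk.nv_mk s hG, nv_toBerk _ hG, key d G hG, hn, mul_pow,
    mul_div_mul_left _ _ (pow_pos hpos d).ne']

theorem kap_eq_zero_iff {w : P1 K} {S : Berk K} : kap w S = 0 ↔ S = toBerk w := by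
  refine ⟨eq_toBerk_of_kap_eq_zero, ?_⟩
  rintro rfl
  rw [kap_toBerk, chordal_self]

theorem toBerk_injective : Function.Injective (toBerk : P1 K → Berk K) := by
  intro z w h
  rw [← chordal_eq_zero_iff, ← kap_toBerk, kap_eq_zero_iff, h]

theorem comap_kap_le (w : P1 K) : comap (kap w) (𝓝 0) ≤ 𝓝 (toBerk w) := by
  rw [le_nhds_iff]
  intro U hU hUo
  by_cases hne : (Uᶜ : Set (Berk K)).Nonempty
  · obtain ⟨S, hS, hmin⟩ := hUo.isClosed_compl.isCompact.exists_isMinOn hne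
      (continuous_kap w).continuousOn
    have hpos : 0 < kap w S := by
      refine lt_of_le_of_ne (kap_nonneg _ _) fun h => ?_
      rw [eq_comm, kap_eq_zero_iff] at h
      exact hS (h ▸ hU)
    refine ⟨Set.Iio (kap w S), Iio_mem_nhds hpos, fun S' hS' => ?_⟩
    by_contra hc
    have h1 : kap w S ≤ kap w S' := hmin hc
    exact (not_le.2 hS') h1
  · rw [Set.not_nonempty_iff_eq_empty, Set.compl_empty_iff] at hne
    rw [hne]
    exact univ_mem

theorem tendsto_toBerk_of_kap {α : Type*} {l : Filter α} {φ : α → Berk K} {w : P1 K}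
    (h : Tendsto (fun x => kap w (φ x)) l (𝓝 0)) : Tendsto φ l (𝓝 (toBerk w)) :=
  (tendsto_comap_iff.2 h).mono_right (comap_kap_le w)

end Points

end BerkDyn

namespace BerkDyn

section Factor

open MvPolynomial

variable {K : Type*} [NontriviallyNormedField K]

/-- The form `∏ (· ∧ w)`, where `w` runs over a multiset of points. -/
noncomputable def formOf (m : Multiset (P1 K)) : MvPolynomial (Fin 2) K :=
  (m.map fun w => linForm w.rep).prod

theorem formOf_cons (w : P1 K) (m : Multiset (P1 K)) :
    formOf (w ::ₘ m) = linForm w.rep * formOf m := by simp [formOf]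

theorem formOf_add (m m' : Multiset (P1 K)) : formOf (m + m') = formOf m * formOf m' := by
  simp [formOf]

theorem formOf_isHomogeneous (m : Multiset (P1 K)) : (formOf m).IsHomogeneous m.card := by
  induction m using Multiset.induction_on with
  | empty => simpa [formOf] using isHomogeneous_one (Fin 2) K
  | cons w m ih =>
    rw [formOf_cons, Multiset.card_cons, add_comm]
    exact (linForm_isHomogeneous _).mul ih

theorem nv_formOf (m : Multiset (P1 K)) (S : Berk K) :
    S.nv m.card (formOf m) = (m.map fun w => vecNorm w.rep).prod * (m.map fun w => kap w S).prod := by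
  induction m using Multiset.induction_on with
  | empty => simpa [formOf] using S.nv_one
  | cons w m ih =>
    rw [formOf_cons, Multiset.card_cons, add_comm, Berk.nv_mul, ih, nv_linForm]
    simp only [Multiset.map_cons, Multiset.prod_cons]
    ring

theorem eval_formOf (m : Multiset (P1 K)) (p : Fin 2 → K) :
    eval p (formOf m) = (m.map fun w => wedge p w.rep).prod := by
  induction m using Multiset.induction_on with
  | empty => simp [formOf]
  | cons w m ih => rw [formOf_cons, map_mul, ih, eval_linForm]; simp

theorem eval_formOf_eq_zero_iff (m : Multiset (P1 K)) (z : P1 K) :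
    eval z.rep (formOf m) = 0 ↔ z ∈ m := by
  rw [eval_formOf, Multiset.prod_eq_zero_iff, Multiset.mem_map]
  constructor
  · rintro ⟨w, hw, h⟩
    rw [wedge_rep_eq_zero_iff] at h
    rwa [h]
  · intro h
    exact ⟨z, h, wedge_self _⟩

theorem exists_homogenize_eq [IsAlgClosed K] (D : ℕ) (P : Polynomial K) (hP : P ≠ 0)
    (hD : P.natDegree ≤ D) :
    ∃ (c : K) (m : Multiset (P1 K)), c ≠ 0 ∧ m.card = D ∧ P.homogenize D = C c * formOf m := by
  induction D generalizing P with
  | zero =>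
    rw [Polynomial.eq_C_of_natDegree_le_zero hD] at hP ⊢
    refine ⟨P.coeff 0, 0, by simpa using hP, rfl, ?_⟩
    simp [formOf, Polynomial.homogenize_C]
  | succ D ih =>
    by_cases h : P.natDegree ≤ D
    · obtain ⟨c, m, hc, hm, he⟩ := ih P hP h
      have hne : (![1, 0] : Fin 2 → K) ≠ 0 := fun h => by simpa using congrFun h 0
      obtain ⟨a, ha, har⟩ := exists_rep_mk_smul _ hne
      refine ⟨-(a⁻¹ * c), Projectivization.mk K _ hne ::ₘ m, by simp [ha, hc], by simp [hm], ?_⟩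
      have h1 := Polynomial.homogenize_mul P 1 h (n := 1) (by simp)
      rw [mul_one, Polynomial.homogenize_one, he] at h1
      have hC : (C a⁻¹ * C a : MvPolynomial (Fin 2) K) = 1 := by
        rw [← C_mul, inv_mul_cancel₀ ha, C_1]
      rw [h1, formOf_cons, har, linForm_smul]
      simp only [linForm, wedge, Matrix.cons_val_zero, Matrix.cons_val_one, C_0, C_1, C_neg, C_mul]
      linear_combination (-(C c * formOf m * X 1)) * hC
    · have hdeg : P.natDegree = D + 1 := by omega
      obtain ⟨r, hr⟩ := IsAlgClosed.exists_root P
        (by rw [Polynomial.degree_eq_natDegree hP, hdeg]; exact Nat.cast_ne_zero.2 (by omega))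
      obtain ⟨Q, rfl⟩ := Polynomial.dvd_iff_isRoot.2 hr
      have hQ : Q ≠ 0 := right_ne_zero_of_mul hP
      have hQd : Q.natDegree ≤ D := by
        rw [Polynomial.natDegree_mul (Polynomial.X_sub_C_ne_zero r) hQ,
          Polynomial.natDegree_X_sub_C] at hdeg
        omega
      obtain ⟨c, m, hc, hm, he⟩ := ih Q hQ hQd
      have hne : (![r, 1] : Fin 2 → K) ≠ 0 := fun h => by simpa using congrFun h 1
      obtain ⟨a, ha, har⟩ := exists_rep_mk_smul _ hne
      refine ⟨a⁻¹ * c, Projectivization.mk K _ hne ::ₘ m, by simp [ha, hc], by simp [hm], ?_⟩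
      have h1 := Polynomial.homogenize_mul (Polynomial.X - Polynomial.C r) Q (m := 1) (by simp) hQd
      rw [add_comm 1 D, Polynomial.homogenize_sub, Polynomial.homogenize_X one_ne_zero,
        Polynomial.homogenize_C, he] at h1
      have hC : (C a⁻¹ * C a : MvPolynomial (Fin 2) K) = 1 := by
        rw [← C_mul, inv_mul_cancel₀ ha, C_1]
      rw [h1, formOf_cons, har, linForm_smul]
      simp only [linForm, wedge, Matrix.cons_val_zero, Matrix.cons_val_one, C_1, C_mul,
        Nat.sub_self, pow_zero, pow_one]
      linear_combination (-(X 0 - C r * X 1) * C c * formOf m) * hC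

/-- A binary form over an algebraically closed field is a product of linear forms. -/
theorem exists_eq_C_mul_formOf [IsAlgClosed K] {G : MvPolynomial (Fin 2) K} {D : ℕ}
    (hG : G.IsHomogeneous D) (h0 : G ≠ 0) :
    ∃ (c : K) (m : Multiset (P1 K)), c ≠ 0 ∧ m.card = D ∧ G = C c * formOf m := by
  have h := Polynomial.homogenize_eq_of_isHomogeneous hG rfl
  have hdeg : (aeval ![Polynomial.X, 1] G : Polynomial K).natDegree ≤ D := by
    rw [aeval_def, eval₂_eq]
    refine Polynomial.natDegree_sum_le_of_forall_le _ _ fun e he => ?_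
    have hd := hG.degree_eq_sum_deg_support he
    refine (Polynomial.natDegree_C_mul_le _ _).trans ?_
    refine (Polynomial.natDegree_prod_le _ _).trans ?_
    rw [hd]
    refine Finset.sum_le_sum fun i _ => ?_
    fin_cases i <;> simp
  rw [← h]
  refine exists_homogenize_eq D _ (fun h1 => h0 ?_) hdeg
  rw [← h, h1, Polynomial.homogenize_zero]

theorem nv_C_mul_formOf (c : K) (m : Multiset (P1 K)) (S : Berk K) :
    S.nv m.card (C c * formOf m) =
      ‖c‖ * (m.map fun w => vecNorm w.rep).prod * (m.map fun w => kap w S).prod := by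
  rw [Berk.nv_C_mul, nv_formOf, mul_assoc]

theorem prod_vecNorm_pos (m : Multiset (P1 K)) : 0 < (m.map fun w => vecNorm w.rep).prod := by
  induction m using Multiset.induction_on with
  | empty => simp
  | cons w m ih => simpa using mul_pos (vecNorm_rep_pos w) ih

theorem prod_kap_pos {m : Multiset (P1 K)} {S : Berk K} (h : ∀ w ∈ m, 0 < kap w S) :
    0 < (m.map fun w => kap w S).prod := by
  induction m using Multiset.induction_on with
  | empty => simp
  | cons w m ih =>
    simp only [Multiset.map_cons, Multiset.prod_cons]
    exact mul_pos (h w (by simp)) (ih fun x hx => h x (by simp [hx]))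

theorem log_prod_kap {m : Multiset (P1 K)} {S : Berk K} (h : ∀ w ∈ m, 0 < kap w S) :
    Real.log (m.map fun w => kap w S).prod = (m.map fun w => Real.log (kap w S)).sum := by
  induction m using Multiset.induction_on with
  | empty => simp
  | cons w m ih =>
    have hm : ∀ x ∈ m, 0 < kap x S := fun x hx => h x (by simp [hx])
    simp only [Multiset.map_cons, Multiset.prod_cons, Multiset.sum_cons]
    rw [Real.log_mul (h w (by simp)).ne' (prod_kap_pos hm).ne', ih hm]

theorem exists_nv_eq_prod_kap [IsAlgClosed K] {G : MvPolynomial (Fin 2) K} {D : ℕ}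
    (hG : G.IsHomogeneous D) (h0 : G ≠ 0) :
    ∃ (A : ℝ) (m : Multiset (P1 K)), 0 < A ∧ m.card = D ∧
      (∀ z : P1 K, eval z.rep G = 0 ↔ z ∈ m) ∧
      ∀ S : Berk K, S.nv D G = A * (m.map fun w => kap w S).prod := by
  obtain ⟨c, m, hc, rfl, rfl⟩ := exists_eq_C_mul_formOf hG h0
  refine ⟨_, m, mul_pos (norm_pos_iff.2 hc) (prod_vecNorm_pos m), rfl, fun z => ?_,
    nv_C_mul_formOf c m⟩
  rw [map_mul, eval_C, mul_eq_zero, or_iff_right hc, eval_formOf_eq_zero_iff]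

open Classical in
theorem multiplicity_linForm {c : K} (hc : c ≠ 0) (m : Multiset (P1 K)) (w : P1 K) :
    multiplicity (linForm w.rep) (C c * formOf m) = m.count w := by
  have hm : formOf m = linForm w.rep ^ m.count w * formOf (m.filter fun x => ¬ w = x) := by
    conv_lhs => rw [← Multiset.filter_add_not (fun x => w = x) m, formOf_add]
    rw [Multiset.filter_eq m w]
    simp [formOf]
  refine multiplicity_eq_of_dvd_of_not_dvd ?_ ?_
  · rw [hm]
    exact Dvd.dvd.mul_left (dvd_mul_right _ _) _
  · rintro ⟨E, hE⟩
    have h0 : linForm w.rep ^ m.count w ≠ 0 := pow_ne_zero _ (linForm_ne_zero w.rep_nonzero)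
    have h1 : C c * formOf (m.filter fun x => ¬ w = x) = linForm w.rep * E := by
      refine mul_left_cancel₀ h0 ?_
      rw [hm] at hE
      rw [pow_succ] at hE
      linear_combination hE
    have h2 := congrArg (eval w.rep) h1
    rw [map_mul, map_mul, eval_linForm, wedge_self, zero_mul, eval_C, mul_eq_zero,
      or_iff_right hc, eval_formOf_eq_zero_iff] at h2
    simp at h2

/-- A binary form that vanishes at `z` is divisible by the linear form of `z`. -/
theorem exists_eq_linForm_mul [IsAlgClosed K] {G : MvPolynomial (Fin 2) K} {D : ℕ}
    (hG : G.IsHomogeneous (D + 1)) (z : P1 K) (h : eval z.rep G = 0) :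
    ∃ E : MvPolynomial (Fin 2) K, E.IsHomogeneous D ∧ G = linForm z.rep * E := by
  classical
  by_cases h0 : G = 0
  · exact ⟨0, isHomogeneous_zero _ _ _, by simp [h0]⟩
  obtain ⟨c, m, hc, hm, rfl⟩ := exists_eq_C_mul_formOf hG h0
  rw [map_mul, eval_C, mul_eq_zero, or_iff_right hc, eval_formOf_eq_zero_iff] at h
  obtain ⟨m', rfl⟩ := Multiset.exists_cons_of_mem h
  refine ⟨C c * formOf m', ?_, by rw [formOf_cons]; ring⟩
  have : m'.card = D := by simpa using hm
  rw [← this]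
  exact (formOf_isHomogeneous m').C_mul c

end Factor

end BerkDyn

namespace BerkDyn

section KapTopology

variable {K : Type*} [NontriviallyNormedField K]

theorem tendsto_multiset_prod_kap {α : Type*} {l : Filter α} {φ : α → Berk K} {S : Berk K}
    (h : ∀ w, Tendsto (fun x => kap w (φ x)) l (𝓝 (kap w S))) (m : Multiset (P1 K)) :
    Tendsto (fun x => (m.map fun w => kap w (φ x)).prod) l (𝓝 (m.map fun w => kap w S).prod) := by
  induction m using Multiset.induction_on with
  | empty => simpa using tendsto_const_nhds
  | cons w m ih => simpa using (h w).mul ih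

/-- The topology of `𝖯¹` is generated by the functions `[w, ·]`. -/
theorem tendsto_nhds_iff_kap [IsAlgClosed K] {α : Type*} {l : Filter α} {φ : α → Berk K}
    {S : Berk K} :
    Tendsto φ l (𝓝 S) ↔ ∀ w, Tendsto (fun x => kap w (φ x)) l (𝓝 (kap w S)) := by
  refine ⟨fun h w => ((continuous_kap w).tendsto S).comp h, fun h => ?_⟩
  refine Berk.tendsto_nhds_iff.2 fun d G hG => ?_
  by_cases h0 : G = 0
  · simpa [h0, Berk.nv] using tendsto_const_nhds
  obtain ⟨A, m, -, -, -, hA⟩ := exists_nv_eq_prod_kap hG h0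
  simp only [hA]
  exact (tendsto_multiset_prod_kap h m).const_mul A

theorem ext_kap [IsAlgClosed K] {S S' : Berk K} (h : ∀ w, kap w S = kap w S') : S = S' := by
  have : Tendsto (fun _ : ℕ => S) atTop (𝓝 S') :=
    tendsto_nhds_iff_kap.2 fun w => by simp [h w]
  exact tendsto_nhds_unique tendsto_const_nhds this

theorem mem_closure_range_toBerk [IsAlgClosed K] {S : Berk K}
    (h : ∀ (W : Finset (P1 K)) (ε : ℝ), 0 < ε → ∃ z, ∀ w ∈ W, |chordal w z - kap w S| < ε) :
    S ∈ closure (Set.range (toBerk : P1 K → Berk K)) := by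
  classical
  have h' : ∀ i : Finset (P1 K) × ℕ, ∃ z, ∀ w ∈ i.1, |chordal w z - kap w S| < 1 / ((i.2 : ℝ) + 1) :=
    fun i => h i.1 _ (by positivity)
  choose z hz using h'
  refine mem_closure_of_tendsto (b := (atTop : Filter (Finset (P1 K) × ℕ)))
    (f := fun i => toBerk (z i)) ?_ (Eventually.of_forall fun i => ⟨z i, rfl⟩)
  refine tendsto_nhds_iff_kap.2 fun w => ?_
  rw [tendsto_iff_norm_sub_tendsto_zero]
  have hlim : Tendsto (fun i : Finset (P1 K) × ℕ => 1 / ((i.2 : ℝ) + 1)) atTop (𝓝 0) := by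
    rw [← prod_atTop_atTop_eq]
    exact tendsto_one_div_add_atTop_nhds_zero_nat.comp tendsto_snd
  refine squeeze_zero' (Eventually.of_forall fun _ => norm_nonneg _) ?_ hlim
  filter_upwards [eventually_ge_atTop ({w}, 0)] with i hi
  rw [kap_toBerk]
  exact (hz i w (hi.1 (by simp))).le

end KapTopology

section NonArch

variable {K : Type*} [NontriviallyNormedField K]

theorem le_of_forall_pow_le_mul_pow {a b : ℝ} (hb : 0 ≤ b)
    (h : ∀ n : ℕ, a ^ n ≤ (n + 1) * b ^ n) : a ≤ b := by
  by_contra! hlt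
  have ha : 0 < a := hb.trans_lt hlt
  have hr : |b / a| < 1 := by
    rw [abs_of_nonneg (by positivity), div_lt_one ha]
    exact hlt
  have h1 := tendsto_pow_const_mul_const_pow_of_abs_lt_one 1 hr
  have h2 := tendsto_pow_atTop_nhds_zero_of_abs_lt_one hr
  have h3 := h1.add h2
  rw [add_zero] at h3
  obtain ⟨n, hn⟩ := (h3.eventually (gt_mem_nhds one_pos)).exists
  have := h n
  rw [pow_one, div_pow] at hn
  have hp : 0 < a ^ n := by positivity
  rw [← add_one_mul, ← mul_div_assoc, div_lt_one hp] at hn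
  linarith

theorem HomSeminorm.add_le_max (hK : IsUltrametricDist K) (s : HomSeminorm K)
    (x y : MvPolynomial (Fin 2) K) :
    s.toSeminorm (x + y) ≤ max (s.toSeminorm x) (s.toSeminorm y) := by
  have hm : 0 ≤ max (s.toSeminorm x) (s.toSeminorm y) := le_max_of_le_left (s.nonneg x)
  refine le_of_forall_pow_le_mul_pow hm fun n => ?_
  rw [← map_pow, add_pow]
  have hsum : ∀ (t : Finset ℕ) (φ : ℕ → MvPolynomial (Fin 2) K),
      s.toSeminorm (∑ i ∈ t, φ i) ≤ ∑ i ∈ t, s.toSeminorm (φ i) := by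
    intro t φ
    classical
    induction t using Finset.induction_on with
    | empty => simp
    | insert a t ha ih =>
      rw [Finset.sum_insert ha, Finset.sum_insert ha]
      exact (map_add_le_add _ _ _).trans (by gcongr)
  refine (hsum _ _).trans ?_
  have hterm : ∀ i ∈ Finset.range (n + 1),
      s.toSeminorm (x ^ i * y ^ (n - i) * (n.choose i : MvPolynomial (Fin 2) K)) ≤
        max (s.toSeminorm x) (s.toSeminorm y) ^ n := by
    intro i hi
    have hi' : i + (n - i) = n := by
      have := Finset.mem_range.1 hi
      omega
    have hc : s.toSeminorm (n.choose i : MvPolynomial (Fin 2) K) ≤ 1 := by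
      have : (n.choose i : MvPolynomial (Fin 2) K) = MvPolynomial.C (n.choose i : K) := by simp
      rw [this, s.map_C]
      exact IsUltrametricDist.norm_natCast_le_one K _
    rw [map_mul, map_mul, map_pow, map_pow]
    calc s.toSeminorm x ^ i * s.toSeminorm y ^ (n - i) * s.toSeminorm (n.choose i : MvPolynomial (Fin 2) K)
        ≤ max (s.toSeminorm x) (s.toSeminorm y) ^ i *
          max (s.toSeminorm x) (s.toSeminorm y) ^ (n - i) * 1 := by
          have h1 := s.nonneg x
          have h2 := s.nonneg y
          have h3 := s.nonneg (n.choose i : MvPolynomial (Fin 2) K)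
          gcongr
          · exact le_max_left _ _
          · exact le_max_right _ _
      _ = _ := by rw [mul_one, ← pow_add, hi']
  refine (Finset.sum_le_sum hterm).trans ?_
  simp

theorem Berk.nv_add_le_max (hK : IsUltrametricDist K) (S : Berk K) (d : ℕ)
    (G H : MvPolynomial (Fin 2) K) : S.nv d (G + H) ≤ max (S.nv d G) (S.nv d H) := by
  unfold Berk.nv
  rw [max_div_div_right (pow_pos (Quotient.out S).norm_pos d).le]
  gcongr
  · exact pow_nonneg (Quotient.out S).norm_pos.le d
  · exact HomSeminorm.add_le_max hK _ _ _

theorem linForm_add (b b' : Fin 2 → K) : linForm (b + b') = linForm b + linForm b' := by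
  simp [linForm, wedge]
  ring

theorem nv_linForm_le (b : Fin 2 → K) (S : Berk K) : S.nv 1 (linForm b) ≤ vecNorm b := by
  have hX := pairNorm_nv_X S
  have e0 : S.nv 1 (MvPolynomial.X 0 * MvPolynomial.C (b 1)) = S.nv 1 (MvPolynomial.X 0) * ‖b 1‖ := by
    rw [mul_comm, Berk.nv_C_mul, mul_comm]
  have e1 : S.nv 1 (-(MvPolynomial.X 1 * MvPolynomial.C (b 0))) =
      S.nv 1 (MvPolynomial.X 1) * ‖b 0‖ := by
    rw [mul_comm, ← neg_mul, ← MvPolynomial.C_neg, Berk.nv_C_mul, norm_neg, mul_comm]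
  have n0 := S.nv_nonneg 1 (MvPolynomial.X 0)
  have n1 := S.nv_nonneg 1 (MvPolynomial.X 1)
  unfold linForm wedge
  rw [sub_eq_add_neg]
  by_cases hK : IsUltrametricDist K
  · have h0 : S.nv 1 (MvPolynomial.X 0) ≤ 1 := by rw [← hX]; exact le_pairNorm_left K
    have h1 : S.nv 1 (MvPolynomial.X 1) ≤ 1 := by rw [← hX]; exact le_pairNorm_right K
    refine (S.nv_add_le_max hK _ _ _).trans (max_le ?_ ?_)
    · rw [e0]
      exact (mul_le_of_le_one_left (norm_nonneg _) h0).trans (norm_apply_le_vecNorm b 1)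
    · rw [e1]
      exact (mul_le_of_le_one_left (norm_nonneg _) h1).trans (norm_apply_le_vecNorm b 0)
  · have hadd : S.nv 1 (MvPolynomial.X 0 * MvPolynomial.C (b 1) +
        -(MvPolynomial.X 1 * MvPolynomial.C (b 0))) ≤
        S.nv 1 (MvPolynomial.X 0) * ‖b 1‖ + S.nv 1 (MvPolynomial.X 1) * ‖b 0‖ := by
      rw [← e0, ← e1]
      unfold Berk.nv
      rw [← add_div]
      gcongr
      · exact pow_nonneg (HomSeminorm.norm_pos _).le 1
      · exact map_add_le_add _ _ _
    refine hadd.trans ((add_mul_le_pairNorm K hK).trans ?_)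
    rw [hX, one_mul, pairNorm_comm]
    exact le_rfl

theorem kap_le_one (w : P1 K) (S : Berk K) : kap w S ≤ 1 :=
  div_le_one_of_le₀ (nv_linForm_le _ _) (vecNorm_nonneg _)

/-- The dual form of the Plücker relation. -/
theorem linForm_relation (p q : Fin 2 → K) (b : Fin 2 → K) :
    MvPolynomial.C (wedge p q) * linForm b =
      MvPolynomial.C (wedge b q) * linForm p + MvPolynomial.C (wedge p b) * linForm q := by
  rw [← linForm_smul, ← linForm_smul, ← linForm_smul, ← linForm_add, wedge_smul_eq]

theorem kap_le_max (hK : IsUltrametricDist K) (w w' : P1 K) (S : Berk K) :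
    kap w S ≤ max (chordal w w') (kap w' S) := by
  obtain ⟨q, hq⟩ := exists_wedge_eq_one w'.rep_nonzero
  have h2 := vecNorm_rep_pos w
  have h3 := vecNorm_rep_pos w'
  have hX := pairNorm_nv_X S
  have h0 : S.nv 1 (MvPolynomial.X 0) ≤ 1 := by rw [← hX]; exact le_pairNorm_left K
  have h1 : S.nv 1 (MvPolynomial.X 1) ≤ 1 := by rw [← hX]; exact le_pairNorm_right K
  have key : ∀ i, ‖w'.rep i‖ * S.nv 1 (linForm w.rep) ≤
      max (‖wedge w.rep w'.rep‖) (‖w.rep i‖ * S.nv 1 (linForm w'.rep)) := by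
    intro i
    have e : MvPolynomial.C (w'.rep i) * linForm w.rep =
        MvPolynomial.C (- wedge w.rep w'.rep) * MvPolynomial.X i +
          MvPolynomial.C (w.rep i) * linForm w'.rep := by
      fin_cases i <;> simp [linForm, wedge] <;> ring
    rw [← Berk.nv_C_mul, e]
    refine (S.nv_add_le_max hK _ _ _).trans (max_le_max ?_ ?_)
    · rw [Berk.nv_C_mul, norm_neg]
      refine mul_le_of_le_one_right (norm_nonneg _) ?_
      fin_cases i
      · exact h0
      · exact h1
    · rw [Berk.nv_C_mul]
  have hv : vecNorm w'.rep = ‖w'.rep 0‖ ∨ vecNorm w'.rep = ‖w'.rep 1‖ := by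
    unfold vecNorm pairNorm
    rw [if_pos hK]
    exact max_choice _ _
  obtain ⟨i, hi⟩ : ∃ i, vecNorm w'.rep = ‖w'.rep i‖ := hv.elim (fun h => ⟨0, h⟩) fun h => ⟨1, h⟩
  have h4 := key i
  rw [← hi] at h4
  have h5 := norm_apply_le_vecNorm w.rep i
  unfold kap
  rcases le_max_iff.1 h4 with h | h
  · refine le_max_of_le_left ?_
    unfold chordal
    rw [div_le_div_iff₀ h2 (by positivity)]
    nlinarith
  · refine le_max_of_le_right ?_
    rw [div_le_div_iff₀ h2 h3]
    have := S.nv_nonneg 1 (linForm w'.rep)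
    nlinarith [mul_le_mul_of_nonneg_right h5 this]

theorem chordal_le_max_kap (hK : IsUltrametricDist K) (w w' : P1 K) (S : Berk K) :
    chordal w w' ≤ max (kap w S) (kap w' S) := by
  have h2 := vecNorm_rep_pos w
  have h3 := vecNorm_rep_pos w'
  have hX := pairNorm_nv_X S
  have key : ∀ i, ‖wedge w.rep w'.rep‖ * S.nv 1 (MvPolynomial.X i) ≤
      max (‖w'.rep i‖ * S.nv 1 (linForm w.rep)) (‖w.rep i‖ * S.nv 1 (linForm w'.rep)) := by
    intro i
    have e : MvPolynomial.C (wedge w.rep w'.rep) * MvPolynomial.X i =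
        MvPolynomial.C (- w'.rep i) * linForm w.rep +
          MvPolynomial.C (w.rep i) * linForm w'.rep := by
      fin_cases i <;> simp [linForm, wedge] <;> ring
    rw [← Berk.nv_C_mul, e]
    refine (S.nv_add_le_max hK _ _ _).trans (max_le_max ?_ ?_)
    · rw [Berk.nv_C_mul, norm_neg]
    · rw [Berk.nv_C_mul]
  have hv : S.nv 1 (MvPolynomial.X 0) = 1 ∨ S.nv 1 (MvPolynomial.X 1) = 1 := by
    unfold pairNorm at hX
    rw [if_pos hK] at hX
    rcases max_choice (S.nv 1 (MvPolynomial.X 0)) (S.nv 1 (MvPolynomial.X 1)) with h | h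
    · left; rwa [h] at hX
    · right; rwa [h] at hX
  obtain ⟨i, hi⟩ : ∃ i, S.nv 1 (MvPolynomial.X i) = 1 := hv.elim (fun h => ⟨0, h⟩) fun h => ⟨1, h⟩
  have h4 := key i
  rw [hi, mul_one, nv_linForm, nv_linForm] at h4
  have h5 := norm_apply_le_vecNorm w.rep i
  have h6 := norm_apply_le_vecNorm w'.rep i
  have k1 := kap_nonneg w S
  have k2 := kap_nonneg w' S
  unfold chordal
  rcases le_max_iff.1 h4 with h | h
  · refine le_max_of_le_left ?_
    rw [div_le_iff₀ (by positivity)]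
    nlinarith [mul_le_mul_of_nonneg_right h6 (mul_nonneg h2.le k1)]
  · refine le_max_of_le_right ?_
    rw [div_le_iff₀ (by positivity)]
    nlinarith [mul_le_mul_of_nonneg_right h5 (mul_nonneg h3.le k2)]

/-- Outside finitely many residue classes. -/
theorem exists_norm_sub_eq_one [IsAlgClosed K] (hK : IsUltrametricDist K) (A : Finset K)
    (hA : ∀ a ∈ A, ‖a‖ ≤ 1) : ∃ u : K, ‖u‖ ≤ 1 ∧ ∀ a ∈ A, ‖u - a‖ = 1 := by
  rcases A.eq_empty_or_nonempty with rfl | hne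
  · exact ⟨0, by simp, by simp⟩
  let P : Polynomial K := ∏ a ∈ A, (Polynomial.X - Polynomial.C a)
  have hmon : P.Monic := Polynomial.monic_prod_of_monic _ _ fun a _ => Polynomial.monic_X_sub_C a
  have hdeg : P.natDegree = A.card := Polynomial.natDegree_finsetProd_X_sub_C_eq_card _ _
  have hd0 : 0 < P.natDegree := by rw [hdeg]; exact hne.card_pos
  obtain ⟨u, hu⟩ := IsAlgClosed.exists_root (P - Polynomial.C 1) (by
    rw [Polynomial.degree_sub_C (Polynomial.natDegree_pos_iff_degree_pos.1 hd0)]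
    exact (Polynomial.natDegree_pos_iff_degree_pos.1 hd0).ne')
  have hprod : ∏ a ∈ A, ‖u - a‖ = 1 := by
    have h1 : P.eval u = 1 := by
      have := hu
      rw [Polynomial.IsRoot, Polynomial.eval_sub, Polynomial.eval_C, sub_eq_zero] at this
      exact this
    rw [← norm_prod]
    have : ∏ a ∈ A, (u - a) = P.eval u := by simp [P, Polynomial.eval_prod]
    rw [this, h1, norm_one]
  have hu1 : ‖u‖ ≤ 1 := by
    by_contra! hlt
    have h2 : ∀ a ∈ A, 1 < ‖u - a‖ := by
      intro a ha
      have : ‖u‖ ≤ max ‖u - a‖ ‖a‖ := by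
        simpa using IsUltrametricDist.norm_add_le_max (u - a) a
      rcases le_max_iff.1 this with h | h
      · linarith
      · linarith [hA a ha]
    obtain ⟨a, ha⟩ := hne
    have : 1 < ∏ a ∈ A, ‖u - a‖ := by
      have h3 := Finset.prod_lt_prod_of_nonempty (s := A) (f := fun _ => (1 : ℝ))
        (g := fun a => ‖u - a‖) (fun _ _ => one_pos) h2 ⟨a, ha⟩
      simpa using h3
    linarith
  have hle : ∀ a ∈ A, ‖u - a‖ ≤ 1 := by
    intro a ha
    rw [sub_eq_add_neg]
    refine (IsUltrametricDist.norm_add_le_max _ _).trans (max_le hu1 ?_)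
    rw [norm_neg]
    exact hA a ha
  refine ⟨u, hu1, fun a ha => le_antisymm (hle a ha) ?_⟩
  classical
  rw [← Finset.mul_prod_erase _ _ ha] at hprod
  have h4 : ∏ x ∈ A.erase a, ‖u - x‖ ≤ 1 :=
    Finset.prod_le_one (fun _ _ => norm_nonneg _) fun x hx => hle x (Finset.mem_of_mem_erase hx)
  nlinarith [norm_nonneg (u - a)]

theorem exists_norm_add_mul_eq_max [IsAlgClosed K] (hK : IsUltrametricDist K)
    {ι : Type*} (A : Finset ι) (x y : ι → K) :
    ∃ u : K, ‖u‖ ≤ 1 ∧ ∀ i ∈ A, ‖x i + u * y i‖ = max ‖x i‖ ‖y i‖ := by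
  classical
  obtain ⟨u, hu, h⟩ := exists_norm_sub_eq_one hK
    ((A.filter fun i => ‖x i‖ ≤ ‖y i‖).image fun i => -(x i / y i)) (by
      intro a ha
      obtain ⟨i, hi, rfl⟩ := Finset.mem_image.1 ha
      rw [norm_neg, norm_div]
      exact div_le_one_of_le₀ (Finset.mem_filter.1 hi).2 (norm_nonneg _))
  refine ⟨u, hu, fun i hi => ?_⟩
  by_cases hxy : ‖x i‖ ≤ ‖y i‖
  · rw [max_eq_right hxy]
    by_cases hy : y i = 0
    · have : x i = 0 := by simpa [hy] using hxy
      simp [hy, this]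
    · have h1 := h (-(x i / y i)) (Finset.mem_image.2 ⟨i, Finset.mem_filter.2 ⟨hi, hxy⟩, rfl⟩)
      have : x i + u * y i = (u - -(x i / y i)) * y i := by field_simp; ring
      rw [this, norm_mul, h1, one_mul]
  · push Not at hxy
    rw [max_eq_left hxy.le]
    have h2 : ‖u * y i‖ < ‖x i‖ := by
      rw [norm_mul]
      exact (mul_le_of_le_one_left (norm_nonneg _) hu).trans_lt hxy
    refine le_antisymm ((IsUltrametricDist.norm_add_le_max _ _).trans (max_le le_rfl h2.le)) ?_
    have : ‖x i‖ ≤ max ‖x i + u * y i‖ ‖u * y i‖ := by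
      have := IsUltrametricDist.norm_add_le_max (x i + u * y i) (-(u * y i))
      rwa [norm_neg, add_neg_cancel_right] at this
    rcases le_max_iff.1 this with h | h
    · exact h
    · linarith

theorem exists_lt_norm_lt [IsAlgClosed K] {r r' : ℝ} (hr : 0 ≤ r) (h : r < r') :
    ∃ t : K, r < ‖t‖ ∧ ‖t‖ < r' := by
  obtain ⟨c, hc⟩ := NormedField.exists_one_lt_norm K
  rcases hr.eq_or_lt with rfl | hr
  · obtain ⟨t, ht, ht'⟩ := NormedField.exists_norm_lt K h
    exact ⟨t, ht, ht'⟩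
  have hq : 1 < r' / r := (one_lt_div hr).2 h
  obtain ⟨N, hN⟩ := pow_unbounded_of_one_lt ‖c‖ hq
  have hN0 : N ≠ 0 := by
    rintro rfl
    simp at hN
    linarith
  obtain ⟨x, hx⟩ := IsAlgClosed.exists_pow_nat_eq c (Nat.pos_of_ne_zero hN0)
  have hx1 : 1 < ‖x‖ := by
    rw [← hx, norm_pow] at hc
    by_contra! hle
    exact absurd (pow_le_one₀ (norm_nonneg x) hle) (not_le.2 hc)
  have hx2 : ‖x‖ < r' / r := by
    rw [← hx, norm_pow] at hN
    exact lt_of_pow_lt_pow_left₀ N (by positivity) hN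
  obtain ⟨k, hk1, hk2⟩ := exists_mem_Ico_zpow hr hx1
  refine ⟨x ^ (k + 1), by rwa [norm_zpow], ?_⟩
  rw [norm_zpow, zpow_add_one₀ (by positivity)]
  rw [lt_div_iff₀ hr] at hx2
  nlinarith [norm_nonneg x]

theorem exists_orthonormal (hK : IsUltrametricDist K) (z : P1 K) :
    ∃ v v' : Fin 2 → K, ∃ hv : v ≠ 0, Projectivization.mk K v hv = z ∧ vecNorm v = 1 ∧
      vecNorm v' = 1 ∧ ‖wedge v v'‖ = 1 := by
  have hmk : ∀ (c : K), c ≠ 0 → ∃ hv : c • z.rep ≠ 0, Projectivization.mk K (c • z.rep) hv = z := by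
    intro c hc
    refine ⟨smul_ne_zero hc z.rep_nonzero, ?_⟩
    conv_rhs => rw [← z.mk_rep]
    exact (Projectivization.mk_eq_mk_iff' K _ _ _ _).2 ⟨c, rfl⟩
  have hn : ∀ a b : K, vecNorm ![a, b] = max ‖a‖ ‖b‖ := fun a b => by
    simp [vecNorm, pairNorm, if_pos hK]
  by_cases h : ‖z.rep 1‖ ≤ ‖z.rep 0‖
  · have h0 : z.rep 0 ≠ 0 := by
      intro h0
      rw [h0, norm_zero] at h
      exact z.rep_nonzero (by ext i; fin_cases i <;> simp_all)
    obtain ⟨hv, hz⟩ := hmk _ (inv_ne_zero h0)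
    have he : (z.rep 0)⁻¹ • z.rep = ![1, z.rep 1 / z.rep 0] := by
      ext i
      fin_cases i <;> simp [h0, div_eq_inv_mul]
    refine ⟨_, ![0, 1], hv, hz, ?_, ?_, ?_⟩
    · rw [he, hn, norm_one, norm_div]
      exact max_eq_left (div_le_one_of_le₀ h (norm_nonneg _))
    · rw [hn]; simp
    · rw [he]; simp [wedge]
  · push Not at h
    have h0 : z.rep 1 ≠ 0 := by
      intro h0
      rw [h0, norm_zero] at h
      exact absurd h (not_lt.2 (norm_nonneg _))
    obtain ⟨hv, hz⟩ := hmk _ (inv_ne_zero h0)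
    have he : (z.rep 1)⁻¹ • z.rep = ![z.rep 0 / z.rep 1, 1] := by
      ext i
      fin_cases i <;> simp [h0, div_eq_inv_mul]
    refine ⟨_, ![1, 0], hv, hz, ?_, ?_, ?_⟩
    · rw [he, hn, norm_one, norm_div]
      exact max_eq_right (div_le_one_of_le₀ h.le (norm_nonneg _))
    · rw [hn]; simp
    · rw [he]; simp [wedge]

/-- Classical points that are generic in the disc of center `z` and radius `‖t‖`. -/
theorem exists_chordal_eq_max [IsAlgClosed K] (hK : IsUltrametricDist K) (z : P1 K) (t : K)
    (ht : ‖t‖ ≤ 1) (W : Finset (P1 K)) : ∃ x : P1 K, ∀ w ∈ W, chordal w x = max (chordal w z) ‖t‖ := by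
  obtain ⟨v, v', hv, hz, h1, h1', hvv⟩ := exists_orthonormal hK z
  obtain ⟨u, hu, h⟩ := exists_norm_add_mul_eq_max hK W (fun w => wedge w.rep v)
    (fun w => t * wedge w.rep v')
  have hw : wedge (v + (u * t) • v') v' = wedge v v' := by
    rw [wedge_add_left, wedge_smul_left, wedge_self, mul_zero, add_zero]
  have hx : v + (u * t) • v' ≠ 0 := by
    intro h0
    rw [h0] at hw
    rw [← hw] at hvv
    simp [wedge] at hvv
  have hut : ‖u * t‖ ≤ 1 := by
    rw [norm_mul]
    exact mul_le_one₀ hu (norm_nonneg _) ht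
  have hnx : vecNorm (v + (u * t) • v') = 1 := by
    refine le_antisymm ((vecNorm_add_le_max hK _ _).trans ?_) ?_
    · rw [vecNorm_smul, h1, h1', mul_one]
      exact max_le le_rfl hut
    · have := norm_wedge_le (v + (u * t) • v') v'
      rwa [hw, hvv, h1', mul_one] at this
  refine ⟨Projectivization.mk K _ hx, fun w hwW => ?_⟩
  have hwp := vecNorm_rep_pos w
  have e1 : chordal w (Projectivization.mk K _ hx) =
      max ‖wedge w.rep v‖ (‖t‖ * ‖wedge w.rep v'‖) / vecNorm w.rep := by
    have := chordal_mk w.rep (v + (u * t) • v') w.rep_nonzero hx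
    rw [w.mk_rep] at this
    rw [this, hnx, mul_one, wedge_add_right, wedge_smul_right, mul_assoc, h w hwW, norm_mul]
  have e2 : chordal w z = ‖wedge w.rep v‖ / vecNorm w.rep := by
    have := chordal_mk w.rep v w.rep_nonzero hv
    rw [w.mk_rep, hz] at this
    rw [this, h1, mul_one]
  have e3 : vecNorm w.rep ≤ max ‖wedge w.rep v‖ ‖wedge w.rep v'‖ := by
    have h3 := congrArg vecNorm (wedge_smul_eq v v' w.rep)
    rw [vecNorm_smul, hvv, one_mul] at h3
    rw [h3]
    refine (vecNorm_add_le_max hK _ _).trans ?_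
    rw [vecNorm_smul, vecNorm_smul, h1, h1', mul_one, mul_one, max_comm, wedge_comm v, norm_neg]
  have e4 : ‖wedge w.rep v‖ ≤ vecNorm w.rep := by
    have := norm_wedge_le w.rep v
    rwa [h1, mul_one] at this
  have e5 : ‖wedge w.rep v'‖ ≤ vecNorm w.rep := by
    have := norm_wedge_le w.rep v'
    rwa [h1', mul_one] at this
  rw [e1, e2, ← max_div_div_right hwp.le]
  rcases le_max_iff.1 e3 with h' | h'
  · have h6 : ‖wedge w.rep v‖ = vecNorm w.rep := le_antisymm e4 h'
    rw [h6, div_self hwp.ne', max_eq_left ht, max_eq_left]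
    rw [div_le_one hwp]
    exact (mul_le_of_le_one_left (norm_nonneg _) ht).trans e5
  · have h6 : ‖wedge w.rep v'‖ = vecNorm w.rep := le_antisymm e5 h'
    rw [h6, mul_div_cancel_right₀ _ hwp.ne']

/-- The point of `𝖯¹` that corresponds to the disc of center `z` and radius `‖t‖`. -/
theorem exists_disc_point [IsAlgClosed K] (hK : IsUltrametricDist K) (z : P1 K) (t : K)
    (ht : ‖t‖ ≤ 1) : ∃ S : Berk K, ∀ w, kap w S = max (chordal w z) ‖t‖ := by
  have := isCompact_univ.inter_iInter_nonempty (fun w : P1 K => {S : Berk K | kap w S = max (chordal w z) ‖t‖})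
    (fun w => isClosed_eq (continuous_kap w) continuous_const) (fun W => by
      obtain ⟨x, hx⟩ := exists_chordal_eq_max hK z t ht W
      refine ⟨toBerk x, Set.mem_univ _, ?_⟩
      simp only [Set.mem_iInter, Set.mem_ofPred_eq]
      intro w hw
      rw [kap_toBerk, hx w hw])
  obtain ⟨S, -, hS⟩ := this
  exact ⟨S, fun w => by simpa using Set.mem_iInter.1 hS w⟩

theorem denseRange_toBerk_of_ultrametric [IsAlgClosed K] (hK : IsUltrametricDist K) :
    DenseRange (toBerk : P1 K → Berk K) := by
  intro S
  refine mem_closure_range_toBerk fun W ε hε => ?_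
  rcases W.eq_empty_or_nonempty with rfl | hne
  · exact ⟨Projectivization.mk K ![1, 0] (fun h => by simpa using congrFun h 0), by simp⟩
  obtain ⟨z, hz, hmin⟩ := W.exists_min_image (fun w => kap w S) hne
  have hmax : ∀ w ∈ W, kap w S = max (chordal w z) (kap z S) := by
    intro w hw
    refine le_antisymm (kap_le_max hK _ _ _) (max_le ?_ (hmin w hw))
    refine (chordal_le_max_kap hK w z S).trans (max_le le_rfl (hmin w hw))
  obtain ⟨t, ht1, ht⟩ : ∃ t : K, ‖t‖ ≤ 1 ∧ |‖t‖ - kap z S| < ε := by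
    rcases (kap_le_one z S).eq_or_lt with h | h
    · exact ⟨1, by simp, by simpa [h] using hε⟩
    · obtain ⟨t, h1, h2⟩ := exists_lt_norm_lt (K := K) (kap_nonneg z S)
        (lt_min h (by linarith : kap z S < kap z S + ε))
      refine ⟨t, (h2.trans_le (min_le_left _ _)).le, ?_⟩
      rw [abs_lt]
      have := h2.trans_le (min_le_right _ _)
      constructor <;> linarith
  obtain ⟨x, hx⟩ := exists_chordal_eq_max hK z t ht1 W
  refine ⟨x, fun w hw => ?_⟩
  rw [hx w hw, hmax w hw]
  refine (abs_max_sub_max_le_max _ _ _ _).trans_lt ?_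
  simp only [sub_self, abs_zero]
  exact max_lt hε ht

end NonArch

end BerkDyn

namespace BerkDyn

section GelfandMazur

variable {R : Type*} [CommRing R] [IsDomain R]

theorem seminorm_sub_smul_le_of_min (ν : MulRingSeminorm R) (φ : ℂ →+* R) {s : ℝ}
    (hφ : ∀ c, ν (φ c) = ‖c‖ ^ s) {x y : R} {m : ℝ} (hm : 0 < m)
    (hmin : ∀ a, m ≤ ν (x - φ a * y)) {a w : ℂ} (ha : ν (x - φ a * y) = m)
    (hw : ‖w‖ ^ s * ν y < m) : ν (x - φ (a + w) * y) = m := by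
  refine le_antisymm ?_ (hmin _)
  set q : ℝ := ‖w‖ ^ s * ν y / m with hq
  have hq0 : 0 ≤ q := div_nonneg (mul_nonneg (by positivity) (apply_nonneg _ _)) hm.le
  have hq1 : q < 1 := (div_lt_one hm).2 hw
  have key : ∀ n : ℕ, ν (x - φ (a + w) * y) ≤ m * (1 + q ^ (n + 1)) := by
    intro n
    have hinj : Function.Injective φ := φ.injective
    have hprim0 := Complex.isPrimitiveRoot_exp (n + 1) (Nat.succ_ne_zero n)
    set ζ := Complex.exp (2 * Real.pi * Complex.I / (n + 1 : ℕ)) with hζ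
    have hprim : IsPrimitiveRoot (φ ζ) (n + 1) := hprim0.map_of_injective hinj
    have hprod := hprim.pow_sub_pow_eq_prod_sub_mul (x - φ a * y) (φ w * y) n.succ_pos
    have hone : (1 : R) ∈ Polynomial.nthRootsFinset (n + 1) (1 : R) :=
      (Polynomial.mem_nthRootsFinset n.succ_pos (1 : R)).2 (one_pow _)
    have hν := congrArg ν hprod
    classical
    rw [← Finset.mul_prod_erase _ _ hone, map_mul, one_mul, map_prod] at hν
    have hge : m ^ n ≤ ∏ i ∈ (Polynomial.nthRootsFinset (n + 1) (1 : R)).erase 1,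
        ν (x - φ a * y - i * (φ w * y)) := by
      have hcard : ((Polynomial.nthRootsFinset (n + 1) (1 : R)).erase 1).card = n := by
        rw [Finset.card_erase_of_mem hone, hprim.card_nthRootsFinset]
        rfl
      conv_lhs => rw [← hcard]
      rw [← Finset.prod_const]
      refine Finset.prod_le_prod (fun _ _ => hm.le) fun i hi => ?_
      have hi1 := (Polynomial.mem_nthRootsFinset n.succ_pos (1 : R)).1 (Finset.mem_of_mem_erase hi)
      obtain ⟨k, -, rfl⟩ := hprim.eq_pow_of_pow_eq_one hi1
      have := hmin (a + ζ ^ k * w)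
      rw [map_add, map_mul, map_pow] at this
      refine this.trans (le_of_eq (congrArg ν ?_))
      ring
    have hle : ν ((x - φ a * y) ^ (n + 1) - (φ w * y) ^ (n + 1)) ≤
        m ^ (n + 1) + (‖w‖ ^ s * ν y) ^ (n + 1) := by
      refine (map_sub_le_add ν _ _).trans ?_
      rw [map_pow, map_pow, ha, map_mul, hφ]
    have hfirst : x - φ a * y - φ w * y = x - φ (a + w) * y := by
      rw [map_add]
      ring
    rw [hν, hfirst] at hle
    have h1 : ν (x - φ (a + w) * y) * m ^ n ≤ m ^ (n + 1) + (‖w‖ ^ s * ν y) ^ (n + 1) :=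
      le_trans (mul_le_mul_of_nonneg_left hge (apply_nonneg _ _)) hle
    have h2 : (‖w‖ ^ s * ν y) = q * m := by rw [hq, div_mul_cancel₀ _ hm.ne']
    rw [h2, mul_pow, pow_succ m] at h1
    have hp : 0 < m ^ n := by positivity
    refine le_of_mul_le_mul_right (h1.trans (le_of_eq ?_)) hp
    ring
  have hlim : Tendsto (fun n : ℕ => m * (1 + q ^ (n + 1))) atTop (𝓝 m) := by
    have h1 := (tendsto_pow_atTop_nhds_zero_of_lt_one hq0 hq1).comp (tendsto_add_atTop_nat 1)
    simpa using (h1.const_add 1).const_mul m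
  exact ge_of_tendsto' hlim key

/-- A form of the Gelfand–Mazur theorem. -/
theorem exists_seminorm_sub_mul_eq_zero (ν : MulRingSeminorm R) (φ : ℂ →+* R) {s : ℝ}
    (hs : 0 < s) (hφ : ∀ c, ν (φ c) = ‖c‖ ^ s) (x y : R) (hy : ν y ≠ 0) :
    ∃ a, ν (x - φ a * y) = 0 := by
  have hy0 : 0 < ν y := lt_of_le_of_ne (apply_nonneg _ _) hy.symm
  have hlip : ∀ a b, ν (x - φ a * y) ≤ ν (x - φ b * y) + ‖a - b‖ ^ s * ν y := by
    intro a b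
    have : x - φ a * y = (x - φ b * y) - φ (a - b) * y := by rw [map_sub]; ring
    rw [this, ← hφ, ← map_mul]
    exact map_sub_le_add ν _ _
  have hcont : Continuous fun a => ν (x - φ a * y) := by
    rw [continuous_iff_continuousAt]
    intro b
    rw [ContinuousAt, tendsto_iff_norm_sub_tendsto_zero]
    have hlim : Tendsto (fun a : ℂ => ‖a - b‖ ^ s * ν y) (𝓝 b) (𝓝 0) := by
      have h1 : Continuous fun a : ℂ => ‖a - b‖ ^ s * ν y :=
        ((continuous_id.sub continuous_const).norm.rpow_const fun _ => Or.inr hs.le).mul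
          continuous_const
      have := h1.tendsto b
      simpa [Real.zero_rpow hs.ne'] using this
    refine squeeze_zero (fun _ => norm_nonneg _) (fun a => ?_) hlim
    rw [Real.norm_eq_abs, abs_le]
    have h1 := hlip a b
    have h2 := hlip b a
    rw [norm_sub_rev] at h2
    constructor <;> linarith
  have hge : ∀ a, ‖a‖ ^ s * ν y - ν x ≤ ν (x - φ a * y) := by
    intro a
    have : ν (φ a * y) ≤ ν (x - φ a * y) + ν x := by
      have h1 : φ a * y = x - (x - φ a * y) := by ring
      conv_lhs => rw [h1]
      rw [add_comm]
      exact map_sub_le_add ν _ _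
    rw [map_mul, hφ] at this
    linarith
  have htend : Tendsto (fun a => ν (x - φ a * y)) (cocompact ℂ) atTop := by
    refine tendsto_atTop_mono hge ?_
    refine tendsto_atTop_add_const_right _ _ ?_
    exact ((tendsto_rpow_atTop hs).comp tendsto_norm_cocompact_atTop).atTop_mul_const hy0
  obtain ⟨a, ha⟩ := hcont.exists_forall_le htend
  refine ⟨a, ?_⟩
  by_contra hne
  have hm : 0 < ν (x - φ a * y) := lt_of_le_of_ne (apply_nonneg _ _) (Ne.symm hne)
  obtain ⟨r, hr0, hr⟩ : ∃ r : ℝ, 0 < r ∧ r ^ s * ν y < ν (x - φ a * y) := by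
    have h1 : Continuous fun r : ℝ => r ^ s * ν y :=
      (continuous_id.rpow_const fun _ => Or.inr hs.le).mul continuous_const
    have h2 : Tendsto (fun r : ℝ => r ^ s * ν y) (𝓝[>] 0) (𝓝 0) := by
      have := (h1.tendsto 0).mono_left (nhdsWithin_le_nhds (s := Set.Ioi 0))
      simpa [Real.zero_rpow hs.ne'] using this
    obtain ⟨r, h3, h4⟩ := ((h2.eventually (gt_mem_nhds hm)).and self_mem_nhdsWithin).exists
    exact ⟨r, h4, h3⟩
  have hall : ∀ n : ℕ, ν (x - φ (a + n * r) * y) = ν (x - φ a * y) := by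
    intro n
    induction n with
    | zero => simp
    | succ n ih =>
      have := seminorm_sub_smul_le_of_min ν φ hφ hm ha (w := (r : ℂ)) ih
        (by rwa [Complex.norm_of_nonneg hr0.le])
      rw [← this]
      congr 4
      push_cast
      ring
  have hunb : Tendsto (fun n : ℕ => a + (n : ℂ) * r) atTop (cocompact ℂ) := by
    rw [← Metric.cobounded_eq_cocompact]
    refine (tendsto_const_add_cobounded a).comp ?_
    rw [← tendsto_norm_atTop_iff_cobounded]
    simp only [norm_mul, Complex.norm_natCast, Complex.norm_of_nonneg hr0.le]
    exact tendsto_natCast_atTop_atTop.atTop_mul_const hr0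
  have h5 := htend.comp hunb
  have h6 : (fun n : ℕ => ν (x - φ (a + n * r) * y)) = fun _ => ν (x - φ a * y) := funext hall
  have h7 : Tendsto (fun _ : ℕ => ν (x - φ a * y)) atTop atTop := by
    rw [← h6]
    exact h5
  exact not_tendsto_const_atTop _ _ h7

end GelfandMazur

section Arch

variable {K : Type*} [NontriviallyNormedField K]

theorem exists_norm_ratCast_eq [CharZero K] (hK : ¬ IsUltrametricDist K) :
    ∃ s : ℝ, 0 < s ∧ ∀ q : ℚ, ‖(q : K)‖ = |(q : ℝ)| ^ s := by
  let v : AbsoluteValue ℚ ℝ :=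
    { toFun := fun q => ‖(q : K)‖
      map_mul' := fun x y => by simp
      nonneg' := fun x => norm_nonneg _
      eq_zero' := fun x => by simp
      add_le' := fun x y => by
        rw [Rat.cast_add]
        exact norm_add_le _ _ }
  have hv : ∀ q, v q = ‖(q : K)‖ := fun _ => rfl
  have hnb : ¬ ∀ n : ℕ, v n ≤ 1 := by
    intro h
    apply hK
    refine IsUltrametricDist.isUltrametricDist_of_forall_norm_natCast_le_one fun n => ?_
    simpa [hv] using h n
  obtain ⟨c, hc, h⟩ := AbsoluteValue.isEquiv_iff_exists_rpow_eq.1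
    (Rat.AbsoluteValue.equiv_real_of_unbounded hnb).symm
  refine ⟨c, hc, fun q => ?_⟩
  have := congrFun h q
  simp only [Rat.AbsoluteValue.real_eq_abs] at this
  rw [← hv, ← this]
  simp

theorem exists_real_embedding [CharZero K] [CompleteSpace K] (hK : ¬ IsUltrametricDist K) :
    ∃ (s : ℝ) (ρ : ℝ →+* K), 0 < s ∧ ∀ x, ‖ρ x‖ = |x| ^ s := by
  obtain ⟨s, hs, hq⟩ := exists_norm_ratCast_eq hK
  have hui : IsUniformInducing (Rat.castHom ℝ) := Rat.isUniformEmbedding_coe_real.isUniformInducing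
  have hdr : DenseRange (Rat.castHom ℝ) := Rat.denseRange_cast
  have huc : UniformContinuous (Rat.castHom K) := by
    rw [Metric.uniformContinuous_iff]
    intro ε hε
    refine ⟨ε ^ s⁻¹, by positivity, fun {a b} hab => ?_⟩
    rw [dist_eq_norm, ← map_sub]
    change ‖((a - b : ℚ) : K)‖ < ε
    rw [hq]
    have h1 : |((a - b : ℚ) : ℝ)| < ε ^ s⁻¹ := by
      rw [Rat.dist_eq] at hab
      simpa using hab
    calc |((a - b : ℚ) : ℝ)| ^ s < (ε ^ s⁻¹) ^ s := Real.rpow_lt_rpow (abs_nonneg _) h1 hs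
      _ = ε := Real.rpow_inv_rpow hε.le hs.ne'
  let ρ : ℝ →+* K := IsDenseInducing.extendRingHom hui hdr huc
  have hρc : Continuous ρ := (uniformContinuous_uniformly_extend hui hdr huc).continuous
  have hρq : ∀ q : ℚ, ρ q = q := fun q =>
    IsDenseInducing.extend_eq (hui.isDenseInducing hdr) huc.continuous q
  refine ⟨s, ρ, hs, fun x => ?_⟩
  have h1 : Continuous fun x : ℝ => |x| ^ s := continuous_abs.rpow_const fun _ => Or.inr hs.le
  have := Rat.denseRange_cast (𝕜 := ℝ) |>.equalizer hρc.norm h1 (by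
    funext q
    simp [hρq, hq])
  exact congrFun this x

/-- A complete algebraically closed archimedean field is `ℂ` with a power of its absolute
value. -/
theorem exists_complex_equiv [IsAlgClosed K] [CharZero K] [CompleteSpace K]
    (hK : ¬ IsUltrametricDist K) :
    ∃ (s : ℝ) (ι : ℂ ≃+* K), 0 < s ∧ ∀ z, ‖ι z‖ = ‖z‖ ^ s := by
  obtain ⟨s, ρ, hs, hρ⟩ := exists_real_embedding hK
  obtain ⟨i, hi⟩ := IsAlgClosed.exists_pow_nat_eq (-1 : K) two_pos
  have hi1 : ‖i‖ = 1 := by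
    have h1 := congrArg norm hi
    rw [norm_pow, norm_neg, norm_one] at h1
    exact (pow_eq_one_iff_of_nonneg (norm_nonneg i) two_ne_zero).1 h1
  let _ : Algebra ℝ K := ρ.toAlgebra
  have hii : i * i = -1 := by rw [← sq, hi]
  let φ : ℂ →ₐ[ℝ] K := Complex.lift ⟨i, hii⟩
  have hφ : ∀ z : ℂ, φ z = ρ z.re + ρ z.im * i := by
    intro z
    have h1 : φ z = algebraMap ℝ K z.re + z.im • i := Complex.liftAux_apply i hii z
    rw [h1, Algebra.smul_def]
    rfl
  have hle : ∀ z : ℂ, ‖z‖ ≤ 1 → ‖φ z‖ ≤ 2 := by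
    intro z hz
    rw [hφ]
    refine (norm_add_le _ _).trans ?_
    rw [norm_mul, hi1, mul_one, hρ, hρ]
    have h1 : |z.re| ^ s ≤ 1 := Real.rpow_le_one (abs_nonneg _)
      ((Complex.abs_re_le_norm z).trans hz) hs.le
    have h2 : |z.im| ^ s ≤ 1 := Real.rpow_le_one (abs_nonneg _)
      ((Complex.abs_im_le_norm z).trans hz) hs.le
    linarith
  have hle1 : ∀ z : ℂ, ‖z‖ ≤ 1 → ‖φ z‖ ≤ 1 := by
    intro z hz
    refine le_of_forall_pow_le_mul_pow zero_le_one fun n => ?_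
    rcases n with _ | n
    · simp
    rw [one_pow, mul_one, ← norm_pow, ← map_pow]
    refine (hle _ ?_).trans ?_
    · rw [norm_pow]
      exact pow_le_one₀ (norm_nonneg _) hz
    · push_cast
      linarith [(Nat.cast_nonneg n : (0 : ℝ) ≤ n)]
  have hone : ∀ z : ℂ, ‖z‖ = 1 → ‖φ z‖ = 1 := by
    intro z hz
    refine le_antisymm (hle1 z hz.le) ?_
    have h1 := hle1 z⁻¹ (by rw [norm_inv, hz, inv_one])
    rw [map_inv₀, norm_inv] at h1
    have hz0 : z ≠ 0 := by
      rintro rfl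
      simp at hz
    have hpos : 0 < ‖φ z‖ := norm_pos_iff.2 ((map_ne_zero φ).2 hz0)
    rwa [inv_le_one₀ hpos] at h1
  have hnorm : ∀ z : ℂ, ‖φ z‖ = ‖z‖ ^ s := by
    intro z
    by_cases hz : z = 0
    · simp [hz, Real.zero_rpow hs.ne']
    have hz' : (‖z‖ : ℂ) ≠ 0 := by simpa using hz
    have h1 : z = (‖z‖ : ℂ) * (z / ‖z‖) := by field_simp
    have h2 : φ (‖z‖ : ℂ) = ρ ‖z‖ := by
      rw [hφ]
      simp
    conv_lhs => rw [h1, map_mul, norm_mul, h2, hρ, hone (z / ‖z‖) (by simp [hz])]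
    rw [mul_one, abs_of_nonneg (norm_nonneg z)]
  have hsurj : Function.Surjective φ := by
    intro x
    obtain ⟨a, ha⟩ := exists_seminorm_sub_mul_eq_zero
      (NormedField.toMulRingNorm K).toMulRingSeminorm φ.toRingHom hs hnorm x 1
      (by
        change ‖(1 : K)‖ ≠ 0
        simp)
    refine ⟨a, ?_⟩
    change ‖x - φ a * 1‖ = 0 at ha
    rw [norm_eq_zero, mul_one, sub_eq_zero] at ha
    exact ha.symm
  exact ⟨s, RingEquiv.ofBijective φ.toRingHom ⟨φ.toRingHom.injective, hsurj⟩, hs, hnorm⟩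

theorem toBerk_surjective_of_not_ultrametric [IsAlgClosed K] [CharZero K] [CompleteSpace K]
    (hK : ¬ IsUltrametricDist K) : Function.Surjective (toBerk : P1 K → Berk K) := by
  obtain ⟨s, ι, hs, hι⟩ := exists_complex_equiv hK
  have key : ∀ S : Berk K, ∀ b : Fin 2 → K, ∀ hb : b ≠ 0, S.nv 1 (linForm b) = 0 →
      ∃ z, toBerk z = S := by
    intro S b hb h
    refine ⟨Projectivization.mk K b hb, (eq_toBerk_of_kap_eq_zero ?_).symm⟩
    rw [kap_mk, h, zero_div]
  intro S
  obtain ⟨t, rfl⟩ := Quotient.exists_rep S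
  by_cases h1 : t.toSeminorm (MvPolynomial.X 1) = 0
  · refine key _ ![1, 0] (fun h => by simpa using congrFun h 0) ?_
    refine (Berk.nv_mk t (linForm_isHomogeneous _)).trans ?_
    have : linForm ![(1 : K), 0] = - MvPolynomial.X 1 := by simp [linForm, wedge]
    rw [this, map_neg_eq_map, h1, zero_div]
  · obtain ⟨a, ha⟩ := exists_seminorm_sub_mul_eq_zero t.toSeminorm
      ((MvPolynomial.C : K →+* MvPolynomial (Fin 2) K).comp ι.toRingHom) hs
      (fun c => (t.map_C _).trans (hι c)) (MvPolynomial.X 0) (MvPolynomial.X 1) h1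
    refine key _ ![ι a, 1] (fun h => by simpa using congrFun h 1) ?_
    refine (Berk.nv_mk t (linForm_isHomogeneous _)).trans ?_
    have : linForm ![ι a, 1] = MvPolynomial.X 0 - MvPolynomial.C (ι a) * MvPolynomial.X 1 := by
      simp [linForm, wedge, mul_comm]
    rw [this]
    have ha' : t.toSeminorm (MvPolynomial.X 0 - MvPolynomial.C (ι a) * MvPolynomial.X 1) = 0 := ha
    rw [ha', zero_div]

theorem denseRange_toBerk [IsAlgClosed K] [CharZero K] [CompleteSpace K] :
    DenseRange (toBerk : P1 K → Berk K) := by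
  by_cases hK : IsUltrametricDist K
  · exact denseRange_toBerk_of_ultrametric hK
  · exact (toBerk_surjective_of_not_ultrametric hK).denseRange

end Arch

end BerkDyn

namespace BerkDyn

section Extension

variable {K : Type*} [NontriviallyNormedField K] [IsAlgClosed K] [CharZero K] [CompleteSpace K]

instance comap_toBerk_neBot (S : Berk K) : (comap toBerk (𝓝 S)).NeBot := by
  rw [comap_neBot_iff]
  intro U hU
  obtain ⟨S', hS', z, rfl⟩ := mem_closure_iff_nhds.1 (denseRange_toBerk S) U hU
  exact ⟨z, hS'⟩

theorem berkExtend_eq {φ : P1 K → ℝ} {ψ : Berk K → ℝ} (hψ : Continuous ψ)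
    (h : ∀ z, ψ (toBerk z) = φ z) : berkExtend φ = ψ := by
  funext S
  refine Tendsto.limUnder_eq ?_
  have := (hψ.tendsto S).comp (tendsto_comap (f := toBerk))
  refine this.congr fun z => h z

theorem hsia_toBerk (w : P1 K) (S : Berk K) : hsia (toBerk w) S = kap w S := by
  refine Tendsto.limsup_eq ?_
  have h1 : Tendsto (fun zw : P1 K × P1 K => chordal w zw.2)
      (comap toBerk (𝓝 (toBerk w)) ×ˢ comap toBerk (𝓝 S)) (𝓝 (kap w S)) := by
    have := (((continuous_kap w).tendsto S).comp (tendsto_comap (f := toBerk))).comp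
      (tendsto_snd (f := comap toBerk (𝓝 (toBerk w))))
    exact this.congr fun z => kap_toBerk _ _
  have h2 : Tendsto (fun zw : P1 K × P1 K => chordal w zw.1)
      (comap toBerk (𝓝 (toBerk w)) ×ˢ comap toBerk (𝓝 S)) (𝓝 0) := by
    have := (((continuous_kap w).tendsto (toBerk w)).comp (tendsto_comap (f := toBerk))).comp
      (tendsto_fst (g := comap toBerk (𝓝 S)))
    rw [kap_toBerk, chordal_self] at this
    exact this.congr fun z => kap_toBerk _ _
  have h3 : Tendsto (fun zw : P1 K × P1 K => chordal zw.1 zw.2 - chordal w zw.2)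
      (comap toBerk (𝓝 (toBerk w)) ×ˢ comap toBerk (𝓝 S)) (𝓝 0) := by
    refine squeeze_zero_norm (fun zw => ?_) h2
    rw [Real.norm_eq_abs, abs_le]
    have e1 := chordal_triangle zw.1 w zw.2
    have e2 := chordal_triangle w zw.1 zw.2
    rw [chordal_comm zw.1 w] at e1
    constructor <;> linarith
  simpa using h3.add h1

end Extension

section PolynomialMap

open MvPolynomial

variable {K : Type*} [NontriviallyNormedField K]

/-- The action of the lift on the points with coordinates in a `K`-algebra. -/
noncomputable def ev (f : RatFunc K) {R : Type*} [CommRing R] [Algebra K R] (p : Fin 2 → R) :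
    Fin 2 → R := fun i => aeval p (lift f i)

variable {R : Type*} [CommRing R] [Algebra K R] {R' : Type*} [CommRing R'] [Algebra K R']

theorem map_ev (f : RatFunc K) (φ : R →ₐ[K] R') (p : Fin 2 → R) :
    (fun i => φ (ev f p i)) = ev f fun i => φ (p i) := by
  funext i
  exact comp_aeval_apply p φ (lift f i)

theorem map_ev_iterate (f : RatFunc K) (φ : R →ₐ[K] R') (p : Fin 2 → R) (n : ℕ) :
    (fun i => φ ((ev f)^[n] p i)) = (ev f)^[n] fun i => φ (p i) := by
  induction n with
  | zero => rfl
  | succ n ih => rw [Function.iterate_succ_apply', Function.iterate_succ_apply', map_ev, ih]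

theorem liftIter_eq (f : RatFunc K) (n : ℕ) : liftIter f n = (ev f)^[n] X := by
  induction n with
  | zero => rfl
  | succ n ih =>
    rw [Function.iterate_succ_apply', ← ih]
    rfl

theorem aeval_liftIter (f : RatFunc K) (n : ℕ) (p : Fin 2 → R) :
    (fun i => aeval p (liftIter f n i)) = (ev f)^[n] p := by
  rw [liftIter_eq, map_ev_iterate f (aeval p)]
  simp

theorem eval_liftIter (f : RatFunc K) (n : ℕ) (p : Fin 2 → K) :
    (fun i => eval p (liftIter f n i)) = (ev f)^[n] p := by
  rw [← aeval_liftIter]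
  simp [aeval_eq_eval]

theorem ev_eq_eval (f : RatFunc K) (p : Fin 2 → K) : ev f p = fun i => eval p (lift f i) := by
  funext i
  simp [ev, aeval_eq_eval]

theorem ev_ne_zero (f : RatFunc K) {p : Fin 2 → K} (hp : p ≠ 0) : ev f p ≠ 0 := by
  intro h
  rw [ev_eq_eval] at h
  exact hp (lift_nondegenerate f p fun i => congrFun h i)

theorem ev_iterate_ne_zero (f : RatFunc K) {p : Fin 2 → K} (hp : p ≠ 0) (n : ℕ) :
    (ev f)^[n] p ≠ 0 := by
  induction n with
  | zero => exact hp
  | succ n ih => rw [Function.iterate_succ_apply']; exact ev_ne_zero f ih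

theorem ev_smul (f : RatFunc K) (c : R) (p : Fin 2 → R) :
    ev f (c • p) = c ^ deg f • ev f p := by
  funext i
  exact aeval_smul_of_isHomogeneous (lift_isHomogeneous f i) c p

theorem map_mk (f : RatFunc K) (p : Fin 2 → K) (hp : p ≠ 0) :
    map f (Projectivization.mk K p hp) = Projectivization.mk K (ev f p) (ev_ne_zero f hp) := by
  obtain ⟨c, hc, h⟩ := exists_rep_mk_smul p hp
  unfold map
  rw [Projectivization.mk_eq_mk_iff']
  refine ⟨c ^ deg f, ?_⟩
  rw [← ev_smul, ← h, ev_eq_eval]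

theorem map_iterate_mk (f : RatFunc K) (n : ℕ) (p : Fin 2 → K) (hp : p ≠ 0) :
    (map f)^[n] (Projectivization.mk K p hp) =
      Projectivization.mk K ((ev f)^[n] p) (ev_iterate_ne_zero f hp n) := by
  induction n with
  | zero => rfl
  | succ n ih =>
    rw [Function.iterate_succ_apply', ih, map_mk]
    congr 1
    rw [Function.iterate_succ_apply']

theorem map_iterate_eq (f : RatFunc K) (n : ℕ) (z : P1 K) :
    (map f)^[n] z = Projectivization.mk K ((ev f)^[n] z.rep)
      (ev_iterate_ne_zero f z.rep_nonzero n) := by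
  conv_lhs => rw [← z.mk_rep, map_iterate_mk]

theorem aeval_homogenize (P : Polynomial K) (n : ℕ) (p : Fin 2 → R) :
    aeval p (P.homogenize n) = ∑ kl ∈ Finset.HasAntidiagonal.antidiagonal n,
      algebraMap K R (P.coeff kl.1) * (p 0 ^ kl.1 * p 1 ^ kl.2) := by
  simp only [Polynomial.homogenize, map_sum]
  refine Finset.sum_congr rfl fun kl _ => ?_
  rw [aeval_monomial, Finsupp.prod_fintype _ _ (fun _ => pow_zero _)]
  simp [Fin.prod_univ_two]

/-- The quotient of `p₀ᵏ p₁ᵏ' q₀ˡ q₁ˡ' - p₀ˡ p₁ˡ' q₀ᵏ q₁ᵏ'`, where `l ≤ k` and `k + k' = l + l'`, by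
`p ∧ q`. -/
def monoQuot (k k' l : ℕ) (p q : Fin 2 → R) : R :=
  p 0 ^ l * q 0 ^ l * p 1 ^ k' * q 1 ^ k' *
    ∑ i ∈ Finset.range (k - l), (p 0 * q 1) ^ i * (p 1 * q 0) ^ (k - l - 1 - i)

theorem monoQuot_mul (k k' l l' : ℕ) (h : l ≤ k) (hd : k + k' = l + l') (p q : Fin 2 → R) :
    wedge p q * monoQuot k k' l p q =
      p 0 ^ k * p 1 ^ k' * (q 0 ^ l * q 1 ^ l') - p 0 ^ l * p 1 ^ l' * (q 0 ^ k * q 1 ^ k') := by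
  have hg := (Commute.all (p 0 * q 1) (p 1 * q 0)).geom_sum₂_mul (k - l)
  obtain ⟨e, rfl⟩ := Nat.exists_eq_add_of_le h
  have hl' : l' = k' + e := by omega
  subst hl'
  rw [Nat.add_sub_cancel_left] at hg
  unfold monoQuot wedge
  rw [Nat.add_sub_cancel_left]
  simp only [mul_pow, pow_add] at hg ⊢
  linear_combination (p 0 ^ l * q 0 ^ l * p 1 ^ k' * q 1 ^ k') * hg

open Classical in
/-- The bihomogeneous form `B` with `F(p) ∧ F(q) = (p ∧ q) B(p, q)`. -/
noncomputable def bez (f : RatFunc K) (p q : Fin 2 → R) : R :=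
  ∑ k ∈ Finset.HasAntidiagonal.antidiagonal (deg f),
    ∑ l ∈ Finset.HasAntidiagonal.antidiagonal (deg f),
      algebraMap K R (f.num.coeff k.1 * f.denom.coeff l.1) *
        (if l.1 ≤ k.1 then monoQuot k.1 k.2 l.1 p q else -monoQuot l.1 l.2 k.1 p q)

theorem wedge_ev (f : RatFunc K) (p q : Fin 2 → R) :
    wedge (ev f p) (ev f q) = wedge p q * bez f p q := by
  have e0 : ∀ p : Fin 2 → R, ev f p 0 = aeval p (f.num.homogenize (deg f)) := fun _ => rfl
  have e1 : ∀ p : Fin 2 → R, ev f p 1 = aeval p (f.denom.homogenize (deg f)) := fun _ => rfl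
  have h1 : wedge (ev f p) (ev f q) = ev f p 0 * ev f q 1 - ev f q 0 * ev f p 1 := by
    unfold wedge
    ring
  rw [h1, e0, e0, e1, e1, aeval_homogenize, aeval_homogenize, aeval_homogenize, aeval_homogenize,
    Finset.sum_mul_sum, Finset.sum_mul_sum, bez, Finset.mul_sum, ← Finset.sum_sub_distrib]
  refine Finset.sum_congr rfl fun k hk => ?_
  rw [Finset.mul_sum, ← Finset.sum_sub_distrib]
  refine Finset.sum_congr rfl fun l hl => ?_
  have hk' := Finset.HasAntidiagonal.mem_antidiagonal.1 hk
  have hl' := Finset.HasAntidiagonal.mem_antidiagonal.1 hl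
  rw [map_mul]
  split_ifs with h
  · have := monoQuot_mul k.1 k.2 l.1 l.2 h (hk'.trans hl'.symm) p q
    linear_combination (-(algebraMap K R (f.num.coeff k.1) * algebraMap K R (f.denom.coeff l.1))) *
      this
  · have := monoQuot_mul l.1 l.2 k.1 k.2 (by omega) (hl'.trans hk'.symm) p q
    linear_combination (algebraMap K R (f.num.coeff k.1) * algebraMap K R (f.denom.coeff l.1)) *
      this

theorem map_bez (f : RatFunc K) (φ : R →ₐ[K] R') (p q : Fin 2 → R) :
    φ (bez f p q) = bez f (fun i => φ (p i)) (fun i => φ (q i)) := by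
  unfold bez
  simp only [map_sum, map_mul, AlgHom.commutes]
  refine Finset.sum_congr rfl fun k _ => Finset.sum_congr rfl fun l _ => ?_
  congr 1
  split_ifs <;> simp [monoQuot]

theorem monoQuot_isHomogeneous {k k' l e e' d : ℕ} {p q : Fin 2 → MvPolynomial (Fin 2) K}
    (hd : k + k' = d) (hlk : l ≤ k)
    (hp : ∀ i, (p i).IsHomogeneous e) (hq : ∀ i, (q i).IsHomogeneous e') :
    (monoQuot k k' l p q).IsHomogeneous ((e + e') * (d - 1)) := by
  rcases hlk.eq_or_lt with rfl | hlt
  · simpa [monoQuot] using isHomogeneous_zero (Fin 2) K _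
  unfold monoQuot
  have h1 := (((hp 0).pow l).mul ((hq 0).pow l)).mul ((hp 1).pow k') |>.mul ((hq 1).pow k')
  have h2 : (∑ i ∈ Finset.range (k - l), (p 0 * q 1) ^ i * (p 1 * q 0) ^ (k - l - 1 - i) :
      MvPolynomial (Fin 2) K).IsHomogeneous ((e + e') * (k - l - 1)) := by
    refine IsHomogeneous.sum _ _ _ fun i hi => ?_
    have := (((hp 0).mul (hq 1)).pow i).mul (((hp 1).mul (hq 0)).pow (k - l - 1 - i))
    rw [← mul_add] at this
    convert this using 2
    have := Finset.mem_range.1 hi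
    omega
  convert h1.mul h2 using 1
  obtain ⟨j, rfl⟩ : ∃ j, k = l + j + 1 := ⟨k - l - 1, by omega⟩
  have e1 : d - 1 = l + j + k' := by omega
  have e2 : l + j + 1 - l - 1 = j := by omega
  rw [e1, e2]
  ring

theorem bez_isHomogeneous (f : RatFunc K) {e e' : ℕ} {p q : Fin 2 → MvPolynomial (Fin 2) K}
    (hp : ∀ i, (p i).IsHomogeneous e) (hq : ∀ i, (q i).IsHomogeneous e') :
    (bez f p q).IsHomogeneous ((e + e') * (deg f - 1)) := by
  unfold bez
  refine IsHomogeneous.sum _ _ _ fun k hk => IsHomogeneous.sum _ _ _ fun l hl => ?_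
  refine IsHomogeneous.C_mul ?_ _
  have hk' := Finset.HasAntidiagonal.mem_antidiagonal.1 hk
  have hl' := Finset.HasAntidiagonal.mem_antidiagonal.1 hl
  split_ifs with h
  · exact monoQuot_isHomogeneous hk' h hp hq
  · exact (monoQuot_isHomogeneous hl' (by omega) hp hq).neg

theorem norm_monoQuot_le {k k' l d : ℕ} {p q : Fin 2 → K} (hd : k + k' = d) (hlk : l ≤ k) :
    ‖monoQuot k k' l p q‖ ≤ d * (vecNorm p * vecNorm q) ^ (d - 1) := by
  have hp := norm_apply_le_vecNorm p
  have hq := norm_apply_le_vecNorm q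
  have hpn := vecNorm_nonneg p
  have hqn := vecNorm_nonneg q
  unfold monoQuot
  rw [norm_mul]
  have h1 : ‖p 0 ^ l * q 0 ^ l * p 1 ^ k' * q 1 ^ k'‖ ≤ (vecNorm p * vecNorm q) ^ (l + k') := by
    simp only [norm_mul, norm_pow]
    calc _ ≤ vecNorm p ^ l * vecNorm q ^ l * vecNorm p ^ k' * vecNorm q ^ k' := by
          gcongr <;> first | exact hp _ | exact hq _
      _ = _ := by rw [mul_pow, pow_add, pow_add]; ring
  have h2 : ‖∑ i ∈ Finset.range (k - l), (p 0 * q 1) ^ i * (p 1 * q 0) ^ (k - l - 1 - i)‖ ≤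
      (k - l : ℕ) * (vecNorm p * vecNorm q) ^ (k - l - 1) := by
    refine (norm_sum_le _ _).trans ?_
    refine (Finset.sum_le_card_nsmul _ _ ((vecNorm p * vecNorm q) ^ (k - l - 1))
      fun i hi => ?_).trans (by simp)
    rw [norm_mul, norm_pow, norm_pow, norm_mul, norm_mul]
    calc _ ≤ (vecNorm p * vecNorm q) ^ i * (vecNorm p * vecNorm q) ^ (k - l - 1 - i) := by
          gcongr <;> first | exact hp _ | exact hq _
      _ = _ := by
        rw [← pow_add]
        congr 1
        have := Finset.mem_range.1 hi
        omega
  rcases hlk.eq_or_lt with rfl | hlt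
  · rw [Nat.sub_self, Finset.range_zero, Finset.sum_empty, norm_zero, mul_zero]
    positivity
  calc _ ≤ (vecNorm p * vecNorm q) ^ (l + k') *
        ((k - l : ℕ) * (vecNorm p * vecNorm q) ^ (k - l - 1)) := by gcongr
    _ = (k - l : ℕ) * (vecNorm p * vecNorm q) ^ (d - 1) := by
      have : d - 1 = (l + k') + (k - l - 1) := by omega
      rw [this, pow_add]
      ring
    _ ≤ _ := by
      gcongr
      omega

theorem exists_norm_bez_le (f : RatFunc K) : ∃ M : ℝ, 0 < M ∧ ∀ p q : Fin 2 → K,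
    ‖bez f p q‖ ≤ M * (vecNorm p * vecNorm q) ^ (deg f - 1) := by
  refine ⟨(∑ k ∈ Finset.HasAntidiagonal.antidiagonal (deg f),
    ∑ l ∈ Finset.HasAntidiagonal.antidiagonal (deg f),
      ‖f.num.coeff k.1 * f.denom.coeff l.1‖ * deg f) + 1, by positivity, fun p q => ?_⟩
  have hpn := vecNorm_nonneg p
  have hqn := vecNorm_nonneg q
  rw [add_mul]
  refine le_trans ?_ (le_add_of_nonneg_right (by positivity))
  unfold bez
  refine (norm_sum_le _ _).trans ?_
  rw [Finset.sum_mul]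
  refine Finset.sum_le_sum fun k hk => (norm_sum_le _ _).trans ?_
  rw [Finset.sum_mul]
  refine Finset.sum_le_sum fun l hl => ?_
  have hk' := Finset.HasAntidiagonal.mem_antidiagonal.1 hk
  have hl' := Finset.HasAntidiagonal.mem_antidiagonal.1 hl
  rw [norm_mul, mul_assoc]
  refine mul_le_mul_of_nonneg_left ?_ (norm_nonneg _)
  split_ifs with h
  · exact norm_monoQuot_le hk' h
  · rw [norm_neg]
    exact norm_monoQuot_le hl' (by omega)

theorem wedge_ev_iterate (f : RatFunc K) (p q : Fin 2 → R) (n : ℕ) :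
    wedge ((ev f)^[n] p) ((ev f)^[n] q) =
      wedge p q * ∏ i ∈ Finset.range n, bez f ((ev f)^[i] p) ((ev f)^[i] q) := by
  induction n with
  | zero => simp
  | succ n ih =>
    rw [Function.iterate_succ_apply', Function.iterate_succ_apply', wedge_ev, ih,
      Finset.prod_range_succ, mul_assoc]

/-- The form of degree `2 d - 2` whose zeros are the critical points. -/
noncomputable def critForm (f : RatFunc K) : MvPolynomial (Fin 2) K := bez f X X

theorem critForm_isHomogeneous (f : RatFunc K) :
    (critForm f).IsHomogeneous (2 * (deg f - 1)) :=
  bez_isHomogeneous f (fun i => isHomogeneous_X K i) (fun i => isHomogeneous_X K i)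

theorem eval_critForm (f : RatFunc K) (p : Fin 2 → K) : eval p (critForm f) = bez f p p := by
  have := map_bez f (aeval p : MvPolynomial (Fin 2) K →ₐ[K] K) X X
  simpa [aeval_eq_eval, critForm] using this

theorem critForm_ne_zero [CharZero K] (f : RatFunc K) (hf : 1 < deg f) : critForm f ≠ 0 := by
  intro h0
  have hpoint : ∀ y : K, (f.num.derivative * f.denom - f.num * f.denom.derivative).eval y = 0 := by
    intro y
    let p : Fin 2 → Polynomial K := ![Polynomial.X, 1]
    let q : Fin 2 → Polynomial K := ![Polynomial.C y, 1]
    have hb := wedge_ev f p q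
    have ep : ∀ (P : Polynomial K), P.natDegree ≤ deg f → aeval p (P.homogenize (deg f)) = P :=
      fun P hP => Polynomial.aeval_homogenize_X_one P hP
    have eq : ∀ (P : Polynomial K), P.natDegree ≤ deg f →
        aeval q (P.homogenize (deg f)) = Polynomial.C (P.eval y) := by
      intro P hP
      rw [Polynomial.aeval_homogenize_of_eq_one hP q rfl]
      change Polynomial.aeval (Polynomial.C y) P = _
      rw [← Polynomial.eval₂_id]
      exact (Polynomial.hom_eval₂ P (RingHom.id K) Polynomial.C y).symm
    have h1 : wedge (ev f p) (ev f q) =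
        f.num * Polynomial.C (f.denom.eval y) - f.denom * Polynomial.C (f.num.eval y) := by
      change aeval p (f.num.homogenize (deg f)) * aeval q (f.denom.homogenize (deg f)) -
        aeval p (f.denom.homogenize (deg f)) * aeval q (f.num.homogenize (deg f)) = _
      rw [ep _ (le_max_left _ _), ep _ (le_max_right _ _), eq _ (le_max_left _ _),
        eq _ (le_max_right _ _)]
    have h2 : wedge p q = Polynomial.X - Polynomial.C y := by simp [p, q, wedge]
    rw [h1, h2] at hb
    have h3 : (bez f p q).eval y = 0 := by
      have := map_bez f (Polynomial.aeval y : Polynomial K →ₐ[K] K) p q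
      have e1 : (fun i => (Polynomial.aeval y : Polynomial K →ₐ[K] K) (p i)) = ![y, 1] := by
        funext i
        fin_cases i <;> simp [p]
      have e2 : (fun i => (Polynomial.aeval y : Polynomial K →ₐ[K] K) (q i)) = ![y, 1] := by
        funext i
        fin_cases i <;> simp [q]
      rw [e1, e2, ← eval_critForm, h0, map_zero] at this
      simpa [Polynomial.coe_aeval_eq_eval] using this
    have h4 := congrArg (fun P => (Polynomial.derivative P).eval y) hb
    simp only [Polynomial.derivative_sub, Polynomial.derivative_mul, Polynomial.derivative_C,
      Polynomial.derivative_X, mul_zero, add_zero, sub_zero, one_mul, Polynomial.eval_sub,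
      Polynomial.eval_mul, Polynomial.eval_add, Polynomial.eval_C, Polynomial.eval_X, sub_self,
      zero_mul, h3] at h4
    rw [Polynomial.eval_sub, Polynomial.eval_mul, Polynomial.eval_mul]
    linear_combination h4
  have hpoly : f.num.derivative * f.denom = f.num * f.denom.derivative := by
    rw [← sub_eq_zero]
    exact Polynomial.funext fun y => by rw [hpoint y, Polynomial.eval_zero]
  have hcop := f.isCoprime_num_denom
  have hd : f.denom.derivative = 0 := by
    have hdvd : f.denom ∣ f.denom.derivative :=
      hcop.symm.dvd_of_dvd_mul_left (Dvd.intro_left _ hpoly)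
    by_contra hne
    have := Polynomial.natDegree_le_of_dvd hdvd hne
    have h1 := Polynomial.natDegree_derivative_lt (p := f.denom) (fun h => hne (by
      rw [Polynomial.eq_C_of_natDegree_eq_zero h, Polynomial.derivative_C]))
    omega
  have hn : f.num.derivative = 0 := by
    rw [hd, mul_zero] at hpoly
    exact (mul_eq_zero.1 hpoly).resolve_right f.denom_ne_zero
  have h1 := Polynomial.derivative_eq_zero.1 hd
  have h2 := Polynomial.derivative_eq_zero.1 hn
  unfold deg at hf
  rw [h1, h2] at hf
  simp at hf

theorem derivative_aeval_line (p q : Fin 2 → K) (G : MvPolynomial (Fin 2) K) :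
    Polynomial.derivative (aeval (fun i => Polynomial.C (p i) + Polynomial.X * Polynomial.C (q i)) G) =
      ∑ j, aeval (fun i => Polynomial.C (p i) + Polynomial.X * Polynomial.C (q i)) (pderiv j G) *
        Polynomial.C (q j) := by
  induction G using MvPolynomial.induction_on with
  | C a => simp [Polynomial.algebraMap_eq]
  | add G H hG hH => simp only [map_add, hG, hH, add_mul, Finset.sum_add_distrib]
  | mul_X G i hG =>
    simp only [map_mul, aeval_X, Polynomial.derivative_mul, hG, Derivation.leibniz, pderiv_X,
      smul_eq_mul, map_add, Fin.sum_univ_two]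
    fin_cases i <;> simp <;> ring

theorem mem_critSet_iff (f : RatFunc K) (n : ℕ) (c : P1 K) :
    c ∈ critSet f n ↔ ∃ i < n, eval ((map f)^[i] c).rep (critForm f) = 0 := by
  have hkey : ∀ q : Fin 2 → K, wedge (fun i => eval c.rep (liftIter f n i))
      (fun i => ∑ j, eval c.rep (pderiv j (liftIter f n i)) * q j) =
      wedge c.rep q * ∏ i ∈ Finset.range n, eval ((ev f)^[i] c.rep) (critForm f) := by
    intro q
    let p : Fin 2 → Polynomial K := fun i => Polynomial.C (c.rep i)
    let p' : Fin 2 → Polynomial K := fun i => Polynomial.C (c.rep i) + Polynomial.X * Polynomial.C (q i)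
    have h := wedge_ev_iterate f p p' n
    have e1 : ∀ i, (ev f)^[i] p = fun j => Polynomial.C ((ev f)^[i] c.rep j) := by
      intro i
      exact (map_ev_iterate f (Algebra.ofId K (Polynomial K)) c.rep i).symm
    have e2 : wedge p p' = Polynomial.X * Polynomial.C (wedge c.rep q) := by
      simp only [p, p', wedge, Polynomial.C_sub, Polynomial.C_mul]
      ring
    have e3 : ∀ i, (fun j => (Polynomial.aeval (0 : K) : Polynomial K →ₐ[K] K) ((ev f)^[i] p' j)) =
        (ev f)^[i] c.rep := by
      intro i
      rw [map_ev_iterate f (Polynomial.aeval (0 : K))]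
      congr 1
      funext j
      simp [p']
    have hd := congrArg (fun P => (Polynomial.derivative P).eval 0) h
    have hl : (Polynomial.derivative (wedge ((ev f)^[n] p) ((ev f)^[n] p'))).eval 0 =
        wedge (fun i => eval c.rep (liftIter f n i))
          (fun i => ∑ j, eval c.rep (pderiv j (liftIter f n i)) * q j) := by
      have hder : ∀ i, (Polynomial.derivative ((ev f)^[n] p' i)).eval 0 =
          ∑ j, eval c.rep (pderiv j (liftIter f n i)) * q j := by
        intro i
        have h1 : (ev f)^[n] p' i = aeval p' (liftIter f n i) :=
          (congrFun (aeval_liftIter f n p') i).symm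
        rw [h1, derivative_aeval_line, Polynomial.eval_finsetSum]
        refine Finset.sum_congr rfl fun j _ => ?_
        rw [Polynomial.eval_mul, Polynomial.eval_C]
        congr 1
        have h2 := comp_aeval_apply p' (Polynomial.aeval (0 : K) : Polynomial K →ₐ[K] K)
          (pderiv j (liftIter f n i))
        have h3 : (fun i => (Polynomial.aeval (0 : K) : Polynomial K →ₐ[K] K) (p' i)) = c.rep :=
          e3 0
        rw [h3, aeval_eq_eval] at h2
        rw [← Polynomial.coe_aeval_eq_eval]
        exact h2
      rw [e1 n, eval_liftIter]
      simp only [wedge, Polynomial.derivative_sub, Polynomial.derivative_mul,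
        Polynomial.derivative_C, zero_mul, zero_add, Polynomial.eval_sub, Polynomial.eval_mul,
        Polynomial.eval_C, hder]
    have hr : (Polynomial.derivative (wedge p p' * ∏ i ∈ Finset.range n,
        bez f ((ev f)^[i] p) ((ev f)^[i] p'))).eval 0 =
        wedge c.rep q * ∏ i ∈ Finset.range n, eval ((ev f)^[i] c.rep) (critForm f) := by
      rw [e2]
      simp only [Polynomial.derivative_mul, Polynomial.derivative_X, Polynomial.derivative_C,
        Polynomial.eval_add, Polynomial.eval_mul, Polynomial.eval_X, Polynomial.eval_C, one_mul,
        mul_zero, zero_mul, add_zero, Polynomial.eval_prod]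
      congr 1
      refine Finset.prod_congr rfl fun i _ => ?_
      rw [eval_critForm]
      have h4 := map_bez f (Polynomial.aeval (0 : K) : Polynomial K →ₐ[K] K) ((ev f)^[i] p)
        ((ev f)^[i] p')
      rw [e3, e1 i] at h4
      simpa [Polynomial.coe_aeval_eq_eval, e1 i] using h4
    rw [← hl, ← hr]
    exact hd
  have hz : ∀ i, eval ((map f)^[i] c).rep (critForm f) = 0 ↔
      eval ((ev f)^[i] c.rep) (critForm f) = 0 := by
    intro i
    obtain ⟨a, ha, har⟩ := exists_rep_mk_smul _ (ev_iterate_ne_zero f c.rep_nonzero i)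
    rw [map_iterate_eq, har, eval_smul_of_isHomogeneous (critForm_isHomogeneous f), mul_eq_zero,
      or_iff_right (pow_ne_zero _ ha)]
  simp only [critSet, Set.mem_ofPred_eq, hkey, hz]
  constructor
  · intro h
    obtain ⟨q, hq⟩ := exists_wedge_eq_one c.rep_nonzero
    have := h q
    rw [hq, one_mul, Finset.prod_eq_zero_iff] at this
    obtain ⟨i, hi, h0⟩ := this
    exact ⟨i, Finset.mem_range.1 hi, h0⟩
  · rintro ⟨i, hi, h0⟩ q
    rw [Finset.prod_eq_zero (Finset.mem_range.2 hi) h0, mul_zero]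

end PolynomialMap

end BerkDyn

namespace BerkDyn

section BerkovichDynamics

open MvPolynomial

variable {K : Type*} [NontriviallyNormedField K]

/-- `exp T_{F^n}`. -/
noncomputable def liftNorm (f : RatFunc K) (n : ℕ) (S : Berk K) : ℝ :=
  pairNorm K (S.nv (deg f ^ n) (liftIter f n 0)) (S.nv (deg f ^ n) (liftIter f n 1))

theorem liftT_eq_log (f : RatFunc K) (n : ℕ) (S : Berk K) :
    liftT f n S = Real.log (liftNorm f n S) := by
  unfold liftT liftNorm
  rw [Berk.val_eq_nv, Berk.val_eq_nv]

theorem continuous_liftNorm (f : RatFunc K) (n : ℕ) : Continuous (liftNorm f n) :=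
  (continuous_pairNorm K).comp ((Berk.continuous_nv (liftIter_isHomogeneous f n 0)).prodMk
    (Berk.continuous_nv (liftIter_isHomogeneous f n 1)))

theorem liftIter_one (f : RatFunc K) : liftIter f 1 = lift f := by
  funext i
  change aeval X (lift f i) = _
  simp

theorem liftNorm_zero (f : RatFunc K) (S : Berk K) : liftNorm f 0 S = 1 := by
  unfold liftNorm
  rw [pow_zero]
  exact pairNorm_nv_X S

theorem liftNorm_toBerk (f : RatFunc K) (n : ℕ) (z : P1 K) :
    liftNorm f n (toBerk z) = vecNorm ((ev f)^[n] z.rep) / vecNorm z.rep ^ deg f ^ n := by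
  unfold liftNorm
  have hp : 0 ≤ (vecNorm z.rep ^ deg f ^ n)⁻¹ := inv_nonneg.2 (pow_nonneg (vecNorm_nonneg _) _)
  rw [nv_toBerk _ (liftIter_isHomogeneous f n 0), nv_toBerk _ (liftIter_isHomogeneous f n 1),
    div_eq_inv_mul, div_eq_inv_mul, pairNorm_mul K _ _ _ hp, div_eq_inv_mul]
  congr 1
  rw [← eval_liftIter]
  rfl

theorem aeval_lift_liftIter (f : RatFunc K) (n : ℕ) (i : Fin 2) :
    aeval (lift f) (liftIter f n i) = liftIter f (n + 1) i := by
  have h := congrFun (aeval_liftIter f n (lift f)) i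
  rw [h, liftIter_eq, Function.iterate_succ_apply, ← liftIter_one, liftIter_eq]
  rfl

theorem liftT_zero (f : RatFunc K) (S : Berk K) : liftT f 0 S = 0 := by
  rw [liftT_eq_log, liftNorm_zero, Real.log_one]

theorem eval_aeval_lift (f : RatFunc K) (p : Fin 2 → K) (G : MvPolynomial (Fin 2) K) :
    eval p (aeval (lift f) G) = eval (ev f p) G := by
  have := comp_aeval_apply (lift f) (aeval p : MvPolynomial (Fin 2) K →ₐ[K] K) G
  simpa [aeval_eq_eval, ev_eq_eval] using this

variable [IsAlgClosed K]

theorem nv_berkMap (f : RatFunc K) (S : Berk K) {e : ℕ} {G : MvPolynomial (Fin 2) K}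
    (hG : G.IsHomogeneous e) :
    (berkMap f S).nv e G = S.nv (deg f * e) (aeval (lift f) G) / liftNorm f 1 S ^ e ∧
      0 < liftNorm f 1 S := by
  obtain ⟨s, rfl⟩ := Quotient.exists_rep S
  have h1 : berkMap f (⟦s⟧ : Berk K) = ⟦s.push f⟧ := rfl
  have h2 : liftNorm f 1 (⟦s⟧ : Berk K) = (s.push f).norm / s.norm ^ deg f := by
    unfold liftNorm
    have hp : 0 ≤ (s.norm ^ deg f)⁻¹ := inv_nonneg.2 (pow_nonneg s.norm_pos.le _)
    rw [Berk.nv_mk _ (liftIter_isHomogeneous f 1 0), Berk.nv_mk _ (liftIter_isHomogeneous f 1 1),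
      pow_one, liftIter_one, div_eq_inv_mul, div_eq_inv_mul, pairNorm_mul K _ _ _ hp,
      div_eq_inv_mul]
    congr 2
    · change _ = s.toSeminorm (aeval (lift f) (X 0))
      rw [aeval_X]
    · change _ = s.toSeminorm (aeval (lift f) (X 1))
      rw [aeval_X]
  have h3 := s.norm_pos
  have h4 := (s.push f).norm_pos
  refine ⟨?_, by rw [h2]; positivity⟩
  rw [h1, h2, Berk.nv_mk _ hG, Berk.nv_mk _ (hG.aeval _ (lift_isHomogeneous f))]
  change s.toSeminorm (aeval (lift f) G) / _ = _
  rw [pow_mul, div_pow]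
  field_simp

theorem liftNorm_succ (f : RatFunc K) (n : ℕ) (S : Berk K) :
    liftNorm f (n + 1) S = liftNorm f n (berkMap f S) * liftNorm f 1 S ^ deg f ^ n := by
  have hpos := (nv_berkMap f S (isHomogeneous_X K (0 : Fin 2))).2
  conv_rhs => rw [liftNorm]
  rw [(nv_berkMap f S (liftIter_isHomogeneous f n 0)).1,
    (nv_berkMap f S (liftIter_isHomogeneous f n 1)).1, div_eq_inv_mul, div_eq_inv_mul,
    pairNorm_mul K _ _ _ (by positivity), aeval_lift_liftIter, aeval_lift_liftIter]
  have h : liftNorm f (n + 1) S = pairNorm K (S.nv (deg f * deg f ^ n) (liftIter f (n + 1) 0))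
      (S.nv (deg f * deg f ^ n) (liftIter f (n + 1) 1)) := by rw [liftNorm, pow_succ']
  rw [h]
  field_simp

theorem liftNorm_pos (f : RatFunc K) (n : ℕ) (S : Berk K) : 0 < liftNorm f n S := by
  induction n generalizing S with
  | zero => rw [liftNorm_zero]; exact one_pos
  | succ n ih =>
    rw [liftNorm_succ]
    exact mul_pos (ih _) (pow_pos (nv_berkMap f S (isHomogeneous_X K (0 : Fin 2))).2 _)

theorem liftNorm_eq_exp (f : RatFunc K) (n : ℕ) (S : Berk K) :
    liftNorm f n S = Real.exp (liftT f n S) := by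
  rw [liftT_eq_log, Real.exp_log (liftNorm_pos f n S)]

theorem continuous_liftT (f : RatFunc K) (n : ℕ) : Continuous (liftT f n) := by
  have : liftT f n = fun S => Real.log (liftNorm f n S) := funext (liftT_eq_log f n)
  rw [this]
  exact (continuous_liftNorm f n).log fun S => (liftNorm_pos f n S).ne'

theorem liftT_succ (f : RatFunc K) (n : ℕ) (S : Berk K) :
    liftT f (n + 1) S = liftT f n (berkMap f S) + deg f ^ n * liftT f 1 S := by
  rw [liftT_eq_log, liftT_eq_log, liftT_eq_log, liftNorm_succ,
    Real.log_mul (liftNorm_pos _ _ _).ne' (pow_pos (liftNorm_pos _ _ _) _).ne', Real.log_pow]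
  push_cast
  ring

theorem liftT_succ' (f : RatFunc K) (n : ℕ) (S : Berk K) :
    liftT f (n + 1) S = liftT f 1 ((berkMap f)^[n] S) + deg f * liftT f n S := by
  induction n generalizing S with
  | zero => simp [liftT_zero]
  | succ n ih =>
    rw [liftT_succ, ih, Function.iterate_succ_apply, liftT_succ f n S]
    ring

theorem continuous_berkMap (f : RatFunc K) : Continuous (berkMap f : Berk K → Berk K) := by
  refine continuous_iff_continuousAt.2 fun S => Berk.tendsto_nhds_iff.2 fun e G hG => ?_
  have h : (fun S => (berkMap f S).nv e G) =
      fun S => S.nv (deg f * e) (aeval (lift f) G) / liftNorm f 1 S ^ e :=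
    funext fun S => (nv_berkMap f S hG).1
  have hc : Continuous fun S => (berkMap f S).nv e G := by
    rw [h]
    exact (Berk.continuous_nv (hG.aeval _ (lift_isHomogeneous f))).div
      ((continuous_liftNorm f 1).pow e) fun S => (pow_pos (liftNorm_pos f 1 S) e).ne'
  exact hc.tendsto S

theorem berkMap_toBerk (f : RatFunc K) (z : P1 K) : berkMap f (toBerk z) = toBerk (map f z) := by
  refine Berk.ext_nv fun e G hG => ?_
  rw [(nv_berkMap f _ hG).1, liftNorm_toBerk, nv_toBerk _ (hG.aeval _ (lift_isHomogeneous f)), map,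
    toBerk_mk, nv_pt _ _ hG, pow_one, Function.iterate_one, ← ev_eq_eval]
  have h : eval z.rep (aeval (lift f) G) = eval (ev f z.rep) G := by
    have := comp_aeval_apply (lift f) (aeval z.rep : MvPolynomial (Fin 2) K →ₐ[K] K) G
    simpa [aeval_eq_eval, ev_eq_eval] using this
  have h1 := vecNorm_rep_pos z
  have h2 := vecNorm_pos (ev_ne_zero f z.rep_nonzero)
  rw [h, pow_mul, div_pow]
  field_simp

end BerkovichDynamics

section Green

variable {K : Type*} [NontriviallyNormedField K] [IsAlgClosed K]

theorem exists_abs_liftT_le (f : RatFunc K) (n : ℕ) : ∃ M : ℝ, 0 ≤ M ∧ ∀ S, |liftT f n S| ≤ M := by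
  obtain ⟨M, hM⟩ := isCompact_univ.exists_bound_of_continuousOn (continuous_liftT f n).continuousOn
  exact ⟨max M 0, le_max_right _ _, fun S => (hM S trivial).trans (le_max_left _ _)⟩

theorem liftGreen_aux (f : RatFunc K) (hf : 1 < deg f) :
    Continuous (liftGreen f) ∧
      ∀ S, Tendsto (fun n => liftT f n S / (deg f : ℝ) ^ n) atTop (𝓝 (liftGreen f S)) := by
  have hd : (1 : ℝ) < deg f := by exact_mod_cast hf
  obtain ⟨M, hM0, hM⟩ := exists_abs_liftT_le f 1
  let u : ℕ → Berk K → ℝ := fun n S => liftT f 1 ((berkMap f)^[n] S) / (deg f : ℝ) ^ (n + 1)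
  have hpart : ∀ S n, ∑ i ∈ Finset.range n, u i S = liftT f n S / (deg f : ℝ) ^ n := by
    intro S n
    induction n with
    | zero => simp [liftT_zero]
    | succ n ih =>
      rw [Finset.sum_range_succ, ih, liftT_succ' f n S]
      simp only [u]
      rw [pow_succ]
      field_simp
      ring
  have hbound : ∀ n S, ‖u n S‖ ≤ M * ((deg f : ℝ)⁻¹) ^ n := by
    intro n S
    have hdn : (0 : ℝ) < (deg f : ℝ) ^ n := by positivity
    rw [Real.norm_eq_abs, abs_div, abs_of_pos (by positivity : (0 : ℝ) < (deg f : ℝ) ^ (n + 1)),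
      inv_pow, ← div_eq_mul_inv]
    gcongr
    · exact hM _
    · exact hd.le
    · omega
  have hsum : Summable fun n => M * ((deg f : ℝ)⁻¹) ^ n :=
    (summable_geometric_of_lt_one (by positivity) (inv_lt_one_of_one_lt₀ hd)).mul_left M
  have hlim : ∀ S, Tendsto (fun n => liftT f n S / (deg f : ℝ) ^ n) atTop (𝓝 (∑' n, u n S)) := by
    intro S
    have := (hsum.of_norm_bounded (hbound · S)).hasSum.tendsto_sum_nat
    exact this.congr (hpart S)
  have heq : liftGreen f = fun S => ∑' n, u n S := funext fun S => (hlim S).limUnder_eq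
  refine ⟨?_, fun S => by rw [heq]; exact hlim S⟩
  rw [heq]
  refine continuous_tsum (fun n => ?_) hsum fun n S => hbound n S
  exact ((continuous_liftT f 1).comp ((continuous_berkMap f).iterate n)).div_const _

theorem continuous_liftGreen (f : RatFunc K) (hf : 1 < deg f) : Continuous (liftGreen f) :=
  (liftGreen_aux f hf).1

theorem liftGreen_berkMap (f : RatFunc K) (hf : 1 < deg f) (S : Berk K) :
    liftGreen f (berkMap f S) = deg f * liftGreen f S - liftT f 1 S := by
  have h1 := (liftGreen_aux f hf).2 (berkMap f S)
  have h2 := ((((liftGreen_aux f hf).2 S).comp (tendsto_add_atTop_nat 1)).const_mul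
    (deg f : ℝ)).sub_const (liftT f 1 S)
  refine tendsto_nhds_unique h1 (h2.congr fun n => ?_)
  have hd : (deg f : ℝ) ≠ 0 := by
    have : deg f ≠ 0 := by omega
    exact_mod_cast this
  simp only [Function.comp]
  rw [liftT_succ, pow_succ]
  field_simp
  ring

theorem liftGreen_iterate (f : RatFunc K) (hf : 1 < deg f) (n : ℕ) (S : Berk K) :
    liftGreen f ((berkMap f)^[n] S) = (deg f : ℝ) ^ n * liftGreen f S - liftT f n S := by
  induction n generalizing S with
  | zero => simp [liftT_zero]
  | succ n ih =>
    rw [Function.iterate_succ_apply, ih, liftGreen_berkMap f hf, liftT_succ f n S]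
    ring

theorem exists_abs_liftGreen_le (f : RatFunc K) (hf : 1 < deg f) :
    ∃ M : ℝ, 0 ≤ M ∧ ∀ S, |liftGreen f S| ≤ M := by
  obtain ⟨M, hM⟩ := isCompact_univ.exists_bound_of_continuousOn
    (continuous_liftGreen f hf).continuousOn
  exact ⟨max M 0, le_max_right _ _, fun S => (hM S trivial).trans (le_max_left _ _)⟩

end Green

section Preimages

open MvPolynomial

variable {K : Type*} [NontriviallyNormedField K] [IsAlgClosed K]

theorem aeval_lift_linForm_ne_zero (f : RatFunc K) (hf : 0 < deg f) {a : Fin 2 → K} (ha : a ≠ 0) :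
    aeval (lift f) (linForm a) ≠ 0 := by
  intro h0
  obtain ⟨q, hq⟩ := exists_wedge_eq_one ha
  have hroot : ∃ z : P1 K, eval z.rep (aeval (lift f) (linForm q)) = 0 := by
    by_cases hH : aeval (lift f) (linForm q) = 0
    · refine ⟨Projectivization.mk K a ha, by rw [hH, map_zero]⟩
    · obtain ⟨A, m, -, hm, hz, -⟩ := exists_nv_eq_prod_kap
        ((linForm_isHomogeneous q).aeval _ (lift_isHomogeneous f)) hH
      have : m ≠ 0 := by
        rintro rfl
        rw [Multiset.card_zero] at hm
        omega
      obtain ⟨z, hzm⟩ := Multiset.exists_mem_of_ne_zero this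
      exact ⟨z, (hz z).2 hzm⟩
  obtain ⟨z, hz⟩ := hroot
  have hz' : eval z.rep (aeval (lift f) (linForm a)) = 0 := by rw [h0, map_zero]
  rw [eval_aeval_lift, eval_linForm] at hz hz'
  refine ev_ne_zero f z.rep_nonzero ?_
  have := wedge_smul_eq a q (ev f z.rep)
  rw [hq, hz, wedge_comm a, hz', one_smul, neg_zero, zero_smul, zero_smul, add_zero] at this
  exact this

theorem exists_preimages (f : RatFunc K) (hf : 0 < deg f) (a : P1 K) :
    ∃ (A : ℝ) (m : Multiset (P1 K)), 0 < A ∧ m.card = deg f ∧ (∀ b ∈ m, map f b = a) ∧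
      ∀ S, kap a (berkMap f S) * liftNorm f 1 S = A * (m.map fun w => kap w S).prod := by
  obtain ⟨A, m, hA, hm, hz, hS⟩ := exists_nv_eq_prod_kap
    ((linForm_isHomogeneous a.rep).aeval _ (lift_isHomogeneous f))
    (aeval_lift_linForm_ne_zero f hf a.rep_nonzero)
  have ha := vecNorm_rep_pos a
  refine ⟨A / vecNorm a.rep, m, by positivity, by omega, fun b hb => ?_, fun S => ?_⟩
  · have := (hz b).2 hb
    rw [eval_aeval_lift, eval_linForm, wedge_comm, neg_eq_zero,
      wedge_eq_zero_iff a.rep_nonzero] at this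
    obtain ⟨c, hc⟩ := this
    have hc' : (fun i => eval b.rep (lift f i)) = c • a.rep := by rw [← ev_eq_eval, hc]
    unfold map
    conv_rhs => rw [← a.mk_rep]
    rw [Projectivization.mk_eq_mk_iff']
    exact ⟨c, hc'.symm⟩
  · have := liftNorm_pos f 1 S
    rw [kap, (nv_berkMap f S (linForm_isHomogeneous _)).1, hS]
    field_simp

open Classical in
/-- The multiset of the preimages of `a` under `f`. -/
noncomputable def preim (f : RatFunc K) (a : P1 K) : Multiset (P1 K) :=
  if hf : 0 < deg f then (exists_preimages f hf a).choose_spec.choose else 0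

/-- The multiset of the preimages of `a` under `f^n`. -/
noncomputable def preimN (f : RatFunc K) : ℕ → P1 K → Multiset (P1 K)
  | 0, a => {a}
  | n + 1, a => (preimN f n a).bind (preim f)

theorem card_preim (f : RatFunc K) (hf : 0 < deg f) (a : P1 K) : (preim f a).card = deg f := by
  rw [preim, dif_pos hf]
  exact (exists_preimages f hf a).choose_spec.choose_spec.2.1

theorem map_of_mem_preim (f : RatFunc K) (hf : 0 < deg f) {a b : P1 K} (hb : b ∈ preim f a) :
    map f b = a := by
  rw [preim, dif_pos hf] at hb
  exact (exists_preimages f hf a).choose_spec.choose_spec.2.2.1 b hb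

theorem exists_preim_prod (f : RatFunc K) (hf : 0 < deg f) (a : P1 K) :
    ∃ A : ℝ, 0 < A ∧
      ∀ S, kap a (berkMap f S) * liftNorm f 1 S = A * ((preim f a).map fun w => kap w S).prod := by
  rw [preim, dif_pos hf]
  exact ⟨_, (exists_preimages f hf a).choose_spec.choose_spec.1,
    (exists_preimages f hf a).choose_spec.choose_spec.2.2.2⟩

theorem card_preimN (f : RatFunc K) (hf : 0 < deg f) (n : ℕ) (a : P1 K) :
    (preimN f n a).card = deg f ^ n := by
  induction n with
  | zero => simp [preimN]
  | succ n ih =>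
    rw [preimN, Multiset.card_bind]
    simp [card_preim f hf, ih, pow_succ]

theorem map_preimN_succ (f : RatFunc K) (hf : 0 < deg f) (n : ℕ) (a : P1 K) (φ : P1 K → ℝ) :
    ((preimN f (n + 1) a).map fun b => φ (map f b)).sum =
      deg f * ((preimN f n a).map φ).sum := by
  rw [preimN, Multiset.map_bind, Multiset.sum_bind]
  have : ∀ b, ((preim f b).map fun c => φ (map f c)).sum = deg f * φ b := by
    intro b
    rw [Multiset.map_congr rfl fun c hc => by rw [map_of_mem_preim f hf hc]]
    simp [card_preim f hf]
  simp_rw [this]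
  rw [Multiset.sum_map_mul_left]

theorem exists_preimN_prod (f : RatFunc K) (hf : 0 < deg f) (n : ℕ) (a : P1 K) :
    ∃ A : ℝ, 0 < A ∧ ∀ S, kap a ((berkMap f)^[n] S) * liftNorm f n S =
      A * ((preimN f n a).map fun w => kap w S).prod := by
  induction n with
  | zero => exact ⟨1, one_pos, fun S => by simp [preimN, liftNorm_zero]⟩
  | succ n ih =>
    obtain ⟨A, hA, h⟩ := ih
    choose B hB hBS using exists_preim_prod f hf
    refine ⟨A * ((preimN f n a).map B).prod, mul_pos hA ?_, fun S => ?_⟩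
    · exact Multiset.prod_pos (by simpa using fun x _ => hB x)
    · rw [liftNorm_succ, Function.iterate_succ_apply, ← mul_assoc, h, preimN, Multiset.map_bind,
        Multiset.prod_bind, mul_assoc A, mul_assoc A]
      congr 1
      have hc : liftNorm f 1 S ^ deg f ^ n =
          ((preimN f n a).map fun _ => liftNorm f 1 S).prod := by
        rw [Multiset.map_const', Multiset.prod_replicate, card_preimN f hf]
      rw [hc, ← Multiset.prod_map_mul, ← Multiset.prod_map_mul]
      congr 1
      refine Multiset.map_congr rfl fun b _ => hBS b S

end Preimages

section ProximityAndDerivative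

open MvPolynomial

section

variable {K : Type*} [NontriviallyNormedField K]

/-- The form `F^n ∧ Id` whose zeros are the fixed points of `f^n`. -/
noncomputable def fixForm (f : RatFunc K) (n : ℕ) : MvPolynomial (Fin 2) K :=
  wedge (liftIter f n) X

theorem fixForm_isHomogeneous (f : RatFunc K) (n : ℕ) :
    (fixForm f n).IsHomogeneous (deg f ^ n + 1) :=
  ((liftIter_isHomogeneous f n 0).mul (isHomogeneous_X K 1)).sub
    ((liftIter_isHomogeneous f n 1).mul (isHomogeneous_X K 0))

theorem eval_fixForm (f : RatFunc K) (n : ℕ) (p : Fin 2 → K) :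
    eval p (fixForm f n) = wedge ((ev f)^[n] p) p := by
  rw [← eval_liftIter, fixForm, map_wedge]
  simp

theorem chordal_mk_left (p : Fin 2 → K) (hp : p ≠ 0) (z : P1 K) :
    chordal (Projectivization.mk K p hp) z = ‖wedge p z.rep‖ / (vecNorm p * vecNorm z.rep) := by
  conv_lhs => rw [← z.mk_rep]
  exact chordal_mk _ _ _ z.rep_nonzero

theorem eval_fixForm_eq_zero_iff (f : RatFunc K) (n : ℕ) (z : P1 K) :
    eval z.rep (fixForm f n) = 0 ↔ (map f)^[n] z = z := by
  have h := chordal_eq_zero_iff ((map f)^[n] z) z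
  rw [map_iterate_eq] at h ⊢
  rw [← h, chordal_mk_left, eval_fixForm, div_eq_zero_iff, norm_eq_zero, or_iff_left]
  exact (mul_pos (vecNorm_pos (ev_iterate_ne_zero f z.rep_nonzero n)) (vecNorm_rep_pos z)).ne'

instance punctured_neBot (z : P1 K) : (punctured z).NeBot := by
  obtain ⟨q, hq⟩ := exists_wedge_eq_one z.rep_nonzero
  have hne : ∀ t : K, z.rep + t • q ≠ 0 := by
    intro t h
    have : wedge (z.rep + t • q) q = 1 := by
      rw [wedge_add_left, wedge_smul_left, wedge_self, hq]
      simp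
    rw [h] at this
    simp [wedge] at this
  let w : K → P1 K := fun t => Projectivization.mk K (z.rep + t • q) (hne t)
  have hw : ∀ t, chordal (w t) z = ‖t‖ / (vecNorm (z.rep + t • q) * vecNorm z.rep) := by
    intro t
    rw [chordal_mk_left, wedge_add_left, wedge_self, wedge_smul_left, wedge_comm, hq]
    simp
  have hpos : ∀ t, 0 < vecNorm (z.rep + t • q) * vecNorm z.rep :=
    fun t => mul_pos (vecNorm_pos (hne t)) (vecNorm_rep_pos z)
  have hc : Continuous fun t => chordal (w t) z := by
    simp_rw [hw]
    refine continuous_norm.div ?_ fun t => (hpos t).ne'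
    exact (continuous_vecNorm.comp (by fun_prop)).mul continuous_const
  have ht : Tendsto w (𝓝[≠] 0) (punctured z) := by
    refine tendsto_comap_iff.2 (tendsto_nhdsWithin_iff.2 ⟨?_, ?_⟩)
    · have := hc.tendsto 0
      rw [hw 0, norm_zero, zero_div] at this
      exact this.mono_left nhdsWithin_le_nhds
    · filter_upwards [self_mem_nhdsWithin] with t ht
      have : 0 < chordal (w t) z := by
        rw [hw]
        exact div_pos (norm_pos_iff.2 ht) (hpos t)
      exact this.ne'
  exact ht.neBot

end

variable {K : Type*} [NontriviallyNormedField K] [IsAlgClosed K]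

theorem fixForm_ne_zero (f : RatFunc K) (hf : 1 < deg f) {n : ℕ} (hn : 1 ≤ n) :
    fixForm f n ≠ 0 := by
  intro h0
  have hX : (X 0 : MvPolynomial (Fin 2) K) ∣ liftIter f n 0 := by
    have hp : Prime (X 0 : MvPolynomial (Fin 2) K) := X_prime
    have h1 : (X 0 : MvPolynomial (Fin 2) K) ∣ liftIter f n 0 * X 1 := by
      refine ⟨liftIter f n 1, ?_⟩
      have : liftIter f n 0 * X 1 - liftIter f n 1 * X 0 = 0 := h0
      linear_combination this
    refine (hp.dvd_or_dvd h1).resolve_right fun hd => ?_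
    rw [X_dvd_X] at hd
    simp at hd
  obtain ⟨H, hH⟩ := hX
  have hH1 : liftIter f n 1 = X 1 * H := by
    have h : X 0 * (liftIter f n 1 - X 1 * H) = 0 := by
      have : liftIter f n 0 * X 1 - liftIter f n 1 * X 0 = 0 := h0
      rw [hH] at this
      linear_combination -this
    exact sub_eq_zero.1 ((mul_eq_zero.1 h).resolve_left (X_ne_zero 0))
  have hdn : 1 < deg f ^ n := Nat.one_lt_pow (by omega) hf
  have hev : ∀ p : Fin 2 → K, p ≠ 0 → eval p H ≠ 0 := by
    intro p hp hHp
    refine ev_iterate_ne_zero f hp n ?_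
    rw [← eval_liftIter]
    funext i
    fin_cases i
    · change eval p (liftIter f n 0) = 0
      rw [hH, map_mul, hHp, mul_zero]
    · change eval p (liftIter f n 1) = 0
      rw [hH1, map_mul, hHp, mul_zero]
  have hHne : H ≠ 0 := by
    rintro rfl
    exact hev (fun _ => 1) (fun h => one_ne_zero (congrFun h 0)) (map_zero _)
  obtain ⟨D, hD⟩ : ∃ D, H.IsHomogeneous (D + 1) := by
    have h1 := liftIter_isHomogeneous f n 0
    rw [hH] at h1
    have hne : (X 0 : MvPolynomial (Fin 2) K) * H ≠ 0 := mul_ne_zero (X_ne_zero 0) hHne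
    refine ⟨deg f ^ n - 2, ?_⟩
    intro s hs
    have h2 : coeff (Finsupp.single 0 1 + s) (X 0 * H) = coeff s H := coeff_X_mul s 0 H
    have h3 := h1 (d := Finsupp.single 0 1 + s) (by rw [h2]; exact hs)
    rw [map_add] at h3
    have h4 : (Finsupp.weight (1 : Fin 2 → ℕ)) (Finsupp.single 0 1) = 1 := by
      simp [Finsupp.weight_single]
    rw [h4] at h3
    omega
  obtain ⟨A, m, -, hm, hz, -⟩ := exists_nv_eq_prod_kap hD hHne
  have : m ≠ 0 := by
    rintro rfl
    rw [Multiset.card_zero] at hm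
    omega
  obtain ⟨z, hzm⟩ := Multiset.exists_mem_of_ne_zero this
  exact hev z.rep z.rep_nonzero ((hz z).2 hzm)

theorem chordalDeriv_eq (f : RatFunc K) (z : P1 K) :
    chordalDeriv f z =
      (toBerk z).nv (2 * (deg f - 1)) (critForm f) / liftNorm f 1 (toBerk z) ^ 2 := by
  have hXC : (bez f X fun i => C (z.rep i)).IsHomogeneous (deg f - 1) := by
    simpa using bez_isHomogeneous f (fun i => isHomogeneous_X K i)
      (fun i => isHomogeneous_C (Fin 2) (z.rep i))
  have hev : ∀ p : Fin 2 → K, eval p (bez f X fun i => C (z.rep i)) = bez f p z.rep := by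
    intro p
    have := map_bez f (aeval p : MvPolynomial (Fin 2) K →ₐ[K] K) X fun i => C (z.rep i)
    simpa [aeval_eq_eval] using this
  let ψ : Berk K → ℝ := fun S => S.nv (deg f - 1) (bez f X fun i => C (z.rep i)) /
    liftNorm f 1 S * (vecNorm z.rep / vecNorm (ev f z.rep))
  have hψ : Continuous ψ := ((Berk.continuous_nv hXC).div (continuous_liftNorm f 1)
    fun S => (liftNorm_pos f 1 S).ne').mul continuous_const
  have hz := vecNorm_rep_pos z
  have hFz := vecNorm_pos (ev_ne_zero f z.rep_nonzero)
  refine Tendsto.limUnder_eq ?_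
  have hlim : ψ (toBerk z) =
      (toBerk z).nv (2 * (deg f - 1)) (critForm f) / liftNorm f 1 (toBerk z) ^ 2 := by
    simp only [ψ]
    rw [nv_toBerk _ hXC, nv_toBerk _ (critForm_isHomogeneous f), hev, eval_critForm,
      liftNorm_toBerk, Function.iterate_one, pow_one]
    by_cases hd : deg f = 0
    · have h0 : bez f z.rep z.rep = 0 := by
        unfold bez
        rw [hd]
        simp [monoQuot]
      rw [h0]
      simp
    · obtain ⟨e, he⟩ : ∃ e, deg f = e + 1 := ⟨deg f - 1, by omega⟩
      rw [he, Nat.add_sub_cancel, pow_succ, div_pow, mul_comm 2 e, pow_mul]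
      field_simp
  rw [← hlim]
  have htend : Tendsto toBerk (punctured z) (𝓝 (toBerk z)) := by
    refine tendsto_toBerk_of_kap ?_
    have h1 : Tendsto (fun w => chordal w z) (punctured z) (𝓝 0) :=
      (tendsto_comap (f := fun w => chordal w z)).mono_right nhdsWithin_le_nhds
    refine h1.congr fun w => ?_
    rw [kap_toBerk, chordal_comm]
  refine ((hψ.tendsto _).comp htend).congr' ?_
  have hne : ∀ᶠ w in punctured z, chordal w z ≠ 0 :=
    (tendsto_comap (f := fun w => chordal w z)).eventually self_mem_nhdsWithin
  filter_upwards [hne] with w hw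
  have h0 : wedge w.rep z.rep ≠ 0 := by
    intro h
    apply hw
    rw [chordal, h, norm_zero, zero_div]
  have h0' : 0 < ‖wedge w.rep z.rep‖ := norm_pos_iff.2 h0
  have hw' := vecNorm_rep_pos w
  have hFw := vecNorm_pos (ev_ne_zero f w.rep_nonzero)
  have h1 : chordal (map f w) (map f z) = ‖wedge (ev f w.rep) (ev f z.rep)‖ /
      (vecNorm (ev f w.rep) * vecNorm (ev f z.rep)) := by
    have e1 := map_mk f w.rep w.rep_nonzero
    have e2 := map_mk f z.rep z.rep_nonzero
    rw [w.mk_rep] at e1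
    rw [z.mk_rep] at e2
    rw [e1, e2, chordal_mk]
  simp only [ψ, Function.comp]
  rw [h1, wedge_ev, norm_mul, nv_toBerk _ hXC, hev, liftNorm_toBerk, Function.iterate_one, pow_one,
    chordal]
  by_cases hd : deg f = 0
  · have h0 : bez f w.rep z.rep = 0 := by
      unfold bez
      rw [hd]
      simp [monoQuot]
    rw [h0]
    simp
  · obtain ⟨e, he⟩ : ∃ e, deg f = e + 1 := ⟨deg f - 1, by omega⟩
    rw [he, Nat.add_sub_cancel, pow_succ]
    field_simp

variable [CharZero K] [CompleteSpace K]

theorem proximity_eq (f : RatFunc K) (n : ℕ) (S : Berk K) :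
    proximity f n S = S.nv (deg f ^ n + 1) (fixForm f n) / liftNorm f n S := by
  unfold proximity
  have h : berkExtend (fun z => chordal ((map f)^[n] z) z) =
      fun S : Berk K => S.nv (deg f ^ n + 1) (fixForm f n) / liftNorm f n S := by
    refine berkExtend_eq ((Berk.continuous_nv (fixForm_isHomogeneous f n)).div
      (continuous_liftNorm f n) fun S => (liftNorm_pos f n S).ne') fun z => ?_
    have h3 := vecNorm_rep_pos z
    rw [map_iterate_eq, chordal_mk_left, nv_toBerk _ (fixForm_isHomogeneous f n), liftNorm_toBerk, eval_fixForm, pow_succ]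
    field_simp
  rw [h]

theorem sharp_eq (f : RatFunc K) (S : Berk K) :
    sharp f S = S.nv (2 * (deg f - 1)) (critForm f) / liftNorm f 1 S ^ 2 := by
  have h : sharp f = fun S : Berk K =>
      S.nv (2 * (deg f - 1)) (critForm f) / liftNorm f 1 S ^ 2 :=
    berkExtend_eq ((Berk.continuous_nv (critForm_isHomogeneous f)).div
      ((continuous_liftNorm f 1).pow 2) fun S => (pow_pos (liftNorm_pos f 1 S) 2).ne')
      fun z => (chordalDeriv_eq f z).symm
  rw [h]

end ProximityAndDerivative

end BerkDyn

namespace BerkDyn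

section NegLog

theorem measurable_negLog : Measurable negLog :=
  Measurable.ite measurableSet_Iic measurable_const Real.measurable_log.neg.ennreal_ofReal

theorem negLog_of_pos {t : ℝ} (ht : 0 < t) : negLog t = ENNReal.ofReal (-Real.log t) :=
  if_neg (not_le.2 ht)

theorem negLog_of_nonpos {t : ℝ} (ht : t ≤ 0) : negLog t = ⊤ := if_pos ht

variable {X : Type*} [MeasurableSpace X] {μ : Measure X} {φ : X → ℝ}

theorem logIntegrable_of_lintegral_negLog_ne_top (hφ : Measurable φ) (h1 : ∀ x, φ x ≤ 1)
    (h : ∫⁻ x, negLog (φ x) ∂μ ≠ ⊤) :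
    (∀ᵐ x ∂μ, 0 < φ x) ∧ Integrable (fun x => Real.log (φ x)) μ ∧
      ∫ x, Real.log (φ x) ∂μ = -(∫⁻ x, negLog (φ x) ∂μ).toReal := by
  have hpos : ∀ᵐ x ∂μ, 0 < φ x := by
    filter_upwards [ae_lt_top (measurable_negLog.comp hφ) h] with x hx
    by_contra hn
    simp [negLog_of_nonpos (not_lt.1 hn)] at hx
  have heq : ∫⁻ x, negLog (φ x) ∂μ = ∫⁻ x, ENNReal.ofReal (-Real.log (φ x)) ∂μ := by
    refine lintegral_congr_ae ?_
    filter_upwards [hpos] with x hx using negLog_of_pos hx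
  have hnn : 0 ≤ᵐ[μ] fun x => -Real.log (φ x) := by
    filter_upwards [hpos] with x hx
    exact neg_nonneg.2 (Real.log_nonpos hx.le (h1 x))
  have hm : AEStronglyMeasurable (fun x => -Real.log (φ x)) μ :=
    (Real.measurable_log.comp hφ).neg.aestronglyMeasurable
  have hint : Integrable (fun x => -Real.log (φ x)) μ :=
    (lintegral_ofReal_ne_top_iff_integrable hm hnn).1 (heq ▸ h)
  refine ⟨hpos, by simpa using hint.neg, ?_⟩
  have h2 := integral_eq_lintegral_of_nonneg_ae hnn hm
  rw [integral_neg, ← heq] at h2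
  linarith

theorem lintegral_negLog_eq (h0 : ∀ᵐ x ∂μ, 0 < φ x) (h1 : ∀ x, φ x ≤ 1)
    (h : Integrable (fun x => Real.log (φ x)) μ) :
    ∫⁻ x, negLog (φ x) ∂μ = ENNReal.ofReal (-∫ x, Real.log (φ x) ∂μ) := by
  have hnn : 0 ≤ᵐ[μ] fun x => -Real.log (φ x) := by
    filter_upwards [h0] with x hx
    exact neg_nonneg.2 (Real.log_nonpos hx.le (h1 x))
  have hi : Integrable (fun x => -Real.log (φ x)) μ := h.neg
  rw [← integral_neg, ofReal_integral_eq_lintegral_ofReal hi hnn]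
  refine lintegral_congr_ae ?_
  filter_upwards [h0] with x hx using negLog_of_pos hx

end NegLog

section NonarchimedeanKernel

variable {K : Type*} [NontriviallyNormedField K]

theorem chordal_eq_max_of_ne (hK : IsUltrametricDist K) {z w x : P1 K}
    (h : chordal x z ≠ chordal x w) : chordal z w = max (chordal x z) (chordal x w) := by
  have h1 := chordal_ultra hK z x w
  have h2 := chordal_ultra hK x z w
  have h3 := chordal_ultra hK x w z
  rw [chordal_comm z x] at h1
  rw [chordal_comm w z] at h3
  refine le_antisymm h1 ?_
  rcases lt_or_gt_of_ne h with hlt | hlt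
  · rw [max_eq_right hlt.le]
    exact (le_max_iff.1 h2).resolve_left (not_le.2 hlt)
  · rw [max_eq_left hlt.le]
    exact (le_max_iff.1 h3).resolve_left (not_le.2 hlt)

theorem tendsto_chordal_fst (x : P1 K) (S S' : Berk K) :
    Tendsto (fun zw : P1 K × P1 K => chordal x zw.1)
      (comap toBerk (𝓝 S) ×ˢ comap toBerk (𝓝 S')) (𝓝 (kap x S)) := by
  have := (((continuous_kap x).tendsto S).comp (tendsto_comap (f := toBerk))).comp
    (tendsto_fst (g := comap toBerk (𝓝 S')))
  exact this.congr fun z => kap_toBerk _ _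

theorem tendsto_chordal_snd (x : P1 K) (S S' : Berk K) :
    Tendsto (fun zw : P1 K × P1 K => chordal x zw.2)
      (comap toBerk (𝓝 S) ×ˢ comap toBerk (𝓝 S')) (𝓝 (kap x S')) := by
  have := (((continuous_kap x).tendsto S').comp (tendsto_comap (f := toBerk))).comp
    (tendsto_snd (f := comap toBerk (𝓝 S)))
  exact this.congr fun z => kap_toBerk _ _

theorem isBounded_chordal (l : Filter (P1 K × P1 K)) :
    l.IsBoundedUnder (· ≤ ·) fun zw => chordal zw.1 zw.2 :=
  isBoundedUnder_of ⟨1, fun _ => chordal_le_one _ _⟩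

theorem isCobounded_chordal (l : Filter (P1 K × P1 K)) [l.NeBot] :
    l.IsCoboundedUnder (· ≤ ·) fun zw => chordal zw.1 zw.2 :=
  (isBoundedUnder_of ⟨0, fun _ => chordal_nonneg _ _⟩ :
    l.IsBoundedUnder (· ≥ ·) _).isCoboundedUnder_flip

variable [IsAlgClosed K] [CharZero K] [CompleteSpace K]

theorem hsia_eq_max_of_ne (hK : IsUltrametricDist K) {x : P1 K} {S S' : Berk K}
    (h : kap x S ≠ kap x S') : hsia S S' = max (kap x S) (kap x S') := by
  refine Tendsto.limsup_eq ?_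
  have h1 := tendsto_chordal_fst x S S'
  have h2 := tendsto_chordal_snd x S S'
  refine (h1.max h2).congr' ?_
  have hne : ∀ᶠ zw : P1 K × P1 K in comap toBerk (𝓝 S) ×ˢ comap toBerk (𝓝 S'),
      chordal x zw.1 - chordal x zw.2 ≠ 0 :=
    (h1.sub h2).eventually_ne (sub_ne_zero.2 h)
  filter_upwards [hne] with zw hzw
  exact (chordal_eq_max_of_ne hK (sub_ne_zero.1 hzw)).symm

theorem hsia_le_max (hK : IsUltrametricDist K) (x : P1 K) (S S' : Berk K) :
    hsia S S' ≤ max (kap x S) (kap x S') := by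
  have h1 := (tendsto_chordal_fst x S S').max (tendsto_chordal_snd x S S')
  rw [← h1.limsup_eq]
  refine limsup_le_limsup (Eventually.of_forall fun zw => ?_) (isCobounded_chordal _)
    h1.isBoundedUnder_le
  have := chordal_ultra hK zw.1 x zw.2
  rwa [chordal_comm zw.1 x] at this

theorem le_hsia_self {S : Berk K} {ρ : ℝ} (h : ∀ x, ρ ≤ kap x S) : ρ ≤ hsia S S := by
  refine le_of_forall_lt fun a ha => ?_
  obtain ⟨b, hab, hb⟩ := exists_between ha
  refine hab.trans_le (le_limsup_of_frequently_le ?_ (isBounded_chordal _))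
  intro hcon
  obtain ⟨U, hU, V, hV, hUV⟩ := mem_prod_iff.1 hcon
  obtain ⟨z, hz⟩ := (comap_toBerk_neBot S).nonempty_of_mem hU
  have h1 : ∀ᶠ w in comap toBerk (𝓝 S), b < chordal z w := by
    have h2 := ((continuous_kap z).tendsto S).comp (tendsto_comap (f := toBerk))
    filter_upwards [h2.eventually_const_lt (hb.trans_le (h z))] with w hw
    rwa [Function.comp_apply, kap_toBerk] at hw
  obtain ⟨w, hw, hwV⟩ := (h1.and hV).exists
  have := hUV (Set.mk_mem_prod hz hwV)
  exact this hw.le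

theorem le_hsia (hK : IsUltrametricDist K) {S S' : Berk K} {ρ : ℝ} (h : ∀ x, ρ ≤ kap x S) :
    ρ ≤ hsia S S' := by
  by_cases hS : S = S'
  · subst hS
    exact le_hsia_self h
  · obtain ⟨x, hx⟩ : ∃ x, kap x S ≠ kap x S' := by
      by_contra! hcon
      exact hS (ext_kap hcon)
    rw [hsia_eq_max_of_ne hK hx]
    exact (h x).trans (le_max_left _ _)

theorem continuous_hsia (hK : IsUltrametricDist K) {S : Berk K} (hS : ∃ ρ > 0, ∀ x, ρ ≤ kap x S) :
    Continuous (hsia S) := by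
  refine continuous_iff_continuousAt.2 fun S' => ?_
  by_cases hSS : S = S'
  · subst hSS
    obtain ⟨ρ₀, hρ₀, hρ₀S⟩ := hS
    have hbdd : BddBelow (Set.range fun x => kap x S) := ⟨ρ₀, by rintro _ ⟨x, rfl⟩; exact hρ₀S x⟩
    have hne : Nonempty (P1 K) :=
      ⟨Projectivization.mk K (fun _ => 1) fun h => one_ne_zero (congrFun h 0)⟩
    have hlow : ∀ S', ⨅ x, kap x S ≤ hsia S S' := fun S' => le_hsia hK fun x => ciInf_le hbdd x
    have hself : hsia S S = ⨅ x, kap x S :=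
      le_antisymm (le_ciInf fun x => by simpa using hsia_le_max hK x S S) (hlow S)
    refine tendsto_order.2 ⟨fun a ha => Eventually.of_forall fun S' => ?_, fun a ha => ?_⟩
    · exact (hself ▸ ha).trans_le (hlow S')
    · rw [hself] at ha
      obtain ⟨x, hx⟩ := exists_lt_of_ciInf_lt ha
      filter_upwards [(continuous_kap x).tendsto S |>.eventually_lt_const hx] with S' hS'
      exact (hsia_le_max hK x S S').trans_lt (max_lt hx hS')
  · obtain ⟨x, hx⟩ : ∃ x, kap x S ≠ kap x S' := by
      by_contra! hcon
      exact hSS (ext_kap hcon)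
    have hc : ContinuousAt (fun T => max (kap x S) (kap x T)) S' :=
      (continuous_const.max (continuous_kap x)).continuousAt
    have hev : ∀ᶠ T in 𝓝 S', kap x T ≠ kap x S :=
      (continuous_kap x).continuousAt.eventually_ne hx.symm
    refine hc.congr ?_
    filter_upwards [hev] with T hT using (hsia_eq_max_of_ne hK hT.symm).symm

theorem hsia_comm_toBerk (S : Berk K) (w : P1 K) : hsia S (toBerk w) = kap w S := by
  refine Tendsto.limsup_eq ?_
  have h1 := tendsto_chordal_fst w S (toBerk w)
  have h2 := tendsto_chordal_snd w S (toBerk w)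
  rw [kap_toBerk, chordal_self] at h2
  have h3 : Tendsto (fun zw : P1 K × P1 K => chordal zw.1 zw.2 - chordal w zw.1)
      (comap toBerk (𝓝 S) ×ˢ comap toBerk (𝓝 (toBerk w))) (𝓝 0) := by
    refine squeeze_zero_norm (fun zw => ?_) h2
    rw [Real.norm_eq_abs, abs_le]
    have e1 := chordal_triangle zw.1 w zw.2
    have e2 := chordal_triangle w zw.2 zw.1
    rw [chordal_comm zw.1 w] at e1
    rw [chordal_comm zw.2 zw.1] at e2
    constructor <;> linarith
  simpa using h3.add h1

/-- The kernel at the point of the disc with center `z` and radius `‖t‖`. -/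
theorem hsia_disc_point (hK : IsUltrametricDist K) {z : P1 K} {t : K} {S : Berk K}
    (hS : ∀ w, kap w S = max (chordal w z) ‖t‖) (S' : Berk K) :
    hsia S S' = max (kap z S') ‖t‖ := by
  have hzS : kap z S = ‖t‖ := by rw [hS, chordal_self, max_eq_right (norm_nonneg _)]
  by_cases h1 : kap z S' = ‖t‖
  · rw [h1, max_self]
    refine le_antisymm ?_ (le_hsia hK fun x => by rw [hS]; exact le_max_right _ _)
    have := hsia_le_max hK z S S'
    rwa [hzS, h1, max_self] at this
  · rw [hsia_eq_max_of_ne hK (x := z) (by rw [hzS]; exact Ne.symm h1), hzS, max_comm]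

end NonarchimedeanKernel

section Completeness

variable {K : Type*} [NontriviallyNormedField K] [CompleteSpace K]

/-- Completeness of `K`: a point of `𝖯¹` with diameter zero is classical. -/
theorem exists_eq_toBerk_or_pos (hK : IsUltrametricDist K) (S : Berk K) :
    (∃ z, S = toBerk z) ∨ ∃ ρ > 0, ∀ x, ρ ≤ kap x S := by
  by_cases hpos : ∃ ρ > 0, ∀ x, ρ ≤ kap x S
  · exact Or.inr hpos
  left
  push Not at hpos
  choose! x hx using hpos
  have h1 : kap (x 1) S < 1 := hx 1 one_pos
  obtain ⟨v, v', hv, hz, hv1, hv1', hvv⟩ := exists_orthonormal hK (x 1)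
  have hvv0 : wedge v v' ≠ 0 := norm_ne_zero_iff.1 (by rw [hvv]; exact one_ne_zero)
  have hne : ∀ s : K, v + s • v' ≠ 0 := by
    intro s h
    have : wedge (v + s • v') v' = wedge v v' := by
      rw [wedge_add_left, wedge_smul_left, wedge_self, mul_zero, add_zero]
    rw [h] at this
    exact hvv0 (by rw [← this]; simp [wedge])
  have hnorm : ∀ s : K, ‖s‖ ≤ 1 → vecNorm (v + s • v') = 1 := by
    intro s hs
    refine le_antisymm ((vecNorm_add_le_max hK _ _).trans ?_) ?_
    · rw [vecNorm_smul, hv1, hv1', mul_one]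
      exact max_le le_rfl hs
    · have := norm_wedge_le (v + s • v') v'
      rwa [wedge_add_left, wedge_smul_left, wedge_self, mul_zero, add_zero, hvv, hv1',
        mul_one] at this
  have hchart : ∀ w : P1 K, chordal w (x 1) < 1 → ∃ s : K, ‖s‖ ≤ 1 ∧
      w = Projectivization.mk K (v + s • v') (hne s) := by
    intro w hw
    have hw' := vecNorm_rep_pos w
    rw [← hz, chordal_comm, chordal_mk_left, hv1, one_mul, div_lt_one hw'] at hw
    have hrep := wedge_smul_eq v v' w.rep
    have ha : ‖wedge w.rep v'‖ = vecNorm w.rep := by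
      refine le_antisymm ((norm_wedge_le _ _).trans (by rw [hv1', mul_one])) ?_
      have h2 := vecNorm_add_le_max hK (wedge w.rep v' • v) (wedge v w.rep • v')
      rw [← hrep, vecNorm_smul, vecNorm_smul, vecNorm_smul, hvv, hv1, hv1', one_mul, mul_one,
        mul_one] at h2
      exact (le_max_iff.1 h2).resolve_right (not_le.2 hw)
    have ha0 : wedge w.rep v' ≠ 0 := norm_ne_zero_iff.1 (by rw [ha]; exact hw'.ne')
    refine ⟨(wedge w.rep v')⁻¹ * wedge v w.rep, ?_, ?_⟩
    · rw [norm_mul, norm_inv, ha, inv_mul_le_iff₀ hw', mul_one]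
      exact hw.le
    · conv_lhs => rw [← w.mk_rep]
      rw [Projectivization.mk_eq_mk_iff']
      refine ⟨(wedge v v')⁻¹ * wedge w.rep v', ?_⟩
      have e : (v + ((wedge w.rep v')⁻¹ * wedge v w.rep) • v') =
          (wedge w.rep v')⁻¹ • (wedge w.rep v' • v + wedge v w.rep • v') := by
        rw [smul_add, smul_smul, smul_smul, inv_mul_cancel₀ ha0, one_smul]
      rw [e, ← hrep, smul_smul, smul_smul, mul_assoc]
      have : (wedge v v')⁻¹ * wedge w.rep v' * ((wedge w.rep v')⁻¹ * wedge v v') = 1 := by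
        field_simp
      rw [this, one_smul]
  have hdist : ∀ s s' : K, ‖s‖ ≤ 1 → ‖s'‖ ≤ 1 →
      chordal (Projectivization.mk K (v + s • v') (hne s))
        (Projectivization.mk K (v + s' • v') (hne s')) = ‖s - s'‖ := by
    intro s s' hs hs'
    rw [chordal_mk, hnorm s hs, hnorm s' hs', mul_one, div_one]
    have : wedge (v + s • v') (v + s' • v') = (s' - s) * wedge v v' := by
      simp only [wedge, Pi.add_apply, Pi.smul_apply, smul_eq_mul]
      ring
    rw [this, norm_mul, hvv, mul_one, norm_sub_rev]
  let y : ℕ → P1 K := fun n => x (1 / ((n : ℝ) + 1))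
  have hy : ∀ n, kap (y n) S < 1 / ((n : ℝ) + 1) := fun n => hx _ (by positivity)
  have hy1 : ∀ n, kap (y n) S < 1 := fun n =>
    (hy n).trans_le ((div_le_one (by positivity)).2 (by linarith [n.cast_nonneg (α := ℝ)]))
  have hyx : ∀ n, chordal (y n) (x 1) < 1 := fun n =>
    (chordal_le_max_kap hK _ _ S).trans_lt (max_lt (hy1 n) h1)
  choose s hs hys using fun n => hchart (y n) (hyx n)
  have hss : ∀ n m, ‖s n - s m‖ ≤ max (kap (y n) S) (kap (y m) S) := by
    intro n m
    rw [← hdist _ _ (hs n) (hs m), ← hys, ← hys]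
    exact chordal_le_max_kap hK _ _ S
  have hcau : CauchySeq s := by
    refine cauchySeq_of_le_tendsto_0 (fun n : ℕ => 1 / ((n : ℝ) + 1)) (fun n m N hn hm => ?_)
      tendsto_one_div_add_atTop_nhds_zero_nat
    rw [dist_eq_norm]
    refine (hss n m).trans (max_le ((hy n).le.trans ?_) ((hy m).le.trans ?_))
    · exact one_div_le_one_div_of_le (by positivity) (by exact_mod_cast Nat.succ_le_succ hn)
    · exact one_div_le_one_div_of_le (by positivity) (by exact_mod_cast Nat.succ_le_succ hm)
  obtain ⟨a, ha⟩ := cauchySeq_tendsto_of_complete hcau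
  have ha1 : ‖a‖ ≤ 1 := le_of_tendsto ha.norm (Eventually.of_forall hs)
  refine ⟨Projectivization.mk K (v + a • v') (hne a), eq_toBerk_of_kap_eq_zero ?_⟩
  refine le_antisymm ?_ (kap_nonneg _ _)
  have h2 : ∀ n, kap (Projectivization.mk K (v + a • v') (hne a)) S ≤
      max ‖a - s n‖ (1 / ((n : ℝ) + 1)) := by
    intro n
    refine (kap_le_max hK _ (y n) S).trans (max_le_max ?_ (hy n).le)
    rw [hys n, hdist _ _ ha1 (hs n)]
  have h3 : Tendsto (fun n => max ‖a - s n‖ (1 / ((n : ℝ) + 1))) atTop (𝓝 0) := by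
    have h4 : Tendsto (fun n => ‖a - s n‖) atTop (𝓝 0) := by
      have := (tendsto_const_nhds (x := a)).sub ha
      simpa using this.norm
    simpa using h4.max tendsto_one_div_add_atTop_nhds_zero_nat
  exact ge_of_tendsto' h3 h2

end Completeness

end BerkDyn

namespace BerkDyn

section Discs

variable {K : Type*} [NontriviallyNormedField K]

/-- The probability measures that are Dirac measures if `K` is non-archimedean. -/
def IsTame (D : Measure (Berk K)) : Prop :=
  IsProbabilityMeasure D ∧ (IsUltrametricDist K → ∃ S, D = Measure.dirac S)

/-- `D` is a measure whose logarithmic potential is the continuous function `-ψ` on `ℙ¹`. -/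
structure IsDisc (D : Measure (Berk K)) (ψ : Berk K → ℝ) : Prop where
  tame : IsTame D
  continuous : Continuous ψ
  ne_top : ∀ b : P1 K, ∫⁻ S, negLog (kap b S) ∂D ≠ ⊤
  integral_eq : ∀ b : P1 K, ∫ S, Real.log (kap b S) ∂D = -ψ (toBerk b)

theorem IsTame.map {D : Measure (Berk K)} (hD : IsTame D) {φ : Berk K → Berk K}
    (hφ : Continuous φ) : IsTame (D.map φ) := by
  have := hD.1
  refine ⟨Measure.isProbabilityMeasure_map hφ.measurable.aemeasurable, fun hK => ?_⟩
  obtain ⟨S, rfl⟩ := hD.2 hK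
  exact ⟨φ S, Measure.map_dirac' hφ.measurable S⟩

theorem measurable_kap (b : P1 K) : Measurable (kap b : Berk K → ℝ) := (continuous_kap b).measurable

theorem isTame_dirac (S : Berk K) : IsTame (Measure.dirac S) :=
  ⟨inferInstance, fun _ => ⟨S, rfl⟩⟩

theorem IsDisc.dirac {S : Berk K} {ψ : Berk K → ℝ} (hψ : Continuous ψ) (hS : ∀ b, 0 < kap b S)
    (h : ∀ b, ψ (toBerk b) = -Real.log (kap b S)) : IsDisc (Measure.dirac S) ψ where
  tame := isTame_dirac S
  continuous := hψ
  ne_top b := by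
    rw [lintegral_dirac, negLog_of_pos (hS b)]
    exact ENNReal.ofReal_ne_top
  integral_eq b := by rw [integral_dirac, h, neg_neg]

theorem Berk.nv_add_le (S : Berk K) (d : ℕ) (G H : MvPolynomial (Fin 2) K) :
    S.nv d (G + H) ≤ S.nv d G + S.nv d H := by
  unfold Berk.nv
  rw [← add_div]
  exact div_le_div_of_nonneg_right (map_add_le_add _ _ _)
    (pow_nonneg (Quotient.out S).norm_pos.le _)

theorem abs_nv_linForm_sub_le (p q : Fin 2 → K) (S : Berk K) :
    |S.nv 1 (linForm p) - S.nv 1 (linForm q)| ≤ vecNorm (p - q) := by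
  have h : ∀ p q : Fin 2 → K, S.nv 1 (linForm p) - S.nv 1 (linForm q) ≤ vecNorm (p - q) := by
    intro p q
    have h1 := S.nv_add_le 1 (linForm q) (linForm (p - q))
    rw [← linForm_add, add_sub_cancel] at h1
    linarith [nv_linForm_le (p - q) S]
  rw [abs_le]
  refine ⟨?_, h p q⟩
  have h2 := h q p
  rw [← neg_sub p q, vecNorm_neg] at h2
  linarith

theorem continuous_nv_linForm :
    Continuous fun x : (Fin 2 → K) × Berk K => x.2.nv 1 (linForm x.1) := by
  refine continuous_iff_continuousAt.2 fun ⟨p, S⟩ => ?_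
  have h1 : Tendsto (fun x : (Fin 2 → K) × Berk K => x.2.nv 1 (linForm p)) (𝓝 (p, S))
      (𝓝 (S.nv 1 (linForm p))) :=
    ((Berk.continuous_nv (linForm_isHomogeneous p)).comp continuous_snd).tendsto _
  have h2 : Tendsto (fun x : (Fin 2 → K) × Berk K =>
      x.2.nv 1 (linForm x.1) - x.2.nv 1 (linForm p)) (𝓝 (p, S)) (𝓝 0) := by
    refine squeeze_zero_norm (fun x => abs_nv_linForm_sub_le x.1 p x.2) ?_
    have h3 : Continuous fun x : (Fin 2 → K) × Berk K => vecNorm (x.1 - p) :=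
      continuous_vecNorm.comp (by fun_prop)
    have := h3.tendsto (p, S)
    simpa [vecNorm, pairNorm_zero_right] using this
  have := h2.add h1
  simp only [sub_add_cancel, zero_add] at this
  exact this

theorem tendsto_pt {α : Type*} {l : Filter α} {p : α → Fin 2 → K} (hp : ∀ x, p x ≠ 0)
    {q : Fin 2 → K} (hq : q ≠ 0) (h : Tendsto p l (𝓝 q)) :
    Tendsto (fun x => pt (p x) (hp x)) l (𝓝 (pt q hq)) := by
  refine Berk.tendsto_nhds_iff.2 fun d G hG => ?_
  simp only [nv_pt _ _ hG]
  have h1 : Tendsto (fun x => ‖MvPolynomial.eval (p x) G‖) l (𝓝 ‖MvPolynomial.eval q G‖) :=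
    ((MvPolynomial.continuous_eval G).tendsto q |>.comp h).norm
  have h2 : Tendsto (fun x => vecNorm (p x) ^ d) l (𝓝 (vecNorm q ^ d)) :=
    ((continuous_vecNorm.tendsto q).comp h).pow d
  exact h1.div h2 (pow_pos (vecNorm_pos hq) d).ne'

theorem nv_pt_linForm (p b : Fin 2 → K) (hp : p ≠ 0) :
    (pt p hp).nv 1 (linForm b) = ‖wedge p b‖ / vecNorm p := by
  rw [nv_pt _ _ (linForm_isHomogeneous b), eval_linForm, pow_one]

theorem kap_pt (p : Fin 2 → K) (hp : p ≠ 0) (b : P1 K) :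
    kap b (pt p hp) = ‖wedge p b.rep‖ / (vecNorm p * vecNorm b.rep) := by
  rw [kap, nv_pt_linForm, div_div]

theorem max_nv_linForm_pos {v v' : Fin 2 → K} (h : wedge v v' ≠ 0) {r : ℝ} (hr : 0 < r)
    (S : Berk K) : 0 < max (S.nv 1 (linForm v)) (r * S.nv 1 (linForm v')) := by
  by_contra! hcon
  have h1 : S.nv 1 (linForm v) = 0 :=
    le_antisymm ((le_max_left _ _).trans hcon) (S.nv_nonneg _ _)
  have h2 : S.nv 1 (linForm v') = 0 := by
    have := (le_max_right _ _).trans hcon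
    exact le_antisymm (nonpos_of_mul_nonpos_right this hr) (S.nv_nonneg _ _)
  have h3 : ∀ b : Fin 2 → K, S.nv 1 (linForm b) = 0 := by
    intro b
    have h4 := congrArg (S.nv 1) (linForm_relation v v' b)
    have h5 := S.nv_add_le 1 (MvPolynomial.C (wedge b v') * linForm v)
      (MvPolynomial.C (wedge v b) * linForm v')
    rw [← h4, Berk.nv_C_mul, Berk.nv_C_mul, Berk.nv_C_mul, h1, h2, mul_zero, mul_zero,
      add_zero] at h5
    refine le_antisymm ?_ (S.nv_nonneg _ _)
    exact nonpos_of_mul_nonpos_right h5 (norm_pos_iff.2 h)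
  have h6 := pairNorm_nv_X S
  have e0 : linForm ![(0 : K), 1] = MvPolynomial.X 0 := by simp [linForm, wedge]
  have e1 : linForm ![(-1 : K), 0] = MvPolynomial.X 1 := by simp [linForm, wedge]
  rw [← e0, ← e1, h3, h3, pairNorm_zero_right K le_rfl] at h6
  exact zero_ne_one h6

end Discs

section Circle

/-- The uniform probability measure on `(0, 2π]`. -/
noncomputable def circ : Measure ℝ :=
  ENNReal.ofReal (2 * Real.pi)⁻¹ • (volume.restrict (Set.Ioc 0 (2 * Real.pi)))

instance : IsProbabilityMeasure circ := by
  refine ⟨?_⟩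
  have : (0 : ℝ) < 2 * Real.pi := by positivity
  rw [circ, Measure.smul_apply, Measure.restrict_apply_univ, Real.volume_Ioc, smul_eq_mul,
    ← ENNReal.ofReal_mul (by positivity), sub_zero, inv_mul_cancel₀ this.ne', ENNReal.ofReal_one]

theorem integral_circ (φ : ℂ → ℝ) :
    ∫ θ, φ (circleMap 0 1 θ) ∂circ = Real.circleAverage φ 0 1 := by
  have : (0 : ℝ) ≤ 2 * Real.pi := by positivity
  rw [circ, integral_smul_measure, ENNReal.toReal_ofReal (by positivity), Real.circleAverage_def,
    intervalIntegral.integral_of_le this]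

theorem integrable_circ {φ : ℂ → ℝ} (h : CircleIntegrable φ 0 1) :
    Integrable (fun θ => φ (circleMap 0 1 θ)) circ := by
  have h0 : (0 : ℝ) ≤ 2 * Real.pi := by positivity
  refine Integrable.smul_measure ?_ ENNReal.ofReal_ne_top
  exact (intervalIntegrable_iff_integrableOn_Ioc_of_le h0).1 h

theorem ae_circ_ne (w : ℂ) : ∀ᵐ θ ∂circ, circleMap 0 1 θ ≠ w := by
  have h : ({w} : Set ℂ).Countable := Set.countable_singleton w
  have h1 : (circleMap 0 1 ⁻¹' {w}).Countable := h.preimage_circleMap 0 one_ne_zero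
  have h2 : ∀ᵐ θ ∂(volume : Measure ℝ), circleMap 0 1 θ ≠ w := by
    filter_upwards [h1.ae_notMem volume] with θ hθ using hθ
  exact Measure.ae_smul_measure (ae_restrict_of_ae h2) _

theorem log_norm_circ (x y : ℂ) (h : x ≠ 0 ∨ y ≠ 0) :
    (∀ᵐ θ ∂circ, x + circleMap 0 1 θ * y ≠ 0) ∧
    Integrable (fun θ => Real.log ‖x + circleMap 0 1 θ * y‖) circ ∧
    ∫ θ, Real.log ‖x + circleMap 0 1 θ * y‖ ∂circ = Real.log (max ‖x‖ ‖y‖) := by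
  by_cases hy : y = 0
  · subst hy
    have hx : x ≠ 0 := by simpa using h
    simp [hx]
  · have hae : ∀ᵐ θ ∂circ, x + circleMap 0 1 θ * y ≠ 0 := by
      filter_upwards [ae_circ_ne (-x / y)] with θ hθ h0
      apply hθ
      rw [eq_div_iff hy]
      linear_combination h0
    have heq : (fun θ => Real.log ‖x + circleMap 0 1 θ * y‖) =ᵐ[circ]
        fun θ => Real.log ‖circleMap 0 1 θ - (-x / y)‖ + Real.log ‖y‖ := by
      filter_upwards [ae_circ_ne (-x / y)] with θ hθ
      rw [← Real.log_mul (norm_ne_zero_iff.2 (sub_ne_zero.2 hθ)) (norm_ne_zero_iff.2 hy), ← norm_mul]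
      congr 2
      field_simp
      ring
    have hint := integrable_circ (circleIntegrable_log_norm_sub_const (a := -x / y) (c := 0) 1)
    refine ⟨hae, (integrable_congr heq).2 (hint.add (integrable_const _)), ?_⟩
    rw [integral_congr_ae heq, integral_add hint (integrable_const _),
      integral_circ fun z => Real.log ‖z - (-x / y)‖, circleAverage_log_norm_sub_const_eq_posLog,
      integral_const, probReal_univ, one_smul]
    have hy' : 0 < ‖y‖ := norm_pos_iff.2 hy
    rw [norm_div, norm_neg]
    change max 0 (Real.log (‖x‖ / ‖y‖)) + _ = _
    by_cases hxy : ‖x‖ ≤ ‖y‖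
    · rw [max_eq_right hxy, max_eq_left, zero_add]
      exact Real.log_nonpos (by positivity) ((div_le_one hy').2 hxy)
    · push Not at hxy
      rw [max_eq_left hxy.le, max_eq_right, Real.log_div (hy'.trans hxy).ne' hy'.ne',
        sub_add_cancel]
      exact Real.log_nonneg ((one_le_div hy').2 hxy.le)

end Circle

section ArchimedeanDiscs

variable {K : Type*} [NontriviallyNormedField K]

theorem add_smul_ne_zero {v v' : Fin 2 → K} (h : wedge v v' ≠ 0) (a : K) : v + a • v' ≠ 0 := by
  intro h0
  have h1 : wedge (v + a • v') v' = wedge v v' := by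
    rw [wedge_add_left, wedge_smul_left, wedge_self, mul_zero, add_zero]
  rw [h0] at h1
  exact h (by rw [← h1]; simp [wedge])

/-- The uniform measure on the circle `{v + u v' : |u| = 1}`. -/
noncomputable def circleMeasure {v v' : Fin 2 → K} (h : wedge v v' ≠ 0) (u : ℝ → K) :
    Measure (Berk K) :=
  circ.map fun θ => pt (v + u θ • v') (add_smul_ne_zero h (u θ))

theorem continuous_circle_pt {v v' : Fin 2 → K} (h : wedge v v' ≠ 0) {u : ℝ → K}
    (hu : Continuous u) : Continuous fun θ => pt (v + u θ • v') (add_smul_ne_zero h (u θ)) := by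
  refine continuous_iff_continuousAt.2 fun θ => tendsto_pt _ _ ?_
  have : Continuous fun θ => v + u θ • v' := by fun_prop
  exact this.tendsto θ

theorem isDisc_circleMeasure (hK : ¬ IsUltrametricDist K) {u : ℝ → K} (hu : Continuous u)
    (hcirc : ∀ x y : K, (x ≠ 0 ∨ y ≠ 0) → (∀ᵐ θ ∂circ, x + u θ * y ≠ 0) ∧
      Integrable (fun θ => Real.log ‖x + u θ * y‖) circ ∧
      ∫ θ, Real.log ‖x + u θ * y‖ ∂circ = Real.log (max ‖x‖ ‖y‖))
    {v v' : Fin 2 → K} (h : wedge v v' ≠ 0) :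
    IsDisc (circleMeasure h u) fun S =>
      (∫ θ, Real.log (vecNorm (v + u θ • v')) ∂circ) -
        Real.log (max (S.nv 1 (linForm v)) (S.nv 1 (linForm v'))) := by
  have hpt := continuous_circle_pt h hu
  have hpos : ∀ S : Berk K, 0 < max (S.nv 1 (linForm v)) (S.nv 1 (linForm v')) := fun S => by
    simpa using max_nv_linForm_pos h one_pos S
  have hnorm : Continuous fun θ => Real.log (vecNorm (v + u θ • v')) := by
    refine Continuous.log ?_ fun θ => (vecNorm_pos (add_smul_ne_zero h (u θ))).ne'
    exact continuous_vecNorm.comp (by fun_prop)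
  have hnorm_int : Integrable (fun θ => Real.log (vecNorm (v + u θ • v'))) circ := by
    refine Integrable.smul_measure ?_ ENNReal.ofReal_ne_top
    exact (hnorm.integrableOn_Icc).mono_set Set.Ioc_subset_Icc_self
  have hkey : ∀ b : P1 K, (∀ᵐ θ ∂circ, 0 < kap b (pt (v + u θ • v') (add_smul_ne_zero h (u θ)))) ∧
      Integrable (fun θ => Real.log (kap b (pt (v + u θ • v') (add_smul_ne_zero h (u θ))))) circ ∧
      ∫ θ, Real.log (kap b (pt (v + u θ • v') (add_smul_ne_zero h (u θ)))) ∂circ =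
        Real.log (max ‖wedge v b.rep‖ ‖wedge v' b.rep‖) - Real.log (vecNorm b.rep) -
          ∫ θ, Real.log (vecNorm (v + u θ • v')) ∂circ := by
    intro b
    have hb := vecNorm_rep_pos b
    have hne : wedge v b.rep ≠ 0 ∨ wedge v' b.rep ≠ 0 := by
      by_contra! hcon
      have h3 := wedge_smul_eq v v' b.rep
      rw [hcon.1, wedge_comm b.rep, hcon.2, neg_zero, zero_smul, zero_smul, add_zero] at h3
      exact b.rep_nonzero ((smul_eq_zero.1 h3).resolve_left h)
    obtain ⟨h1, h2, h3⟩ := hcirc _ _ hne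
    have hw : ∀ θ, wedge (v + u θ • v') b.rep = wedge v b.rep + u θ * wedge v' b.rep := fun θ => by
      rw [wedge_add_left, wedge_smul_left]
    have heq : (fun θ => Real.log (kap b (pt (v + u θ • v') (add_smul_ne_zero h (u θ))))) =ᵐ[circ]
        fun θ => Real.log ‖wedge v b.rep + u θ * wedge v' b.rep‖ - Real.log (vecNorm b.rep) -
          Real.log (vecNorm (v + u θ • v')) := by
      filter_upwards [h1] with θ hθ
      have hp := vecNorm_pos (add_smul_ne_zero h (u θ))
      rw [kap_pt, hw, Real.log_div (norm_ne_zero_iff.2 hθ) (by positivity),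
        Real.log_mul hp.ne' hb.ne']
      ring
    refine ⟨?_, (integrable_congr heq).2 ((h2.sub (integrable_const _)).sub hnorm_int), ?_⟩
    · filter_upwards [h1] with θ hθ
      have hp := vecNorm_pos (add_smul_ne_zero h (u θ))
      have := norm_pos_iff.2 hθ
      rw [kap_pt, hw]
      positivity
    · rw [integral_congr_ae heq]
      have h5 : Integrable (fun θ => Real.log ‖wedge v b.rep + u θ * wedge v' b.rep‖ -
        Real.log (vecNorm b.rep)) circ := h2.sub (integrable_const _)
      rw [integral_sub h5 hnorm_int, integral_sub h2 (integrable_const _), h3, integral_const,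
        probReal_univ, one_smul]
  have hmlog : ∀ b : P1 K, Measurable fun S : Berk K => Real.log (kap b S) := fun b =>
    Real.measurable_log.comp (measurable_kap b)
  refine ⟨⟨Measure.isProbabilityMeasure_map hpt.measurable.aemeasurable, fun h' => absurd h' hK⟩,
    ?_, fun b => ?_, fun b => ?_⟩
  · refine continuous_const.sub (Continuous.log ?_ fun S => (hpos S).ne')
    exact (Berk.continuous_nv (linForm_isHomogeneous v)).max
      (Berk.continuous_nv (linForm_isHomogeneous v'))
  · have hm : Measurable fun S : Berk K => negLog (kap b S) :=
      measurable_negLog.comp (measurable_kap b)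
    rw [circleMeasure, lintegral_map hm hpt.measurable,
      lintegral_negLog_eq (hkey b).1 (fun θ => kap_le_one _ _) (hkey b).2.1]
    exact ENNReal.ofReal_ne_top
  · rw [circleMeasure, integral_map hpt.measurable.aemeasurable (hmlog b).aestronglyMeasurable,
      (hkey b).2.2]
    have hb := vecNorm_rep_pos b
    have hmax : max ((toBerk b).nv 1 (linForm v)) ((toBerk b).nv 1 (linForm v')) =
        max ‖wedge v b.rep‖ ‖wedge v' b.rep‖ / vecNorm b.rep := by
      rw [toBerk_eq_pt, nv_pt_linForm, nv_pt_linForm, wedge_comm v, wedge_comm v', norm_neg,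
        norm_neg, max_div_div_right hb.le]
    have h4 := hpos (toBerk b)
    rw [hmax] at h4 ⊢
    have h5 : 0 < max ‖wedge v b.rep‖ ‖wedge v' b.rep‖ := by
      rcases div_pos_iff.1 h4 with h | h
      · exact h.1
      · exact absurd h.2 (not_lt.2 hb.le)
    rw [Real.log_div h5.ne' hb.ne']
    ring

variable [IsAlgClosed K] [CharZero K] [CompleteSpace K]

theorem exists_circle (hK : ¬ IsUltrametricDist K) : ∃ u : ℝ → K, Continuous u ∧
    (∀ θ, ‖u θ‖ = 1) ∧ ∀ x y : K, (x ≠ 0 ∨ y ≠ 0) → (∀ᵐ θ ∂circ, x + u θ * y ≠ 0) ∧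
      Integrable (fun θ => Real.log ‖x + u θ * y‖) circ ∧
      ∫ θ, Real.log ‖x + u θ * y‖ ∂circ = Real.log (max ‖x‖ ‖y‖) := by
  obtain ⟨s, ι, hs, hι⟩ := exists_complex_equiv hK
  have hcont : Continuous ι := by
    refine continuous_iff_continuousAt.2 fun z => tendsto_iff_norm_sub_tendsto_zero.2 ?_
    have h1 : ∀ w, ‖ι w - ι z‖ = ‖w - z‖ ^ s := fun w => by rw [← map_sub, hι]
    simp_rw [h1]
    have h2 : Continuous fun w : ℂ => ‖w - z‖ ^ s := by
      have : Continuous fun w : ℂ => ‖w - z‖ := by fun_prop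
      exact this.rpow_const fun _ => Or.inr hs.le
    have := h2.tendsto z
    simpa [Real.zero_rpow hs.ne'] using this
  refine ⟨fun θ => ι (circleMap 0 1 θ), hcont.comp (continuous_circleMap 0 1), fun θ => ?_,
    fun x y hxy => ?_⟩
  · rw [hι]
    simp
  · obtain ⟨x, rfl⟩ := ι.surjective x
    obtain ⟨y, rfl⟩ := ι.surjective y
    have hxy' : x ≠ 0 ∨ y ≠ 0 := by simpa using hxy
    obtain ⟨h1, h2, h3⟩ := log_norm_circ x y hxy'
    have hlog : ∀ z : ℂ, Real.log (‖z‖ ^ s) = s * Real.log ‖z‖ := by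
      intro z
      by_cases hz : z = 0
      · simp [hz, Real.zero_rpow hs.ne']
      · exact Real.log_rpow (norm_pos_iff.2 hz) s
    have he : ∀ θ, ι x + ι (circleMap 0 1 θ) * ι y = ι (x + circleMap 0 1 θ * y) := by
      intro θ
      rw [map_add, map_mul]
    simp only [he, hι, hlog]
    refine ⟨?_, h2.const_mul s, ?_⟩
    · filter_upwards [h1] with θ hθ
      exact (map_ne_zero ι).2 hθ
    · rw [integral_const_mul, h3]
      have hm : max (‖x‖ ^ s) (‖y‖ ^ s) = (max ‖x‖ ‖y‖) ^ s :=
        ((Real.monotoneOn_rpow_Ici_of_exponent_nonneg hs.le).map_max (norm_nonneg x)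
          (norm_nonneg y)).symm
      have hpos : 0 < max ‖x‖ ‖y‖ := by
        rcases hxy' with h | h
        · exact lt_max_of_lt_left (norm_pos_iff.2 h)
        · exact lt_max_of_lt_right (norm_pos_iff.2 h)
      rw [hm, Real.log_rpow hpos]

theorem exists_norm_eq (hK : ¬ IsUltrametricDist K) {r : ℝ} (hr : 0 < r) : ∃ t : K, ‖t‖ = r := by
  obtain ⟨s, ι, hs, hι⟩ := exists_complex_equiv hK
  refine ⟨ι ((r ^ s⁻¹ : ℝ) : ℂ), ?_⟩
  rw [hι, Complex.norm_real, Real.norm_of_nonneg (by positivity), ← Real.rpow_mul hr.le,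
    inv_mul_cancel₀ hs.ne', Real.rpow_one]

end ArchimedeanDiscs

end BerkDyn

namespace BerkDyn

section DiscSequences

variable {K : Type*} [NontriviallyNormedField K]

/-- The measures `D j` are discs that shrink to the classical point `z`, and their potentials
decrease to the one of `z`. -/
structure IsShrinking (z : P1 K) (D : ℕ → Measure (Berk K)) (h : ℕ → Berk K → ℝ) (e : ℕ → ℝ) :
    Prop where
  isDisc : ∀ j, IsDisc (D j) fun S => h j S + e j
  tendsto_const : Tendsto e atTop (𝓝 0)
  nonneg : ∀ j S, 0 ≤ h j S
  mono : ∀ S, Monotone fun j => h j S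
  tendsto_negLog : ∀ S, Tendsto (fun j => ENNReal.ofReal (h j S)) atTop (𝓝 (negLog (kap z S)))
  tendsto_integral : ∀ φ : Berk K → ℝ, Continuous φ →
    Tendsto (fun j => ∫ S, φ S ∂(D j)) atTop (𝓝 (φ (toBerk z)))

theorem exists_seq_norm_tendsto_zero {r : ℝ} (hr : 0 < r) : ∃ t : ℕ → K, (∀ j, t j ≠ 0) ∧
    (∀ j, ‖t j‖ ≤ r) ∧ (Antitone fun j => ‖t j‖) ∧ Tendsto (fun j => ‖t j‖) atTop (𝓝 0) := by
  obtain ⟨a, ha0, ha⟩ := NormedField.exists_norm_lt K (lt_min hr one_pos)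
  have har : ‖a‖ ≤ r := (ha.trans_le (min_le_left _ _)).le
  have ha1 : ‖a‖ < 1 := ha.trans_le (min_le_right _ _)
  refine ⟨fun j => a ^ (j + 1), fun j => pow_ne_zero _ (norm_pos_iff.1 ha0), fun j => ?_, ?_, ?_⟩
  · rw [norm_pow, pow_succ]
    exact (mul_le_of_le_one_left (norm_nonneg _) (pow_le_one₀ (norm_nonneg _) ha1.le)).trans har
  · intro i j hij
    simp only [norm_pow]
    exact pow_le_pow_of_le_one (norm_nonneg _) ha1.le (by omega)
  · simp only [norm_pow]
    exact (tendsto_pow_atTop_nhds_zero_of_lt_one (norm_nonneg _) ha1).comp (tendsto_add_atTop_nat 1)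

theorem tendsto_ofReal_neg_log {a : ℕ → ℝ} {b : ℝ} (hb : 0 ≤ b) (ha : ∀ j, 0 < a j)
    (h : Tendsto a atTop (𝓝 b)) :
    Tendsto (fun j => ENNReal.ofReal (-Real.log (a j))) atTop (𝓝 (negLog b)) := by
  rcases hb.eq_or_lt with rfl | hb
  · rw [negLog_of_nonpos le_rfl]
    refine ENNReal.tendsto_ofReal_atTop.comp (tendsto_neg_atBot_atTop.comp ?_)
    refine Real.tendsto_log_nhdsGT_zero.comp (tendsto_nhdsWithin_iff.2 ⟨h, ?_⟩)
    exact Eventually.of_forall ha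
  · rw [negLog_of_pos hb]
    exact ENNReal.tendsto_ofReal (h.log hb.ne').neg

theorem tendsto_max_mul {a b : ℝ} {t : ℕ → ℝ} (ha : 0 ≤ a) (h : Tendsto t atTop (𝓝 0)) :
    Tendsto (fun j => max a (t j * b)) atTop (𝓝 a) := by
  have := (tendsto_const_nhds (x := a)).max (h.mul_const b)
  rwa [zero_mul, max_eq_left ha] at this

variable [IsAlgClosed K]

theorem exists_isShrinking_of_ultrametric (hK : IsUltrametricDist K) (z : P1 K) :
    ∃ D h e, IsShrinking z D h e := by
  obtain ⟨t, ht0, ht1, hanti, hlim⟩ := exists_seq_norm_tendsto_zero (K := K) one_pos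
  choose S hS using fun j => exists_disc_point hK z (t j) (ht1 j)
  have hpos : ∀ j, 0 < ‖t j‖ := fun j => norm_pos_iff.2 (ht0 j)
  have hmax : ∀ j (T : Berk K), 0 < max (kap z T) ‖t j‖ := fun j T => lt_max_of_lt_right (hpos j)
  have hle : ∀ j (T : Berk K), max (kap z T) ‖t j‖ ≤ 1 := fun j T => max_le (kap_le_one _ _) (ht1 j)
  refine ⟨fun j => Measure.dirac (S j), fun j T => -Real.log (max (kap z T) ‖t j‖), fun _ => 0, ?_⟩
  refine ⟨fun j => ?_, tendsto_const_nhds, fun j T => ?_, fun T => ?_, fun T => ?_, fun φ hφ => ?_⟩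
  · refine IsDisc.dirac ?_ (fun b => ?_) fun b => ?_
    · refine Continuous.add ?_ continuous_const
      exact (((continuous_kap z).max continuous_const).log fun T => (hmax j T).ne').neg
    · rw [hS]
      exact lt_max_of_lt_right (hpos j)
    · rw [hS, kap_toBerk, chordal_comm, add_zero]
  · exact neg_nonneg.2 (Real.log_nonpos (hmax j T).le (hle j T))
  · intro i j hij
    exact neg_le_neg (Real.log_le_log (hmax j T) (max_le_max le_rfl (hanti hij)))
  · refine tendsto_ofReal_neg_log (kap_nonneg z T) (fun j => hmax j T) ?_
    have := (tendsto_const_nhds (x := kap z T)).max hlim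
    rwa [max_eq_left (kap_nonneg z T)] at this
  · simp only [integral_dirac]
    refine (hφ.tendsto _).comp (tendsto_toBerk_of_kap ?_)
    refine hlim.congr fun j => ?_
    rw [hS, chordal_self, max_eq_right (norm_nonneg _)]

variable [CharZero K] [CompleteSpace K]

theorem exists_isShrinking_of_not_ultrametric (hK : ¬ IsUltrametricDist K) (z : P1 K) :
    ∃ D h e, IsShrinking z D h e := by
  obtain ⟨u, hu, hu1, hcirc⟩ := exists_circle hK
  obtain ⟨q, hq⟩ := exists_wedge_eq_one z.rep_nonzero
  set v := z.rep with hv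
  have hvpos := vecNorm_rep_pos z
  have hqne : q ≠ 0 := by
    rintro rfl
    simp [wedge] at hq
  have hqpos := vecNorm_pos hqne
  obtain ⟨t, ht0, ht1, hanti, hlim⟩ := exists_seq_norm_tendsto_zero (K := K)
    (show 0 < vecNorm v / vecNorm q / 2 by positivity)
  have htq : ∀ j, ‖t j‖ * vecNorm q ≤ vecNorm v / 2 := by
    intro j
    calc ‖t j‖ * vecNorm q ≤ vecNorm v / vecNorm q / 2 * vecNorm q := by gcongr; exact ht1 j
      _ = vecNorm v / 2 := by field_simp
  have hpos : ∀ j, 0 < ‖t j‖ := fun j => norm_pos_iff.2 (ht0 j)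
  have hw : ∀ j, wedge v (t j • q) ≠ 0 := by
    intro j
    rw [wedge_smul_right, hq, mul_one]
    exact ht0 j
  let m : ℕ → Berk K → ℝ := fun j S => max (S.nv 1 (linForm v)) (‖t j‖ * S.nv 1 (linForm q))
  have hm : ∀ j S, 0 < m j S := fun j S => max_nv_linForm_pos (by rw [hq]; exact one_ne_zero) (hpos j) S
  have hmle : ∀ j S, m j S ≤ vecNorm v := by
    intro j S
    refine max_le (nv_linForm_le _ _) ?_
    calc ‖t j‖ * S.nv 1 (linForm q) ≤ ‖t j‖ * vecNorm q := by gcongr; exact nv_linForm_le _ _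
      _ ≤ vecNorm v := by linarith [htq j]
  let c : ℕ → ℝ := fun j => ∫ θ, Real.log (vecNorm (v + u θ • t j • q)) ∂circ
  have hbd : ∀ j θ, vecNorm v - ‖t j‖ * vecNorm q ≤ vecNorm (v + u θ • t j • q) ∧
      vecNorm (v + u θ • t j • q) ≤ vecNorm v + ‖t j‖ * vecNorm q := by
    intro j θ
    have h1 : vecNorm (u θ • t j • q) = ‖t j‖ * vecNorm q := by
      rw [vecNorm_smul, vecNorm_smul, hu1, one_mul]
    have h2 := vecNorm_add_le v (u θ • t j • q)
    have h3 := vecNorm_add_le (v + u θ • t j • q) (-(u θ • t j • q))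
    rw [vecNorm_neg, add_neg_cancel_right] at h3
    constructor <;> linarith
  have hclim : Tendsto c atTop (𝓝 (Real.log (vecNorm v))) := by
    have hlow : ∀ j, 0 < vecNorm v - ‖t j‖ * vecNorm q := fun j => by linarith [htq j]
    have hint : ∀ j, Integrable (fun θ => Real.log (vecNorm (v + u θ • t j • q))) circ := by
      intro j
      have hnorm : Continuous fun θ => Real.log (vecNorm (v + u θ • t j • q)) := by
        refine Continuous.log ?_ fun θ => ((hlow j).trans_le (hbd j θ).1).ne'
        exact continuous_vecNorm.comp (by fun_prop)
      refine Integrable.smul_measure ?_ ENNReal.ofReal_ne_top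
      exact (hnorm.integrableOn_Icc).mono_set Set.Ioc_subset_Icc_self
    have hl1 : Tendsto (fun j => Real.log (vecNorm v - ‖t j‖ * vecNorm q)) atTop
        (𝓝 (Real.log (vecNorm v))) := by
      have h1 := (tendsto_const_nhds (x := vecNorm v)).sub (hlim.mul_const (vecNorm q))
      rw [zero_mul, sub_zero] at h1
      exact h1.log hvpos.ne'
    have hl2 : Tendsto (fun j => Real.log (vecNorm v + ‖t j‖ * vecNorm q)) atTop
        (𝓝 (Real.log (vecNorm v))) := by
      have h1 := (tendsto_const_nhds (x := vecNorm v)).add (hlim.mul_const (vecNorm q))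
      rw [zero_mul, add_zero] at h1
      exact h1.log hvpos.ne'
    refine tendsto_of_tendsto_of_tendsto_of_le_of_le hl1 hl2 (fun j => ?_) fun j => ?_
    · have h1 := integral_mono (integrable_const (Real.log (vecNorm v - ‖t j‖ * vecNorm q)))
        (hint j) fun θ => Real.log_le_log (hlow j) (hbd j θ).1
      simpa using h1
    · have h1 := integral_mono (hint j)
        (integrable_const (Real.log (vecNorm v + ‖t j‖ * vecNorm q)))
        fun θ => Real.log_le_log ((hlow j).trans_le (hbd j θ).1) (hbd j θ).2
      simpa using h1
  refine ⟨fun j => circleMeasure (hw j) u, fun j S => -Real.log (m j S / vecNorm v),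
    fun j => c j - Real.log (vecNorm v), ?_⟩
  have hneg : ∀ j S, -Real.log (m j S / vecNorm v) = Real.log (vecNorm v) - Real.log (m j S) := by
    intro j S
    rw [Real.log_div (hm j S).ne' hvpos.ne', neg_sub]
  have hdiv : ∀ j S, 0 < m j S / vecNorm v := fun j S => div_pos (hm j S) hvpos
  refine ⟨fun j => ?_, ?_, fun j S => ?_, fun S => ?_, fun S => ?_, fun φ hφ => ?_⟩
  · have hd := isDisc_circleMeasure hK hu hcirc (hw j)
    have hfun : (fun S : Berk K => -Real.log (m j S / vecNorm v) + (c j - Real.log (vecNorm v))) =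
        fun S => (∫ θ, Real.log (vecNorm (v + u θ • t j • q)) ∂circ) -
          Real.log (max (S.nv 1 (linForm v)) (S.nv 1 (linForm (t j • q)))) := by
      funext S
      rw [hneg, linForm_smul, Berk.nv_C_mul]
      ring
    rw [hfun]
    exact hd
  · have := hclim.sub_const (Real.log (vecNorm v))
    rwa [sub_self] at this
  · exact neg_nonneg.2 (Real.log_nonpos (hdiv j S).le ((div_le_one hvpos).2 (hmle j S)))
  · intro i j hij
    refine neg_le_neg (Real.log_le_log (hdiv j S) ?_)
    gcongr
    refine max_le_max le_rfl ?_
    exact mul_le_mul_of_nonneg_right (hanti hij) (S.nv_nonneg _ _)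
  · refine tendsto_ofReal_neg_log (kap_nonneg z S) (fun j => hdiv j S) ?_
    exact (tendsto_max_mul (S.nv_nonneg _ _) hlim).div_const _
  · have hpt := fun j => continuous_circle_pt (hw j) hu
    obtain ⟨M, hM⟩ := isCompact_univ.exists_bound_of_continuousOn hφ.continuousOn
    have hmap : ∀ j, ∫ S, φ S ∂(circleMeasure (hw j) u) =
        ∫ θ, φ (pt (v + u θ • t j • q) (add_smul_ne_zero (hw j) (u θ))) ∂circ := fun j =>
      integral_map (hpt j).measurable.aemeasurable hφ.measurable.aestronglyMeasurable
    simp_rw [hmap]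
    have hconst : φ (toBerk z) = ∫ _θ, φ (toBerk z) ∂circ := by simp
    rw [hconst]
    refine tendsto_integral_of_dominated_convergence (fun _ => M)
      (fun j => (hφ.comp (hpt j)).measurable.aestronglyMeasurable) (integrable_const M)
      (fun j => Eventually.of_forall fun θ => hM _ trivial) (Eventually.of_forall fun θ => ?_)
    refine (hφ.tendsto _).comp (tendsto_pt _ z.rep_nonzero ?_)
    have ht : Tendsto t atTop (𝓝 0) := tendsto_zero_iff_norm_tendsto_zero.2 hlim
    have := (tendsto_const_nhds (x := v)).add ((ht.smul_const q).const_smul (u θ))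
    simpa using this

theorem exists_isShrinking (z : P1 K) : ∃ D h e, IsShrinking z D h e := by
  by_cases hK : IsUltrametricDist K
  · exact exists_isShrinking_of_ultrametric hK z
  · exact exists_isShrinking_of_not_ultrametric hK z

end DiscSequences

section Averaging

variable {K : Type*} [NontriviallyNormedField K] [IsAlgClosed K]

theorem exists_kap_eq_one (hK : IsUltrametricDist K) {J : Type*} (A : Finset J) (S : J → Berk K) :
    ∃ a : P1 K, ∀ j ∈ A, kap a (S j) = 1 := by
  classical
  have hone : ‖(1 : K)‖ ≤ 1 := by simp
  have hx : ∀ j, ∃ x : P1 K, (∃ y, kap y (S j) < 1) → kap x (S j) < 1 := by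
    intro j
    by_cases h : ∃ y, kap y (S j) < 1
    · exact ⟨h.choose, fun _ => h.choose_spec⟩
    · exact ⟨Projectivization.mk K (fun _ => 1) fun h => one_ne_zero (congrFun h 0),
        fun h' => absurd h' h⟩
  choose x hx using hx
  obtain ⟨a, ha⟩ := exists_chordal_eq_max hK
    (Projectivization.mk K (fun _ => 1) fun h => one_ne_zero (congrFun h 0)) 1 hone (A.image x)
  refine ⟨a, fun j hj => ?_⟩
  have h1 := ha (x j) (Finset.mem_image_of_mem x hj)
  rw [norm_one, max_eq_right (chordal_le_one _ _)] at h1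
  refine le_antisymm (kap_le_one _ _) ?_
  by_contra! hlt
  have h2 := chordal_le_max_kap hK (x j) a (S j)
  rw [h1] at h2
  exact absurd h2 (not_le.2 (max_lt (hx j ⟨a, hlt⟩) hlt))

variable [CharZero K] [CompleteSpace K]

/-- There is a classical point whose potential is bounded at finitely many given measures. -/
theorem exists_lintegral_negLog_kap_le : ∃ B : ℝ, 0 ≤ B ∧ ∀ {J : Type*} (A : Finset J)
    (D : J → Measure (Berk K)), (∀ j, IsTame (D j)) →
      ∃ a : P1 K, ∀ j ∈ A, ∫⁻ S, negLog (kap a S) ∂(D j) ≤ ENNReal.ofReal (A.card * B) := by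
  by_cases hK : IsUltrametricDist K
  · refine ⟨0, le_rfl, fun A D hD => ?_⟩
    choose S hS using fun j => (hD j).2 hK
    obtain ⟨a, ha⟩ := exists_kap_eq_one hK A S
    refine ⟨a, fun j hj => ?_⟩
    rw [hS j, lintegral_dirac, ha j hj, negLog_of_pos one_pos]
    simp
  · obtain ⟨u, hu, hu1, hcirc⟩ := exists_circle hK
    have hw : wedge (![1, 0] : Fin 2 → K) ![0, 1] ≠ 0 := by simp [wedge]
    have hdisc := isDisc_circleMeasure hK hu hcirc hw
    have hpt := continuous_circle_pt hw hu
    set ψ := fun S : Berk K => (∫ θ, Real.log (vecNorm ((![1, 0] : Fin 2 → K) + u θ • ![0, 1])) ∂circ) -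
        Real.log (max (S.nv 1 (linForm ![1, 0])) (S.nv 1 (linForm ![0, 1]))) with hψ
    obtain ⟨M, hM⟩ := isCompact_univ.exists_bound_of_continuousOn hdisc.continuous.continuousOn
    refine ⟨max M 0, le_max_right _ _, fun A D hD => ?_⟩
    let a : ℝ → P1 K := fun θ => Projectivization.mk K ((![1, 0] : Fin 2 → K) + u θ • ![0, 1])
      (add_smul_ne_zero hw (u θ))
    have hswap : ∀ θ (w : P1 K), kap (a θ) (toBerk w) =
        kap w (pt ((![1, 0] : Fin 2 → K) + u θ • ![0, 1]) (add_smul_ne_zero hw (u θ))) := by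
      intro θ w
      rw [kap_toBerk, ← toBerk_mk, kap_toBerk, chordal_comm]
    have hbound : ∀ S : Berk K, ∫⁻ θ, negLog (kap (a θ) S) ∂circ ≤ ENNReal.ofReal (max M 0) := by
      intro S
      obtain ⟨w, rfl⟩ := toBerk_surjective_of_not_ultrametric hK S
      simp_rw [hswap]
      have hm : Measurable fun S : Berk K => negLog (kap w S) :=
        measurable_negLog.comp (measurable_kap w)
      rw [← lintegral_map (f := fun S : Berk K => negLog (kap w S)) hm hpt.measurable]
      obtain ⟨h1, h2, h3⟩ := logIntegrable_of_lintegral_negLog_ne_top (measurable_kap w)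
        (kap_le_one w) (hdisc.ne_top w)
      change ∫⁻ S, negLog (kap w S) ∂(circleMeasure hw u) ≤ _
      rw [lintegral_negLog_eq h1 (kap_le_one w) h2, hdisc.integral_eq, neg_neg]
      refine ENNReal.ofReal_le_ofReal ((le_abs_self _).trans ((hM (toBerk w) trivial).trans
        (le_max_left _ _)))
    have hjoint : Measurable fun x : ℝ × Berk K => negLog (kap (a x.1) x.2) := by
      refine measurable_negLog.comp ?_
      have hc : Continuous fun x : ℝ × Berk K => kap (a x.1) x.2 := by
        simp only [a, kap_mk]
        refine Continuous.div ?_ ?_ fun x => (vecNorm_pos (add_smul_ne_zero hw (u x.1))).ne'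
        · exact continuous_nv_linForm.comp (by fun_prop :
            Continuous fun x : ℝ × Berk K => ((![1, 0] : Fin 2 → K) + u x.1 • ![0, 1], x.2))
        · exact continuous_vecNorm.comp (by fun_prop)
      exact hc.measurable
    have hprob : ∀ j, IsProbabilityMeasure (D j) := fun j => (hD j).1
    have hmeas : ∀ j, Measurable fun θ => ∫⁻ S, negLog (kap (a θ) S) ∂(D j) := fun j =>
      hjoint.lintegral_prod_right'
    have htot : ∫⁻ θ, ∑ j ∈ A, ∫⁻ S, negLog (kap (a θ) S) ∂(D j) ∂circ ≤
        ENNReal.ofReal (A.card * max M 0) := by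
      rw [lintegral_finsetSum _ fun j _ => hmeas j]
      calc ∑ j ∈ A, ∫⁻ θ, ∫⁻ S, negLog (kap (a θ) S) ∂(D j) ∂circ
          ≤ ∑ j ∈ A, ENNReal.ofReal (max M 0) := by
            refine Finset.sum_le_sum fun j _ => ?_
            rw [lintegral_lintegral_swap hjoint.aemeasurable]
            refine (lintegral_mono hbound).trans ?_
            simp
        _ = ENNReal.ofReal (A.card * max M 0) := by
            rw [Finset.sum_const, nsmul_eq_mul, ENNReal.ofReal_mul (Nat.cast_nonneg _),
              ENNReal.ofReal_natCast]
    obtain ⟨θ, hθ⟩ := exists_le_lintegral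
      (Finset.measurable_sum A fun j _ => hmeas j).aemeasurable (μ := circ)
    refine ⟨a θ, fun j hj => ?_⟩
    refine (Finset.single_le_sum (f := fun j => ∫⁻ S, negLog (kap (a θ) S) ∂(D j))
      (fun _ _ => zero_le) hj).trans ?_
    exact le_trans (by simpa using hθ) htot

end Averaging

end BerkDyn

namespace BerkDyn

section Riesz

open scoped CompactlySupported

variable {X : Type*} [TopologicalSpace X] [CompactSpace X] [T2Space X] [MeasurableSpace X]
  [BorelSpace X]

/-- A net of normalized positive functionals on a compact space has a subnet that converges to a
regular probability measure. -/
theorem exists_measure_of_net {I : Type*} (l : Filter I) [l.NeBot] (L : I → (X → ℝ) → ℝ)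
    (hadd : ∀ i φ χ, L i (φ + χ) = L i φ + L i χ) (hsmul : ∀ i (c : ℝ) φ, L i (c • φ) = c * L i φ)
    (hpos : ∀ i φ, 0 ≤ φ → 0 ≤ L i φ) (hone : ∀ i, L i 1 = 1) :
    ∃ (U : Ultrafilter I) (ν : Measure X), ↑U ≤ l ∧ IsProbabilityMeasure ν ∧ ν.Regular ∧
      ∀ φ : X → ℝ, Continuous φ → Tendsto (fun i => L i φ) U (𝓝 (∫ x, φ x ∂ν)) := by
  let U := Ultrafilter.of l
  have hmono : ∀ i φ χ, φ ≤ χ → L i φ ≤ L i χ := by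
    intro i φ χ h
    have h1 := hadd i φ (χ - φ)
    rw [add_sub_cancel] at h1
    linarith [hpos i (χ - φ) (sub_nonneg.2 h)]
  have hbd : ∀ i φ (M : ℝ), (∀ x, |φ x| ≤ M) → L i φ ∈ Set.Icc (-M) M := by
    intro i φ M h
    constructor
    · have h1 := hmono i ((-M) • (1 : X → ℝ)) φ fun x => by
        simpa using (abs_le.1 (h x)).1
      rwa [hsmul, hone, mul_one] at h1
    · have h1 := hmono i φ (M • (1 : X → ℝ)) fun x => by
        simpa using (abs_le.1 (h x)).2
      rwa [hsmul, hone, mul_one] at h1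
  have hlim : ∀ φ : X → ℝ, Continuous φ → ∃ y, Tendsto (fun i => L i φ) U (𝓝 y) := by
    intro φ hφ
    obtain ⟨M, hM⟩ := isCompact_univ.exists_bound_of_continuousOn hφ.continuousOn
    have hmem : ∀ i, L i φ ∈ Set.Icc (-M) M := fun i => hbd i φ M fun x => hM x trivial
    obtain ⟨y, -, hy⟩ := (isCompact_Icc (a := -M) (b := M)).ultrafilter_le_nhds
      (U.map fun i => L i φ) (by
        rw [le_principal_iff]
        exact Filter.mem_map.2 (Filter.univ_mem' hmem))
    exact ⟨y, hy⟩
  choose! y hy using hlim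
  let Λ₀ : C_c(X, ℝ) →ₗ[ℝ] ℝ :=
    { toFun := fun φ => y φ
      map_add' := fun φ χ => by
        have h1 := (hy φ φ.continuous).add (hy χ χ.continuous)
        refine tendsto_nhds_unique (hy _ (φ + χ).continuous) (h1.congr fun i => ?_)
        exact (hadd i φ χ).symm
      map_smul' := fun c φ => by
        have h1 := (hy φ φ.continuous).const_mul c
        refine tendsto_nhds_unique (hy _ (c • φ).continuous) (h1.congr fun i => ?_)
        exact (hsmul i c φ).symm }
  let Λ : C_c(X, ℝ) →ₚ[ℝ] ℝ := PositiveLinearMap.mk₀ Λ₀ fun φ hφ =>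
    ge_of_tendsto' (hy φ φ.continuous) fun i => hpos i φ hφ
  have hint : ∀ φ : X → ℝ, Continuous φ → ∫ x, φ x ∂(RealRMK.rieszMeasure Λ) = y φ := by
    intro φ hφ
    exact RealRMK.integral_rieszMeasure Λ ⟨⟨φ, hφ⟩, HasCompactSupport.of_compactSpace φ⟩
  refine ⟨U, RealRMK.rieszMeasure Λ, Ultrafilter.of_le l, ⟨?_⟩, inferInstance, fun φ hφ => ?_⟩
  · have h1 := hint (1 : X → ℝ) continuous_const
    have h2 : y (1 : X → ℝ) = 1 := by
      refine tendsto_nhds_unique (hy _ continuous_const) ?_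
      simp only [hone]
      exact tendsto_const_nhds
    rw [h2] at h1
    simp only [Pi.one_apply, integral_const, smul_eq_mul, mul_one] at h1
    rw [← ENNReal.toReal_eq_one_iff]
    exact h1
  · rw [hint φ hφ]
    exact hy φ hφ

end Riesz

section Products

variable {K : Type*} [NontriviallyNormedField K]

theorem ae_forall_mem_multiset {X Y : Type*} [MeasurableSpace X] {μ : Measure X} (m : Multiset Y)
    {P : Y → X → Prop} (h : ∀ b ∈ m, ∀ᵐ x ∂μ, P b x) : ∀ᵐ x ∂μ, ∀ b ∈ m, P b x := by
  induction m using Multiset.induction_on with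
  | empty => simp
  | cons b m ih =>
    filter_upwards [h b (Multiset.mem_cons_self b m),
      ih fun c hc => h c (Multiset.mem_cons_of_mem hc)] with x h1 h2
    simpa [h1] using h2

theorem integral_multiset_sum {X Y : Type*} [MeasurableSpace X] {μ : Measure X} (m : Multiset Y)
    {φ : Y → X → ℝ} (h : ∀ b ∈ m, Integrable (φ b) μ) :
    Integrable (fun x => (m.map fun b => φ b x).sum) μ ∧
      ∫ x, (m.map fun b => φ b x).sum ∂μ = (m.map fun b => ∫ x, φ b x ∂μ).sum := by
  induction m using Multiset.induction_on with
  | empty => simp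
  | cons b m ih =>
    obtain ⟨h1, h2⟩ := ih fun c hc => h c (Multiset.mem_cons_of_mem hc)
    have h3 := h b (Multiset.mem_cons_self b m)
    simp only [Multiset.map_cons, Multiset.sum_cons]
    exact ⟨h3.add h1, by rw [integral_add h3 h1, h2]⟩

theorem log_of_mul_exp_eq {φ T : Berk K → ℝ} {A : ℝ} (hA : 0 < A) {m : Multiset (P1 K)}
    (h : ∀ S, φ S * Real.exp (T S) = A * (m.map fun b => kap b S).prod) {S : Berk K}
    (hS : ∀ b ∈ m, 0 < kap b S) :
    0 < φ S ∧ Real.log (φ S) =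
      Real.log A + (m.map fun b => Real.log (kap b S)).sum - T S := by
  have h1 := prod_kap_pos hS
  have h2 : 0 < φ S * Real.exp (T S) := by rw [h]; positivity
  have h3 : 0 < φ S := (mul_pos_iff_of_pos_right (Real.exp_pos _)).1 h2
  refine ⟨h3, ?_⟩
  have h4 := congrArg Real.log (h S)
  rw [Real.log_mul h3.ne' (Real.exp_pos _).ne', Real.log_exp, Real.log_mul hA.ne' h1.ne',
    log_prod_kap hS] at h4
  linarith

theorem integral_log_of_mul_exp_eq {μ : Measure (Berk K)} [IsProbabilityMeasure μ]
    (hμ : ∀ b : P1 K, ∫⁻ S, negLog (kap b S) ∂μ ≠ ⊤) {φ T : Berk K → ℝ} (hT : Continuous T) {A : ℝ}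
    (hA : 0 < A) {m : Multiset (P1 K)}
    (h : ∀ S, φ S * Real.exp (T S) = A * (m.map fun b => kap b S).prod) :
    LogIntegrable φ μ ∧ ∫ S, Real.log (φ S) ∂μ =
      Real.log A + (m.map fun b => ∫ S, Real.log (kap b S) ∂μ).sum - ∫ S, T S ∂μ := by
  have hb := fun b => logIntegrable_of_lintegral_negLog_ne_top (measurable_kap b) (kap_le_one b)
    (hμ b)
  have hae : ∀ᵐ S ∂μ, ∀ b ∈ m, 0 < kap b S := ae_forall_mem_multiset m fun b _ => (hb b).1
  obtain ⟨h1, h2⟩ := integral_multiset_sum (μ := μ) m fun b _ => (hb b).2.1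
  have hTi : Integrable T μ := by
    obtain ⟨M, hM⟩ := isCompact_univ.exists_bound_of_continuousOn hT.continuousOn
    exact Integrable.of_bound hT.measurable.aestronglyMeasurable M
      (Eventually.of_forall fun S => hM S trivial)
  have heq : (fun S => Real.log (φ S)) =ᵐ[μ]
      fun S => Real.log A + (m.map fun b => Real.log (kap b S)).sum - T S := by
    filter_upwards [hae] with S hS using (log_of_mul_exp_eq hA h hS).2
  have h3 : Integrable (fun S => Real.log A + (m.map fun b => Real.log (kap b S)).sum) μ :=
    (integrable_const _).add h1
  refine ⟨⟨?_, (integrable_congr heq).2 (h3.sub hTi)⟩, ?_⟩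
  · filter_upwards [hae] with S hS using (log_of_mul_exp_eq hA h hS).1
  · rw [integral_congr_ae heq, integral_sub h3 hTi, integral_add (integrable_const _) h1, h2,
      integral_const, probReal_univ, one_smul]

theorem integrable_of_continuous {μ : Measure (Berk K)} [IsProbabilityMeasure μ] {φ : Berk K → ℝ}
    (hφ : Continuous φ) : Integrable φ μ := by
  obtain ⟨M, hM⟩ := isCompact_univ.exists_bound_of_continuousOn hφ.continuousOn
  exact Integrable.of_bound hφ.measurable.aestronglyMeasurable M
    (Eventually.of_forall fun S => hM S trivial)

end Products

section Existence

variable {K : Type*} [NontriviallyNormedField K] [IsAlgClosed K]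

/-- The average of `φ` over the `k`-th preimages of `a`. -/
noncomputable def preimMean (f : RatFunc K) (k : ℕ) (a : P1 K) (φ : Berk K → ℝ) : ℝ :=
  ((deg f : ℝ) ^ k)⁻¹ * ((preimN f k a).map fun b => φ (toBerk b)).sum

theorem abs_preimMean_le (f : RatFunc K) (hf : 1 < deg f) (k : ℕ) (a : P1 K) {φ : Berk K → ℝ} {M : ℝ} (h : ∀ S, |φ S| ≤ M) :
    |preimMean f k a φ| ≤ M := by
  have hd : (0 : ℝ) < (deg f : ℝ) ^ k := by
    have : (0 : ℝ) < deg f := by exact_mod_cast (by omega : 0 < deg f)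
    positivity
  have h1 : |((preimN f k a).map fun b => φ (toBerk b)).sum| ≤ (deg f : ℝ) ^ k * M := by
    have h2 := card_preimN f (by omega) k a
    have h3 : ∀ m : Multiset (P1 K), |(m.map fun b => φ (toBerk b)).sum| ≤ m.card * M := by
      intro m
      induction m using Multiset.induction_on with
      | empty => simp
      | cons b m ih =>
        simp only [Multiset.map_cons, Multiset.sum_cons, Multiset.card_cons]
        push_cast
        refine (abs_add_le _ _).trans ?_
        linarith [h (toBerk b)]
    have h4 := h3 (preimN f k a)
    rw [h2] at h4
    exact_mod_cast h4
  rw [preimMean, abs_mul, abs_of_pos (inv_pos.2 hd), inv_mul_le_iff₀ hd]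
  exact h1

theorem preimMean_succ_comp (f : RatFunc K) (hf : 1 < deg f) (k : ℕ) (a : P1 K) (φ : Berk K → ℝ) :
    preimMean f (k + 1) a (fun S => φ (berkMap f S)) = preimMean f k a φ := by
  have hd : (deg f : ℝ) ≠ 0 := by
    have : deg f ≠ 0 := by omega
    exact_mod_cast this
  have h := map_preimN_succ f (by omega) k a fun b => φ (toBerk b)
  unfold preimMean
  simp only [berkMap_toBerk]
  rw [h, pow_succ]
  field_simp

theorem exists_preimMean_disc_eq (f : RatFunc K) (hf : 1 < deg f) (k : ℕ) (a : P1 K) :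
    ∃ c : ℝ, ∀ (D : Measure (Berk K)) (ψ : Berk K → ℝ), IsDisc D ψ → preimMean f k a ψ = ((deg f : ℝ) ^ k)⁻¹ *
      ((∫⁻ S, negLog (kap a S) ∂(D.map (berkMap f)^[k])).toReal - ∫ S, liftT f k S ∂D) + c := by
  obtain ⟨A, hA, h⟩ := exists_preimN_prod f (by omega) k a
  refine ⟨((deg f : ℝ) ^ k)⁻¹ * Real.log A, fun D ψ hD => ?_⟩
  have hprob := hD.tame.1
  simp only [liftNorm_eq_exp] at h
  obtain ⟨h1, h2⟩ := integral_log_of_mul_exp_eq hD.ne_top (continuous_liftT f k) hA h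
  have hit : Measurable ((berkMap f : Berk K → Berk K)^[k]) :=
    ((continuous_berkMap f).iterate k).measurable
  have h3 : ∫⁻ S, negLog (kap a S) ∂(D.map (berkMap f)^[k]) =
      ENNReal.ofReal (-∫ S, Real.log (kap a ((berkMap f)^[k] S)) ∂D) := by
    rw [lintegral_map (f := fun S : Berk K => negLog (kap a S))
      (measurable_negLog.comp (measurable_kap a)) hit]
    exact lintegral_negLog_eq h1.1 (fun S => kap_le_one _ _) h1.2
  have h4 : 0 ≤ -∫ S, Real.log (kap a ((berkMap f)^[k] S)) ∂D := by
    rw [← integral_neg]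
    exact integral_nonneg fun S => neg_nonneg.2
      (Real.log_nonpos (kap_nonneg _ _) (kap_le_one _ _))
  have h5 : ((preimN f k a).map fun b => ψ (toBerk b)).sum =
      -((preimN f k a).map fun b => ∫ S, Real.log (kap b S) ∂D).sum := by
    rw [← Multiset.sum_map_neg]
    congr 1
    refine Multiset.map_congr rfl fun b _ => ?_
    rw [hD.integral_eq, neg_neg]
  rw [h3, ENNReal.toReal_ofReal h4, h2, preimMean, h5]
  ring

theorem tendsto_mul_inv_pow {d : ℝ} (hd : 1 < d) (B M : ℝ) :
    Tendsto (fun N : ℕ => ((N : ℝ) ^ 2 * B + M) * (d ^ N)⁻¹) atTop (𝓝 0) := by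
  have h1 := tendsto_pow_const_div_const_pow_of_one_lt 2 hd
  have h2 := tendsto_pow_const_div_const_pow_of_one_lt 0 hd
  have := (h1.const_mul B).add (h2.const_mul M)
  simp only [mul_zero, add_zero] at this
  refine this.congr fun N => ?_
  rw [pow_zero]
  field_simp

variable [CharZero K] [CompleteSpace K]

theorem exists_limit_measure (f : RatFunc K) (hf : 1 < deg f) :
    ∃ (ν : Measure (Berk K)) (C : ℝ), IsProbRadon ν ∧
      (∀ D ψ, IsDisc D ψ → ∫ S, ψ S ∂ν = C - ∫ S, liftGreen f S ∂D) ∧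
      ∀ φ : Berk K → ℝ, Continuous φ → ∫ S, φ (berkMap f S) ∂ν = ∫ S, φ S ∂ν := by
  classical
  have hd1 : (1 : ℝ) < deg f := by exact_mod_cast hf
  have hd0 : (0 : ℝ) < deg f := by linarith
  let Δ := {δ : Measure (Berk K) × (Berk K → ℝ) // IsDisc δ.1 δ.2}
  let p : Finset Δ × ℕ → ℕ := fun i => i.2 + i.1.card
  obtain ⟨B, hB, hav⟩ := exists_lintegral_negLog_kap_le (K := K)
  have hav' : ∀ i : Finset Δ × ℕ, ∃ a : P1 K, ∀ δ ∈ i.1, ∀ j ∈ Finset.range (p i + 1),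
      ∫⁻ S, negLog (kap a S) ∂(δ.1.1.map (berkMap f)^[p i + 1 + j]) ≤
        ENNReal.ofReal ((i.1.card * (p i + 1) : ℕ) * B) := by
    intro i
    obtain ⟨a, ha⟩ := hav (i.1 ×ˢ Finset.range (p i + 1))
      (fun x => x.1.1.1.map (berkMap f)^[p i + 1 + x.2])
      fun x => x.1.2.tame.map ((continuous_berkMap f).iterate _)
    refine ⟨a, fun δ hδ j hj => ?_⟩
    have := ha (δ, j) (Finset.mk_mem_product hδ hj)
    rwa [Finset.card_product, Finset.card_range] at this
  choose a ha using hav'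
  choose c hc using fun k x => exists_preimMean_disc_eq f hf k x
  let L : Finset Δ × ℕ → (Berk K → ℝ) → ℝ := fun i φ =>
    ((p i + 1 : ℕ) : ℝ)⁻¹ * ∑ j ∈ Finset.range (p i + 1), preimMean f (p i + 1 + j) (a i) φ
  have hN : ∀ i, (0 : ℝ) < ((p i + 1 : ℕ) : ℝ) := fun i => by positivity
  obtain ⟨U, ν, hU, hprob, hreg, hlim⟩ := exists_measure_of_net (X := Berk K)
    (atTop : Filter (Finset Δ × ℕ)) L
    (fun i φ χ => by
      simp only [L, preimMean, Pi.add_apply, Multiset.sum_map_add, mul_add, Finset.sum_add_distrib])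
    (fun i t φ => by
      simp only [L, preimMean, Pi.smul_apply, smul_eq_mul, Multiset.sum_map_mul_left,
        Finset.mul_sum]
      exact Finset.sum_congr rfl fun j _ => by ring)
    (fun i φ hφ => by
      refine mul_nonneg (inv_nonneg.2 (hN i).le) (Finset.sum_nonneg fun j _ => ?_)
      refine mul_nonneg (by positivity) (Multiset.sum_nonneg fun x hx => ?_)
      obtain ⟨b, -, rfl⟩ := Multiset.mem_map.1 hx
      exact hφ _)
    (fun i => by
      have h1 : ∀ k, preimMean f k (a i) 1 = 1 := by
        intro k
        simp only [preimMean, Pi.one_apply, Multiset.map_const', Multiset.sum_replicate,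
          card_preimN f (by omega : 0 < deg f), nsmul_eq_mul, mul_one]
        push_cast
        exact inv_mul_cancel₀ (by positivity)
      simp only [L, h1, Finset.sum_const, Finset.card_range, nsmul_eq_mul, mul_one]
      exact inv_mul_cancel₀ (hN i).ne')
  have hp : Tendsto (fun i : Finset Δ × ℕ => p i + 1) U atTop := by
    refine tendsto_atTop.2 fun n => hU ?_
    filter_upwards [eventually_ge_atTop ((∅ : Finset Δ), n)] with i hi
    have : n ≤ i.2 := hi.2
    simp only [p]
    omega
  obtain ⟨M, hM0, hM⟩ := exists_abs_liftGreen_le f hf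
  let γ : Finset Δ × ℕ → ℝ := fun i => ((p i + 1 : ℕ) : ℝ)⁻¹ *
    ∑ j ∈ Finset.range (p i + 1), c (p i + 1 + j) (a i)
  have hdisc : ∀ D ψ, IsDisc D ψ →
      Tendsto (fun i => L i ψ - γ i) U (𝓝 (-∫ S, liftGreen f S ∂D)) := by
    intro D ψ hD
    have hDp := hD.tame.1
    have hgi : Integrable (liftGreen f) D := integrable_of_continuous (continuous_liftGreen f hf)
    rw [tendsto_iff_norm_sub_tendsto_zero]
    refine squeeze_zero' (Eventually.of_forall fun _ => norm_nonneg _) ?_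
      ((tendsto_mul_inv_pow hd1 B M).comp hp)
    refine hU ?_
    filter_upwards [eventually_ge_atTop (({⟨(D, ψ), hD⟩} : Finset Δ), 0)] with i hi
    have hmem : (⟨(D, ψ), hD⟩ : Δ) ∈ i.1 := hi.1 (Finset.mem_singleton_self _)
    have hterm : ∀ j ∈ Finset.range (p i + 1),
        |preimMean f (p i + 1 + j) (a i) ψ - c (p i + 1 + j) (a i) + ∫ S, liftGreen f S ∂D| ≤
          (((p i + 1 : ℕ) : ℝ) ^ 2 * B + M) * ((deg f : ℝ) ^ (p i + 1))⁻¹ := by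
      intro j hj
      set k := p i + 1 + j with hk
      have hdk : (0 : ℝ) < (deg f : ℝ) ^ k := by positivity
      have hTi : Integrable (liftT f k) D := integrable_of_continuous (continuous_liftT f k)
      have h1 := ha i ⟨(D, ψ), hD⟩ hmem j hj
      set E := (∫⁻ S, negLog (kap (a i) S) ∂(D.map (berkMap f)^[k])).toReal with hE
      have hE0 : 0 ≤ E := ENNReal.toReal_nonneg
      have hE1 : E ≤ ((p i + 1 : ℕ) : ℝ) ^ 2 * B := by
        refine (ENNReal.toReal_le_of_le_ofReal (by positivity) h1).trans ?_
        refine mul_le_mul_of_nonneg_right ?_ hB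
        rw [sq]
        push_cast
        have : (i.1.card : ℝ) ≤ (p i : ℝ) + 1 := by
          have : i.1.card ≤ p i + 1 := by
            simp only [p]
            omega
          exact_mod_cast this
        gcongr
      have h2 : preimMean f k (a i) ψ - c k (a i) + ∫ S, liftGreen f S ∂D =
          ((deg f : ℝ) ^ k)⁻¹ * (E + ∫ S, liftGreen f ((berkMap f)^[k] S) ∂D) := by
        have h3 : ∫ S, liftGreen f ((berkMap f)^[k] S) ∂D =
            (deg f : ℝ) ^ k * ∫ S, liftGreen f S ∂D - ∫ S, liftT f k S ∂D := by
          simp only [liftGreen_iterate f hf]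
          rw [integral_sub (hgi.const_mul _) hTi, integral_const_mul]
        rw [h3, hc k (a i) D ψ hD]
        field_simp
        ring
      have h4 : |∫ S, liftGreen f ((berkMap f)^[k] S) ∂D| ≤ M := by
        have := norm_integral_le_of_norm_le_const (μ := D)
          (f := fun S => liftGreen f ((berkMap f)^[k] S)) (C := M)
          (Eventually.of_forall fun S => hM _)
        simpa using this
      rw [h2, abs_mul, abs_of_pos (inv_pos.2 hdk), mul_comm]
      refine mul_le_mul ?_ ?_ (inv_nonneg.2 hdk.le) (by positivity)
      · refine (abs_add_le _ _).trans ?_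
        rw [abs_of_nonneg hE0]
        linarith
      · exact inv_anti₀ (by positivity) (pow_le_pow_right₀ hd1.le (by omega))
    have h5 : L i ψ - γ i - -∫ S, liftGreen f S ∂D = ((p i + 1 : ℕ) : ℝ)⁻¹ *
        ∑ j ∈ Finset.range (p i + 1), (preimMean f (p i + 1 + j) (a i) ψ -
          c (p i + 1 + j) (a i) + ∫ S, liftGreen f S ∂D) := by
      simp only [L, γ, Finset.sum_add_distrib, Finset.sum_sub_distrib, Finset.sum_const,
        Finset.card_range, nsmul_eq_mul]
      have := (hN i).ne'
      field_simp
      ring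
    rw [h5, norm_mul, Real.norm_of_nonneg (inv_nonneg.2 (hN i).le), inv_mul_le_iff₀ (hN i)]
    refine (norm_sum_le _ _).trans ((Finset.sum_le_card_nsmul _ _ _ hterm).trans ?_)
    rw [Finset.card_range, nsmul_eq_mul]
    rfl
  obtain ⟨D₀, h₀, e₀, hsh⟩ := exists_isShrinking
    (Projectivization.mk K (fun _ => 1) fun h => one_ne_zero (congrFun h 0) : P1 K)
  have hγ : ∃ C, Tendsto γ U (𝓝 C) := by
    have h1 := (hlim _ (hsh.isDisc 0).continuous).sub (hdisc _ _ (hsh.isDisc 0))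
    exact ⟨_, h1.congr fun i => by ring⟩
  obtain ⟨C, hC⟩ := hγ
  refine ⟨ν, C, ⟨hprob, hreg⟩, fun D ψ hD => ?_, fun φ hφ => ?_⟩
  · have h1 := (hdisc D ψ hD).add hC
    refine tendsto_nhds_unique (hlim ψ hD.continuous) ?_
    have h2 : -∫ S, liftGreen f S ∂D + C = C - ∫ S, liftGreen f S ∂D := by ring
    rw [← h2]
    exact h1.congr fun i => by ring
  · have h1 := hlim _ (hφ.comp (continuous_berkMap f))
    have h2 := hlim φ hφ
    obtain ⟨M', hM'⟩ := isCompact_univ.exists_bound_of_continuousOn hφ.continuousOn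
    have h3 : Tendsto (fun i => L i (φ ∘ berkMap f) - L i φ) U (𝓝 0) := by
      have h4 : Tendsto (fun N : ℕ => (2 * M') * (N : ℝ)⁻¹) atTop (𝓝 0) := by
        simpa using (tendsto_inv_atTop_nhds_zero_nat (𝕜 := ℝ)).const_mul (2 * M')
      refine squeeze_zero_norm (fun i => ?_) (h4.comp hp)
      have h5 : L i (φ ∘ berkMap f) - L i φ = ((p i + 1 : ℕ) : ℝ)⁻¹ *
          (preimMean f (p i) (a i) φ - preimMean f (p i + (p i + 1)) (a i) φ) := by
        have h6 : ∀ j, preimMean f (p i + 1 + j) (a i) (φ ∘ berkMap f) =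
            preimMean f (p i + j) (a i) φ := by
          intro j
          rw [add_right_comm]
          exact preimMean_succ_comp f hf (p i + j) (a i) φ
        have h7 := Finset.sum_range_sub' (fun j => preimMean f (p i + j) (a i) φ) (p i + 1)
        rw [add_zero] at h7
        simp only [L, h6]
        rw [← mul_sub, ← Finset.sum_sub_distrib, ← h7]
        congr 1
        refine Finset.sum_congr rfl fun j _ => ?_
        rw [show p i + 1 + j = p i + (j + 1) by ring]
      rw [h5, norm_mul, Real.norm_of_nonneg (inv_nonneg.2 (hN i).le), mul_comm]
      refine mul_le_mul_of_nonneg_right ?_ (inv_nonneg.2 (hN i).le)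
      refine (abs_sub _ _).trans ?_
      have hb := fun k => abs_preimMean_le f hf k (a i) fun S => hM' S trivial
      linarith [hb (p i), hb (p i + (p i + 1))]
    have h4 := tendsto_nhds_unique h3 (h1.sub h2)
    simp only [Function.comp] at h4
    linarith

/-- The equilibrium measure exists, and there is an invariant one. -/
theorem exists_hasWeightMeasure (f : RatFunc K) (hf : 1 < deg f) :
    ∃ ν : Measure (Berk K), HasWeightMeasure (liftGreen f) ν ∧
      ∀ φ : Berk K → ℝ, Continuous φ → ∫ S, φ (berkMap f S) ∂ν = ∫ S, φ S ∂ν := by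
  obtain ⟨ν, C, hν, hdisc, hinv⟩ := exists_limit_measure f hf
  have hprob := hν.isProbabilityMeasure
  have hpot : ∀ S : Berk K, 0 ≤ C - liftGreen f S ∧
      negPotential ν S = ENNReal.ofReal (C - liftGreen f S) := by
    intro S
    by_cases hS : ∃ z, S = toBerk z
    · obtain ⟨z, rfl⟩ := hS
      obtain ⟨D, h, e, hsh⟩ := exists_isShrinking z
      have hcont : ∀ j, Continuous (h j) := fun j => by
        have := (hsh.isDisc j).continuous.add (continuous_const (y := -e j))
        exact this.congr fun S => add_neg_cancel_right _ _
      have hint : ∀ j, ∫ S, h j S ∂ν = C - ∫ S, liftGreen f S ∂(D j) - e j := by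
        intro j
        have h1 := hdisc _ _ (hsh.isDisc j)
        rw [integral_add (integrable_of_continuous (hcont j)) (integrable_const _), integral_const,
          probReal_univ, one_smul] at h1
        linarith
      have hlim : Tendsto (fun j => ∫ S, h j S ∂ν) atTop (𝓝 (C - liftGreen f (toBerk z))) := by
        simp only [hint]
        have := ((tendsto_const_nhds (x := C)).sub
          (hsh.tendsto_integral _ (continuous_liftGreen f hf))).sub hsh.tendsto_const
        simpa using this
      refine ⟨ge_of_tendsto' hlim fun j => integral_nonneg (hsh.nonneg j), ?_⟩
      have h1 : Tendsto (fun j => ∫⁻ S, ENNReal.ofReal (h j S) ∂ν) atTop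
          (𝓝 (∫⁻ S, negLog (kap z S) ∂ν)) :=
        lintegral_tendsto_of_tendsto_of_monotone
          (fun j => (hcont j).measurable.ennreal_ofReal.aemeasurable)
          (Eventually.of_forall fun S i j hij => ENNReal.ofReal_le_ofReal (hsh.mono S hij))
          (Eventually.of_forall fun S => hsh.tendsto_negLog S)
      have h2 : ∀ j, ∫⁻ S, ENNReal.ofReal (h j S) ∂ν = ENNReal.ofReal (∫ S, h j S ∂ν) := fun j =>
        (ofReal_integral_eq_lintegral_ofReal (integrable_of_continuous (hcont j))
          (Eventually.of_forall (hsh.nonneg j))).symm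
      simp only [h2] at h1
      unfold negPotential
      simp only [hsia_toBerk]
      exact tendsto_nhds_unique h1 (ENNReal.tendsto_ofReal hlim)
    · have hK : IsUltrametricDist K := by
        by_contra hK
        obtain ⟨z, hz⟩ := toBerk_surjective_of_not_ultrametric hK S
        exact hS ⟨z, hz.symm⟩
      have hρ := (exists_eq_toBerk_or_pos hK S).resolve_left hS
      have hcont := continuous_hsia hK hρ
      obtain ⟨ρ, hρ0, hρS⟩ := hρ
      have hpos : ∀ T, 0 < hsia S T := fun T => hρ0.trans_le (le_hsia hK hρS)
      have hle : ∀ T, hsia S T ≤ 1 := fun T => by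
        refine (hsia_le_max hK (Projectivization.mk K (fun _ => 1)
          fun h => one_ne_zero (congrFun h 0) : P1 K) S T).trans
          (max_le (kap_le_one _ _) (kap_le_one _ _))
      have hclog : Continuous fun T => Real.log (hsia S T) := hcont.log fun T => (hpos T).ne'
      have hneg : Continuous fun T => -Real.log (hsia S T) := hclog.neg
      have h1 := hdisc _ _ (IsDisc.dirac hneg (fun b => hρ0.trans_le (hρS b)) fun b => by
        rw [hsia_comm_toBerk])
      rw [integral_dirac, integral_neg] at h1
      have h2 : negPotential ν S = ENNReal.ofReal (-∫ T, Real.log (hsia S T) ∂ν) :=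
        lintegral_negLog_eq (Eventually.of_forall hpos) hle (integrable_of_continuous hclog)
      rw [h1] at h2
      refine ⟨?_, h2⟩
      rw [← h1, ← integral_neg]
      exact integral_nonneg fun T => neg_nonneg.2 (Real.log_nonpos (hpos T).le (hle T))
  refine ⟨ν, ⟨continuous_liftGreen f hf, hν, fun S => ?_, C, fun S => ?_⟩, hinv⟩
  · rw [(hpot S).2]
    exact ENNReal.ofReal_ne_top
  · rw [(hpot S).2, ENNReal.toReal_ofReal (hpot S).1]
    ring

end Existence

end BerkDyn

namespace BerkDyn

section Lipschitz

variable {K : Type*} [NontriviallyNormedField K]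

theorem sum_log_max_bounds {m : Multiset (P1 K)} {S : Berk K} {r : ℝ} (hr : 0 < r) (hr1 : r ≤ 1) :
    (m.map fun b => Real.log (max (kap b S) r)).sum ≤ 0 ∧
      m.card * Real.log r ≤ (m.map fun b => Real.log (max (kap b S) r)).sum := by
  induction m using Multiset.induction_on with
  | empty => simp
  | cons b m ih =>
    have h1 : Real.log (max (kap b S) r) ≤ 0 :=
      Real.log_nonpos (hr.le.trans (le_max_right _ _)) (max_le (kap_le_one _ _) hr1)
    have h2 : Real.log r ≤ Real.log (max (kap b S) r) := Real.log_le_log hr (le_max_right _ _)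
    simp only [Multiset.map_cons, Multiset.sum_cons, Multiset.card_cons]
    push_cast
    constructor <;> linarith [ih.1, ih.2]

theorem chordal_map (f : RatFunc K) (z w : P1 K) : chordal (map f z) (map f w) =
    ‖wedge z.rep w.rep‖ * ‖bez f z.rep w.rep‖ /
      (vecNorm (ev f z.rep) * vecNorm (ev f w.rep)) := by
  have e1 := map_mk f z.rep z.rep_nonzero
  have e2 := map_mk f w.rep w.rep_nonzero
  rw [z.mk_rep] at e1
  rw [w.mk_rep] at e2
  rw [e1, e2, chordal_mk, wedge_ev, norm_mul]

variable [IsAlgClosed K]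

theorem exists_le_vecNorm_ev (f : RatFunc K) : ∃ c : ℝ, 0 < c ∧ ∀ z : P1 K,
    c * vecNorm z.rep ^ deg f ≤ vecNorm (ev f z.rep) := by
  obtain ⟨M, -, hM⟩ := exists_abs_liftT_le f 1
  refine ⟨Real.exp (-M), Real.exp_pos _, fun z => ?_⟩
  have h1 := liftNorm_toBerk f 1 z
  have hz := vecNorm_rep_pos z
  rw [pow_one, Function.iterate_one, liftNorm_eq_exp] at h1
  rw [← le_div_iff₀ (by positivity), ← h1]
  exact Real.exp_le_exp.2 (abs_le.1 (hM _)).1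

theorem exists_chordal_map_le (f : RatFunc K) (hf : 0 < deg f) : ∃ L : ℝ, 1 ≤ L ∧ ∀ z w : P1 K,
    chordal (map f z) (map f w) ≤ L * chordal z w := by
  obtain ⟨c, hc, hcz⟩ := exists_le_vecNorm_ev f
  obtain ⟨M, hM, hbez⟩ := exists_norm_bez_le f
  refine ⟨max 1 (M / c ^ 2), le_max_left _ _, fun z w => ?_⟩
  have hz := vecNorm_rep_pos z
  have hw := vecNorm_rep_pos w
  refine le_trans ?_ (mul_le_mul_of_nonneg_right (le_max_right 1 _) (chordal_nonneg z w))
  obtain ⟨e, he⟩ : ∃ e, deg f = e + 1 := ⟨deg f - 1, by omega⟩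
  have h1 := hcz z
  have h2 := hcz w
  have h3 := hbez z.rep w.rep
  rw [he] at h1 h2 h3
  rw [Nat.add_sub_cancel] at h3
  rw [chordal_map, chordal]
  calc ‖wedge z.rep w.rep‖ * ‖bez f z.rep w.rep‖ /
        (vecNorm (ev f z.rep) * vecNorm (ev f w.rep))
      ≤ ‖wedge z.rep w.rep‖ * (M * (vecNorm z.rep * vecNorm w.rep) ^ e) /
        ((c * vecNorm z.rep ^ (e + 1)) * (c * vecNorm w.rep ^ (e + 1))) := by
        gcongr
        exact vecNorm_nonneg _
    _ = _ := by
      rw [pow_succ, pow_succ, mul_pow]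
      field_simp

theorem map_iterate_of_mem_preimN (f : RatFunc K) (hf : 0 < deg f) {n : ℕ} {a b : P1 K}
    (hb : b ∈ preimN f n a) : (map f)^[n] b = a := by
  induction n generalizing b with
  | zero => simpa [preimN] using hb
  | succ n ih =>
    rw [preimN, Multiset.mem_bind] at hb
    obtain ⟨c, hc, hbc⟩ := hb
    rw [Function.iterate_succ_apply, map_of_mem_preim f hf hbc]
    exact ih hc

variable [CharZero K] [CompleteSpace K]

theorem kap_map_le (f : RatFunc K) {L : ℝ} (hL : ∀ z w : P1 K,
    chordal (map f z) (map f w) ≤ L * chordal z w) (b : P1 K) (S : Berk K) :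
    kap (map f b) (berkMap f S) ≤ L * kap b S := by
  refine (isClosed_le ((continuous_kap _).comp (continuous_berkMap f))
    (continuous_const.mul (continuous_kap b))).closure_subset_iff.2 ?_ (denseRange_toBerk S)
  rintro _ ⟨z, rfl⟩
  change kap (map f b) (berkMap f (toBerk z)) ≤ L * kap b (toBerk z)
  rw [berkMap_toBerk, kap_toBerk, kap_toBerk]
  exact hL b z

theorem kap_map_iterate_le (f : RatFunc K) {L : ℝ} (hL1 : 1 ≤ L) (hL : ∀ z w : P1 K,
    chordal (map f z) (map f w) ≤ L * chordal z w) (n : ℕ) (b : P1 K) (S : Berk K) :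
    kap ((map f)^[n] b) ((berkMap f)^[n] S) ≤ L ^ n * kap b S := by
  induction n with
  | zero => simp
  | succ n ih =>
    rw [Function.iterate_succ_apply', Function.iterate_succ_apply', pow_succ']
    refine (kap_map_le f hL _ _).trans ?_
    rw [mul_assoc]
    gcongr

end Lipschitz

section WeightMeasure

variable {K : Type*} [NontriviallyNormedField K] [IsAlgClosed K] [CharZero K] [CompleteSpace K]

theorem HasWeightMeasure.lintegral_ne_top {g : Berk K → ℝ} {μ : Measure (Berk K)}
    (h : HasWeightMeasure g μ) (b : P1 K) : ∫⁻ S, negLog (kap b S) ∂μ ≠ ⊤ := by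
  have := h.potential_ne_top (toBerk b)
  unfold negPotential at this
  simpa only [hsia_toBerk] using this

theorem HasWeightMeasure.integral_log_kap {g : Berk K → ℝ} {μ : Measure (Berk K)}
    (h : HasWeightMeasure g μ) {C : ℝ} (hC : ∀ S, g S = C - (negPotential μ S).toReal) (b : P1 K) :
    ∫ S, Real.log (kap b S) ∂μ = g (toBerk b) - C := by
  rw [(logIntegrable_of_lintegral_negLog_ne_top (measurable_kap b) (kap_le_one b)
    (h.lintegral_ne_top b)).2.2, hC]
  unfold negPotential
  simp only [hsia_toBerk]
  ring

theorem multiset_sum_sub_const {Y : Type*} (m : Multiset Y) (φ : Y → ℝ) (C : ℝ) :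
    (m.map fun b => φ b - C).sum = (m.map φ).sum - m.card * C := by
  rw [Multiset.sum_map_sub]
  simp

end WeightMeasure

section UniquenessNonarchimedean

variable {K : Type*} [NontriviallyNormedField K] [IsAlgClosed K] [CharZero K] [CompleteSpace K]

theorem integral_liftT_eq_of_ultrametric (hK : IsUltrametricDist K) (f : RatFunc K)
    (hf : 1 < deg f) {g : Berk K → ℝ} {μ ν : Measure (Berk K)} (hμ : HasWeightMeasure g μ)
    (hν : HasWeightMeasure g ν) {C C' : ℝ} (hC : ∀ S, g S = C - (negPotential μ S).toReal)
    (hC' : ∀ S, g S = C' - (negPotential ν S).toReal) (n : ℕ) :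
    ∫ S, liftT f n S ∂μ + deg f ^ n * C = ∫ S, liftT f n S ∂ν + deg f ^ n * C' := by
  have hpμ := hμ.isProbRadon.isProbabilityMeasure
  have hpν := hν.isProbRadon.isProbabilityMeasure
  obtain ⟨L, hL1, hL⟩ := exists_chordal_map_le f (by omega)
  have hLn : (0 : ℝ) < L ^ n := by positivity
  have hLn1 : (1 : ℝ) ≤ L ^ n := one_le_pow₀ hL1
  obtain ⟨t, ht0, ht⟩ := NormedField.exists_norm_lt K (inv_pos.2 hLn)
  have ht1 : ‖t‖ ≤ 1 := ht.le.trans (inv_le_one_of_one_le₀ hLn1)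
  obtain ⟨ζ, hζ⟩ := exists_disc_point hK
    (Projectivization.mk K (fun _ => 1) fun h => one_ne_zero (congrFun h 0) : P1 K) 1 (by simp)
  have hζ1 : ∀ w, kap w ζ = 1 := fun w => by
    rw [hζ, norm_one, max_eq_right (chordal_le_one _ _)]
  choose A hA hAS using exists_preimN_prod f (by omega : 0 < deg f) n
  simp only [liftNorm_eq_exp] at hAS
  obtain ⟨M, hM0, hM⟩ := exists_abs_liftT_le f n
  let Q : P1 K → Berk K → ℝ := fun a S => Real.log (A a) +
    ((preimN f n a).map fun b => Real.log (max (kap b S) ‖t‖)).sum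
  have hlogc : ∀ b : P1 K, Continuous fun S : Berk K => Real.log (max (kap b S) ‖t‖) := fun b =>
    ((continuous_kap b).max continuous_const).log fun S => (lt_max_of_lt_right ht0).ne'
  have hdisc : ∀ (b : P1 K), ∃ S₀ : Berk K, ∀ (μ : Measure (Berk K)), HasWeightMeasure g μ →
      ∀ C : ℝ, (∀ S, g S = C - (negPotential μ S).toReal) →
        ∫ S, Real.log (max (kap b S) ‖t‖) ∂μ = g S₀ - C := by
    intro b
    obtain ⟨S₀, hS₀⟩ := exists_disc_point hK b t ht1
    refine ⟨S₀, fun μ hμ C hC => ?_⟩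
    have hp := hμ.isProbRadon.isProbabilityMeasure
    have hpot : negPotential μ S₀ =
        ENNReal.ofReal (-∫ S, Real.log (max (kap b S) ‖t‖) ∂μ) := by
      unfold negPotential
      simp only [hsia_disc_point hK hS₀]
      exact lintegral_negLog_eq (Eventually.of_forall fun S => lt_max_of_lt_right ht0)
        (fun S => max_le (kap_le_one _ _) ht1) (integrable_of_continuous (hlogc b))
    rw [hC S₀, hpot, ENNReal.toReal_ofReal]
    · ring
    · rw [← integral_neg]
      exact integral_nonneg fun S => neg_nonneg.2 (Real.log_nonpos
        (ht0.le.trans (le_max_right _ _)) (max_le (kap_le_one _ _) ht1))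
  choose E hE using hdisc
  have hQint : ∀ (a : P1 K) (μ : Measure (Berk K)), HasWeightMeasure g μ →
      ∀ C : ℝ, (∀ S, g S = C - (negPotential μ S).toReal) → Integrable (Q a) μ ∧
        ∫ S, Q a S ∂μ = Real.log (A a) + ((preimN f n a).map fun b => g (E b)).sum -
          deg f ^ n * C := by
    intro a μ hμ C hC
    have hp := hμ.isProbRadon.isProbabilityMeasure
    obtain ⟨h1, h2⟩ := integral_multiset_sum (μ := μ) (preimN f n a) fun b _ =>
      integrable_of_continuous (hlogc b)
    refine ⟨(integrable_const _).add h1, ?_⟩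
    simp only [Q]
    rw [integral_add (integrable_const _) h1, h2, integral_const, probReal_univ, one_smul,
      Multiset.map_congr rfl fun b _ => hE b μ hμ C hC, multiset_sum_sub_const,
      card_preimN f (by omega)]
    push_cast
    ring
  have hseq : ∃ a : ℕ → P1 K, (∀ i, kap (a i) ((berkMap f)^[n] ζ) = 1) ∧
      ∀ i j, i < j → chordal (a i) (a j) = 1 := by
    refine exists_seq_of_forall_finset_exists
      (fun a : P1 K => kap a ((berkMap f)^[n] ζ) = 1) (fun a b => chordal a b = 1) fun s _ => ?_
    classical
    obtain ⟨y, hy⟩ := exists_kap_eq_one hK (insert ((berkMap f)^[n] ζ) (s.image toBerk)) id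
    refine ⟨y, hy _ (Finset.mem_insert_self _ _), fun x hx => ?_⟩
    have := hy (toBerk x) (Finset.mem_insert_of_mem (Finset.mem_image_of_mem _ hx))
    rwa [id, kap_toBerk, chordal_comm] at this
  obtain ⟨a, haζ, hadist⟩ := hseq
  have hAa : ∀ i, Real.log (A (a i)) = liftT f n ζ := by
    intro i
    have h1 := hAS (a i) ζ
    rw [haζ, one_mul] at h1
    have h2 : ((preimN f n (a i)).map fun w => kap w ζ).prod = 1 := by
      simp [hζ1]
    rw [h2, mul_one] at h1
    rw [← h1, Real.log_exp]
  have hQeq : ∀ i S, kap (a i) ((berkMap f)^[n] S) = 1 → liftT f n S - Q (a i) S = 0 := by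
    intro i S h1
    have hb : ∀ b ∈ preimN f n (a i), ‖t‖ < kap b S := by
      intro b hb
      have h2 := kap_map_iterate_le f hL1 hL n b S
      rw [map_iterate_of_mem_preimN f (by omega) hb, h1] at h2
      have h3 : (L ^ n)⁻¹ ≤ kap b S := by rwa [inv_le_iff_one_le_mul₀' hLn]
      exact ht.trans_le h3
    have h4 := (log_of_mul_exp_eq (hA (a i)) (hAS (a i)) fun b hbm => ht0.trans (hb b hbm)).2
    rw [h1, Real.log_one] at h4
    have h5 : ((preimN f n (a i)).map fun b => Real.log (max (kap b S) ‖t‖)).sum =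
        ((preimN f n (a i)).map fun b => Real.log (kap b S)).sum := by
      congr 1
      exact Multiset.map_congr rfl fun b hbm => by rw [max_eq_left (hb b hbm).le]
    simp only [Q, h5]
    linarith
  let R : ℝ := 2 * M - deg f ^ n * Real.log ‖t‖
  have hlogt : Real.log ‖t‖ ≤ 0 := Real.log_nonpos ht0.le ht1
  have hQbd : ∀ i S, |liftT f n S - Q (a i) S| ≤ R := by
    intro i S
    have h1 := sum_log_max_bounds (m := preimN f n (a i)) (S := S) ht0 ht1
    rw [card_preimN f (by omega)] at h1
    push_cast at h1
    have h2 := abs_le.1 (hM S)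
    have h3 := abs_le.1 (hM ζ)
    simp only [Q, R, hAa]
    have h4 : (0 : ℝ) ≤ -((deg f : ℝ) ^ n * Real.log ‖t‖) := by
      rw [← mul_neg]
      have : 0 ≤ -Real.log ‖t‖ := by linarith
      positivity
    rw [abs_le]
    constructor <;> linarith [h1.1, h1.2]
  have hsum : ∀ (m : ℕ) S, |∑ i ∈ Finset.range m, (liftT f n S - Q (a i) S)| ≤ R := by
    intro m S
    have hR : 0 ≤ R := (abs_nonneg _).trans (hQbd 0 S)
    by_cases hex : ∃ i ∈ Finset.range m, kap (a i) ((berkMap f)^[n] S) ≠ 1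
    · obtain ⟨i, hi, hne⟩ := hex
      rw [Finset.sum_eq_single_of_mem i hi]
      · exact hQbd i S
      · intro j _ hji
        apply hQeq
        by_contra hne'
        have hlt : ∀ k, kap (a k) ((berkMap f)^[n] S) ≠ 1 → kap (a k) ((berkMap f)^[n] S) < 1 :=
          fun k hk => lt_of_le_of_ne (kap_le_one _ _) hk
        have h1 := (chordal_le_max_kap hK (a i) (a j) ((berkMap f)^[n] S)).trans_lt
          (max_lt (hlt i hne) (hlt j hne'))
        rcases lt_or_gt_of_ne hji with hlt | hlt
        · rw [chordal_comm, hadist j i hlt] at h1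
          exact lt_irrefl _ h1
        · rw [hadist i j hlt] at h1
          exact lt_irrefl _ h1
    · push Not at hex
      rw [Finset.sum_eq_zero fun i hi => hQeq i S (hex i hi), abs_zero]
      exact hR
  have hTμ : Integrable (liftT f n) μ := integrable_of_continuous (continuous_liftT f n)
  have hTν : Integrable (liftT f n) ν := integrable_of_continuous (continuous_liftT f n)
  have hkey : ∀ m : ℕ, m * (∫ S, liftT f n S ∂μ + deg f ^ n * C -
      (∫ S, liftT f n S ∂ν + deg f ^ n * C')) =
      ∫ S, ∑ i ∈ Finset.range m, (liftT f n S - Q (a i) S) ∂μ -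
        ∫ S, ∑ i ∈ Finset.range m, (liftT f n S - Q (a i) S) ∂ν := by
    intro m
    have i1 : ∀ i, Integrable (fun S => liftT f n S - Q (a i) S) μ := fun i =>
      hTμ.sub (hQint (a i) μ hμ C hC).1
    have i2 : ∀ i, Integrable (fun S => liftT f n S - Q (a i) S) ν := fun i =>
      hTν.sub (hQint (a i) ν hν C' hC').1
    rw [integral_finsetSum _ fun i _ => i1 i, integral_finsetSum _ fun i _ => i2 i,
      ← Finset.sum_sub_distrib]
    have : ∀ i ∈ Finset.range m, (∫ S, liftT f n S - Q (a i) S ∂μ) -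
        (∫ S, liftT f n S - Q (a i) S ∂ν) = ∫ S, liftT f n S ∂μ + deg f ^ n * C -
          (∫ S, liftT f n S ∂ν + deg f ^ n * C') := by
      intro i _
      rw [integral_sub hTμ (hQint (a i) μ hμ C hC).1, integral_sub hTν (hQint (a i) ν hν C' hC').1,
        (hQint (a i) μ hμ C hC).2, (hQint (a i) ν hν C' hC').2]
      ring
    rw [Finset.sum_congr rfl this, Finset.sum_const, Finset.card_range, nsmul_eq_mul]
  set δ := ∫ S, liftT f n S ∂μ + deg f ^ n * C - (∫ S, liftT f n S ∂ν + deg f ^ n * C') with hδ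
  have hbd : ∀ m : ℕ, m * |δ| ≤ 2 * R := by
    intro m
    have h1 : ∀ (κ : Measure (Berk K)) [IsProbabilityMeasure κ],
        |∫ S, ∑ i ∈ Finset.range m, (liftT f n S - Q (a i) S) ∂κ| ≤ R := by
      intro κ _
      have := norm_integral_le_of_norm_le_const (μ := κ)
        (f := fun S => ∑ i ∈ Finset.range m, (liftT f n S - Q (a i) S)) (C := R)
        (Eventually.of_forall fun S => hsum m S)
      simpa using this
    have h2 := congrArg abs (hkey m)
    rw [abs_mul, Nat.abs_cast] at h2
    rw [h2]
    refine (abs_sub _ _).trans ?_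
    linarith [h1 μ, h1 ν]
  by_contra hne
  have hδ0 : 0 < |δ| := abs_pos.2 (sub_ne_zero.2 hne)
  obtain ⟨m, hm⟩ := exists_nat_gt (2 * R / |δ|)
  rw [div_lt_iff₀ hδ0] at hm
  exact absurd (hbd m) (not_le.2 hm)

end UniquenessNonarchimedean

end BerkDyn

namespace BerkDyn

section LogMax

theorem log_max_le {x q u : ℝ} (hx : 0 ≤ x) (hq : 0 ≤ q) (h : x + q = 1) (hu0 : 0 < u)
    (hu1 : u < 1) : 0 < max ((1 - u) * x) (u * q) ∧
      |Real.log (max ((1 - u) * x) (u * q))| ≤ Real.log 2 - Real.log u - Real.log (1 - u) := by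
  have hu1' : 0 < 1 - u := by linarith
  have hlow : u * (1 - u) / 2 ≤ max ((1 - u) * x) (u * q) := by
    rcases le_total (1 / 2) x with h2 | h2
    · refine le_max_of_le_left ?_
      nlinarith
    · refine le_max_of_le_right ?_
      nlinarith
  have hpos : 0 < u * (1 - u) / 2 := by positivity
  have hup : max ((1 - u) * x) (u * q) ≤ 1 := max_le (by nlinarith) (by nlinarith)
  refine ⟨hpos.trans_le hlow, ?_⟩
  rw [abs_of_nonpos (Real.log_nonpos (hpos.le.trans hlow) hup)]
  have h3 := Real.log_le_log hpos hlow
  rw [Real.log_div (by positivity) two_ne_zero, Real.log_mul hu0.ne' hu1'.ne'] at h3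
  linarith

theorem max_pow_two {a b : ℝ} (ha : 0 ≤ a) (hb : 0 ≤ b) : max a b ^ 2 = max (a ^ 2) (b ^ 2) := by
  rcases le_total a b with h | h
  · rw [max_eq_right h, max_eq_right (pow_le_pow_left₀ ha h 2)]
  · rw [max_eq_left h, max_eq_left (pow_le_pow_left₀ hb h 2)]

theorem integral_log_one_sub (a b : ℝ) :
    ∫ u in a..b, Real.log (1 - u) = ∫ u in (1 - b)..(1 - a), Real.log u :=
  intervalIntegral.integral_comp_sub_left Real.log 1

theorem integral_log_max {x q : ℝ} (hx : 0 ≤ x) (hq : 0 ≤ q) (h : x + q = 1) :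
    ∫ u in (0 : ℝ)..1, Real.log (max ((1 - u) * x) (u * q)) = -1 := by
  have hq' : q = 1 - x := by linarith
  have hi1 : IntervalIntegrable (fun u => Real.log (1 - u)) volume 0 x := by
    have := (intervalIntegral.intervalIntegrable_log' (a := 1 - 0) (b := 1 - x)).comp_sub_left 1
    simpa using this
  have hi2 : IntervalIntegrable Real.log volume x 1 := intervalIntegral.intervalIntegrable_log'
  have c1 : ∫ u in (0 : ℝ)..x, Real.log (max ((1 - u) * x) (u * q)) =
      ∫ u in (0 : ℝ)..x, (Real.log (1 - u) + Real.log x) := by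
    refine intervalIntegral.integral_congr_ae ?_
    have : ∀ᵐ u : ℝ, u ≠ 1 := by simp [ae_iff, measure_singleton]
    filter_upwards [this] with u hu1 hu
    rw [Set.uIoc_of_le hx] at hu
    have : u < 1 := lt_of_le_of_ne (by linarith [hu.2]) hu1
    rw [max_eq_left (by rw [hq']; nlinarith [hu.1, hu.2]),
      Real.log_mul (by linarith) (by linarith [hu.1, hu.2])]
  have c2 : ∫ u in x..1, Real.log (max ((1 - u) * x) (u * q)) =
      ∫ u in x..1, (Real.log u + Real.log q) := by
    refine intervalIntegral.integral_congr_ae ?_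
    refine Eventually.of_forall fun u hu => ?_
    rw [Set.uIoc_of_le (by linarith)] at hu
    rw [max_eq_right (by rw [hq']; nlinarith [hu.1, hu.2]),
      Real.log_mul (by linarith [hu.1]) (by linarith [hu.1, hu.2])]
  have d1 : IntervalIntegrable (fun u => Real.log (max ((1 - u) * x) (u * q))) volume 0 x := by
    refine (hi1.add (intervalIntegrable_const (c := Real.log x))).congr_ae ?_
    have : ∀ᵐ u : ℝ, u ≠ 1 := by simp [ae_iff, measure_singleton]
    refine (ae_restrict_iff' measurableSet_uIoc).2 ?_
    filter_upwards [this] with u hu1 hu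
    rw [Set.uIoc_of_le hx] at hu
    have : u < 1 := lt_of_le_of_ne (by linarith [hu.2]) hu1
    rw [max_eq_left (by rw [hq']; nlinarith [hu.1, hu.2]),
      Real.log_mul (by linarith) (by linarith [hu.1, hu.2])]
  have d2 : IntervalIntegrable (fun u => Real.log (max ((1 - u) * x) (u * q))) volume x 1 := by
    refine (hi2.add (intervalIntegrable_const (c := Real.log q))).congr_ae ?_
    refine (ae_restrict_iff' measurableSet_uIoc).2 (Eventually.of_forall fun u hu => ?_)
    rw [Set.uIoc_of_le (by linarith)] at hu
    beta_reduce
    rw [max_eq_right (by rw [hq']; nlinarith [hu.1, hu.2]),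
      Real.log_mul (by linarith [hu.1]) (by linarith [hu.1, hu.2])]
  rw [← intervalIntegral.integral_add_adjacent_intervals d1 d2, c1, c2,
    intervalIntegral.integral_add hi1 intervalIntegrable_const,
    intervalIntegral.integral_add hi2 intervalIntegrable_const, integral_log_one_sub,
    integral_log, integral_log, ← hq']
  simp
  rw [hq']
  ring_nf

theorem integrableOn_log_sub_log :
    IntegrableOn (fun u => Real.log 2 - Real.log u - Real.log (1 - u)) (Set.Ioc 0 1) := by
  rw [← intervalIntegrable_iff_integrableOn_Ioc_of_le zero_le_one]
  have h := (intervalIntegral.intervalIntegrable_log' (a := 1 - 0) (b := 1 - 1)).comp_sub_left 1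
  refine (intervalIntegrable_const.sub intervalIntegral.intervalIntegrable_log').sub ?_
  simpa using h

end LogMax

section UniquenessArchimedean

variable {K : Type*} [NontriviallyNormedField K] [IsAlgClosed K] [CharZero K] [CompleteSpace K]

theorem integral_log_max_nv_eq (hK : ¬ IsUltrametricDist K) {μ ν : Measure (Berk K)}
    [IsProbabilityMeasure μ] [IsProbabilityMeasure ν]
    (hμ : ∀ a : P1 K, ∫⁻ S, negLog (kap a S) ∂μ ≠ ⊤)
    (hν : ∀ a : P1 K, ∫⁻ S, negLog (kap a S) ∂ν ≠ ⊤) {δ : ℝ}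
    (h : ∀ a : P1 K, ∫ S, Real.log (kap a S) ∂μ = ∫ S, Real.log (kap a S) ∂ν + δ)
    {v v' : Fin 2 → K} (hw : wedge v v' ≠ 0) :
    ∫ S, Real.log (max (S.nv 1 (linForm v)) (S.nv 1 (linForm v'))) ∂μ =
      ∫ S, Real.log (max (S.nv 1 (linForm v)) (S.nv 1 (linForm v'))) ∂ν + δ := by
  obtain ⟨u, hu, hu1, hcirc⟩ := exists_circle hK
  have hdisc := isDisc_circleMeasure hK hu hcirc hw
  have hpt := continuous_circle_pt hw hu
  set c := ∫ θ, Real.log (vecNorm (v + u θ • v')) ∂circ with hc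
  set ψ : Berk K → ℝ := fun S =>
    c - Real.log (max (S.nv 1 (linForm v)) (S.nv 1 (linForm v'))) with hψ
  let a : ℝ → P1 K := fun θ => Projectivization.mk K (v + u θ • v') (add_smul_ne_zero hw (u θ))
  have hswap : ∀ θ (w : P1 K), kap (a θ) (toBerk w) =
      kap w (pt (v + u θ • v') (add_smul_ne_zero hw (u θ))) := by
    intro θ w
    rw [kap_toBerk, ← toBerk_mk, kap_toBerk, chordal_comm]
  have hψS : ∀ S : Berk K, 0 ≤ ψ S ∧ ∫⁻ θ, negLog (kap (a θ) S) ∂circ = ENNReal.ofReal (ψ S) := by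
    intro S
    obtain ⟨w, rfl⟩ := toBerk_surjective_of_not_ultrametric hK S
    simp_rw [hswap]
    have hm : Measurable fun S : Berk K => negLog (kap w S) :=
      measurable_negLog.comp (measurable_kap w)
    rw [← lintegral_map (f := fun S : Berk K => negLog (kap w S)) hm hpt.measurable]
    obtain ⟨h1, h2, h3⟩ := logIntegrable_of_lintegral_negLog_ne_top (measurable_kap w)
      (kap_le_one w) (hdisc.ne_top w)
    have h4 := hdisc.integral_eq w
    constructor
    · rw [h3] at h4
      rw [← neg_neg (ψ (toBerk w)), ← h4, neg_neg]
      exact ENNReal.toReal_nonneg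
    · change ∫⁻ S, negLog (kap w S) ∂(circleMeasure hw u) = _
      rw [lintegral_negLog_eq h1 (kap_le_one w) h2, h4, neg_neg]
  have hjoint : Measurable fun x : ℝ × Berk K => negLog (kap (a x.1) x.2) := by
    refine measurable_negLog.comp ?_
    have hc : Continuous fun x : ℝ × Berk K => kap (a x.1) x.2 := by
      simp only [a, kap_mk]
      refine Continuous.div ?_ ?_ fun x => (vecNorm_pos (add_smul_ne_zero hw (u x.1))).ne'
      · exact continuous_nv_linForm.comp (by fun_prop :
          Continuous fun x : ℝ × Berk K => (v + u x.1 • v', x.2))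
      · exact continuous_vecNorm.comp (by fun_prop)
    exact hc.measurable
  have key : ∀ (κ : Measure (Berk K)) [IsProbabilityMeasure κ],
      (∀ a : P1 K, ∫⁻ S, negLog (kap a S) ∂κ ≠ ⊤) →
      Integrable (fun θ => ∫ S, Real.log (kap (a θ) S) ∂κ) circ ∧
      ∫ θ, ∫ S, Real.log (kap (a θ) S) ∂κ ∂circ =
        ∫ S, Real.log (max (S.nv 1 (linForm v)) (S.nv 1 (linForm v'))) ∂κ - c := by
    intro κ _ hκ
    have e1 : ∀ θ, ∫ S, Real.log (kap (a θ) S) ∂κ =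
        -(∫⁻ S, negLog (kap (a θ) S) ∂κ).toReal := fun θ =>
      (logIntegrable_of_lintegral_negLog_ne_top (measurable_kap _) (kap_le_one _) (hκ (a θ))).2.2
    have hmeas : Measurable fun θ => ∫⁻ S, negLog (kap (a θ) S) ∂κ := hjoint.lintegral_prod_right'
    have hψi : Integrable ψ κ := integrable_of_continuous hdisc.continuous
    have e2 : ∫⁻ θ, ∫⁻ S, negLog (kap (a θ) S) ∂κ ∂circ = ENNReal.ofReal (∫ S, ψ S ∂κ) := by
      rw [lintegral_lintegral_swap hjoint.aemeasurable,
        ofReal_integral_eq_lintegral_ofReal hψi (Eventually.of_forall fun S => (hψS S).1)]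
      exact lintegral_congr fun S => (hψS S).2
    simp_rw [e1]
    have hne : ∫⁻ θ, ∫⁻ S, negLog (kap (a θ) S) ∂κ ∂circ ≠ ⊤ := by
      rw [e2]
      exact ENNReal.ofReal_ne_top
    refine ⟨(integrable_toReal_of_lintegral_ne_top hmeas.aemeasurable hne).neg, ?_⟩
    rw [integral_neg, integral_toReal hmeas.aemeasurable
      (Eventually.of_forall fun θ => (hκ (a θ)).lt_top), e2,
      ENNReal.toReal_ofReal (integral_nonneg fun S => (hψS S).1), hψ]
    have hl : Integrable (fun S : Berk K =>
        Real.log (max (S.nv 1 (linForm v)) (S.nv 1 (linForm v')))) κ := by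
      have := (integrable_const c).sub hψi
      refine this.congr (Eventually.of_forall fun S => ?_)
      simp [hψ]
    rw [integral_sub (integrable_const c) hl, integral_const, probReal_univ, one_smul, neg_sub]
  obtain ⟨k1, k2⟩ := key μ hμ
  obtain ⟨k3, k4⟩ := key ν hν
  simp_rw [h] at k2
  rw [integral_add k3 (integrable_const δ), k4] at k2
  simp only [integral_const, probReal_univ, one_smul] at k2
  linarith

theorem eq_zero_of_integral_log_kap_eq (hK : ¬ IsUltrametricDist K) {μ ν : Measure (Berk K)}
    [IsProbabilityMeasure μ] [IsProbabilityMeasure ν]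
    (hμ : ∀ a : P1 K, ∫⁻ S, negLog (kap a S) ∂μ ≠ ⊤)
    (hν : ∀ a : P1 K, ∫⁻ S, negLog (kap a S) ∂ν ≠ ⊤) {δ : ℝ}
    (h : ∀ a : P1 K, ∫ S, Real.log (kap a S) ∂μ = ∫ S, Real.log (kap a S) ∂ν + δ) : δ = 0 := by
  let X : Berk K → ℝ := fun S => S.nv 1 (linForm (![0, 1] : Fin 2 → K)) ^ 2
  let Y : Berk K → ℝ := fun S => S.nv 1 (linForm (![1, 0] : Fin 2 → K)) ^ 2
  have hXY : ∀ S, X S + Y S = 1 := by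
    intro S
    have h1 := pairNorm_nv_X S
    have e1 : linForm (![0, 1] : Fin 2 → K) = MvPolynomial.X 0 := by
      simp [linForm, wedge]
    have e2 : linForm (![1, 0] : Fin 2 → K) = MvPolynomial.C (-1) * MvPolynomial.X 1 := by
      simp [linForm, wedge]
    simp only [X, Y, e1, e2, Berk.nv_C_mul, norm_neg, norm_one, one_mul]
    rw [pairNorm, if_neg hK, Real.sqrt_eq_one] at h1
    exact h1
  have hXc : Continuous X := (Berk.continuous_nv (linForm_isHomogeneous _)).pow 2
  have hYc : Continuous Y := (Berk.continuous_nv (linForm_isHomogeneous _)).pow 2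
  let L : ℝ → Berk K → ℝ := fun u S => Real.log (max ((1 - u) * X S) (u * Y S))
  have hX0 : ∀ S, 0 ≤ X S := fun S => sq_nonneg _
  have hY0 : ∀ S, 0 ≤ Y S := fun S => sq_nonneg _
  have hL : ∀ u ∈ Set.Ioo (0 : ℝ) 1, ∫ S, L u S ∂μ = ∫ S, L u S ∂ν + 2 * δ := by
    intro u hu
    obtain ⟨t, ht⟩ := exists_norm_eq hK (Real.sqrt_pos.2 (show 0 < 1 - u by linarith [hu.2]))
    obtain ⟨s, hs⟩ := exists_norm_eq hK (Real.sqrt_pos.2 hu.1)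
    have ht0 : t ≠ 0 := norm_pos_iff.1 (by rw [ht]; exact Real.sqrt_pos.2 (by linarith [hu.2]))
    have hs0 : s ≠ 0 := norm_pos_iff.1 (by rw [hs]; exact Real.sqrt_pos.2 hu.1)
    have hw : wedge (t • ![0, 1] : Fin 2 → K) (s • ![1, 0]) ≠ 0 := by
      simp [wedge, ht0, hs0]
    have h1 := integral_log_max_nv_eq hK hμ hν h hw
    have h2 : ∀ S, L u S = 2 * Real.log (max (S.nv 1 (linForm (t • ![0, 1] : Fin 2 → K)))
        (S.nv 1 (linForm (s • ![1, 0] : Fin 2 → K)))) := by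
      intro S
      simp only [L, X, Y]
      rw [linForm_smul, linForm_smul, Berk.nv_C_mul, Berk.nv_C_mul, ht, hs]
      have e := Real.log_pow (n := 2) (max (√(1 - u) * S.nv 1 (linForm (![0, 1] : Fin 2 → K)))
        (√u * S.nv 1 (linForm (![1, 0] : Fin 2 → K))))
      push_cast at e
      rw [← e]
      have n1 := S.nv_nonneg 1 (linForm (![0, 1] : Fin 2 → K))
      have n2 := S.nv_nonneg 1 (linForm (![1, 0] : Fin 2 → K))
      congr 1
      rw [max_pow_two (by positivity) (by positivity), mul_pow, mul_pow, Real.sq_sqrt (by linarith [hu.2]), Real.sq_sqrt hu.1.le]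
    simp_rw [h2, integral_const_mul, h1]
    ring
  have hLm : Measurable fun x : ℝ × Berk K => L x.1 x.2 := by
    refine Real.measurable_log.comp (Continuous.measurable ?_)
    exact ((continuous_const.sub continuous_fst).mul (hXc.comp continuous_snd)).max
      (continuous_fst.mul (hYc.comp continuous_snd))
  set lam : Measure ℝ := volume.restrict (Set.Ioc 0 1) with hlam
  have hIoo : ∀ᵐ u ∂lam, u ∈ Set.Ioo (0 : ℝ) 1 := by
    have : ∀ᵐ u : ℝ, u ≠ 1 := by simp [ae_iff, measure_singleton]
    refine (ae_restrict_iff' measurableSet_Ioc).2 ?_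
    filter_upwards [this] with u hu1 hu
    exact ⟨hu.1, lt_of_le_of_ne hu.2 hu1⟩
  have hprod : ∀ (κ : Measure (Berk K)) [IsProbabilityMeasure κ],
      Integrable (Function.uncurry L) (lam.prod κ) := by
    intro κ _
    have hb : Integrable (fun u => Real.log 2 - Real.log u - Real.log (1 - u)) lam :=
      integrableOn_log_sub_log
    refine (hb.comp_fst κ).mono' hLm.aestronglyMeasurable ?_
    have : ∀ᵐ x ∂(lam.prod κ), x.1 ∈ Set.Ioo (0 : ℝ) 1 :=
      Measure.quasiMeasurePreserving_fst.ae hIoo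
    filter_upwards [this] with x hx
    exact (log_max_le (hX0 x.2) (hY0 x.2) (hXY x.2) hx.1 hx.2).2
  have hval : ∀ (κ : Measure (Berk K)) [IsProbabilityMeasure κ], ∫ u, ∫ S, L u S ∂κ ∂lam = -1 := by
    intro κ _
    rw [integral_integral_swap (hprod κ)]
    have : ∀ S, ∫ u, L u S ∂lam = -1 := by
      intro S
      have := integral_log_max (hX0 S) (hY0 S) (hXY S)
      rwa [intervalIntegral.integral_of_le zero_le_one] at this
    simp_rw [this]
    simp
  have h1 := hval μ
  have hi : Integrable (fun u => ∫ S, L u S ∂ν) lam := (hprod ν).integral_prod_left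
  rw [integral_congr_ae (hIoo.mono fun u hu => hL u hu),
    integral_add hi (integrable_const _), hval ν] at h1
  have h2 : ∫ _u, 2 * δ ∂lam = 2 * δ := by simp [hlam]
  rw [h2] at h1
  linarith

theorem integral_liftT_eq_of_not_ultrametric (hK : ¬ IsUltrametricDist K) (f : RatFunc K)
    (hf : 1 < deg f) {g : Berk K → ℝ} {μ ν : Measure (Berk K)} (hμ : HasWeightMeasure g μ)
    (hν : HasWeightMeasure g ν) {C C' : ℝ} (hC : ∀ S, g S = C - (negPotential μ S).toReal)
    (hC' : ∀ S, g S = C' - (negPotential ν S).toReal) (n : ℕ) :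
    ∫ S, liftT f n S ∂μ + deg f ^ n * C = ∫ S, liftT f n S ∂ν + deg f ^ n * C' := by
  have hpμ := hμ.isProbRadon.isProbabilityMeasure
  have hpν := hν.isProbRadon.isProbabilityMeasure
  choose A hA hAS using exists_preimN_prod f (by omega : 0 < deg f) n
  simp only [liftNorm_eq_exp] at hAS
  have hcont : Continuous (berkMap f)^[n] := (continuous_berkMap f).iterate n
  have key : ∀ (κ : Measure (Berk K)), HasWeightMeasure g κ → ∀ C : ℝ,
      (∀ S, g S = C - (negPotential κ S).toReal) → ∀ a : P1 K,
        ∫⁻ S, negLog (kap a S) ∂(κ.map (berkMap f)^[n]) ≠ ⊤ ∧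
        ∫ S, Real.log (kap a S) ∂(κ.map (berkMap f)^[n]) = Real.log (A a) +
          ((preimN f n a).map fun b => g (toBerk b)).sum -
            (∫ S, liftT f n S ∂κ + deg f ^ n * C) := by
    intro κ hκ C hC a
    have hp := hκ.isProbRadon.isProbabilityMeasure
    obtain ⟨h1, h2⟩ := integral_log_of_mul_exp_eq hκ.lintegral_ne_top (continuous_liftT f n)
      (hA a) (hAS a)
    constructor
    · rw [lintegral_map (f := fun S => negLog (kap a S))
        (measurable_negLog.comp (measurable_kap a)) hcont.measurable,
        lintegral_negLog_eq h1.1 (fun S => kap_le_one _ _) h1.2]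
      exact ENNReal.ofReal_ne_top
    · rw [integral_map (f := fun S => Real.log (kap a S)) hcont.measurable.aemeasurable
        (Real.measurable_log.comp (measurable_kap a)).aestronglyMeasurable, h2,
        Multiset.map_congr rfl fun b _ => hκ.integral_log_kap hC b, multiset_sum_sub_const,
        card_preimN f (by omega)]
      push_cast
      ring
  have hp1 : IsProbabilityMeasure (μ.map (berkMap f)^[n]) :=
    Measure.isProbabilityMeasure_map hcont.measurable.aemeasurable
  have hp2 : IsProbabilityMeasure (ν.map (berkMap f)^[n]) :=
    Measure.isProbabilityMeasure_map hcont.measurable.aemeasurable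
  have := eq_zero_of_integral_log_kap_eq hK (fun a => (key μ hμ C hC a).1)
    (fun a => (key ν hν C' hC' a).1) (δ := (∫ S, liftT f n S ∂ν + deg f ^ n * C') -
      (∫ S, liftT f n S ∂μ + deg f ^ n * C)) fun a => by
      rw [(key μ hμ C hC a).2, (key ν hν C' hC' a).2]
      ring
  linarith

end UniquenessArchimedean

end BerkDyn

namespace BerkDyn

section Energy

variable {K : Type*} [NontriviallyNormedField K]

theorem energy_add_const {g : Berk K → ℝ} (hg : Continuous g) {ν : Measure (Berk K)}
    (hν : IsProbRadon ν) (γ : ℝ) :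
    energy (fun S => g S + γ) ν = energy g ν + ((-(2 * γ) : ℝ) : EReal) := by
  have := hν.isProbabilityMeasure
  unfold energy
  rw [integral_add (integrable_of_continuous hg) (integrable_const γ), integral_const,
    probReal_univ, one_smul, sub_eq_add_neg, sub_eq_add_neg, add_assoc, ← EReal.coe_neg,
    ← EReal.coe_neg, ← EReal.coe_add]
  congr 2
  ring

theorem exists_equilibriumEnergy_eq {g : Berk K → ℝ} {μ : Measure (Berk K)}
    (h : HasWeightMeasure g μ) : ∃ v : ℝ, equilibriumEnergy g = v := by
  have hp := h.isProbRadon.isProbabilityMeasure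
  obtain ⟨M, hM⟩ := isCompact_univ.exists_bound_of_continuousOn h.continuous.continuousOn
  obtain ⟨C, hC⟩ := h.eq_potential
  have hup : equilibriumEnergy g ≤ ((2 * M : ℝ) : EReal) := by
    refine iSup_le fun ⟨ν, hν⟩ => ?_
    have := hν.isProbabilityMeasure
    have h1 : |∫ S, g S ∂ν| ≤ M := by
      have := norm_integral_le_of_norm_le_const (μ := ν) (f := g) (C := M)
        (Eventually.of_forall fun S => hM S trivial)
      simpa using this
    have h2 : -((∫⁻ S, negPotential ν S ∂ν : ℝ≥0∞) : EReal) ≤ 0 :=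
      EReal.neg_le_zero.2 (EReal.coe_ennreal_nonneg _)
    calc energy g ν ≤ 0 + ((-(2 * ∫ S, g S ∂ν) : ℝ) : EReal) := by
          unfold energy
          rw [sub_eq_add_neg, ← EReal.coe_neg]
          exact add_le_add_left h2 _
      _ ≤ _ := by
          rw [zero_add, EReal.coe_le_coe_iff]
          linarith [neg_abs_le (∫ S, g S ∂ν)]
  have hlow : equilibriumEnergy g ≠ ⊥ := by
    have h1 : energy g μ ≤ equilibriumEnergy g :=
      le_iSup (fun ν : {ν : Measure (Berk K) // IsProbRadon ν} => energy g ν.1) ⟨μ, h.isProbRadon⟩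
    have h2 : ∀ S, negPotential μ S ≤ ENNReal.ofReal (C + M) := by
      intro S
      rw [← ENNReal.ofReal_toReal (h.potential_ne_top S)]
      refine ENNReal.ofReal_le_ofReal ?_
      have := (abs_le.1 (hM S trivial)).1
      linarith [hC S]
    have h3 : ∫⁻ S, negPotential μ S ∂μ ≠ ⊤ := by
      refine ne_top_of_le_ne_top (ENNReal.ofReal_ne_top (r := C + M)) ((lintegral_mono h2).trans ?_)
      simp
    refine ne_bot_of_le_ne_bot ?_ h1
    unfold energy
    lift (∫⁻ S, negPotential μ S ∂μ) to NNReal using h3 with x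
    rw [EReal.coe_nnreal_eq_coe_real, ← EReal.coe_neg, ← EReal.coe_sub]
    exact EReal.coe_ne_bot _
  have htop : equilibriumEnergy g ≠ ⊤ := ne_top_of_le_ne_top (EReal.coe_ne_top _) hup
  exact ⟨_, (EReal.coe_toReal htop hlow).symm⟩

end Energy

section Green

variable {K : Type*} [NontriviallyNormedField K] [IsAlgClosed K] [CharZero K] [CompleteSpace K]

theorem hasWeightMeasure_eqMeasure (f : RatFunc K) (hf : 1 < deg f) :
    HasWeightMeasure (liftGreen f) (eqMeasure f) :=
  Classical.epsilon_spec ((exists_hasWeightMeasure f hf).imp fun _ h => h.1)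

theorem integral_liftT_eq (f : RatFunc K) (hf : 1 < deg f) {g : Berk K → ℝ}
    {μ ν : Measure (Berk K)} (hμ : HasWeightMeasure g μ) (hν : HasWeightMeasure g ν) (n : ℕ) :
    ∫ S, liftT f n S ∂μ = ∫ S, liftT f n S ∂ν := by
  obtain ⟨C, hC⟩ := hμ.eq_potential
  obtain ⟨C', hC'⟩ := hν.eq_potential
  have key : ∀ n, ∫ S, liftT f n S ∂μ + deg f ^ n * C = ∫ S, liftT f n S ∂ν + deg f ^ n * C' := by
    intro n
    by_cases hK : IsUltrametricDist K
    · exact integral_liftT_eq_of_ultrametric hK f hf hμ hν hC hC' n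
    · exact integral_liftT_eq_of_not_ultrametric hK f hf hμ hν hC hC' n
  have h0 := key 0
  simp only [liftT_zero, integral_zero, pow_zero, one_mul, zero_add] at h0
  have hn := key n
  rw [h0] at hn
  linarith

/-- The mean of `T_F` with respect to the equilibrium measure. -/
theorem integral_liftT_one_eqMeasure (f : RatFunc K) (hf : 1 < deg f) :
    ∫ S, liftT f 1 S ∂(eqMeasure f) = (deg f - 1) * ∫ S, liftGreen f S ∂(eqMeasure f) := by
  obtain ⟨ν, hν, hinv⟩ := exists_hasWeightMeasure f hf
  have hμ := hasWeightMeasure_eqMeasure f hf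
  set μ := eqMeasure f
  have hpμ := hμ.isProbRadon.isProbabilityMeasure
  have hpν := hν.isProbRadon.isProbabilityMeasure
  have hg := continuous_liftGreen f hf
  obtain ⟨M, -, hM⟩ := exists_abs_liftGreen_le f hf
  have hiter : ∀ (κ : Measure (Berk K)) [IsProbabilityMeasure κ] (n : ℕ),
      ∫ S, liftT f n S ∂κ = deg f ^ n * ∫ S, liftGreen f S ∂κ -
        ∫ S, liftGreen f ((berkMap f)^[n] S) ∂κ := by
    intro κ _ n
    have h1 : ∀ S, liftT f n S = deg f ^ n * liftGreen f S - liftGreen f ((berkMap f)^[n] S) := by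
      intro S
      rw [liftGreen_iterate f hf]
      ring
    simp_rw [h1]
    rw [integral_sub, integral_const_mul]
    · exact (integrable_of_continuous hg).const_mul _
    · exact integrable_of_continuous (hg.comp ((continuous_berkMap f).iterate n))
  have hbd : ∀ (κ : Measure (Berk K)) [IsProbabilityMeasure κ] (n : ℕ),
      |∫ S, liftGreen f ((berkMap f)^[n] S) ∂κ| ≤ M := by
    intro κ _ n
    have := norm_integral_le_of_norm_le_const (μ := κ)
      (f := fun S => liftGreen f ((berkMap f)^[n] S)) (C := M) (Eventually.of_forall fun S => hM _)
    simpa using this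
  have hgeq : ∫ S, liftGreen f S ∂μ = ∫ S, liftGreen f S ∂ν := by
    by_contra hne
    have hpos : 0 < |∫ S, liftGreen f S ∂μ - ∫ S, liftGreen f S ∂ν| := abs_pos.2 (sub_ne_zero.2 hne)
    obtain ⟨n, hn⟩ := pow_unbounded_of_one_lt
      (2 * M / |∫ S, liftGreen f S ∂μ - ∫ S, liftGreen f S ∂ν|)
      (show (1 : ℝ) < deg f by exact_mod_cast hf)
    rw [div_lt_iff₀ hpos] at hn
    have h1 := integral_liftT_eq f hf hμ hν n
    rw [hiter μ, hiter ν] at h1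
    have h2 : (deg f : ℝ) ^ n * (∫ S, liftGreen f S ∂μ - ∫ S, liftGreen f S ∂ν) =
        ∫ S, liftGreen f ((berkMap f)^[n] S) ∂μ - ∫ S, liftGreen f ((berkMap f)^[n] S) ∂ν := by
      linarith
    have h3 := congrArg abs h2
    rw [abs_mul, abs_of_nonneg (by positivity : (0 : ℝ) ≤ (deg f : ℝ) ^ n)] at h3
    have h4 := abs_sub (∫ S, liftGreen f ((berkMap f)^[n] S) ∂μ)
      (∫ S, liftGreen f ((berkMap f)^[n] S) ∂ν)
    linarith [hbd μ n, hbd ν n]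
  rw [integral_liftT_eq f hf hμ hν 1, hiter ν 1, hgeq, Function.iterate_one, hinv _ hg]
  ring

theorem exists_green_eq (f : RatFunc K) (hf : 1 < deg f) :
    ∃ γ : ℝ, ∀ S, green f S = liftGreen f S + γ := by
  have hμ := hasWeightMeasure_eqMeasure f hf
  obtain ⟨C, hC⟩ := hμ.eq_potential
  have hex : ∃ g : Berk K → ℝ, HasWeightMeasure g (eqMeasure f) ∧ equilibriumEnergy g = 0 := by
    obtain ⟨v, hv⟩ := exists_equilibriumEnergy_eq hμ
    have hen : ∀ ν : {ν : Measure (Berk K) // IsProbRadon ν},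
        energy (fun S => liftGreen f S + v / 2) ν.1 = energy (liftGreen f) ν.1 + ((-v : ℝ) : EReal) := by
      intro ν
      rw [energy_add_const hμ.continuous ν.2]
      congr 3
      ring
    refine ⟨fun S => liftGreen f S + v / 2, ⟨hμ.continuous.add continuous_const, hμ.isProbRadon,
      hμ.potential_ne_top, C + v / 2, fun S => ?_⟩, le_antisymm ?_ ?_⟩
    · rw [hC S]
      ring
    · refine iSup_le fun ν => ?_
      rw [hen]
      have h1 : energy (liftGreen f) ν.1 ≤ v := hv ▸ le_iSup
        (fun ν : {ν : Measure (Berk K) // IsProbRadon ν} => energy (liftGreen f) ν.1) ν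
      refine (add_le_add_left h1 _).trans ?_
      rw [← EReal.coe_add, add_neg_cancel, EReal.coe_zero]
    · set W := equilibriumEnergy fun S => liftGreen f S + v / 2 with hW
      have h1 : (v : EReal) ≤ W + (v : EReal) := by
        rw [← hv]
        refine iSup_le fun ν => ?_
        have h2 : energy (fun S => liftGreen f S + v / 2) ν.1 ≤ W := le_iSup
          (fun ν : {ν : Measure (Berk K) // IsProbRadon ν} =>
            energy (fun S => liftGreen f S + v / 2) ν.1) ν
        have h3 : energy (liftGreen f) ν.1 =
            energy (fun S => liftGreen f S + v / 2) ν.1 + (v : EReal) := by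
          rw [hen, add_assoc, ← EReal.coe_add, neg_add_cancel, EReal.coe_zero, add_zero]
        rw [h3, hv]
        exact add_le_add_left h2 _
      have h4 := add_le_add_left h1 ((-v : ℝ) : EReal)
      rwa [add_assoc, ← EReal.coe_add, add_neg_cancel, EReal.coe_zero, add_zero] at h4
  obtain ⟨C', hC'⟩ := (Classical.epsilon_spec hex).1.eq_potential
  refine ⟨C' - C, fun S => ?_⟩
  have h1 : green f S = C' - (negPotential (eqMeasure f) S).toReal := hC' S
  rw [h1, hC S]
  ring

end Green

end BerkDyn

namespace BerkDyn

section Returns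

variable {K : Type*} [NontriviallyNormedField K]

theorem chordal_iterate_le (f : RatFunc K) {L : ℝ} (hL1 : 1 ≤ L) (hL : ∀ z w : P1 K,
    chordal (map f z) (map f w) ≤ L * chordal z w) (n : ℕ) (z w : P1 K) :
    chordal ((map f)^[n] z) ((map f)^[n] w) ≤ L ^ n * chordal z w := by
  induction n with
  | zero => simp
  | succ n ih =>
    rw [Function.iterate_succ_apply', Function.iterate_succ_apply', pow_succ']
    refine (hL _ _).trans ?_
    rw [mul_assoc]
    gcongr

/-- If `h` is quadratically close to a constant near `c` and moves `c` by a very small amount,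
then the orbit of `c` stays in an annulus around `c`. -/
theorem chordal_iterate_mem_Icc {h : P1 K → P1 K} {c : P1 K} {D : ℝ} (hD0 : 0 ≤ D)
    (hD : ∀ z, chordal (h z) (h c) ≤ D * chordal z c ^ 2)
    (hsmall : D * chordal (h c) c ≤ 3 / 16) {k : ℕ} (hk : 1 ≤ k) :
    2 / 3 * chordal (h c) c ≤ chordal (h^[k] c) c ∧
      chordal (h^[k] c) c ≤ 4 / 3 * chordal (h c) c := by
  have hδ := chordal_nonneg (h c) c
  induction k, hk using Nat.le_induction with
  | base => rw [Function.iterate_one]; constructor <;> linarith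
  | succ k _ ih =>
    rw [Function.iterate_succ_apply']
    have h1 := hD (h^[k] c)
    have h2 : chordal (h^[k] c) c ^ 2 ≤ (4 / 3 * chordal (h c) c) ^ 2 :=
      pow_le_pow_left₀ (chordal_nonneg _ _) ih.2 2
    have h3 : D * chordal (h^[k] c) c ^ 2 ≤ 1 / 3 * chordal (h c) c := by
      calc D * chordal (h^[k] c) c ^ 2 ≤ D * (4 / 3 * chordal (h c) c) ^ 2 := by gcongr
        _ = 16 / 9 * (D * chordal (h c) c) * chordal (h c) c := by ring
        _ ≤ 16 / 9 * (3 / 16) * chordal (h c) c := by gcongr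
        _ = 1 / 3 * chordal (h c) c := by ring
    have h4 := chordal_triangle (h (h^[k] c)) (h c) c
    have h5 := chordal_triangle (h c) (h (h^[k] c)) c
    rw [chordal_comm (h c) (h (h^[k] c))] at h5
    constructor <;> linarith

variable [IsAlgClosed K]

theorem exists_chordal_map_le_sq (f : RatFunc K) (hf : 1 < deg f) {c : P1 K}
    (hc : MvPolynomial.eval c.rep (critForm f) = 0) : ∃ A : ℝ, 0 < A ∧ ∀ z : P1 K,
      chordal (map f z) (map f c) ≤ A * chordal z c ^ 2 := by
  obtain ⟨e, he⟩ : ∃ e, deg f = e + 2 := ⟨deg f - 2, by omega⟩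
  have hXC : (bez f MvPolynomial.X fun i => MvPolynomial.C (c.rep i)).IsHomogeneous (e + 1) := by
    have := bez_isHomogeneous f (fun i => MvPolynomial.isHomogeneous_X K i)
      (fun i => MvPolynomial.isHomogeneous_C (Fin 2) (c.rep i))
    simpa [he] using this
  have hev : ∀ p : Fin 2 → K, MvPolynomial.eval p
      (bez f MvPolynomial.X fun i => MvPolynomial.C (c.rep i)) = bez f p c.rep := by
    intro p
    have := map_bez f (MvPolynomial.aeval p : MvPolynomial (Fin 2) K →ₐ[K] K) MvPolynomial.X
      fun i => MvPolynomial.C (c.rep i)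
    simpa [MvPolynomial.aeval_eq_eval] using this
  obtain ⟨E, hE, hEeq⟩ := exists_eq_linForm_mul hXC c (by rw [hev, ← eval_critForm, hc])
  obtain ⟨M, hM⟩ := isCompact_univ.exists_bound_of_continuousOn
    (Berk.continuous_nv hE).continuousOn
  have hbd : ∀ z : P1 K, ‖MvPolynomial.eval z.rep E‖ ≤ (|M| + 1) * vecNorm z.rep ^ e := by
    intro z
    have h1 := (hM (toBerk z) trivial).trans ((le_abs_self M).trans (lt_add_one _).le)
    rw [nv_toBerk z hE, Real.norm_of_nonneg (by have := vecNorm_rep_pos z; positivity),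
      div_le_iff₀ (pow_pos (vecNorm_rep_pos z) _)] at h1
    exact h1
  obtain ⟨c₀, hc₀, hcz⟩ := exists_le_vecNorm_ev f
  have hcp := vecNorm_rep_pos c
  have hFc := vecNorm_pos (ev_ne_zero f c.rep_nonzero)
  refine ⟨(|M| + 1) * vecNorm c.rep ^ 2 / (c₀ * vecNorm (ev f c.rep)), by positivity, fun z => ?_⟩
  have hz := vecNorm_rep_pos z
  have h1 := hcz z
  rw [he] at h1
  have h2 : ‖bez f z.rep c.rep‖ ≤ ‖wedge z.rep c.rep‖ * ((|M| + 1) * vecNorm z.rep ^ e) := by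
    rw [← hev, hEeq, map_mul, eval_linForm, norm_mul]
    gcongr
    exact hbd z
  rw [chordal_map, chordal]
  calc ‖wedge z.rep c.rep‖ * ‖bez f z.rep c.rep‖ / (vecNorm (ev f z.rep) * vecNorm (ev f c.rep))
      ≤ ‖wedge z.rep c.rep‖ * (‖wedge z.rep c.rep‖ * ((|M| + 1) * vecNorm z.rep ^ e)) /
        (c₀ * vecNorm z.rep ^ (e + 2) * vecNorm (ev f c.rep)) := by gcongr
    _ = _ := by
      rw [pow_add]
      field_simp

theorem exists_chordal_iterate_le_sq (f : RatFunc K) (hf : 1 < deg f) {n i : ℕ} (hi : i < n)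
    {w : P1 K} (hw : MvPolynomial.eval ((map f)^[i] w).rep (critForm f) = 0) :
    ∃ B : ℝ, 0 ≤ B ∧ ∀ z : P1 K,
      chordal ((map f)^[n] z) ((map f)^[n] w) ≤ B * chordal z w ^ 2 := by
  obtain ⟨L, hL1, hL⟩ := exists_chordal_map_le f (by omega)
  obtain ⟨A, hA, hAz⟩ := exists_chordal_map_le_sq f hf hw
  obtain ⟨j, rfl⟩ : ∃ j, n = j + 1 + i := ⟨n - i - 1, by omega⟩
  refine ⟨L ^ j * (A * (L ^ i) ^ 2), by positivity, fun z => ?_⟩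
  have e : ∀ x, (map f)^[j + 1 + i] x = (map f)^[j] (map f ((map f)^[i] x)) := fun x => by
    rw [Function.iterate_add_apply, Function.iterate_succ_apply]
  rw [e, e]
  have hz := chordal_nonneg ((map f)^[i] z) ((map f)^[i] w)
  calc _ ≤ L ^ j * chordal (map f ((map f)^[i] z)) (map f ((map f)^[i] w)) :=
        chordal_iterate_le f hL1 hL j _ _
    _ ≤ L ^ j * (A * chordal ((map f)^[i] z) ((map f)^[i] w) ^ 2) := by gcongr; exact hAz _
    _ ≤ L ^ j * (A * (L ^ i * chordal z w) ^ 2) := by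
        gcongr
        exact chordal_iterate_le f hL1 hL i _ _
    _ = _ := by ring

/-- A critical point returns to itself at most exponentially fast, unless it is periodic. -/
theorem exists_neg_log_chordal_iterate_le (f : RatFunc K) (hf : 1 < deg f) {c : P1 K}
    (hc : MvPolynomial.eval c.rep (critForm f) = 0) : ∃ B : ℝ, 0 ≤ B ∧ ∀ n : ℕ, 1 ≤ n →
      (map f)^[n] c ≠ c → -Real.log (chordal ((map f)^[n] c) c) ≤ B * n := by
  obtain ⟨L, hL1, hL⟩ := exists_chordal_map_le f (by omega)
  obtain ⟨A, hA, hAz⟩ := exists_chordal_map_le_sq f hf hc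
  have hD : ∀ n, ∀ z, chordal ((map f)^[n + 1] z) ((map f)^[n + 1] c) ≤
      L ^ n * A * chordal z c ^ 2 := by
    intro n z
    rw [Function.iterate_succ_apply, Function.iterate_succ_apply, mul_assoc]
    exact (chordal_iterate_le f hL1 hL n _ _).trans (by gcongr; exact hAz z)
  have hpos : ∀ n, (map f)^[n] c ≠ c → 0 < chordal ((map f)^[n] c) c := fun n hn =>
    lt_of_le_of_ne (chordal_nonneg _ _) fun h => hn ((chordal_eq_zero_iff _ _).1 h.symm)
  have hlarge : ∀ n, (map f)^[n + 1] c ≠ c →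
      3 / 16 < L ^ n * A * chordal ((map f)^[n + 1] c) c →
      -Real.log (chordal ((map f)^[n + 1] c) c) ≤
        (Real.log L + |Real.log A - Real.log (3 / 16)|) * ((n + 1 : ℕ) : ℝ) := by
    intro n hn hlt
    have h1 := Real.log_le_log (by norm_num) hlt.le
    rw [Real.log_mul (by positivity) (hpos _ hn).ne', Real.log_mul (by positivity) hA.ne',
      Real.log_pow] at h1
    have h2 := Real.log_nonneg hL1
    have h3 := le_abs_self (Real.log A - Real.log (3 / 16))
    have h4 := abs_nonneg (Real.log A - Real.log (3 / 16))
    have h5 : (0 : ℝ) ≤ n := Nat.cast_nonneg n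
    push_cast
    nlinarith [mul_nonneg h5 h4, mul_nonneg h5 h2]
  have hB0 : 0 ≤ Real.log L + |Real.log A - Real.log (3 / 16)| :=
    add_nonneg (Real.log_nonneg hL1) (abs_nonneg _)
  by_cases hex : ∃ n, (map f)^[n + 1] c ≠ c ∧ L ^ n * A * chordal ((map f)^[n + 1] c) c ≤ 3 / 16
  · obtain ⟨n₀, hn₀, hs₀⟩ := hex
    refine ⟨max (Real.log L + |Real.log A - Real.log (3 / 16)|)
      |Real.log (chordal ((map f)^[n₀ + 1] c) c / 2)|, le_max_of_le_left hB0, fun n hn hne => ?_⟩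
    obtain ⟨n, rfl⟩ : ∃ k, n = k + 1 := ⟨n - 1, by omega⟩
    have hn1 : (1 : ℝ) ≤ ((n + 1 : ℕ) : ℝ) := by exact_mod_cast hn
    by_cases hs : L ^ n * A * chordal ((map f)^[n + 1] c) c ≤ 3 / 16
    · have h1 := (chordal_iterate_mem_Icc (h := (map f)^[n + 1]) (by positivity) (hD n) hs
        (Nat.succ_pos n₀)).2
      have h2 := (chordal_iterate_mem_Icc (h := (map f)^[n₀ + 1]) (by positivity) (hD n₀) hs₀
        (Nat.succ_pos n)).1
      rw [← Function.iterate_mul] at h1 h2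
      rw [Nat.mul_comm] at h2
      have h3 : chordal ((map f)^[n₀ + 1] c) c / 2 ≤ chordal ((map f)^[n + 1] c) c := by
        linarith
      have h4 := Real.log_le_log (half_pos (hpos _ hn₀)) h3
      have h5 := neg_le_abs (Real.log (chordal ((map f)^[n₀ + 1] c) c / 2))
      have h6 : |Real.log (chordal ((map f)^[n₀ + 1] c) c / 2)| ≤
          |Real.log (chordal ((map f)^[n₀ + 1] c) c / 2)| * ((n + 1 : ℕ) : ℝ) :=
        le_mul_of_one_le_right (abs_nonneg _) hn1
      calc _ ≤ |Real.log (chordal ((map f)^[n₀ + 1] c) c / 2)| * ((n + 1 : ℕ) : ℝ) := by linarith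
        _ ≤ _ := by gcongr; exact le_max_right _ _
    · refine (hlarge n hne (not_le.1 hs)).trans ?_
      gcongr
      exact le_max_left _ _
  · push Not at hex
    refine ⟨_, hB0, fun n hn hne => ?_⟩
    obtain ⟨n, rfl⟩ : ∃ k, n = k + 1 := ⟨n - 1, by omega⟩
    exact hlarge n hne (hex n hne)

end Returns

section SuperattractingPoints

variable {K : Type*} [NontriviallyNormedField K]

theorem mem_satSet_iff (f : RatFunc K) {n : ℕ} (hn : 1 ≤ n) {w : P1 K} (hw : (map f)^[n] w = w) :
    w ∈ satSet f ↔ ∃ i < n, MvPolynomial.eval ((map f)^[i] w).rep (critForm f) = 0 := by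
  constructor
  · intro h
    simp only [satSet, Set.mem_iUnion] at h
    obtain ⟨k, hk, -, hcrit⟩ := h
    obtain ⟨i, -, hi⟩ := (mem_critSet_iff f k w).1 hcrit
    refine ⟨i % n, Nat.mod_lt _ hn, ?_⟩
    rwa [Function.IsPeriodicPt.iterate_mod_apply hw]
  · intro h
    simp only [satSet, Set.mem_iUnion]
    exact ⟨n, hn, hw, (mem_critSet_iff f n w).2 h⟩

theorem map_mem_satSet_iff (f : RatFunc K) {n : ℕ} (hn : 1 ≤ n) {w : P1 K}
    (hw : (map f)^[n] w = w) : map f w ∈ satSet f ↔ w ∈ satSet f := by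
  have hw' : (map f)^[n] (map f w) = map f w := by
    rw [← Function.iterate_succ_apply, Function.iterate_succ_apply', hw]
  rw [mem_satSet_iff f hn hw, mem_satSet_iff f hn hw']
  constructor
  · rintro ⟨i, -, hi⟩
    refine ⟨(i + 1) % n, Nat.mod_lt _ hn, ?_⟩
    rwa [Function.IsPeriodicPt.iterate_mod_apply hw]
  · rintro ⟨i, -, hi⟩
    refine ⟨(i + (n - 1)) % n, Nat.mod_lt _ hn, ?_⟩
    rwa [Function.IsPeriodicPt.iterate_mod_apply hw', ← Function.iterate_succ_apply,
      show (i + (n - 1)).succ = i + n by omega, Function.iterate_add_apply, hw]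

theorem finite_satSet (f : RatFunc K) {m : Multiset (P1 K)}
    (hm : ∀ z : P1 K, MvPolynomial.eval z.rep (critForm f) = 0 → z ∈ m) : (satSet f).Finite := by
  classical
  refine (m.toFinset.biUnion fun c => (Finset.range (Function.minimalPeriod (map f) c)).image
    fun j => (map f)^[j] c).finite_toSet.subset fun w hw => ?_
  simp only [satSet, Set.mem_iUnion] at hw
  obtain ⟨k, hk, hfix, hcrit⟩ := hw
  obtain ⟨i, hik, hi⟩ := (mem_critSet_iff f k w).1 hcrit
  have hfix' : (map f)^[k] w = w := hfix
  have hper : Function.IsPeriodicPt (map f) k ((map f)^[i] w) :=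
    Function.IsPeriodicPt.apply_iterate hfix' i
  simp only [Finset.coe_biUnion, Set.mem_iUnion, Finset.mem_coe, Finset.mem_image]
  refine ⟨(map f)^[i] w, Multiset.mem_toFinset.2 (hm _ hi),
    (k - i) % Function.minimalPeriod (map f) ((map f)^[i] w),
    Finset.mem_range.2 (Nat.mod_lt _ (hper.minimalPeriod_pos hk)), ?_⟩
  rw [Function.iterate_mod_minimalPeriod_eq, ← Function.iterate_add_apply,
    Nat.sub_add_cancel hik.le, hfix']

end SuperattractingPoints

end BerkDyn

namespace BerkDyn

section Multiplicity

variable {K : Type*} [NontriviallyNormedField K]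

open Classical in
theorem exists_eq_linForm_pow_mul {c : K} (hc : c ≠ 0) (m : Multiset (P1 K)) (w : P1 K) :
    ∃ (H : MvPolynomial (Fin 2) K) (D : ℕ), H.IsHomogeneous D ∧
      MvPolynomial.C c * formOf m = linForm w.rep ^ m.count w * H ∧
      MvPolynomial.eval w.rep H ≠ 0 := by
  have hm : formOf m = linForm w.rep ^ m.count w * formOf (m.filter fun x => ¬ w = x) := by
    conv_lhs => rw [← Multiset.filter_add_not (fun x => w = x) m, formOf_add]
    rw [Multiset.filter_eq m w]
    simp [formOf]
  refine ⟨MvPolynomial.C c * formOf (m.filter fun x => ¬ w = x), _,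
    (MvPolynomial.isHomogeneous_C _ c).mul (formOf_isHomogeneous _), by rw [hm]; ring, ?_⟩
  rw [map_mul, MvPolynomial.eval_C, mul_ne_zero_iff, Ne, Ne, eval_formOf_eq_zero_iff]
  exact ⟨hc, by simp⟩

theorem eq_of_linForm_pow_mul_eq {w : P1 K} {k l : ℕ} {U V : MvPolynomial (Fin 2) K}
    (hU : MvPolynomial.eval w.rep U ≠ 0) (hV : MvPolynomial.eval w.rep V ≠ 0)
    (h : linForm w.rep ^ k * U = linForm w.rep ^ l * V) : k = l := by
  have key : ∀ {k l : ℕ} {U V : MvPolynomial (Fin 2) K}, MvPolynomial.eval w.rep U ≠ 0 →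
      linForm w.rep ^ k * U = linForm w.rep ^ l * V → l ≤ k := by
    intro k l U V hU h
    by_contra! hlt
    obtain ⟨j, rfl⟩ : ∃ j, l = k + (j + 1) := ⟨l - k - 1, by omega⟩
    rw [pow_add, mul_assoc] at h
    have h1 := mul_left_cancel₀ (pow_ne_zero k (linForm_ne_zero w.rep_nonzero)) h
    apply hU
    rw [h1, map_mul, map_pow, eval_linForm, wedge_self, zero_pow (by omega), zero_mul]
  exact le_antisymm (key hV h.symm) (key hU h)

theorem eval_bez_X_C (f : RatFunc K) (p q : Fin 2 → K) :
    MvPolynomial.eval p (bez f MvPolynomial.X fun i => MvPolynomial.C (q i)) = bez f p q := by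
  have := map_bez f (MvPolynomial.aeval p : MvPolynomial (Fin 2) K →ₐ[K] K) MvPolynomial.X
    fun i => MvPolynomial.C (q i)
  simpa [MvPolynomial.aeval_eq_eval] using this

theorem aeval_lift_fixForm (f : RatFunc K) (n : ℕ) :
    MvPolynomial.aeval (lift f) (fixForm f n) =
      fixForm f n * bez f (liftIter f n) MvPolynomial.X := by
  have h1 : lift f = ev f (MvPolynomial.X : Fin 2 → MvPolynomial (Fin 2) K) := by
    funext i
    simp [ev]
  have h2 : (fun i => MvPolynomial.aeval (lift f) (liftIter f n i)) = ev f (liftIter f n) := by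
    rw [aeval_liftIter, liftIter_eq, h1]
    exact (Function.Commute.iterate_self (ev f) n) MvPolynomial.X
  unfold fixForm
  rw [← wedge_ev, ← h2, ← h1]
  simp [wedge]

theorem ev_C (f : RatFunc K) (p : Fin 2 → K) :
    ev f (fun i => (MvPolynomial.C (p i) : MvPolynomial (Fin 2) K)) =
      fun i => MvPolynomial.C (ev f p i) :=
  (map_ev f (Algebra.ofId K (MvPolynomial (Fin 2) K)) p).symm

open Classical in
/-- The multiplicity of a fixed point of `f^n` is constant along its orbit, if the orbit has no
critical point. -/
theorem count_map_of_fixed (f : RatFunc K) {n : ℕ} {c : K} (hc : c ≠ 0) {m : Multiset (P1 K)}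
    (hm : fixForm f n = MvPolynomial.C c * formOf m) {w : P1 K} (hw : (map f)^[n] w = w)
    (hcrit : MvPolynomial.eval w.rep (critForm f) ≠ 0) : m.count (map f w) = m.count w := by
  obtain ⟨H, D, hH, hHeq, hH0⟩ := exists_eq_linForm_pow_mul hc m (map f w)
  obtain ⟨H', -, -, hHeq', hH0'⟩ := exists_eq_linForm_pow_mul hc m w
  rw [← hm] at hHeq hHeq'
  have hbez : bez f w.rep w.rep ≠ 0 := by rwa [← eval_critForm]
  obtain ⟨a, ha, harep⟩ := exists_rep_mk_smul (ev f w.rep) (ev_ne_zero f w.rep_nonzero)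
  have hfw : (map f w).rep = a • ev f w.rep := by
    have := map_mk f w.rep w.rep_nonzero
    rw [w.mk_rep] at this
    rw [this, harep]
  have h1 : lift f = ev f (MvPolynomial.X : Fin 2 → MvPolynomial (Fin 2) K) := by
    funext i
    simp [ev]
  have hlin : MvPolynomial.aeval (lift f) (linForm (map f w).rep) =
      linForm w.rep * (MvPolynomial.C a * bez f MvPolynomial.X fun i => MvPolynomial.C (w.rep i)) := by
    have h2 : MvPolynomial.aeval (lift f) (linForm (map f w).rep) =
        wedge (lift f) fun i => MvPolynomial.C ((map f w).rep i) := by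
      simp [linForm, wedge, MvPolynomial.algebraMap_eq]
    have h3 : (fun i => (MvPolynomial.C ((map f w).rep i) : MvPolynomial (Fin 2) K)) =
        (MvPolynomial.C a : MvPolynomial (Fin 2) K) • ev f fun i => MvPolynomial.C (w.rep i) := by
      rw [ev_C, hfw]
      funext i
      simp
    rw [h2, h3, wedge_smul_right, h1, wedge_ev]
    unfold linForm
    ring
  have hmain : linForm w.rep ^ m.count (map f w) *
      ((MvPolynomial.C a * bez f MvPolynomial.X fun i => MvPolynomial.C (w.rep i)) ^
        m.count (map f w) * MvPolynomial.aeval (lift f) H) =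
      linForm w.rep ^ m.count w * (H' * bez f (liftIter f n) MvPolynomial.X) := by
    have h2 := aeval_lift_fixForm f n
    conv_lhs at h2 => rw [hHeq, map_mul, map_pow, hlin, mul_pow]
    rw [hHeq'] at h2
    linear_combination h2
  refine eq_of_linForm_pow_mul_eq ?_ ?_ hmain
  · rw [map_mul, map_pow, map_mul, MvPolynomial.eval_C, eval_bez_X_C, eval_aeval_lift]
    refine mul_ne_zero (pow_ne_zero _ (mul_ne_zero ha hbez)) fun h0 => hH0 ?_
    rw [hfw, eval_smul_of_isHomogeneous hH, h0, mul_zero]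
  · rw [map_mul]
    refine mul_ne_zero hH0' ?_
    have h2 : MvPolynomial.eval w.rep (bez f (liftIter f n) MvPolynomial.X) =
        bez f ((ev f)^[n] w.rep) w.rep := by
      have := map_bez f (MvPolynomial.aeval w.rep : MvPolynomial (Fin 2) K →ₐ[K] K)
        (liftIter f n) MvPolynomial.X
      rw [aeval_liftIter] at this
      simpa [MvPolynomial.aeval_eq_eval] using this
    have hX := bez_isHomogeneous f (fun i => MvPolynomial.isHomogeneous_X K i)
      (fun i => MvPolynomial.isHomogeneous_C (Fin 2) (w.rep i))
    have h3 : ∃ b : K, b ≠ 0 ∧ (ev f)^[n] w.rep = b • w.rep := by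
      rw [map_iterate_eq] at hw
      obtain ⟨b, hb, hbr⟩ := exists_rep_mk_smul ((ev f)^[n] w.rep)
        (ev_iterate_ne_zero f w.rep_nonzero n)
      rw [hw] at hbr
      refine ⟨b⁻¹, inv_ne_zero hb, ?_⟩
      conv_rhs => rw [hbr]
      rw [inv_smul_smul₀ hb]
    obtain ⟨b, hb, hbw⟩ := h3
    rw [h2, hbw, ← eval_bez_X_C, eval_smul_of_isHomogeneous hX, eval_bez_X_C]
    exact mul_ne_zero (pow_ne_zero _ hb) hbez

end Multiplicity

section FixedPoints

variable {K : Type*} [NontriviallyNormedField K] [IsAlgClosed K] [CharZero K] [CompleteSpace K]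

theorem proximity_toBerk (f : RatFunc K) (n : ℕ) (z : P1 K) :
    proximity f n (toBerk z) = chordal ((map f)^[n] z) z := by
  have h3 := vecNorm_rep_pos z
  rw [proximity_eq, map_iterate_eq, chordal_mk_left, nv_toBerk _ (fixForm_isHomogeneous f n),
    liftNorm_toBerk, eval_fixForm, pow_succ]
  field_simp

/-- The derivative of `F^n ∧ Id` at a superattracting fixed point. -/
theorem prod_erase_kap_of_mem_satSet (f : RatFunc K) (hf : 1 < deg f) {n : ℕ} (hn : 1 ≤ n) {A : ℝ}
    {m : Multiset (P1 K)} [DecidableEq (P1 K)]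
    (hm : ∀ S, proximity f n S * Real.exp (liftT f n S) = A * (m.map fun b => kap b S).prod)
    {w : P1 K} (hwm : w ∈ m) (hw : (map f)^[n] w = w) (hsat : w ∈ satSet f) :
    A * ((m.erase w).map fun b => kap b (toBerk w)).prod = Real.exp (liftT f n (toBerk w)) := by
  obtain ⟨i, hi, hcrit⟩ := (mem_satSet_iff f hn hw).1 hsat
  obtain ⟨B, hB, hBz⟩ := exists_chordal_iterate_le_sq f hf hi hcrit
  rw [hw] at hBz
  have hch : Tendsto (fun z => chordal z w) (punctured w) (𝓝 0) :=
    (tendsto_comap (f := fun z => chordal z w)).mono_right nhdsWithin_le_nhds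
  have htend : Tendsto toBerk (punctured w) (𝓝 (toBerk w)) := by
    refine tendsto_toBerk_of_kap (hch.congr fun z => ?_)
    rw [kap_toBerk, chordal_comm]
  have hne : ∀ᶠ z in punctured w, chordal z w ≠ 0 :=
    (tendsto_comap (f := fun z => chordal z w)).eventually self_mem_nhdsWithin
  have hratio : Tendsto (fun z => chordal ((map f)^[n] z) z / chordal z w) (punctured w) (𝓝 1) := by
    rw [tendsto_iff_norm_sub_tendsto_zero]
    have hBt : Tendsto (fun z => B * chordal z w) (punctured w) (𝓝 0) := by
      simpa using hch.const_mul B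
    refine squeeze_zero' (Eventually.of_forall fun z => norm_nonneg _) ?_ hBt
    filter_upwards [hne] with z hz
    have hz0 : 0 < chordal z w := lt_of_le_of_ne (chordal_nonneg _ _) (Ne.symm hz)
    have h1 := chordal_triangle ((map f)^[n] z) w z
    have h2 := chordal_triangle z ((map f)^[n] z) w
    rw [chordal_comm w z] at h1
    rw [chordal_comm z ((map f)^[n] z)] at h2
    have h3 := hBz z
    rw [div_sub_one hz, norm_div, Real.norm_of_nonneg hz0.le, div_le_iff₀ hz0, Real.norm_eq_abs,
      abs_le]
    constructor <;> nlinarith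
  have hl : Tendsto (fun z => chordal ((map f)^[n] z) z / chordal z w *
      Real.exp (liftT f n (toBerk z))) (punctured w) (𝓝 (Real.exp (liftT f n (toBerk w)))) := by
    have h1 : Continuous fun S : Berk K => Real.exp (liftT f n S) :=
      (continuous_liftT f n).rexp
    have := hratio.mul ((h1.tendsto (toBerk w)).comp htend)
    rwa [one_mul] at this
  have hr : Tendsto (fun z => A * ((m.erase w).map fun b => kap b (toBerk z)).prod) (punctured w)
      (𝓝 (A * ((m.erase w).map fun b => kap b (toBerk w)).prod)) := by
    have h1 : Continuous fun S : Berk K => A * ((m.erase w).map fun b => kap b S).prod :=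
      continuous_const.mul (continuous_multiset_prod _ fun b _ => continuous_kap b)
    exact (h1.tendsto (toBerk w)).comp htend
  have := punctured_neBot w
  refine tendsto_nhds_unique hr (hl.congr' ?_)
  filter_upwards [hne] with z hz
  have h1 := hm (toBerk z)
  rw [proximity_toBerk, ← Multiset.cons_erase hwm, Multiset.map_cons, Multiset.prod_cons,
    kap_toBerk, chordal_comm w z] at h1
  rw [div_mul_eq_mul_div, h1]
  field_simp

theorem count_eq_one_of_mem_satSet (f : RatFunc K) (hf : 1 < deg f) {n : ℕ} (hn : 1 ≤ n) {A : ℝ}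
    {m : Multiset (P1 K)} [DecidableEq (P1 K)]
    (hm : ∀ S, proximity f n S * Real.exp (liftT f n S) = A * (m.map fun b => kap b S).prod)
    {w : P1 K} (hwm : w ∈ m) (hw : (map f)^[n] w = w) (hsat : w ∈ satSet f) : m.count w = 1 := by
  have h1 := prod_erase_kap_of_mem_satSet f hf hn hm hwm hw hsat
  have h2 : w ∉ m.erase w := by
    intro h
    have h3 : ((m.erase w).map fun b => kap b (toBerk w)).prod = 0 := by
      refine Multiset.prod_eq_zero (Multiset.mem_map.2 ⟨w, h, ?_⟩)
      rw [kap_toBerk, chordal_self]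
    have h4 := Real.exp_pos (liftT f n (toBerk w))
    rw [← h1, h3, mul_zero] at h4
    exact lt_irrefl _ h4
  have h3 := Multiset.count_eq_zero.2 h2
  rw [Multiset.count_erase_self] at h3
  have h4 := Multiset.one_le_count_iff_mem.2 hwm
  omega

end FixedPoints

end BerkDyn

namespace BerkDyn

section FixedPointMeasure

theorem sum_map_filter_eq {Y : Type*} (m : Multiset Y) (p : Y → Prop) [DecidablePred p]
    (φ : Y → ℝ) : ((m.filter p).map φ).sum = (m.map fun y => if p y then φ y else 0).sum := by
  induction m using Multiset.induction_on with
  | empty => simp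
  | cons y m ih =>
    by_cases h : p y
    · simp [h, ih]
    · simp [h, ih]

variable {K : Type*} [NontriviallyNormedField K]

open Classical in
theorem setIntegral_fixMeasure (f : RatFunc K) {n : ℕ} {m : Multiset (P1 K)}
    (hmem : ∀ z, z ∈ m ↔ (map f)^[n] z = z) (hmult : ∀ w, fixMult f n w = m.count w)
    {s : Set (P1 K)} (hs : s.Finite) (φ : Berk K → ℝ) :
    ∫ S in (toBerk '' s)ᶜ, φ S ∂(fixMeasure f n) =
      ((m.filter fun w => w ∉ s).map fun w => φ (toBerk w)).sum := by
  have hset : ∀ w, w ∈ m.toFinset ↔ w ∈ fixSet f n := fun w => by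
    rw [Multiset.mem_toFinset, hmem]
    rfl
  have hfix : fixSet f n = ↑m.toFinset := Set.ext fun w => (hset w).symm
  have : Fintype (fixSet f n) := (hfix ▸ m.toFinset.finite_toSet : (fixSet f n).Finite).fintype
  have hmeas : MeasurableSet (toBerk '' s)ᶜ := (hs.image toBerk).measurableSet.compl
  have hint : ∀ (ψ : Berk K → ℝ) (S : Berk K) (k : ℕ), Integrable ψ ((k : ℝ≥0∞) • Measure.dirac S) :=
    fun ψ S k => (integrable_dirac (by simp)).smul_measure (ENNReal.natCast_ne_top k)
  rw [← integral_indicator hmeas, fixMeasure, Measure.sum_fintype,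
    integral_finsetSum_measure fun i _ => hint _ _ _, sum_map_filter_eq,
    Finset.sum_multiset_map_count, ← Finset.sum_subtype m.toFinset hset
      (fun w => ∫ S, (toBerk '' s)ᶜ.indicator φ S
        ∂((fixMult f n w : ℝ≥0∞) • Measure.dirac (toBerk w)))]
  refine Finset.sum_congr rfl fun w _ => ?_
  rw [integral_smul_measure, integral_dirac, hmult, ENNReal.toReal_natCast, nsmul_eq_mul,
    smul_eq_mul]
  congr 1
  by_cases hw : w ∈ s
  · rw [if_neg (by simpa using hw), Set.indicator_of_notMem]
    simpa using ⟨w, hw, rfl⟩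
  · rw [if_pos hw, Set.indicator_of_mem]
    rintro ⟨w', hw', h⟩
    exact hw (toBerk_injective h ▸ hw')

open Classical in
theorem real_fixMeasure_compl (f : RatFunc K) {n : ℕ} {m : Multiset (P1 K)}
    (hmem : ∀ z, z ∈ m ↔ (map f)^[n] z = z) (hmult : ∀ w, fixMult f n w = m.count w)
    {s : Set (P1 K)} (hs : s.Finite) :
    (fixMeasure f n).real (toBerk '' s)ᶜ = (m.filter fun w => w ∉ s).card := by
  have h := setIntegral_fixMeasure f hmem hmult hs fun _ => 1
  rw [integral_const, measureReal_restrict_apply_univ] at h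
  simpa using h

open Classical in
/-- The map `f` permutes the fixed points of `f^n` that are not superattracting. -/
theorem sum_comp_map_eq (f : RatFunc K) {n : ℕ} (hn : 1 ≤ n) {m : Multiset (P1 K)}
    (hmem : ∀ z, z ∈ m ↔ (map f)^[n] z = z)
    (hcount : ∀ w, (map f)^[n] w = w → MvPolynomial.eval w.rep (critForm f) ≠ 0 →
      m.count (map f w) = m.count w) (φ : P1 K → ℝ) :
    ((m.filter fun w => w ∉ satSet f).map fun w => φ (map f w)).sum =
      ((m.filter fun w => w ∉ satSet f).map φ).sum := by
  set N := m.filter fun w => w ∉ satSet f with hN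
  have hNmem : ∀ w, w ∈ N.toFinset ↔ (map f)^[n] w = w ∧ w ∉ satSet f := fun w => by
    rw [Multiset.mem_toFinset, hN, Multiset.mem_filter, hmem]
  have hfix : ∀ {w} (k : ℕ), (map f)^[n] w = w → (map f)^[n] ((map f)^[k] w) = (map f)^[k] w := by
    intro w k hw
    rw [← Function.iterate_add_apply, add_comm, Function.iterate_add_apply, hw]
  have hsat : ∀ {w} (k : ℕ), (map f)^[n] w = w → w ∉ satSet f → (map f)^[k] w ∉ satSet f := by
    intro w k hw hws
    induction k with
    | zero => exact hws
    | succ k ih =>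
      rw [Function.iterate_succ_apply', map_mem_satSet_iff f hn (hfix k hw)]
      exact ih
  obtain ⟨j, rfl⟩ : ∃ j, n = j + 1 := ⟨n - 1, by omega⟩
  rw [Finset.sum_multiset_map_count, Finset.sum_multiset_map_count]
  refine Finset.sum_nbij' (map f) (map f)^[j] (fun w hw => ?_) (fun w hw => ?_) (fun w hw => ?_)
    (fun w hw => ?_) fun w hw => ?_
  · obtain ⟨h1, h2⟩ := (hNmem w).1 hw
    exact (hNmem _).2 ⟨hfix 1 h1, hsat 1 h1 h2⟩
  · obtain ⟨h1, h2⟩ := (hNmem w).1 hw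
    exact (hNmem _).2 ⟨hfix j h1, hsat j h1 h2⟩
  · obtain ⟨h1, h2⟩ := (hNmem w).1 hw
    rw [← Function.iterate_succ_apply]
    exact h1
  · obtain ⟨h1, h2⟩ := (hNmem w).1 hw
    rw [← Function.iterate_succ_apply' (map f)]
    exact h1
  · obtain ⟨h1, h2⟩ := (hNmem w).1 hw
    have h3 : MvPolynomial.eval w.rep (critForm f) ≠ 0 := fun h =>
      h2 ((mem_satSet_iff f hn h1).2 ⟨0, by omega, h⟩)
    have h4 : map f w ∉ satSet f := hsat 1 h1 h2
    rw [hN, Multiset.count_filter_of_pos (p := fun w => w ∉ satSet f) h4,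
      Multiset.count_filter_of_pos (p := fun w => w ∉ satSet f) h2, hcount w h1 h3]

end FixedPointMeasure

section FixedPoints

variable {K : Type*} [NontriviallyNormedField K] [IsAlgClosed K] [CharZero K] [CompleteSpace K]

open Classical in
theorem exists_fixed_multiset (f : RatFunc K) (hf : 1 < deg f) {n : ℕ} (hn : 1 ≤ n) :
    ∃ (A : ℝ) (m : Multiset (P1 K)), 0 < A ∧ m.card = deg f ^ n + 1 ∧
      (∀ z, z ∈ m ↔ (map f)^[n] z = z) ∧ (∀ w, fixMult f n w = m.count w) ∧
      (∀ S, proximity f n S * Real.exp (liftT f n S) = A * (m.map fun b => kap b S).prod) ∧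
      ∀ w, (map f)^[n] w = w → MvPolynomial.eval w.rep (critForm f) ≠ 0 →
        m.count (map f w) = m.count w := by
  obtain ⟨c, m, hc, hcard, hG⟩ := exists_eq_C_mul_formOf (fixForm_isHomogeneous f n)
    (fixForm_ne_zero f hf hn)
  refine ⟨‖c‖ * (m.map fun w => vecNorm w.rep).prod, m, ?_, hcard, fun z => ?_, fun w => ?_,
    fun S => ?_, fun w hw hcrit => count_map_of_fixed f hc hG hw hcrit⟩
  · refine mul_pos (norm_pos_iff.2 hc) (Multiset.prod_pos ?_)
    simpa using fun w _ => vecNorm_rep_pos w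
  · rw [← eval_fixForm_eq_zero_iff, hG, map_mul, MvPolynomial.eval_C, mul_eq_zero,
      or_iff_right hc, eval_formOf_eq_zero_iff]
  · change multiplicity (linForm w.rep) (fixForm f n) = _
    rw [hG, multiplicity_linForm hc]
  · rw [proximity_eq, liftNorm_eq_exp, div_mul_cancel₀ _ (Real.exp_pos _).ne', hG, ← hcard,
      nv_C_mul_formOf]

end FixedPoints

end BerkDyn

namespace BerkDyn

section Estimates

variable {K : Type*} [NontriviallyNormedField K] [IsAlgClosed K] [CharZero K] [CompleteSpace K]

open Classical in
theorem abs_sum_filter_mem_satSet_le (f : RatFunc K) (hf : 1 < deg f) (hs : (satSet f).Finite)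
    {n : ℕ} (hn : 1 ≤ n) {A : ℝ} {m : Multiset (P1 K)} (hmem : ∀ z, z ∈ m ↔ (map f)^[n] z = z)
    (hm : ∀ S, proximity f n S * Real.exp (liftT f n S) = A * (m.map fun b => kap b S).prod)
    (φ : P1 K → ℝ) :
    |((m.filter fun w => w ∈ satSet f).map φ).sum| ≤ ∑ w ∈ hs.toFinset, |φ w| := by
  rw [Finset.sum_multiset_map_count]
  refine (Finset.abs_sum_le_sum_abs _ _).trans ?_
  have h1 : ∀ w ∈ (m.filter fun w => w ∈ satSet f).toFinset,
      |(m.filter fun w => w ∈ satSet f).count w • φ w| = |φ w| := by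
    intro w hw
    rw [Multiset.mem_toFinset, Multiset.mem_filter] at hw
    rw [Multiset.count_filter_of_pos (p := fun w => w ∈ satSet f) hw.2,
      count_eq_one_of_mem_satSet f hf hn hm hw.1 ((hmem w).1 hw.1) hw.2, one_smul]
  rw [Finset.sum_congr rfl h1]
  refine Finset.sum_le_sum_of_subset_of_nonneg (fun w hw => ?_) fun w _ _ => abs_nonneg _
  rw [Multiset.mem_toFinset, Multiset.mem_filter] at hw
  exact hs.mem_toFinset.2 hw.2

open Classical in
theorem exists_abs_sum_log_kap_le (f : RatFunc K) (hf : 1 < deg f) (hs : (satSet f).Finite)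
    {c : P1 K} (hc : MvPolynomial.eval c.rep (critForm f) = 0) : ∃ B : ℝ, 0 ≤ B ∧
      ∀ (n : ℕ), 1 ≤ n → ∀ (A : ℝ) (m : Multiset (P1 K)), 0 < A →
        (∀ z, z ∈ m ↔ (map f)^[n] z = z) →
        (∀ S, proximity f n S * Real.exp (liftT f n S) = A * (m.map fun b => kap b S).prod) →
        |((m.filter fun w => w ∉ satSet f).map fun w => Real.log (kap c (toBerk w))).sum +
          Real.log A - liftT f n (toBerk c)| ≤ B * n := by
  obtain ⟨B, hB, hBn⟩ := exists_neg_log_chordal_iterate_le f hf hc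
  set R := ∑ w ∈ hs.toFinset, |Real.log (kap c (toBerk w))| with hR
  have hR0 : 0 ≤ R := Finset.sum_nonneg fun w _ => abs_nonneg _
  refine ⟨B + R, by positivity, fun n hn A m hA hmem hm => ?_⟩
  have hn1 : (1 : ℝ) ≤ n := by exact_mod_cast hn
  have hswap : ∀ w : P1 K, kap c (toBerk w) = kap w (toBerk c) := fun w => by
    rw [kap_toBerk, kap_toBerk, chordal_comm]
  have hall : |(m.map fun w => Real.log (kap c (toBerk w))).sum + Real.log A -
      liftT f n (toBerk c)| ≤ B * n := by
    simp_rw [hswap]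
    by_cases hfix : (map f)^[n] c = c
    · have hcm : c ∈ m := (hmem c).2 hfix
      have hsat : c ∈ satSet f := (mem_satSet_iff f hn hfix).2 ⟨0, by omega, hc⟩
      have h1 := prod_erase_kap_of_mem_satSet f hf hn hm hcm hfix hsat
      have h2 := count_eq_one_of_mem_satSet f hf hn hm hcm hfix hsat
      have h3 : ∀ w ∈ m.erase c, 0 < kap w (toBerk c) := by
        intro w hw
        rw [kap_toBerk]
        refine lt_of_le_of_ne (chordal_nonneg _ _) fun h => ?_
        rw [(chordal_eq_zero_iff w c).1 h.symm, ← Multiset.count_pos, Multiset.count_erase_self,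
          h2] at hw
        omega
      have h4 := congrArg Real.log h1
      rw [Real.log_mul hA.ne' (prod_kap_pos h3).ne', log_prod_kap h3, Real.log_exp] at h4
      have h5 : (m.map fun w => Real.log (kap w (toBerk c))).sum =
          ((m.erase c).map fun w => Real.log (kap w (toBerk c))).sum := by
        conv_lhs => rw [← Multiset.cons_erase hcm]
        rw [Multiset.map_cons, Multiset.sum_cons, kap_toBerk, chordal_self, Real.log_zero, zero_add]
      rw [h5, ← h4]
      have : 0 ≤ B * n := by positivity
      simpa [add_comm] using this
    · have h1 : ∀ w ∈ m, 0 < kap w (toBerk c) := by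
        intro w hw
        rw [kap_toBerk]
        refine lt_of_le_of_ne (chordal_nonneg _ _) fun h => hfix ?_
        rw [(chordal_eq_zero_iff w c).1 h.symm] at hw
        exact (hmem c).1 hw
      have h2 := (log_of_mul_exp_eq hA hm h1).2
      rw [proximity_toBerk] at h2
      have h3 := hBn n hn hfix
      have h4 := Real.log_nonpos (chordal_nonneg ((map f)^[n] c) c) (chordal_le_one _ _)
      rw [show (m.map fun w => Real.log (kap w (toBerk c))).sum + Real.log A -
        liftT f n (toBerk c) = Real.log (chordal ((map f)^[n] c) c) by rw [h2]; ring,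
        abs_of_nonpos h4]
      exact h3
  have hP := abs_sum_filter_mem_satSet_le f hf hs hn hmem hm fun w => Real.log (kap c (toBerk w))
  rw [← hR] at hP
  have hsplit : (m.map fun w => Real.log (kap c (toBerk w))).sum =
      ((m.filter fun w => w ∈ satSet f).map fun w => Real.log (kap c (toBerk w))).sum +
      ((m.filter fun w => w ∉ satSet f).map fun w => Real.log (kap c (toBerk w))).sum := by
    rw [← Multiset.sum_add, ← Multiset.map_add, Multiset.filter_add_not]
  rw [hsplit] at hall
  rw [abs_le] at hall hP ⊢
  have hRn : R ≤ R * n := le_mul_of_one_le_right hR0 hn1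
  constructor <;> nlinarith [hall.1, hall.2, hP.1, hP.2]

end Estimates

section Integrals

variable {K : Type*} [NontriviallyNormedField K] [IsAlgClosed K]

open Classical in
theorem sum_log_sharp (f : RatFunc K) (hf : 1 < deg f) {n : ℕ} (hn : 1 ≤ n) {A : ℝ} (hA : 0 < A)
    {l : Multiset (P1 K)} (hl : ∀ z : P1 K, MvPolynomial.eval z.rep (critForm f) = 0 ↔ z ∈ l)
    (hlS : ∀ S, sharp f S * Real.exp (2 * liftT f 1 S) = A * (l.map fun b => kap b S).prod)
    {m : Multiset (P1 K)} (hmem : ∀ z, z ∈ m ↔ (map f)^[n] z = z)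
    (hcount : ∀ w, (map f)^[n] w = w → MvPolynomial.eval w.rep (critForm f) ≠ 0 →
      m.count (map f w) = m.count w) :
    ((m.filter fun w => w ∉ satSet f).map fun w => Real.log (sharp f (toBerk w))).sum =
      (m.filter fun w => w ∉ satSet f).card * Real.log A +
      (l.map fun c => ((m.filter fun w => w ∉ satSet f).map fun w =>
        Real.log (kap c (toBerk w))).sum).sum -
      2 * (deg f - 1) *
        ((m.filter fun w => w ∉ satSet f).map fun w => liftGreen f (toBerk w)).sum := by
  set N := m.filter fun w => w ∉ satSet f with hN
  have h1 : ∀ w ∈ N, Real.log (sharp f (toBerk w)) = Real.log A +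
      (l.map fun c => Real.log (kap c (toBerk w))).sum -
        (2 * deg f * liftGreen f (toBerk w) - 2 * liftGreen f (toBerk (map f w))) := by
    intro w hw
    rw [hN, Multiset.mem_filter, hmem] at hw
    have h2 : ∀ c ∈ l, 0 < kap c (toBerk w) := by
      intro c hc
      rw [kap_toBerk]
      refine lt_of_le_of_ne (chordal_nonneg _ _) fun h => hw.2 ?_
      rw [(chordal_eq_zero_iff c w).1 h.symm, ← hl] at hc
      exact (mem_satSet_iff f hn hw.1).2 ⟨0, by omega, hc⟩
    rw [(log_of_mul_exp_eq hA hlS h2).2, ← berkMap_toBerk, liftGreen_berkMap f hf]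
    ring
  have h2 := sum_comp_map_eq f hn hmem hcount fun w => liftGreen f (toBerk w)
  rw [← hN] at h2
  rw [Multiset.map_congr rfl h1, Multiset.sum_map_sub, Multiset.sum_map_sub, Multiset.sum_map_add,
    Multiset.sum_map_mul_left, Multiset.sum_map_mul_left, h2, Multiset.sum_map_sum_map]
  simp only [Multiset.map_const', Multiset.sum_replicate, nsmul_eq_mul]
  ring

variable [CharZero K] [CompleteSpace K]

theorem logIntegrable_sharp (f : RatFunc K) (hf : 1 < deg f) {C : ℝ}
    (hC : ∀ S, liftGreen f S = C - (negPotential (eqMeasure f) S).toReal) {A : ℝ} (hA : 0 < A)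
    {m : Multiset (P1 K)} (hcard : m.card = 2 * (deg f - 1))
    (hm : ∀ S, sharp f S * Real.exp (2 * liftT f 1 S) = A * (m.map fun b => kap b S).prod) :
    LogIntegrable (sharp f) (eqMeasure f) ∧ lyapunov f = Real.log A +
      (m.map fun c => liftGreen f (toBerk c)).sum -
        2 * (deg f - 1) * (C + ∫ S, liftGreen f S ∂(eqMeasure f)) := by
  have hμ := hasWeightMeasure_eqMeasure f hf
  have hp := hμ.isProbRadon.isProbabilityMeasure
  obtain ⟨h1, h2⟩ := integral_log_of_mul_exp_eq (T := fun S => 2 * liftT f 1 S)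
    hμ.lintegral_ne_top (continuous_const.mul (continuous_liftT f 1)) hA hm
  refine ⟨h1, ?_⟩
  rw [lyapunov, h2, Multiset.map_congr rfl fun b _ => hμ.integral_log_kap hC b,
    multiset_sum_sub_const, hcard, integral_const_mul, integral_liftT_one_eqMeasure f hf]
  push_cast [Nat.cast_sub hf.le]
  ring

theorem integral_logProximity (f : RatFunc K) (hf : 1 < deg f) {C γ : ℝ}
    (hC : ∀ S, liftGreen f S = C - (negPotential (eqMeasure f) S).toReal)
    (hγ : ∀ S, green f S = liftGreen f S + γ) {n : ℕ} {A : ℝ} (hA : 0 < A) {m : Multiset (P1 K)}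
    (hcard : m.card = deg f ^ n + 1)
    (hm : ∀ S, proximity f n S * Real.exp (liftT f n S) = A * (m.map fun b => kap b S).prod) :
    LogIntegrable (proximity f n) (eqMeasure f) ∧
      ∫ S, logProximity f n S ∂(eqMeasure f) = Real.log A +
        (m.map fun w => liftGreen f (toBerk w)).sum -
          (deg f ^ n + 1) * (C + ∫ S, liftGreen f S ∂(eqMeasure f)) - 2 * γ := by
  have hμ := hasWeightMeasure_eqMeasure f hf
  have hp := hμ.isProbRadon.isProbabilityMeasure
  obtain ⟨h1, h2⟩ := integral_log_of_mul_exp_eq hμ.lintegral_ne_top (continuous_liftT f n) hA hm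
  refine ⟨h1, ?_⟩
  have hT : Integrable (liftT f n) (eqMeasure f) := integrable_of_continuous (continuous_liftT f n)
  have hg : Integrable (liftGreen f) (eqMeasure f) :=
    integrable_of_continuous (continuous_liftGreen f hf)
  have h3 : ∀ S, logProximity f n S = Real.log (proximity f n S) + liftT f n S -
      (deg f ^ n + 1) * liftGreen f S - 2 * γ := by
    intro S
    rw [logProximity, hγ, hγ, liftGreen_iterate f hf]
    ring
  simp_rw [h3]
  have i1 : Integrable (fun S => Real.log (proximity f n S) + liftT f n S) (eqMeasure f) :=
    h1.2.add hT
  have i2 : Integrable (fun S => (deg f ^ n + 1 : ℝ) * liftGreen f S) (eqMeasure f) :=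
    hg.const_mul _
  have i3 : Integrable (fun S => Real.log (proximity f n S) + liftT f n S -
      (deg f ^ n + 1 : ℝ) * liftGreen f S) (eqMeasure f) := i1.sub i2
  rw [integral_sub i3 (integrable_const _), integral_sub i1 i2, integral_add h1.2 hT, integral_const_mul,
    integral_const, probReal_univ, one_smul, h2,
    Multiset.map_congr rfl fun b _ => hμ.integral_log_kap hC b, multiset_sum_sub_const, hcard]
  push_cast
  ring

end Integrals

end BerkDyn

open BerkDyn in
theorem key_decomposition_simple {K : Type*} [NontriviallyNormedField K] [IsAlgClosed K]
    [CharZero K] [CompleteSpace K] (f : RatFunc K) (hf : 1 < BerkDyn.deg f) :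
    BerkDyn.LogIntegrable (BerkDyn.sharp f) (BerkDyn.eqMeasure f) ∧
    (∀ n : ℕ, 1 ≤ n → BerkDyn.LogIntegrable (BerkDyn.proximity f n) (BerkDyn.eqMeasure f)) ∧
    (fun n : ℕ =>
        (1 / (BerkDyn.deg f : ℝ) ^ n *
            (∫ S in (BerkDyn.toBerk '' BerkDyn.satSet f)ᶜ,
              Real.log (BerkDyn.sharp f S) ∂(BerkDyn.fixMeasure f n))
          - (BerkDyn.fixMeasure f n).real (BerkDyn.toBerk '' BerkDyn.satSet f)ᶜ
              / (BerkDyn.deg f : ℝ) ^ n * BerkDyn.lyapunov f)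
        - (-((2 * (BerkDyn.deg f : ℝ) - 2) / (BerkDyn.deg f : ℝ) ^ n)
            * ∫ S, BerkDyn.logProximity f n S ∂(BerkDyn.eqMeasure f)))
      =O[atTop] (fun n : ℕ => (n : ℝ) * ((BerkDyn.deg f : ℝ) ^ n)⁻¹) := by
  classical
  have hμ := hasWeightMeasure_eqMeasure f hf
  obtain ⟨C, hC⟩ := hμ.eq_potential
  obtain ⟨γ, hγ⟩ := exists_green_eq f hf
  obtain ⟨A₀, l, hA₀, hlcard, hl, hlnv⟩ := exists_nv_eq_prod_kap (critForm_isHomogeneous f)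
    (critForm_ne_zero f hf)
  have hlS : ∀ S, sharp f S * Real.exp (2 * liftT f 1 S) =
      A₀ * (l.map fun b => kap b S).prod := by
    intro S
    have h1 : Real.exp (2 * liftT f 1 S) = liftNorm f 1 S ^ 2 := by
      rw [liftNorm_eq_exp, ← Real.exp_nat_mul]
      norm_num
    rw [h1, sharp_eq, div_mul_cancel₀ _ (pow_pos (liftNorm_pos f 1 S) 2).ne', hlnv]
  have hs : (satSet f).Finite := finite_satSet f fun z hz => (hl z).1 hz
  obtain ⟨hsharp, hlyap⟩ := logIntegrable_sharp f hf hC hA₀ hlcard hlS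
  refine ⟨hsharp, fun n hn => ?_, ?_⟩
  · obtain ⟨A, m, hA, hcard, -, -, hm, -⟩ := exists_fixed_multiset f hf hn
    exact (integral_logProximity f hf hC hγ hA hcard hm).1
  have hB : ∀ c : P1 K, ∃ B : ℝ, 0 ≤ B ∧ (MvPolynomial.eval c.rep (critForm f) = 0 →
      ∀ (n : ℕ), 1 ≤ n → ∀ (A : ℝ) (m : Multiset (P1 K)), 0 < A →
        (∀ z, z ∈ m ↔ (map f)^[n] z = z) →
        (∀ S, proximity f n S * Real.exp (liftT f n S) = A * (m.map fun b => kap b S).prod) →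
        |((m.filter fun w => w ∉ satSet f).map fun w => Real.log (kap c (toBerk w))).sum +
          Real.log A - liftT f n (toBerk c)| ≤ B * n) := by
    intro c
    by_cases hc : MvPolynomial.eval c.rep (critForm f) = 0
    · obtain ⟨B, hB, h⟩ := exists_abs_sum_log_kap_le f hf hs hc
      exact ⟨B, hB, fun _ => h⟩
    · exact ⟨0, le_rfl, fun h => absurd h hc⟩
  choose B hB0 hB using hB
  obtain ⟨M, hM0, hM⟩ := exists_abs_liftGreen_le f hf
  set G := ∫ S, liftGreen f S ∂(eqMeasure f) with hG
  set k : ℝ := (hs.toFinset.card : ℝ) with hk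
  set Q : ℝ := (2 + 2 * k) * M + k * |C + G| + 2 * |γ| with hQ
  have hk0 : 0 ≤ k := Nat.cast_nonneg _
  have hQ0 : 0 ≤ Q := by positivity
  refine Asymptotics.IsBigO.of_bound (l.map fun c => B c + Q).sum ?_
  filter_upwards [eventually_ge_atTop 1] with n hn
  have hn1 : (1 : ℝ) ≤ n := by exact_mod_cast hn
  have hd : (0 : ℝ) < (deg f : ℝ) ^ n := by
    have : (0 : ℝ) < deg f := by exact_mod_cast (by omega : 0 < deg f)
    positivity
  obtain ⟨A, m, hA, hcard, hmem, hmult, hm, hcount⟩ := exists_fixed_multiset f hf hn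
  have hΦ := (integral_logProximity f hf hC hγ hA hcard hm).2
  rw [setIntegral_fixMeasure f hmem hmult hs, real_fixMeasure_compl f hmem hmult hs, hlyap, hΦ,
    sum_log_sharp f hf hn hA₀ hl hlS hmem hcount]
  set N := m.filter fun w => w ∉ satSet f with hN
  set P := m.filter fun w => w ∈ satSet f with hP
  set gP := (P.map fun w => liftGreen f (toBerk w)).sum with hgP
  have hPN : P + N = m := Multiset.filter_add_not _ _
  have hsplit : (m.map fun w => liftGreen f (toBerk w)).sum =
      gP + (N.map fun w => liftGreen f (toBerk w)).sum := by
    rw [← hPN, Multiset.map_add, Multiset.sum_add]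
  have hcard' : (P.card : ℝ) + N.card = (deg f : ℝ) ^ n + 1 := by
    have := congrArg Multiset.card hPN
    rw [Multiset.card_add, hcard] at this
    exact_mod_cast this
  have hPcard : (P.card : ℝ) ≤ k := by
    have := abs_sum_filter_mem_satSet_le f hf hs hn hmem hm fun _ => 1
    rw [← hP] at this
    simpa [hk] using this
  have hgPle : |gP| ≤ k * M := by
    refine (abs_sum_filter_mem_satSet_le f hf hs hn hmem hm fun w => liftGreen f (toBerk w)).trans ?_
    rw [hk, ← nsmul_eq_mul]
    exact Finset.sum_le_card_nsmul _ _ _ fun w _ => hM _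
  have hlcard' : (l.card : ℝ) = 2 * (deg f - 1) := by
    rw [hlcard]
    push_cast [Nat.cast_sub hf.le]
    ring
  have hmain : (l.map fun c => ((N.map fun w => Real.log (kap c (toBerk w))).sum +
      (Real.log A + gP - P.card * (C + G) - 2 * γ)) - N.card * liftGreen f (toBerk c)).sum =
      (l.map fun c => (N.map fun w => Real.log (kap c (toBerk w))).sum).sum +
        2 * (deg f - 1) * (Real.log A + gP - P.card * (C + G) - 2 * γ) -
        N.card * (l.map fun c => liftGreen f (toBerk c)).sum := by
    rw [Multiset.sum_map_sub, Multiset.sum_map_add, Multiset.sum_map_mul_left]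
    simp only [Multiset.map_const', Multiset.sum_replicate, nsmul_eq_mul, hlcard']
  have hterm : ∀ c ∈ l, |((N.map fun w => Real.log (kap c (toBerk w))).sum +
      (Real.log A + gP - P.card * (C + G) - 2 * γ)) - N.card * liftGreen f (toBerk c)| ≤
        (B c + Q) * n := by
    intro c hc
    have h1 := hB c ((hl c).2 hc) n hn A m hA hmem hm
    rw [← hN] at h1
    have h2 := liftGreen_iterate f hf n (toBerk c)
    have h3 := hM ((berkMap f)^[n] (toBerk c))
    have h4 := hM (toBerk c)
    have e : ((N.map fun w => Real.log (kap c (toBerk w))).sum +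
        (Real.log A + gP - P.card * (C + G) - 2 * γ)) - N.card * liftGreen f (toBerk c) =
        ((N.map fun w => Real.log (kap c (toBerk w))).sum + Real.log A - liftT f n (toBerk c)) +
        (gP + P.card * (liftGreen f (toBerk c) - (C + G)) - liftGreen f ((berkMap f)^[n] (toBerk c)) -
          liftGreen f (toBerk c) - 2 * γ) := by
      rw [h2]
      linear_combination (-liftGreen f (toBerk c)) * hcard'
    have h5 : |(P.card : ℝ) * (liftGreen f (toBerk c) - (C + G))| ≤ k * (M + |C + G|) := by
      rw [abs_mul, Nat.abs_cast]
      refine mul_le_mul hPcard ((abs_sub _ _).trans ?_) (abs_nonneg _) hk0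
      linarith
    have h6 : |gP + P.card * (liftGreen f (toBerk c) - (C + G)) -
        liftGreen f ((berkMap f)^[n] (toBerk c)) - liftGreen f (toBerk c) - 2 * γ| ≤ Q := by
      have h7 := abs_le.1 h3
      have h8 := abs_le.1 h4
      have h9 := abs_le.1 h5
      have h10 := abs_le.1 hgPle
      have h11 := neg_abs_le γ
      have h12 := le_abs_self γ
      rw [abs_le, hQ]
      constructor <;> linarith [h7.1, h7.2, h8.1, h8.2, h9.1, h9.2, h10.1, h10.2]
    rw [e, add_mul]
    exact (abs_add_le _ _).trans (add_le_add h1 (h6.trans (le_mul_of_one_le_right hQ0 hn1)))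
  have hsum : |(l.map fun c => ((N.map fun w => Real.log (kap c (toBerk w))).sum +
      (Real.log A + gP - P.card * (C + G) - 2 * γ)) - N.card * liftGreen f (toBerk c)).sum| ≤
        (l.map fun c => B c + Q).sum * n := by
    refine (Multiset.abs_sum_le_sum_abs).trans ?_
    rw [Multiset.map_map, ← Multiset.sum_map_mul_right]
    exact Multiset.sum_map_le_sum_map _ _ hterm
  rw [hmain] at hsum
  rw [hsplit, Real.norm_eq_abs, Real.norm_eq_abs,
    abs_of_nonneg (by positivity : (0 : ℝ) ≤ n * ((deg f : ℝ) ^ n)⁻¹), ← mul_assoc]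
  refine le_trans (le_of_eq ?_) (mul_le_mul_of_nonneg_right hsum (inv_nonneg.2 hd.le))
  conv_rhs => rw [← abs_of_nonneg (inv_nonneg.2 hd.le), ← abs_mul]
  congr 1
  field_simp
  linear_combination ((2 * (deg f : ℝ) - 2) * (C + G)) * hcard'
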